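/- Let k be a finite field of characteristic p. For every s ∈ ℕ there exists N ∈ ℕ such that for all n ≥ N, the k-dimension of H^s(GL(n,k), gl_n) equals the coefficient of t^s in the formal power series 1/(1−t²); that is, the stable dimension is 1 if s is even and 0 if s is odd. -/

import Mathlib

open scoped MatrixGroups TensorProduct

noncomputable section

/-- The adjoint (conjugation) representation of `GL(n,k)` on `gl_n`. -/
def glConj (k : Type) [Field k] (n : ℕ) :
    Representation k (GL (Fin n) k) (Matrix (Fin n) (Fin n) k) where
  toFun g :=
    { toFun := fun x => (g : Matrix (Fin n) (Fin n) k) * x * (↑g⁻¹ : Matrix (Fin n) (Fin n) k)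
      map_add' := fun x y => by noncomm_ring
      map_smul' := fun c x => by simp [Matrix.smul_mul, Matrix.mul_smul] }
  map_one' := by ext x; simp
  map_mul' g h := by
    ext x
    simp [Matrix.mul_assoc]

variable (k : Type) [Field k] {G : Type} [Group G]
variable (V : Type) [AddCommGroup V] [Module k V]

/-- The `m`-th tensor power of a representation (diagonal action). -/
def tpowRep (m : ℕ) (ρ : Representation k G V) :
    Representation k G (⨂[k] (_ : Fin m), V) :=
  PiTensorProduct.mapMonoidHom.comp (Pi.monoidHom fun _ => ρ)

lemma tpowRep_apply (m : ℕ) (ρ : Representation k G V) (g : G) (f : Fin m → V) :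
    tpowRep k V m ρ g (PiTensorProduct.tprod k f)
      = PiTensorProduct.tprod k (fun i => ρ g (f i)) := by
  exact PiTensorProduct.map_tprod (fun _ => ρ g) f

/-- The subspace of the `m`-th tensor power by which one quotients to obtain
the `m`-th symmetric power. -/
def symPowSub (m : ℕ) : Submodule k (⨂[k] (_ : Fin m), V) :=
  Submodule.span k {z | ∃ (σ : Equiv.Perm (Fin m)) (f : Fin m → V),
    z = PiTensorProduct.tprod k f - PiTensorProduct.tprod k (f ∘ σ)}

/-- The `m`-th symmetric power of a `k`-vector space. -/
abbrev SymPow (m : ℕ) := (⨂[k] (_ : Fin m), V) ⧸ symPowSub k V m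

/-- The `m`-th symmetric power of a representation. -/
def symPowRep (m : ℕ) (ρ : Representation k G V) :
    Representation k G (SymPow k V m) where
  toFun g := Submodule.mapQ _ _ (tpowRep k V m ρ g) (by
    rw [symPowSub, Submodule.span_le]
    rintro z ⟨σ, f, rfl⟩
    simp only [SetLike.mem_coe, Submodule.mem_comap, map_sub, tpowRep_apply]
    refine Submodule.subset_span ⟨σ, fun i => ρ g (f i), ?_⟩
    simp [Function.comp_def])
  map_one' := by
    refine Submodule.linearMap_qext _ ?_
    refine PiTensorProduct.ext ?_
    ext f
    simp [Submodule.mapQ_apply, tpowRep_apply]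
  map_mul' g h := by
    refine Submodule.linearMap_qext _ ?_
    refine PiTensorProduct.ext ?_
    ext f
    simp [Submodule.mapQ_apply, tpowRep_apply]

/-- The subspace of the `m`-th tensor power by which one quotients to obtain
the `m`-th exterior power: the span of pure tensors with two equal entries. -/
def altPowSub (m : ℕ) : Submodule k (⨂[k] (_ : Fin m), V) :=
  Submodule.span k {z | ∃ (f : Fin m → V) (i j : Fin m), i ≠ j ∧ f i = f j ∧
    z = PiTensorProduct.tprod k f}

/-- The `m`-th exterior power of a `k`-vector space. -/
abbrev AltPow (m : ℕ) := (⨂[k] (_ : Fin m), V) ⧸ altPowSub k V m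

/-- The `m`-th exterior power of a representation. -/
def altPowRep (m : ℕ) (ρ : Representation k G V) :
    Representation k G (AltPow k V m) where
  toFun g := Submodule.mapQ _ _ (tpowRep k V m ρ g) (by
    rw [altPowSub, Submodule.span_le]
    rintro z ⟨f, i, j, hij, hfij, rfl⟩
    simp only [SetLike.mem_coe, Submodule.mem_comap, tpowRep_apply]
    exact Submodule.subset_span ⟨fun i => ρ g (f i), i, j, hij, by simp only [hfij], rfl⟩)
  map_one' := by
    refine Submodule.linearMap_qext _ (PiTensorProduct.ext ?_)
    ext f
    simp [Submodule.mapQ_apply, tpowRep_apply]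
  map_mul' g h := by
    refine Submodule.linearMap_qext _ (PiTensorProduct.ext ?_)
    ext f
    simp [Submodule.mapQ_apply, tpowRep_apply]

/-- The second divided power `Γ²V ⊆ V ⊗ V`: tensors invariant under the flip. -/
def gamma2 : Submodule k (V ⊗[k] V) :=
  LinearMap.eqLocus (TensorProduct.comm k V V).toLinearMap LinearMap.id

lemma comm_comp_map (f : V →ₗ[k] V) :
    (TensorProduct.comm k V V).toLinearMap ∘ₗ TensorProduct.map f f
      = TensorProduct.map f f ∘ₗ (TensorProduct.comm k V V).toLinearMap :=
  TensorProduct.ext' fun x y => by simp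

lemma gamma2_stable (f : V →ₗ[k] V) :
    ∀ z ∈ gamma2 k V, TensorProduct.map f f z ∈ gamma2 k V := by
  intro z hz
  have h1 : (TensorProduct.comm k V V).toLinearMap z = z := hz
  have h2 := congrArg (fun φ => φ z) (comm_comp_map k V f)
  simp only [LinearMap.comp_apply] at h2
  rw [h1] at h2
  exact h2

/-- The second divided power of a representation. -/
def gamma2Rep (ρ : Representation k G V) : Representation k G (gamma2 k V) where
  toFun g := ((ρ.tprod ρ) g).restrict (p := gamma2 k V) (q := gamma2 k V)
    (gamma2_stable k V (ρ g))
  map_one' := by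
    ext z
    simp [LinearMap.restrict_apply, Representation.tprod_apply]
  map_mul' g h := by
    ext z
    simp only [LinearMap.restrict_apply, Representation.tprod_apply, map_mul,
      Module.End.mul_apply, LinearMap.coe_mk, AddHom.coe_mk, Submodule.coe_subtype]


end

open Module
open LinearMap (ker range fst snd inl inr mem_ker finrank_range_add_finrank_ker comp_apply)
open QuotientAddGroup (mk_surjective eq_zero_iff)
open Submodule (disjoint_def mem_bot mem_sup mem_sup_left mem_sup_right span map_comap_subtype finrank_mono prodEquivOfIsCompl mem_span_singleton)
open Finset (sum_congr sum_add_distrib sum_apply sum_eq_zero sum_const sum_eq_single mem_univ)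
open Finsupp (single weight_apply single_le_iff)
open Function (Injective Surjective)
open Equiv (Perm)
open Fintype (card)
open Subgroup (inclusion)
local notation "unitWt" => (fun _ : Unit => 1)
local notation "BIdx" => Basis.ofVectorSpaceIndex
local notation "BVec" => Basis.ofVectorSpace
local notation "IsWH" => MvPolynomial.IsWeightedHomogeneous
local postfix:max "ˡ" => LinearEquiv.toLinearMap
local notation "AbGrp" => AddCommGroup
local notation "FinDim" => FiniteDimensional
local notation "whComp" => MvPolynomial.weightedHomogeneousComponent
noncomputable section

lemma charP_nsmul (k : Type) [Field k] {p : ℕ} [CharP k p] {V : Type} [AbGrp V] [Module k V]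
  (v : V) : p • v = 0 := by rw [← Nat.cast_smul_eq_nsmul k, CharP.cast_eq_zero, zero_smul]

lemma primeOut (p : ℕ) [Fact p.Prime] : p.Prime := Fact.out

lemma map_mem_bot {k V : Type} [Field k] [AbGrp V] [Module k V] (g : V ≃ₗ[k] V) :
  ∀ a ∈ (⊥ : Submodule k V), g a = a := fun a ha => by rw [(mem_bot k).1 ha, map_zero]

/-! ### Group cohomology by inhomogeneous cochains, additively -/

section Cochains

variable {G H M N L : Type} [Group G] [Group H] [AbGrp M] [AbGrp N] [AbGrp L]

/-- An additive action of `G` on `M`. -/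
abbrev GMod (G M : Type) [Group G] [AbGrp M] := G →* AddMonoid.End M

lemma GMod.one_apply (ρ : GMod G M) (m : M) : ρ 1 m = m := by rw [map_one]; rfl

lemma GMod.mul_apply (ρ : GMod G M) (g h : G) (m : M) : ρ (g * h) m = ρ g (ρ h m) := by
  rw [map_mul]; rfl

lemma GMod.apply_inv_self (ρ : GMod G M) (g : G) (m : M) : ρ g (ρ g⁻¹ m) = m := by
  rw [← GMod.mul_apply, mul_inv_cancel, GMod.one_apply]

/-- The additive map by which a group element acts. -/
def GMod.hom (ρ : GMod G M) (g : G) : M →+ M := ρ g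

@[simp] lemma GMod.hom_apply (ρ : GMod G M) (g : G) (m : M) : ρ.hom g m = ρ g m := rfl

/-- The differential on inhomogeneous cochains. -/
def cd (ρ : GMod G M) (n : ℕ) : ((Fin n → G) → M) →+ ((Fin (n + 1) → G) → M) where
  toFun c g := ρ (g 0) (c fun i => g i.succ) +
    ∑ j : Fin (n + 1), (-1 : ℤ) ^ ((j : ℕ) + 1) • c (Fin.contractNth j (· * ·) g)
  map_zero' := by ext; simp
  map_add' a b := by ext; simp [sum_add_distrib, add_add_add_comm]

lemma cd_apply (ρ : GMod G M) (n : ℕ) (c : (Fin n → G) → M) (g : Fin (n + 1) → G) :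
  cd ρ n c g = ρ (g 0) (c fun i => g i.succ) +
  ∑ j : Fin (n + 1), (-1 : ℤ) ^ ((j : ℕ) + 1) • c (Fin.contractNth j (· * ·) g) := rfl

/-- The integral representation underlying an additive action. -/
def GMod.toRep (ρ : GMod G M) : Representation ℤ G M where
  toFun g := (ρ g).toIntLinearMap
  map_one' := by ext m; exact ρ.one_apply m
  map_mul' g h := by ext m; exact ρ.mul_apply g h m

lemma cd_cd (ρ : GMod G M) (n : ℕ) (c : (Fin n → G) → M) : cd ρ (n + 1) (cd ρ n c) = 0 := by
  have h := congrArg (fun f => f.hom c)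
    (groupCohomology.inhomogeneousCochains.d_comp_d n (Rep.of (GMod.toRep ρ)))
  exact h

/-- A cochain is a coboundary; in degree zero only `0` is. -/
def IsCob (ρ : GMod G M) : (n : ℕ) → ((Fin n → G) → M) → Prop
  | 0, c => c = 0
  | n + 1, c => ∃ u, cd ρ n u = c

/-- Every cocycle of degree `n` is a coboundary. -/
def Van (n : ℕ) (ρ : GMod G M) : Prop := ∀ c, cd ρ n c = 0 → IsCob ρ n c

lemma IsCob.add {ρ : GMod G M} {n : ℕ} {a b : (Fin n → G) → M} (ha : IsCob ρ n a)
  (hb : IsCob ρ n b) : IsCob ρ n (a + b) := by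
  cases n with
  | zero => simp_all [IsCob]
  | succ n =>
    obtain ⟨u, rfl⟩ := ha; obtain ⟨v, rfl⟩ := hb; exact ⟨u + v, map_add _ _ _⟩

lemma IsCob.neg {ρ : GMod G M} {n : ℕ} {a : (Fin n → G) → M} (ha : IsCob ρ n a) :
  IsCob ρ n (-a) := by
  cases n with
  | zero => simp_all [IsCob]
  | succ n =>
    obtain ⟨u, rfl⟩ := ha; exact ⟨-u, map_neg _ _⟩

lemma IsCob.zero (ρ : GMod G M) (n : ℕ) : IsCob ρ n 0 := by
  cases n with
  | zero => rfl
  | succ n => exact ⟨0, map_zero _⟩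

lemma IsCob.sub {ρ : GMod G M} {n : ℕ} {a b : (Fin n → G) → M} (ha : IsCob ρ n a)
  (hb : IsCob ρ n b) : IsCob ρ n (a - b) := by
  rw [sub_eq_add_neg]; exact ha.add hb.neg

lemma IsCob.sum {ι : Type*} {ρ : GMod G M} {n : ℕ} (s : Finset ι) {a : ι → (Fin n → G) → M}
  (ha : ∀ i ∈ s, IsCob ρ n (a i)) : IsCob ρ n (∑ i ∈ s, a i) := by
  classical
  induction s using Finset.induction_on with
  | empty => simpa using IsCob.zero ρ n
  | insert i s hi ih =>
    rw [Finset.sum_insert hi]; exact (ha i (by simp)).add (ih fun j hj => ha j (by simp [hj]))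

lemma IsCob.cocycle {ρ : GMod G M} {n : ℕ} {a : (Fin n → G) → M} (ha : IsCob ρ n a) :
  cd ρ n a = 0 := by
  cases n with
  | zero => rw [show a = 0 from ha, map_zero]
  | succ n =>
    obtain ⟨u, rfl⟩ := ha; exact cd_cd _ _ _

/-- Pulling cochains back along a group homomorphism and pushing coefficients forward. -/
def pull (f : H →* G) (φ : M →+ N) (n : ℕ) : ((Fin n → G) → M) →+ ((Fin n → H) → N) where
  toFun c h := φ (c (f ∘ h))
  map_zero' := by ext; simp
  map_add' a b := by ext; simp

@[simp] lemma pull_apply (f : H →* G) (φ : M →+ N) (n : ℕ) (c : (Fin n → G) → M)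
  (h : Fin n → H) : pull f φ n c h = φ (c (f ∘ h)) := rfl

lemma contractNth_comp (f : H →* G) {n : ℕ} (j : Fin (n + 1)) (h : Fin (n + 1) → H) :
  Fin.contractNth j (· * ·) (f ∘ h) = f ∘ Fin.contractNth j (· * ·) h := by
  ext i; simp only [Fin.contractNth, Function.comp]; split_ifs <;> simp

/-- `φ` is equivariant along `f`. -/
def Equi (f : H →* G) (ρ : GMod G M) (σ : GMod H N) (φ : M →+ N) : Prop :=
  ∀ h m, φ (ρ (f h) m) = σ h (φ m)

lemma cd_pull {f : H →* G} {ρ : GMod G M} {σ : GMod H N} {φ : M →+ N} (hφ : Equi f ρ σ φ)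
  (n : ℕ) (c : (Fin n → G) → M) : cd σ n (pull f φ n c) = pull f φ (n + 1) (cd ρ n c) := by
  ext h; simp only [cd_apply, pull_apply, map_add, map_sum, map_zsmul, contractNth_comp]; congr 1
  exact (hφ _ _).symm

lemma IsCob.push {f : H →* G} {ρ : GMod G M} {σ : GMod H N} {φ : M →+ N} (hφ : Equi f ρ σ φ)
  {n : ℕ} {c : (Fin n → G) → M} (hc : IsCob ρ n c) : IsCob σ n (pull f φ n c) := by
  cases n with
  | zero => rw [show c = 0 from hc, map_zero]; rfl
  | succ n =>
    obtain ⟨u, rfl⟩ := hc; exact ⟨_, cd_pull hφ n u⟩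

/-- Restriction of cochains along a homomorphism. -/
abbrev res (f : H →* G) (n : ℕ) : ((Fin n → G) → M) →+ ((Fin n → H) → M) :=
  pull f (.id M) n

lemma equi_res (f : H →* G) (ρ : GMod G M) : Equi f ρ (ρ.comp f) (.id M) :=
  fun _ _ => rfl

lemma IsCob.of_pull_equiv (f : H ≃* G) (φ : M ≃+ N) {ρ : GMod G M} {σ : GMod H N}
  (hφ : Equi f.toMonoidHom ρ σ φ.toAddMonoidHom) {n : ℕ} {c : (Fin n → G) → M}
  (hc : IsCob σ n (pull f.toMonoidHom φ.toAddMonoidHom n c)) : IsCob ρ n c := by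
  have h : Equi f.symm.toMonoidHom σ ρ φ.symm.toAddMonoidHom := by
    intro g m; apply φ.injective; have := hφ (f.symm g) (φ.symm m); simp at this ⊢; exact this.symm
  convert hc.push h using 1; ext g; change c g = φ.symm (φ (c _))
  rw [AddEquiv.symm_apply_apply]; congr 1; ext i; exact (f.apply_symm_apply _).symm

lemma Van.of_equiv (f : H ≃* G) (φ : M ≃+ N) {ρ : GMod G M} {σ : GMod H N}
  (hφ : Equi f.toMonoidHom ρ σ φ.toAddMonoidHom) {n : ℕ} (hv : Van n σ) : Van n ρ := by
  intro c hc; exact IsCob.of_pull_equiv f φ hφ (hv _ (by rw [cd_pull hφ, hc, map_zero]))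

lemma Van.of_retract {ρ : GMod G M} {σ : GMod G N} {i : M →+ N} {r : N →+ M}
  (hi : Equi (.id G) ρ σ i) (hr : Equi (.id G) σ ρ r)
  (h : ∀ m, r (i m) = m) {n : ℕ} (hv : Van n σ) : Van n ρ := by
  intro c hc; convert (hv _ (by rw [cd_pull hi, hc, map_zero])).push hr using 1; ext g
  exact (h _).symm

/-- A restricted cochain is a coboundary if that holds for an injective homomorphism with the
same image. -/
lemma IsCob.res_of_range {K : Type} [Group K] {f : H →* G} {g : K →* G}
  (hf : Injective f) (hfg : ∀ x, ∃ y, f y = g x) {σ : GMod K N} {φ : M →+ N}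
  {τ : GMod H N}
  (hcomp : ∀ x y, f y = g x → τ y = σ x) {n : ℕ} {c : (Fin n → G) → M}
  (hc : IsCob τ n (pull f φ n c)) : IsCob σ n (pull g φ n c) := by
  choose e he using hfg
  let E : K →* H :=
    { toFun := e
      map_one' := hf (by rw [he, map_one, map_one])
      map_mul' := fun x y => hf (by rw [he, map_mul, map_mul, he, he]) }
  have : Equi E τ σ (.id N) := fun x m => by simp only [AddMonoidHom.id_apply, hcomp x (E x) (he x)]
  convert hc.push this using 1; ext x; simp only [pull_apply, AddMonoidHom.id_apply]
  congr 2; ext i; exact (he _).symm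

lemma cd_zero_apply (ρ : GMod G M) (c : (Fin 0 → G) → M) (g : Fin 1 → G) :
  cd ρ 0 c g = ρ (g 0) (c Fin.elim0) - c Fin.elim0 := by
  rw [cd_apply, Fin.sum_univ_one, Subsingleton.elim (fun i : Fin 0 => g i.succ) Fin.elim0,
    Subsingleton.elim (Fin.contractNth (0 : Fin 1) (· * ·) g) Fin.elim0]
  simp [sub_eq_add_neg]

lemma cd_zero_iff (ρ : GMod G M) (c : (Fin 0 → G) → M) :
  cd ρ 0 c = 0 ↔ ∀ g, ρ g (c Fin.elim0) = c Fin.elim0 := by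
  constructor
  · intro h g; have := congrFun h (fun _ => g); rw [cd_zero_apply] at this; exact sub_eq_zero.1 this
  · intro h; ext g; rw [cd_zero_apply, h, sub_self]; rfl

lemma van_zero_iff (ρ : GMod G M) : Van 0 ρ ↔ ∀ m, (∀ g, ρ g m = m) → m = 0 := by
  constructor
  · intro h m hm; exact congrFun (h (fun _ => m) ((cd_zero_iff _ _).2 hm)) Fin.elim0
  · intro h c hc; ext x; rw [Subsingleton.elim x Fin.elim0]; exact h _ ((cd_zero_iff _ _).1 hc)

/-! ### Modules of functions -/

variable {X Y : Type}

/-- The conjugation action on functions `X → M`. -/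
def funRep (a : G →* Perm X) (ρ : GMod G M) : GMod G (X → M) where
  toFun g :=
    { toFun := fun F x => ρ g (F (a g⁻¹ x))
      map_zero' := by ext; simp
      map_add' := fun F F' => by ext; simp }
  map_one' := by ext F x; change ρ 1 (F (a 1⁻¹ x)) = F x; simp
  map_mul' g h := by
    ext F x; change ρ (g * h) (F (a (g * h)⁻¹ x)) = ρ g (ρ h (F (a h⁻¹ (a g⁻¹ x))))
    rw [GMod.mul_apply, mul_inv_rev, map_mul]; rfl

@[simp] lemma funRep_apply (a : G →* Perm X) (ρ : GMod G M) (g : G) (F : X → M) (x : X) :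
  funRep a ρ g F x = ρ g (F (a g⁻¹ x)) := rfl

lemma contractNth_zero_cons {n : ℕ} (x : G) (g : Fin (n + 1) → G) :
  Fin.contractNth 0 (· * ·) (Fin.cons x g : Fin (n + 2) → G) =
  Fin.cons (x * g 0) (fun i => g i.succ) := by
  ext i; refine Fin.cases ?_ (fun i => ?_) i
  · simp [Fin.contractNth]
  · simp [Fin.contractNth]

lemma contractNth_succ_cons {n : ℕ} (x : G) (g : Fin (n + 1) → G) (j : Fin (n + 1)) :
  Fin.contractNth j.succ (· * ·) (Fin.cons x g : Fin (n + 2) → G) =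
  Fin.cons x (Fin.contractNth j (· * ·) g) := by
  ext i; refine Fin.cases ?_ (fun i => ?_) i
  · simp [Fin.contractNth]
  · simp only [Fin.contractNth, Fin.val_succ, Fin.cons_succ]
    have : ((i.succ : Fin (n + 1)).castSucc : Fin (n + 2)) = (i.castSucc).succ := rfl; rw [this]
    simp only [Fin.cons_succ]; congr 1
    · simp
    · congr 1; simp

lemma cd_cons (ρ : GMod G M) {n : ℕ} (c : (Fin (n + 1) → G) → M) (x : G) (g : Fin (n + 1) → G) :
  cd ρ (n + 1) c (Fin.cons x g) = ρ x (c g) - c (Fin.cons (x * g 0) fun i => g i.succ) -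
  ∑ j : Fin (n + 1), (-1 : ℤ) ^ ((j : ℕ) + 1) • c (Fin.cons x (Fin.contractNth j (· * ·) g)) := by
  rw [cd_apply, Fin.sum_univ_succ, contractNth_zero_cons]; simp only [contractNth_succ_cons]
  simp [pow_succ, sub_eq_add_neg, add_assoc]

/-- Functions on a free `G`-set have no higher cohomology. -/
lemma funRep_van (a : G →* Perm X) (ρ : GMod G M) (η : X → G)
  (hη : ∀ g x, η (a g x) = g * η x) (n : ℕ) : Van (n + 1) (funRep a ρ) := by
  intro c hc; refine ⟨fun g x => ρ (η x) (c (Fin.cons (η x)⁻¹ g) (a (η x)⁻¹ x)), ?_⟩; ext g x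
  have h := congrFun (congrFun hc (Fin.cons (η x)⁻¹ g)) (a (η x)⁻¹ x); rw [cd_cons] at h
  simp only [Pi.sub_apply, Finset.sum_apply, Pi.smul_apply, Pi.zero_apply, funRep_apply,
    inv_inv] at h
  rw [cd_apply]; simp only [Pi.add_apply, Finset.sum_apply, Pi.smul_apply, funRep_apply]
  have h1 : ∀ m, ρ (η x) (ρ (η x)⁻¹ m) = m := fun m => ρ.apply_inv_self _ _
  have h2 : ∀ m, ρ (g 0) (ρ ((g 0)⁻¹ * η x) m) = ρ (η x) m := fun m => by
    rw [← GMod.mul_apply]; simp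
  have h3 : a ((g 0)⁻¹ * η x)⁻¹ (a (g 0)⁻¹ x) = a (η x)⁻¹ x := by
    rw [← Equiv.Perm.mul_apply, ← map_mul]; simp
  have h4 : a (η x) (a (η x)⁻¹ x) = x := by rw [← Equiv.Perm.mul_apply, ← map_mul]; simp
  rw [hη, h2, h3]; rw [h4] at h; have h5 := congrArg (ρ (η x)) h
  simp only [map_sub, map_sum, map_zsmul, h1, map_zero] at h5; rw [mul_inv_rev, inv_inv]
  rw [sub_sub, sub_eq_zero] at h5; exact h5.symm

end Cochains

/-! ### Short exact sequences and dimension shifting -/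

section SES

variable {G A B C M : Type} [Group G] [AbGrp A] [AbGrp B] [AbGrp C]
  [AbGrp M]

/-- The action on a quotient. -/
def GMod.quot (ρ : GMod G M) (S : AddSubgroup M) (hS : ∀ g, S ≤ S.comap (ρ.hom g)) :
  GMod G (M ⧸ S) where
  toFun g := QuotientAddGroup.map S S (ρ.hom g) (hS g)
  map_one' := AddMonoidHom.ext fun x => by
    obtain ⟨x, rfl⟩ := mk_surjective x; exact congrArg QuotientAddGroup.mk (ρ.one_apply x)
  map_mul' g h := AddMonoidHom.ext fun x => by
    obtain ⟨x, rfl⟩ := mk_surjective x; exact congrArg QuotientAddGroup.mk (ρ.mul_apply g h x)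

/-- Pushing cochains forward along a coefficient map. -/
abbrev push (φ : A →+ B) (n : ℕ) : ((Fin n → G) → A) →+ ((Fin n → G) → B) := pull (.id G) φ n

/-- Short exact sequences of modules. -/
structure SES (ρ : GMod G A) (σ : GMod G B) (τ : GMod G C) (f : A →+ B) (g : B →+ C) : Prop where
  ef : Equi (.id G) ρ σ f
  eg : Equi (.id G) σ τ g
  inj : Injective f
  surj : Surjective g
  exact : ∀ b, g b = 0 ↔ ∃ a, f a = b

namespace SES

variable {ρ : GMod G A} {σ : GMod G B} {τ : GMod G C} {f : A →+ B} {g : B →+ C}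
  (h : SES ρ σ τ f g)
include h

lemma push_inj (n : ℕ) : Injective (push (G := G) f n) :=
  fun _ _ hab => funext fun x => h.inj (congrFun hab x)

lemma push_surj (n : ℕ) (c : (Fin n → G) → C) : ∃ b, push g n b = c := by
  choose s hs using h.surj; exact ⟨fun x => s (c x), funext fun x => hs _⟩

lemma push_comp (n : ℕ) (a : (Fin n → G) → A) : push g n (push f n a) = 0 :=
  funext fun x => (h.exact _).2 ⟨a x, rfl⟩

lemma push_lift (n : ℕ) (b : (Fin n → G) → B) (hb : push g n b = 0) : ∃ a, push f n a = b := by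
  choose a ha using fun x => (h.exact (b x)).1 (congrFun hb x); exact ⟨a, funext ha⟩

lemma exists_isCob_lift {i : ℕ} {u : (Fin i → G) → B} (hu : IsCob τ i (push g i u)) :
  ∃ w a, IsCob σ i w ∧ push f i a = u - w := by
  obtain ⟨w, hw, hw'⟩ : ∃ w, IsCob σ i w ∧ push g i w = push g i u := by
    cases i with
    | zero => exact ⟨0, rfl, (map_zero _).trans (show push g 0 u = 0 from hu).symm⟩
    | succ i =>
      obtain ⟨v, hv⟩ := hu; obtain ⟨v, rfl⟩ := h.push_surj i v
      exact ⟨cd σ i v, ⟨v, rfl⟩, by rw [← hv, cd_pull h.eg]⟩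
  obtain ⟨a, ha⟩ := h.push_lift i (u - w) (by rw [map_sub, hw', sub_self]); exact ⟨w, a, hw, ha⟩

lemma isCob_succ {i : ℕ} {u : (Fin i → G) → B} {z : (Fin (i + 1) → G) → A}
  (hz : cd σ i u = push f (i + 1) z) (hu : IsCob τ i (push g i u)) : IsCob ρ (i + 1) z := by
  obtain ⟨w, a, hw, ha⟩ := h.exists_isCob_lift hu
  exact ⟨a, h.push_inj _ (by rw [← cd_pull h.ef, ha, map_sub, hw.cocycle, sub_zero, hz])⟩

lemma van_mid {i : ℕ} (hA : Van i ρ) (hC : Van i τ) : Van i σ := by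
  intro z hz
  obtain ⟨w, a, hw, ha⟩ :=
    h.exists_isCob_lift (hC (push g i z) (by rw [cd_pull h.eg, hz, map_zero]))
  have h3 := (IsCob.push h.ef (hA a (h.push_inj _ (by
    rw [← cd_pull h.ef, ha, map_sub, hz, hw.cocycle, map_zero, sub_zero])))).add hw
  rwa [ha, sub_add_cancel] at h3

lemma van_left {i : ℕ} (hC : Van i τ) (hB : Van (i + 1) σ) : Van (i + 1) ρ := by
  intro z hz; obtain ⟨u, hu⟩ := hB (push f (i + 1) z) (by rw [cd_pull h.ef, hz, map_zero])
  exact h.isCob_succ hu (hC _ (by rw [cd_pull h.eg, hu, h.push_comp]))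

lemma van_left_zero (hB : Van 0 σ) : Van 0 ρ := by
  rw [van_zero_iff] at hB ⊢
  exact fun m hm => h.inj ((hB _ fun x => (h.ef x m).symm.trans (congrArg f (hm x))).trans
    (map_zero f).symm)

lemma isCob_push_of_van {i : ℕ} (hB : Van i σ) {u : (Fin i → G) → B} {a : (Fin (i + 1) → G) → A}
  (ha : cd σ i u = push f (i + 1) a) (h1 : IsCob ρ (i + 1) a) : IsCob τ i (push g i u) := by
  obtain ⟨v, rfl⟩ := h1
  have h2 := IsCob.push h.eg (hB (u - push f i v) (by rw [map_sub, cd_pull h.ef, ha, sub_self]))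
  rwa [map_sub, h.push_comp, sub_zero] at h2

lemma van_right {i : ℕ} (hB : Van i σ) (hA : Van (i + 1) ρ) : Van i τ := by
  intro z hz; obtain ⟨u, rfl⟩ := h.push_surj i z
  obtain ⟨a, ha⟩ := h.push_lift (i + 1) (cd σ i u) (by rw [← cd_pull h.eg, hz])
  exact h.isCob_push_of_van hB ha.symm
    (hA a (h.push_inj _ (by rw [← cd_pull h.ef, ha, cd_cd, map_zero])))

lemma compLeft {X : Type} (a : G →* Perm X) :
  SES (funRep a ρ) (funRep a σ) (funRep a τ) (f.compLeft X) (g.compLeft X) where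
  ef x c := funext fun y => h.ef _ _
  eg x c := funext fun y => h.eg _ _
  inj c c' hc := funext fun y => h.inj (congrFun hc y)
  surj c := by choose s hs using h.surj; exact ⟨fun y => s (c y), funext fun y => hs _⟩
  exact c := by
    refine ⟨fun hc => ?_, ?_⟩
    · choose a ha using fun y => (h.exact (c y)).1 (congrFun hc y); exact ⟨a, funext ha⟩
    · rintro ⟨a, rfl⟩; exact funext fun y => (h.exact _).2 ⟨a y, rfl⟩

end SES

end SES

section DimensionShift

variable {G H M N L : Type} [Group G] [Group H] [AbGrp M] [AbGrp N] [AbGrp L]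
variable {X Y : Type}

/-- The left translation action of a group on itself. -/
def leftPerm (G : Type) [Group G] : G →* Perm G := MulAction.toPermHom G G

@[simp] lemma leftPerm_apply (g x : G) : leftPerm G g x = g * x := rfl

lemma exists_free_section (f : H →* G) (hf : Injective f) :
  ∃ η : G → H, ∀ h x, η (f h * x) = h * η x := by
  classical
  let s : Setoid G := MulAction.orbitRel f.range G
  have key : ∀ x : G, ∃ h : H, f h * (Quotient.out (Quotient.mk s x)) = x := by
    intro x; have h1 : s (Quotient.out (Quotient.mk s x)) x := Quotient.exact (Quotient.out_eq _)
    have h2 : x ∈ MulAction.orbit f.range (Quotient.out (Quotient.mk s x)) :=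
      (MulAction.orbitRel_apply).1 (s.symm h1)
    obtain ⟨⟨_, h, rfl⟩, hx⟩ := h2; exact ⟨h, hx⟩
  choose η hη using key; refine ⟨η, fun h x => ?_⟩
  have hq : Quotient.mk s (f h * x) = Quotient.mk s x :=
    Quotient.sound ((MulAction.orbitRel_apply).2 ⟨⟨f h, h, rfl⟩, rfl⟩)
  apply hf; have h1 := hη (f h * x); rw [hq] at h1; have h2 := hη x; rw [map_mul]
  apply mul_right_cancel (b := Quotient.out (Quotient.mk s x)); rw [h1, mul_assoc, h2]

lemma van_funRep_funRep (a : G →* Perm X) (ρ : GMod G M) (n : ℕ) :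
  Van (n + 1) (funRep a (funRep (leftPerm G) ρ)) := by
  let b : G →* Perm (X × G) :=
    { toFun := fun g => Equiv.prodCongr (a g) (leftPerm G g)
      map_one' := by ext x <;> simp
      map_mul' := fun g h => by ext x <;> simp }
  let e : (X → G → M) ≃+ (X × G → M) :=
    { toFun := fun F x => F x.1 x.2
      invFun := fun F x y => F (x, y)
      left_inv := fun _ => rfl
      right_inv := fun _ => rfl
      map_add' := fun _ _ => rfl }
  refine Van.of_equiv (.refl G) e (σ := funRep b ρ) ?_
    (funRep_van b ρ (fun x => x.2) (fun g x => rfl) n)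
  intro g F; rfl

/-- Every module embeds in one which is cohomologically trivial over all subgroups. -/
lemma exists_dimension_shift (ρ : GMod G M) : ∃ (I Q : Type) (_ : AbGrp I)
  (_ : AbGrp Q) (σ : GMod G I) (τ : GMod G Q) (ι : M →+ I) (π : I →+ Q), SES ρ σ τ ι π ∧
  (∀ (H : Type) [Group H] (f : H →* G), Injective f → ∀ n, Van (n + 1) (σ.comp f)) ∧
  (∀ (X : Type) (a : G →* Perm X) (n : ℕ), Van (n + 1) (funRep a σ)) := by
  let σ := funRep (leftPerm G) ρ
  let ι : M →+ (G → M) := ⟨⟨fun m _ => m, rfl⟩, fun _ _ => rfl⟩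
  have hR : ∀ g, ι.range ≤ ι.range.comap (σ.hom g) := by rintro g _ ⟨m, rfl⟩; exact ⟨ρ g m, rfl⟩
  refine ⟨G → M, _, inferInstance, inferInstance, σ, σ.quot ι.range hR, ι, QuotientAddGroup.mk' _,
    ⟨fun _ _ => rfl, fun _ _ => rfl, fun a b h => congrFun h 1, mk_surjective,
      eq_zero_iff⟩, fun H _ f hf n => ?_, fun X a n => van_funRep_funRep a ρ n⟩
  obtain ⟨η, hη⟩ := exists_free_section f hf
  have e : MonoidHom.comp σ f = funRep ((leftPerm G).comp f) (MonoidHom.comp ρ f) := by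
    ext h F x; simp [σ]
  exact e ▸ funRep_van ((leftPerm G).comp f) (ρ.comp f) η hη n

/-- Inner automorphisms act trivially on cohomology. -/
lemma isCob_conj (i : ℕ) : ∀ {M : Type} [AbGrp M] (ρ : GMod G M) (c : G)
  (z : (Fin i → G) → M), cd ρ i z = 0 →
  IsCob ρ i (pull (MulAut.conj c⁻¹).toMonoidHom (ρ.hom c) i z - z) := by
  induction i with
  | zero =>
    intro M _ ρ c z hz; rw [cd_zero_iff] at hz; ext g
    rw [Pi.sub_apply, pull_apply, Subsingleton.elim (_ ∘ g) Fin.elim0,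
      Subsingleton.elim g Fin.elim0, GMod.hom_apply, hz, sub_self]
    rfl
  | succ i ih =>
    intro M _ ρ c z hz; obtain ⟨I, Q, _, _, σ, τ, ι, π, h, hI, -⟩ := exists_dimension_shift ρ
    have hI : Van (i + 1) σ := hI G (.id G) (fun _ _ h => h) i
    obtain ⟨u, hu⟩ := hI (push ι _ z) (by rw [cd_pull h.ef, hz, map_zero])
    have hequi : Equi (MulAut.conj c⁻¹).toMonoidHom σ σ (σ.hom c) := by
      intro g m; change σ c (σ (c⁻¹ * g * c⁻¹⁻¹) m) = σ g (σ c m)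
      rw [← GMod.mul_apply, ← GMod.mul_apply]; congr 2; group
    refine h.isCob_succ (u := pull (MulAut.conj c⁻¹).toMonoidHom (σ.hom c) i u - u) ?_ ?_
    · rw [map_sub, cd_pull hequi, hu, map_sub]
      exact congrArg (· - push ι _ z) (funext fun g => (h.ef c _).symm)
    · rw [map_sub]; convert ih τ c (push π i u) (by rw [cd_pull h.eg, hu, h.push_comp]) using 2
      exact funext fun g => h.eg c _

/-- The stabilizer of a point. -/
def stabSub (a : G →* Perm X) (x : X) : Subgroup G where
  carrier := {g | a g x = x}
  one_mem' := by simp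
  mul_mem' := fun {g h} hg hh => by
    change a (g * h) x = x
    rw [map_mul, Equiv.Perm.mul_apply, show a h x = x from hh, show a g x = x from hg]
  inv_mem' := fun {g} hg => by
    change a g⁻¹ x = x; rw [map_inv, Equiv.Perm.inv_eq_iff_eq]; exact (show a g x = x from hg).symm

/-- Evaluation at a point. -/
def evHom (M : Type) [AbGrp M] (x : X) : (X → M) →+ M := Pi.evalAddMonoidHom _ x

@[simp] lemma evHom_apply (x : X) (F : X → M) : evHom M x F = F x := rfl

lemma equi_ev (a : G →* Perm X) (ρ : GMod G M) (x : X) (f : H →* G)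
  (hf : ∀ h, a (f h) x = x) : Equi f (funRep a ρ) (ρ.comp f) (evHom M x) := by
  intro h F; simp only [evHom_apply, funRep_apply, MonoidHom.comp_apply]
  rw [show a (f h)⁻¹ x = x by rw [map_inv, Equiv.Perm.inv_eq_iff_eq]; exact (hf h).symm]

lemma isCob_funRep_aux (i : ℕ) : ∀ {M : Type} [AbGrp M] (a : G →* Perm X)
  (ρ : GMod G M) (w : (Fin i → G) → X → M), cd (funRep a ρ) i w = 0 →
  (∀ x, IsCob (ρ.comp (stabSub a x).subtype) i (pull (stabSub a x).subtype (evHom M x) i w)) →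
  IsCob (funRep a ρ) i w := by
  induction i with
  | zero =>
    intro M _ a ρ w hw h; ext g x; rw [Subsingleton.elim g ((stabSub a x).subtype ∘ Fin.elim0)]
    exact congrFun (h x) Fin.elim0
  | succ i ih =>
    intro M _ a ρ w hw h; obtain ⟨I, Q, _, _, σ, τ, ι, π, hS, hI, hIX⟩ := exists_dimension_shift ρ
    have hF := hS.compLeft a
    obtain ⟨u, hu⟩ : IsCob (funRep a σ) (i + 1) (push (ι.compLeft X) _ w) :=
      hIX X a i _ (by rw [cd_pull hF.ef, hw, map_zero])
    have hub : cd (funRep a τ) i (push (π.compLeft X) i u) = 0 := by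
      rw [cd_pull hF.eg, hu, hF.push_comp]
    have hb : ∀ x, ∃ b : (Fin i → stabSub a x) → M,
        cd (σ.comp (stabSub a x).subtype) i (push ι i b -
          pull (stabSub a x).subtype (evHom I x) i u) = 0 := by
      intro x; obtain ⟨b, hb⟩ := h x; refine ⟨b, ?_⟩
      rw [map_sub, cd_pull (equi_ev a σ x _ fun h => h.2), hu,
        cd_pull (ρ := ρ.comp (stabSub a x).subtype) (fun h m => hS.ef _ _), hb]
      exact funext fun g => sub_self _
    choose b hb using hb; have hπι : ∀ m, π (ι m) = 0 := fun m => (hS.exact _).2 ⟨m, rfl⟩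
    cases i with
    | zero =>
      classical
      let e : X → I := fun x => ι (b x Fin.elim0) - u Fin.elim0 x
      have hb' : ∀ x, ∀ g : G, a g x = x → σ g (e x) = e x := by
        intro x g hg; have h1 := (cd_zero_iff _ _).1 (hb x) ⟨g, hg⟩
        rw [Pi.sub_apply, pull_apply, pull_apply,
          Subsingleton.elim ((stabSub a x).subtype ∘ Fin.elim0 : Fin 0 → G) Fin.elim0,
          Subsingleton.elim (⇑(MonoidHom.id ↥(stabSub a x)) ∘ Fin.elim0 : Fin 0 → _) Fin.elim0]
          at h1
        exact h1
      let s : Setoid X := ⟨fun x y => ∃ g, a g x = y, fun x => ⟨1, by simp⟩,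
        fun ⟨g, hg⟩ => ⟨g⁻¹, by rw [map_inv, Equiv.Perm.inv_eq_iff_eq]; exact hg.symm⟩,
        fun ⟨g, hg⟩ ⟨h, hh⟩ => ⟨h * g, by rw [map_mul, Equiv.Perm.mul_apply, hg, hh]⟩⟩
      let o : X → X := fun x => Quotient.out (Quotient.mk s x)
      have hoe : ∀ g x, o (a g x) = o x := fun g x =>
        congrArg Quotient.out (Quotient.sound (s.symm ⟨g, rfl⟩))
      choose t ht using fun x => (Quotient.exact (Quotient.out_eq (Quotient.mk s x)) : s (o x) x)
      refine hF.isCob_succ (u := u - fun _ x => - σ (t x) (e (o x))) ?_ (funext fun g => funext fun x => ?_)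
      · rw [map_sub, hu, sub_eq_self, cd_zero_iff]; intro g; ext x
        rw [funRep_apply, map_neg, neg_inj, hoe, ← GMod.mul_apply]
        have h1 : a ((t x)⁻¹ * (g * t (a g⁻¹ x))) (o x) = o x := by
          have h2 := ht (a g⁻¹ x); rw [hoe] at h2
          rw [map_mul, map_mul, Equiv.Perm.mul_apply, Equiv.Perm.mul_apply, h2,
            ← Equiv.Perm.mul_apply (a g), ← map_mul, mul_inv_cancel, map_one,
            Equiv.Perm.one_apply, map_inv, Equiv.Perm.inv_eq_iff_eq, ht]
        conv_rhs => rw [← hb' (o x) _ h1, ← GMod.mul_apply]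
        congr 2; group
      · change π (u _ x - -σ (t x) (ι (b (o x) Fin.elim0) - u Fin.elim0 (o x))) = 0
        have h1 := congrFun (congrFun hu (fun _ => t x)) x
        rw [cd_zero_apply, Pi.sub_apply, funRep_apply,
          show a (t x)⁻¹ x = o x by rw [map_inv, Equiv.Perm.inv_eq_iff_eq, ht]] at h1
        rw [Subsingleton.elim (_ ∘ g) Fin.elim0, sub_neg_eq_add, map_sub (σ (t x)), ← hS.ef,
          add_sub_left_comm, ← neg_sub _ (u _ x), h1, map_add, hπι, map_neg, zero_add, neg_eq_zero]
        exact hπι _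
    | succ i =>
      refine hF.isCob_succ hu (ih a τ _ hub fun x => ?_)
      have h3 : Equi (.id _) (σ.comp (stabSub a x).subtype) (τ.comp (stabSub a x).subtype) π :=
        fun h m => hS.eg _ _
      convert ((hI _ (stabSub a x).subtype Subtype.val_injective i _ (hb x)).push h3).neg using 1
      ext g; simp only [pull_apply, Pi.neg_apply, Pi.sub_apply, map_sub]
      rw [hπι, zero_sub, neg_neg]; rfl

/-- A cohomology class with coefficients in functions on a `G`-set vanishes when its values on
stabilizers do. -/
lemma isCob_funRep {i : ℕ} {a : G →* Perm X} {ρ : GMod G M} {w : (Fin i → G) → X → M}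
  (hw : cd (funRep a ρ) i w = 0)
  (h : ∀ x, ∃ (H : Type) (_ : Group H) (f : H →* G), Injective f ∧
  (∀ g, a g x = x → ∃ h, f h = g) ∧ IsCob (ρ.comp f) i (pull f (evHom M x) i w)) :
  IsCob (funRep a ρ) i w := by
  refine isCob_funRep_aux i a ρ w hw fun x => ?_
  obtain ⟨H, _, f, hf, hfx, hc⟩ := h x
  refine IsCob.res_of_range hf (fun y : stabSub a x => hfx y y.2) ?_ hc; intro y z hyz
  simp only [MonoidHom.comp_apply, hyz]

lemma van_funRep {i : ℕ} {a : G →* Perm X} {ρ : GMod G M}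
  (h : ∀ x, ∃ (H : Type) (_ : Group H) (f : H →* G), Injective f ∧
  (∀ g, a g x = x → ∃ h, f h = g) ∧ (∀ h, a (f h) x = x) ∧ Van i (ρ.comp f)) :
  Van i (funRep a ρ) := by
  intro w hw; refine isCob_funRep hw fun x => ?_
  obtain ⟨H, _, f, hf, hfx, hfx', hc⟩ := h x
  exact ⟨H, _, f, hf, hfx, hc _ (by rw [cd_pull (equi_ev a ρ x f hfx'), hw, map_zero])⟩

/-- Restriction to a subgroup of index prime to `p` is injective on `p`-torsion cohomology. -/
lemma isCob_of_res_index [Finite G] (p : ℕ) [Fact p.Prime] (ρ : GMod G M)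
  (hM : ∀ m : M, p • m = 0) (P : Subgroup G) (hP : ¬ p ∣ P.index) {i : ℕ}
  {z : (Fin i → G) → M} (hz : cd ρ i z = 0)
  (h : IsCob (ρ.comp P.subtype) i (res P.subtype i z)) : IsCob ρ i z := by
  classical
  have := Fintype.ofFinite (G ⧸ P)
  let a : G →* Perm (G ⧸ P) := MulAction.toPermHom G (G ⧸ P)
  let ι : M →+ (G ⧸ P → M) := ⟨⟨fun m _ => m, rfl⟩, fun _ _ => rfl⟩
  have hι : Equi (.id G) ρ (funRep a ρ) ι := fun g m => rfl
  have h1 : IsCob (funRep a ρ) i (pull (.id G) ι i z) := by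
    refine isCob_funRep (by rw [cd_pull hι, hz, map_zero]) fun x => ?_
    obtain ⟨c, rfl⟩ := QuotientGroup.mk_surjective x
    refine ⟨P, inferInstance, (MulAut.conj c).toMonoidHom.comp P.subtype, ?_, ?_, ?_⟩
    · exact (MulAut.conj c).injective.comp Subtype.val_injective
    · intro g hg
      change (QuotientGroup.mk (g * c) : G ⧸ P) = QuotientGroup.mk c at hg
      refine ⟨⟨c⁻¹ * g * c, ?_⟩, ?_⟩
      · rw [mul_assoc]; exact QuotientGroup.eq.1 hg.symm
      · simp [mul_assoc]
    · have e : Equi (.id P) (ρ.comp P.subtype)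
          (ρ.comp ((MulAut.conj c).toMonoidHom.comp P.subtype)) (ρ.hom c) := by
        intro q m
        change ρ c (ρ q m) = ρ (c * q * c⁻¹) (ρ c m)
        rw [← GMod.mul_apply, ← GMod.mul_apply]
        congr 2
        group
      have hc := ((isCob_conj i ρ c⁻¹ z hz).push (equi_res P.subtype ρ)).add h
      convert hc.push e using 1
      ext g
      simp only [pull_apply, Pi.sub_apply, Pi.add_apply, AddMonoidHom.id_apply, inv_inv,
        sub_add_cancel, evHom_apply, GMod.hom_apply]
      rw [GMod.apply_inv_self]
      rfl
  let s : (G ⧸ P → M) →+ M := ⟨⟨fun F => ∑ x, F x, by simp⟩, fun F F' => by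
    simp [sum_add_distrib]⟩
  have hs : Equi (.id G) (funRep a ρ) ρ s := by
    intro g F
    change ∑ x, ρ g (F (a g⁻¹ x)) = ρ g (∑ x, F x)
    rw [map_sum]
    exact (Equiv.sum_comp (a g⁻¹) (fun x => ρ g (F x)))
  have h2 := h1.push hs
  have e : pull (.id G) s i (pull (.id G) ι i z) = P.index • z := by
    ext g
    change ∑ x : G ⧸ P, z g = P.index • z g
    rw [sum_const, Finset.card_univ, Subgroup.index_eq_card, Nat.card_eq_fintype_card]
  rw [e] at h2
  have hcop : Nat.Coprime P.index p :=
    ((Nat.Prime.coprime_iff_not_dvd Fact.out).2 hP).symm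
  obtain ⟨x, y, hxy⟩ := Int.isCoprime_iff_gcd_eq_one.2 (by
    simpa using hcop : Int.gcd (P.index : ℤ) p = 1)
  have h3 : z = x • (P.index • z) := by
    ext g
    have : (1 : ℤ) • z g = (x * P.index + y * p) • z g := by rw [hxy]
    rw [one_smul, add_smul, mul_smul, mul_smul] at this
    simp only [natCast_zsmul, hM, smul_zero, add_zero] at this
    exact this
  rw [h3]
  have h4 : ∀ (x : ℤ) (w : (Fin i → G) → M), IsCob ρ i w → IsCob ρ i (x • w) := by
    intro x w hw
    have : Equi (.id G) ρ ρ (DistribSMul.toAddMonoidHom M x) := by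
      intro g m; simp
    exact hw.push this
  exact h4 _ _ h2

end DimensionShift

/-! ### Zigzags in double complexes -/

section Zigzag

variable {G G' : Type} [Group G] [Group G']

/-- Comparison of two complexes of modules: if the class of `cd u` becomes trivial in the second
complex and invariants are compared suitably, then it is trivial in the first. -/
lemma zigzag_compare (i : ℕ) : ∀ (Y Y' : ℕ → Type) [∀ b, AbGrp (Y b)]
  [∀ b, AbGrp (Y' b)] (ρ : ∀ b, GMod G (Y b)) (ρ' : ∀ b, GMod G' (Y' b))
  (δ : ∀ b, Y b →+ Y (b + 1)) (δ' : ∀ b, Y' b →+ Y' (b + 1))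
  (_ : ∀ b, Equi (MonoidHom.id G) (ρ b) (ρ (b + 1)) (δ b))
  (_ : ∀ b, Equi (MonoidHom.id G') (ρ' b) (ρ' (b + 1)) (δ' b))
  (_ : ∀ b y, δ (b + 1) (δ b y) = 0) (_ : ∀ b y, δ' (b + 1) (δ' b y) = 0)
  (f : G' →* G) (Φ : ∀ b, Y b →+ Y' b) (_ : ∀ b, Equi f (ρ b) (ρ' b) (Φ b))
  (_ : ∀ b y, Φ (b + 1) (δ b y) = δ' b (Φ b y))
  (_ : ∀ b x, x + b + 1 = i → Van (x + 1) (ρ (b + 1)))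
  (_ : ∀ b x, x + 1 + b = i → Van (x + 1) (ρ' b))
  (_ : ∀ b x, x + b + 1 = i → ∀ v : (Fin x → G) → Y (b + 1), push (δ (b + 1)) x v = 0 →
  (∃ u, push (δ b) (x + 1) u = cd (ρ (b + 1)) x v) →
  ∃ v', cd (ρ (b + 1)) x (push (δ b) x v') = cd (ρ (b + 1)) x v)
  (_ : ∀ c : Y (i + 1), (∀ g, ρ (i + 1) g c = c) → δ (i + 1) c = 0 →
  ∀ e : Y' i, (∀ g, ρ' i g e = e) → Φ (i + 1) c = δ' i e →
  ∃ e0 : Y i, (∀ g, ρ i g e0 = e0) ∧ δ i e0 = c)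
  (u : (Fin i → G) → Y 0) (w : (Fin i → G') → Y' 0)
  (_ : push (δ 0) (i + 1) (cd (ρ 0) i u) = 0) (_ : push (δ' 0) i w = 0)
  (_ : cd (ρ' 0) i w = pull f (Φ 0) (i + 1) (cd (ρ 0) i u)),
  ∃ u', push (δ 0) i u' = 0 ∧ cd (ρ 0) i u' = cd (ρ 0) i u := by
  induction i with
  | zero =>
    intro Y Y' _ _ ρ ρ' δ δ' hδ hδ' hδδ _ f Φ hΦ hΦδ _ _ _ hc u w hu hw huw
    have h1 : cd (ρ 1) 0 (push (δ 0) 0 u) = 0 := by rw [cd_pull (hδ 0), hu]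
    have h2 : cd (ρ' 0) 0 (pull f (Φ 0) 0 u - w) = 0 := by
      rw [map_sub, cd_pull (hΦ 0), huw, sub_self]
    obtain ⟨e0, he0, he1⟩ := hc _ ((cd_zero_iff _ _).1 h1) (hδδ _ _) _ ((cd_zero_iff _ _).1 h2) (by
      have := congrFun hw Fin.elim0
      simp only [pull_apply, Pi.sub_apply, map_sub, Pi.zero_apply] at this ⊢
      rw [Subsingleton.elim (⇑(MonoidHom.id G') ∘ Fin.elim0 : Fin 0 → G') Fin.elim0] at this
      rw [this, sub_zero, hΦδ,
        Subsingleton.elim (⇑(MonoidHom.id G) ∘ Fin.elim0 : Fin 0 → G) (f ∘ Fin.elim0)])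
    refine ⟨u - fun _ => e0, ?_, ?_⟩
    · ext g; rw [map_sub, Pi.sub_apply]; simp only [pull_apply]
      rw [he1, Subsingleton.elim g Fin.elim0, pull_apply]; exact sub_self _
    · rw [map_sub, (cd_zero_iff (ρ 0) (fun _ => e0)).2 he0, sub_zero]
  | succ i ih =>
    intro Y Y' _ _ ρ ρ' δ δ' hδ hδ' hδδ hδδ' f Φ hΦ hΦδ hv hv' hfill hc u w hu hw huw
    have h1 : cd (ρ 1) (i + 1) (push (δ 0) (i + 1) u) = 0 := by rw [cd_pull (hδ 0), hu]
    obtain ⟨v, hv1⟩ := hv 0 i (by simp) _ h1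
    have h2 : cd (ρ' 0) (i + 1) (pull f (Φ 0) (i + 1) u - w) = 0 := by
      rw [map_sub, cd_pull (hΦ 0), huw, sub_self]
    obtain ⟨t, ht⟩ := hv' 0 i (by simp) _ h2
    obtain ⟨v', hv'0, hv'1⟩ := ih (fun b => Y (b + 1)) (fun b => Y' (b + 1)) (fun b => ρ (b + 1))
      (fun b => ρ' (b + 1)) (fun b => δ (b + 1)) (fun b => δ' (b + 1)) (fun b => hδ (b + 1))
      (fun b => hδ' (b + 1)) (fun b => hδδ (b + 1)) (fun b => hδδ' (b + 1)) f
      (fun b => Φ (b + 1)) (fun b => hΦ (b + 1)) (fun b => hΦδ (b + 1))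
      (fun b x h => hv (b + 1) x (by omega)) (fun b x h => hv' (b + 1) x (by omega))
      (fun b x h => hfill (b + 1) x (by omega)) hc v (push (δ' 0) i t)
      (by rw [hv1]; ext g; exact hδδ _ _) (by ext g; exact hδδ' _ _) (by
        rw [cd_pull (hδ' 0), ht, hv1, map_sub, hw, sub_zero]; ext g; exact (hΦδ _ _).symm)
    obtain ⟨v'', hv''⟩ := hfill 0 i (by simp) v' hv'0 ⟨u, by rw [hv'1, hv1]⟩
    refine ⟨u - cd (ρ 0) i v'', ?_, ?_⟩
    · rw [map_sub, ← cd_pull (hδ 0), hv'', hv'1, hv1, sub_self]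
    · rw [map_sub, cd_cd, sub_zero]

lemma zigzag (i : ℕ) (Y : ℕ → Type) [∀ b, AbGrp (Y b)]
  (ρ : ∀ b, GMod G (Y b)) (δ : ∀ b, Y b →+ Y (b + 1))
  (hδ : ∀ b, Equi (.id G) (ρ b) (ρ (b + 1)) (δ b))
  (hδδ : ∀ b y, δ (b + 1) (δ b y) = 0)
  (hv : ∀ b x, x + b + 1 = i → Van (x + 1) (ρ (b + 1)))
  (hfill : ∀ b x, x + b + 1 = i → ∀ v : (Fin x → G) → Y (b + 1), push (δ (b + 1)) x v = 0 →
  (∃ u, push (δ b) (x + 1) u = cd (ρ (b + 1)) x v) →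
  ∃ v', cd (ρ (b + 1)) x (push (δ b) x v') = cd (ρ (b + 1)) x v)
  (hrow : ∀ c : Y (i + 1), (∀ g, ρ (i + 1) g c = c) → δ (i + 1) c = 0 →
  ∃ e0 : Y i, (∀ g, ρ i g e0 = e0) ∧ δ i e0 = c)
  (u : (Fin i → G) → Y 0) (hu : push (δ 0) (i + 1) (cd (ρ 0) i u) = 0) :
  ∃ u', push (δ 0) i u' = 0 ∧ cd (ρ 0) i u' = cd (ρ 0) i u := by
  refine zigzag_compare i Y (fun _ => PUnit) ρ (fun _ => (1 : GMod G PUnit)) δ (fun _ => 0)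
    hδ (fun _ _ _ => rfl) hδδ (fun _ _ => rfl) (.id G) (fun _ => 0) (fun _ _ _ => rfl)
    (fun _ _ => rfl) hv (fun _ _ _ _ _ => ⟨0, rfl⟩) hfill (fun c hc hc' _ _ _ => hrow c hc hc') u 0
    hu rfl rfl

lemma fill_of_exact {Y : ℕ → Type} [∀ b, AbGrp (Y b)] {ρ : ∀ b, GMod G (Y b)}
  {δ : ∀ b, Y b →+ Y (b + 1)} (hex : ∀ b y, δ (b + 1) y = 0 → ∃ y', δ b y' = y)
  (b x : ℕ) (v : (Fin x → G) → Y (b + 1)) (hv : push (δ (b + 1)) x v = 0) :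
  ∃ v', cd (ρ (b + 1)) x (push (δ b) x v') = cd (ρ (b + 1)) x v := by
  choose v' hv' using fun g => hex b (v g) (congrFun hv g); refine ⟨v', ?_⟩; congr 1; ext g
  exact hv' g

end Zigzag

/-! ### The Čech complex of a set -/

section Cech

variable {X Y M N G : Type} [AbGrp M] [AbGrp N] [Group G]

/-- The differential of the augmented complex of functions on powers of a set. -/
def cech (X M : Type) [AbGrp M] : (n : ℕ) → ((Fin n → X) → M) →+ ((Fin (n + 1) → X) → M)
  | 0 => ⟨⟨fun c _ => c Fin.elim0, rfl⟩, fun _ _ => rfl⟩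
  | n + 1 =>
    { toFun := fun c x => c (Fin.tail x) - cech X M n (fun y => c (Fin.cons (x 0) y)) (Fin.tail x)
      map_zero' := by
        ext x
        have : (fun y : Fin n → X => (0 : (Fin (n + 1) → X) → M) (Fin.cons (x 0) y)) = 0 := rfl
        rw [this, map_zero]; simp
      map_add' := fun a b => by
        ext x
        have : (fun y : Fin n → X => (a + b) (Fin.cons (x 0) y)) =
          (fun y => a (Fin.cons (x 0) y)) + fun y => b (Fin.cons (x 0) y) := rfl
        rw [this, map_add]; simp only [Pi.add_apply]; abel }

lemma cech_zero_apply (c : (Fin 0 → X) → M) (x : Fin 1 → X) : cech X M 0 c x = c Fin.elim0 := rfl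

lemma cech_cons (n : ℕ) (c : (Fin (n + 1) → X) → M) (x0 : X) (x : Fin (n + 1) → X) :
  cech X M (n + 1) c (Fin.cons x0 x) = c x - cech X M n (fun y => c (Fin.cons x0 y)) x := rfl

lemma cech_cech (n : ℕ) : ∀ c : (Fin n → X) → M, cech X M (n + 1) (cech X M n c) = 0 := by
  induction n with
  | zero =>
    intro c; ext x; rw [← Fin.cons_self_tail x, cech_cons]; simp [cech_zero_apply]
  | succ n ih =>
    intro c; ext x; rw [← Fin.cons_self_tail x, cech_cons]
    have : (fun y => cech X M (n + 1) c (Fin.cons (x 0) y)) =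
        c - cech X M n (fun y => c (Fin.cons (x 0) y)) := by
      ext y; exact cech_cons _ _ _ _
    rw [this, map_sub, ih, sub_zero, sub_self]; rfl

lemma cech_exact [Nonempty X] (n : ℕ) (c : (Fin (n + 1) → X) → M) (hc : cech X M (n + 1) c = 0) :
  ∃ c', cech X M n c' = c := by
  obtain ⟨x0⟩ := ‹Nonempty X›; refine ⟨fun y => c (Fin.cons x0 y), ?_⟩; ext x
  have := congrFun hc (Fin.cons x0 x); rw [cech_cons] at this; exact (sub_eq_zero.1 this).symm

lemma cech_natural (φ : M →+ N) (f : Y → X) (n : ℕ) : ∀ (c : (Fin n → X) → M) (y : Fin (n + 1) → Y),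
  cech Y N n (fun z => φ (c (f ∘ z))) y = φ (cech X M n c (f ∘ y)) := by
  induction n with
  | zero =>
    intro c y; rw [cech_zero_apply, cech_zero_apply, Subsingleton.elim (f ∘ Fin.elim0) Fin.elim0]
  | succ n ih =>
    intro c y
    change φ (c (f ∘ Fin.tail y)) - cech Y N n _ (Fin.tail y) = φ (c (Fin.tail (f ∘ y)) - _)
    rw [map_sub]; congr 1; have h := ih (fun z => c (Fin.cons (f (y 0)) z)) (Fin.tail y)
    have e : Fin.tail (f ∘ y) = f ∘ Fin.tail y := rfl; rw [e]
    change _ = φ (cech X M n (fun z => c (Fin.cons (f (y 0)) z)) (f ∘ Fin.tail y)); rw [← h]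
    refine congrArg (fun w => cech Y N n w (Fin.tail y)) (funext fun z => congrArg (φ ∘ c) ?_)
    funext j; refine Fin.cases ?_ (fun j => ?_) j <;> simp

/-- The action on tuples. -/
def tuplePerm (a : G →* Perm X) (n : ℕ) : G →* Perm (Fin n → X) where
  toFun g := Equiv.piCongrRight fun _ => a g
  map_one' := by ext; simp
  map_mul' g h := by ext; simp

@[simp] lemma tuplePerm_apply (a : G →* Perm X) (n : ℕ) (g : G) (x : Fin n → X) :
  tuplePerm a n g x = a g ∘ x := rfl

lemma cech_equi (a : G →* Perm X) (ρ : GMod G M) (n : ℕ) :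
  Equi (.id G) (funRep (tuplePerm a n) ρ) (funRep (tuplePerm a (n + 1)) ρ) (cech X M n) := by
  intro g c; ext x; exact cech_natural (ρ.hom g) (a g⁻¹) n c x

lemma isCob_of_isCob_const [Nonempty X] (a : G →* Perm X) (ρ : GMod G M) (i : ℕ)
  (hv : ∀ b x, x + b + 1 = i → Van (x + 1) (funRep (tuplePerm a (b + 2)) ρ))
  (hrow : ∀ c : (Fin (i + 2) → X) → M, (∀ g, funRep (tuplePerm a (i + 2)) ρ g c = c) →
  cech X M (i + 2) c = 0 →
  ∃ e : (Fin (i + 1) → X) → M, (∀ g, funRep (tuplePerm a (i + 1)) ρ g e = e) ∧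
  cech X M (i + 1) e = c)
  (z : (Fin (i + 1) → G) → M)
  (hz : IsCob (funRep a ρ) (i + 1) (fun g _ => z g)) : IsCob ρ (i + 1) z := by
  obtain ⟨x0⟩ := id ‹Nonempty X›; obtain ⟨u, hu⟩ := hz
  let E : (X → M) →+ ((Fin 1 → X) → M) := ⟨⟨fun F x => F (x 0), rfl⟩, fun _ _ => rfl⟩
  have hE : Equi (.id G) (funRep a ρ) (funRep (tuplePerm a 1) ρ) E := fun _ _ => rfl
  have h1 : cd (funRep (tuplePerm a 1) ρ) i (push E i u) = fun g _ => z g := by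
    rw [cd_pull hE, hu]; rfl
  obtain ⟨u', hu', hu''⟩ := zigzag i (fun b => (Fin (b + 1) → X) → M)
    (fun b => funRep (tuplePerm a (b + 1)) ρ) (fun b => cech X M (b + 1))
    (fun b => cech_equi a ρ (b + 1)) (fun b y => cech_cech (b + 1) y) hv
    (fun b x _ v h _ => fill_of_exact (Y := fun b => (Fin (b + 1) → X) → M)
      (ρ := fun b => funRep (tuplePerm a (b + 1)) ρ)
      (fun b y h => cech_exact (b + 1) y h) b x v h) hrow (push E i u) (by
      rw [h1]; ext g x; exact congrFun (cech_cech 0 (fun _ : Fin 0 → X => z g)) x)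
  choose y hy using fun g => cech_exact 0 (u' g) (congrFun hu' g)
  refine ⟨fun g => y g Fin.elim0, ?_⟩; rw [h1] at hu''
  have hC : Equi (.id G) ρ (funRep (tuplePerm a 1) ρ)
    (⟨⟨fun m _ => m, rfl⟩, fun _ _ => rfl⟩ : M →+ ((Fin 1 → X) → M)) := fun _ _ => rfl
  have h2 := cd_pull hC i (fun g => y g Fin.elim0)
  have h3 : (pull (.id G) (⟨⟨fun m _ => m, rfl⟩, fun _ _ => rfl⟩ :
      M →+ ((Fin 1 → X) → M)) i (fun g => y g Fin.elim0)) = u' := by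
    ext g x; rw [← hy g]; rfl
  rw [h3, hu''] at h2; ext g; exact (congrFun (congrFun h2 g) (fun _ => x0)).symm

end Cech

section Products

variable {G₁ G₂ M : Type} [Group G₁] [Group G₂] [AbGrp M]

/-- The action of a product on its first factor by translation. -/
def fstPerm (G₁ G₂ : Type) [Group G₁] [Group G₂] : G₁ × G₂ →* Perm G₁ :=
  (leftPerm G₁).comp (.fst G₁ G₂)

lemma inr_of_fstPerm_fixed {n : ℕ} (x : Fin (n + 1) → G₁) (g : G₁ × G₂)
  (hg : tuplePerm (fstPerm G₁ G₂) (n + 1) g x = x) : ∃ h, MonoidHom.inr G₁ G₂ h = g := by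
  refine ⟨g.2, ?_⟩; have h : g.1 * x 0 = x 0 := congrFun hg 0; rw [mul_eq_right] at h
  ext <;> simp [h]

lemma inr_fixes {n : ℕ} (x : Fin n → G₁) (h : G₂) :
  tuplePerm (fstPerm G₁ G₂) n (MonoidHom.inr G₁ G₂ h) x = x := by
  ext j; simp [fstPerm]

lemma van_prod_tuple (ρ : GMod (G₁ × G₂) M) {i n : ℕ} (h : Van i (ρ.comp (.inr G₁ G₂))) :
  Van i (funRep (tuplePerm (fstPerm G₁ G₂) (n + 1)) ρ) :=
  van_funRep fun x => ⟨G₂, inferInstance, MonoidHom.inr G₁ G₂,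
    fun a b hab => congrArg Prod.snd hab, inr_of_fstPerm_fixed x, inr_fixes x, h⟩

/-- Vanishing for a factor in all lower degrees implies vanishing for the product. -/
lemma van_prod (ρ : GMod (G₁ × G₂) M) (i : ℕ)
  (h : ∀ j ≤ i, Van j (ρ.comp (.inr G₁ G₂))) : Van i ρ := by
  cases i with
  | zero =>
    rw [van_zero_iff]; intro m hm; exact (van_zero_iff _).1 (h 0 le_rfl) m fun g => hm _
  | succ i =>
    intro z hz
    refine isCob_of_isCob_const (fstPerm G₁ G₂) ρ i
      (fun b x hx => van_prod_tuple ρ (h _ (by omega))) ?_ z ?_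
    · intro c hc _; have := (van_zero_iff _).1 (van_prod_tuple (n := i + 1) ρ (h 0 (by omega))) c hc
      exact ⟨0, fun g => map_zero _, by rw [map_zero, this]⟩
    · have hE : Equi (.id _) ρ (funRep (fstPerm G₁ G₂) ρ)
        (⟨⟨fun m _ => m, rfl⟩, fun _ _ => rfl⟩ : M →+ (G₁ → M)) := fun _ _ => rfl
      have hv : Van (i + 1) (funRep (fstPerm G₁ G₂) ρ) :=
        van_funRep fun x => ⟨G₂, inferInstance, MonoidHom.inr G₁ G₂,
          fun a b hab => congrArg Prod.snd hab,
          fun g hg => inr_of_fstPerm_fixed (n := 0) (fun _ => x) g (funext fun _ => hg),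
          fun g => congrFun (inr_fixes (n := 1) (fun _ => x) g) 0, h _ le_rfl⟩
      exact hv (push _ _ z) (by rw [cd_pull hE, hz, map_zero])

/-- If the second factor acts trivially and has no cohomology in positive degrees then classes of
the product are detected on the first factor. -/
lemma isCob_prod_of_res_inl (ρ : GMod (G₁ × G₂) M) (htriv : ∀ g m, ρ (1, g) m = m) (i : ℕ)
  (h : ∀ j < i, Van (j + 1) (ρ.comp (MonoidHom.inr G₁ G₂)))
  (z : (Fin i → G₁ × G₂) → M) (hz : cd ρ i z = 0)
  (hz1 : IsCob (ρ.comp (MonoidHom.inl G₁ G₂)) i (res (MonoidHom.inl G₁ G₂) i z)) :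
  IsCob ρ i z := by
  cases i with
  | zero =>
    ext g; have := congrFun hz1 Fin.elim0
    rw [Subsingleton.elim g (MonoidHom.inl G₁ G₂ ∘ Fin.elim0)]; exact this
  | succ i =>
    let a := fstPerm G₁ G₂
    let C : M →+ ((Fin 1 → G₁) → M) := ⟨⟨fun m _ => m, rfl⟩, fun _ _ => rfl⟩
    have hC : Equi (.id _) ρ (funRep (tuplePerm a 1) ρ) C := fun _ _ => rfl
    obtain ⟨u, hu⟩ := van_prod_tuple (n := 0) ρ (h i (by omega)) (push C (i + 1) z)
      (by rw [cd_pull hC, hz, map_zero])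
    obtain ⟨w, hw⟩ := hz1
    let f := MonoidHom.inl G₁ G₂
    have hC' : Equi (.id _) (ρ.comp f) ((funRep (tuplePerm a 1) ρ).comp f) C :=
      fun _ _ => rfl
    have hfac : ∀ g : G₁ × G₂, g = f g.1 * (1, g.2) := fun g => by ext <;> simp [f]
    have hinv : ∀ n (e : (Fin n → G₁) → M), (∀ g, funRep (tuplePerm a n) ρ (f g) e = e) →
        ∀ g, funRep (tuplePerm a n) ρ g e = e := by
      intro n e he g; rw [hfac g, GMod.mul_apply]
      have : funRep (tuplePerm a n) ρ (1, g.2) e = e := by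
        ext x; rw [funRep_apply, htriv]; congr 1
        have : ((1, g.2) : G₁ × G₂)⁻¹ = MonoidHom.inr G₁ G₂ g.2⁻¹ := by simp
        rw [this]; exact inr_fixes x g.2⁻¹
      rw [this, he]
    obtain ⟨u', hu', hu''⟩ := zigzag_compare i (fun b => (Fin (b + 1) → G₁) → M)
      (fun b => (Fin (b + 1) → G₁) → M) (fun b => funRep (tuplePerm a (b + 1)) ρ)
      (fun b => (funRep (tuplePerm a (b + 1)) ρ).comp f)
      (fun b => cech G₁ M (b + 1)) (fun b => cech G₁ M (b + 1)) (fun b => cech_equi a ρ (b + 1))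
      (fun b g c => cech_equi a ρ (b + 1) (f g) c)
      (fun b y => cech_cech (b + 1) y) (fun b y => cech_cech (b + 1) y) f
      (fun b => AddMonoidHom.id _) (fun _ _ _ => rfl) (fun _ _ => rfl)
      (fun b x hx => van_prod_tuple ρ (h _ (by omega)))
      (fun b x hx => by
        have : (funRep (tuplePerm a (b + 1)) ρ).comp f =
            funRep ((tuplePerm a (b + 1)).comp f) (ρ.comp f) := by
          ext g F x; simp
        rw [this]; exact funRep_van _ _ (fun x => x 0) (fun g x => rfl) x)
      (fun b x _ v h _ => fill_of_exact (Y := fun b => (Fin (b + 1) → G₁) → M)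
        (ρ := fun b => funRep (tuplePerm a (b + 1)) ρ)
        (fun b y h => cech_exact (b + 1) y h) b x v h)
      (fun c hc _ e he hce => ⟨e, hinv _ e he, hce.symm⟩) u (push C i w)
      (by rw [hu]; ext g x; exact congrFun (cech_cech 0 (fun _ : Fin 0 → G₁ => z g)) x)
      (by ext g x; exact congrFun (cech_cech 0 (fun _ : Fin 0 → G₁ => w g)) x)
      (by rw [cd_pull hC', hw, hu]; rfl)
    choose y hy using fun g => cech_exact 0 (u' g) (congrFun hu' g)
    refine ⟨fun g => y g Fin.elim0, ?_⟩; have h2 := cd_pull hC i (fun g => y g Fin.elim0)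
    have h3 : (pull (.id _) C i (fun g => y g Fin.elim0)) = u' := by ext g x; rw [← hy g]; rfl
    rw [h3, hu'', hu] at h2; ext g; exact (congrFun (congrFun h2 g) (fun _ => 1)).symm

end Products

/-! ### Groups of linear automorphisms fixing a subspace and a quotient -/

section Geometry

variable {k : Type} [Field k] {V W E : Type} [AbGrp V] [Module k V]
  [AbGrp W] [Module k W] [AbGrp E] [Module k E]

/-- Automorphisms which are the identity on `A` and modulo `K`. -/
def Gs (K A : Submodule k V) : Subgroup (V ≃ₗ[k] V) where
  carrier := {g | (∀ v, g v - v ∈ K) ∧ ∀ a ∈ A, g a = a}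
  one_mem' := ⟨fun v => by simp, fun a _ => rfl⟩
  mul_mem' := fun {g h} hg hh => by
    refine ⟨fun v => ?_, fun a ha => ?_⟩
    · have := K.add_mem (hg.1 (h v)) (hh.1 v); rwa [sub_add_sub_cancel] at this
    · rw [LinearEquiv.mul_apply, hh.2 a ha, hg.2 a ha]
  inv_mem' := fun {g} hg => by
    refine ⟨fun v => ?_, fun a ha => ?_⟩
    · have := K.neg_mem (hg.1 (g⁻¹ v))
      rwa [neg_sub, ← LinearEquiv.mul_apply, mul_inv_cancel] at this
    · conv_lhs => rw [← hg.2 a ha]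
      rw [← LinearEquiv.mul_apply, inv_mul_cancel]; rfl

lemma Gs_mono {K K' A A' : Submodule k V} (hK : K' ≤ K) (hA : A ≤ A') : Gs K' A' ≤ Gs K A :=
  fun _ hg => ⟨fun v => hK (hg.1 v), fun a ha => hg.2 a (hA ha)⟩

/-- The automorphism `1 + n` for `n` of square zero. -/
def oneAdd (n : V →ₗ[k] V) (hn : n ∘ₗ n = 0) : V ≃ₗ[k] V :=
  LinearEquiv.ofLinear (.id + n) (.id - n)
    (by ext v; have := LinearMap.congr_fun hn v; simp at this; simp [this])
    (by ext v; have := LinearMap.congr_fun hn v; simp at this; simp [this])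

@[simp] lemma oneAdd_apply (n : V →ₗ[k] V) (hn : n ∘ₗ n = 0) (v : V) :
  oneAdd n hn v = v + n v := rfl

lemma exists_injective_of_finrank_le [FinDim k V] [FinDim k W]
  (h : finrank k V ≤ finrank k W) : ∃ f : V →ₗ[k] W, Injective f := by
  have hr : Module.rank k V ≤ Module.rank k W := by
    rw [← finrank_eq_rank, ← finrank_eq_rank]; exact_mod_cast h
  obtain ⟨f, hf⟩ := (rank_le_iff_exists_linearMap).1 hr; exact ⟨f, hf⟩

/-- If there is room in `K` relative to `E₀`, then `E` is a retract of `V` through `K`, by a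
retraction vanishing on `E₀`. -/
lemma exists_room [FinDim k V] [FinDim k E] (K E₀ : Submodule k V)
  (h : finrank k (K ⊓ E₀ : Submodule k V) + finrank k E ≤ finrank k K) :
  ∃ (t : E →ₗ[k] V) (τ : V →ₗ[k] E), (∀ e, t e ∈ K) ∧ (∀ e, τ (t e) = e) ∧ ∀ v ∈ E₀, τ v = 0 := by
  let q := E₀.mkQ.domRestrict K
  have h1 : finrank k (ker q) = finrank k (K ⊓ E₀ : Submodule k V) := by
    have : ker q = (E₀.comap K.subtype) := by ext x; simp [q]
    rw [this, ← Submodule.finrank_map_subtype_eq K, map_comap_subtype]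
  have h2 := finrank_range_add_finrank_ker q
  obtain ⟨s, hs⟩ := exists_injective_of_finrank_le (k := k) (V := E) (W := range q) (by omega)
  obtain ⟨r, hr⟩ := (LinearMap.rangeRestrict q).exists_rightInverse_of_surjective
    (LinearMap.range_rangeRestrict q)
  obtain ⟨l, hl⟩ := ((range q).subtype ∘ₗ s).exists_leftInverse_of_injective
    (LinearMap.ker_eq_bot.2 (Subtype.val_injective.comp hs))
  refine ⟨K.subtype ∘ₗ r ∘ₗ s, l ∘ₗ E₀.mkQ, fun e => (r (s e)).2, fun e => ?_, fun v hv => ?_⟩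
  · have e1 := LinearMap.congr_fun hr (s e); have e2 := LinearMap.congr_fun hl e
    have e3 : E₀.mkQ (K.subtype (r (s e))) = (s e : V ⧸ E₀) := congrArg Subtype.val e1
    simp only [comp_apply, LinearMap.id_apply] at e2 ⊢; rw [e3]; exact e2
  · simp [(Submodule.Quotient.mk_eq_zero E₀).2 hv]

lemma finrank_le_inf_ker_add [FinDim k V] [FinDim k E] (K : Submodule k V) (φ : V →ₗ[k] E) :
  finrank k K ≤ finrank k (K ⊓ ker φ : Submodule k V) + finrank k E := by
  have h := finrank_range_add_finrank_ker (φ.domRestrict K)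
  have h1 : finrank k (ker (φ.domRestrict K)) = finrank k (K ⊓ ker φ : Submodule k V) := by
    have : ker (φ.domRestrict K) = (ker φ).comap K.subtype := by ext x; simp
    rw [this, ← Submodule.finrank_map_subtype_eq K, map_comap_subtype]
  have h2 := (range (φ.domRestrict K)).finrank_le; omega

/-- Two maps with a common section through `K` agreeing on `A` are conjugate. -/
lemma exists_Gs_of_common_section (K A : Submodule k V) (φ φ' : V →ₗ[k] E) (s : E →ₗ[k] V)
  (hs : ∀ e, s e ∈ K) (h : ∀ e, φ (s e) = e) (h' : ∀ e, φ' (s e) = e)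
  (hA : ∀ a ∈ A, φ a = φ' a) : ∃ g ∈ Gs K A, ∀ v, φ' (g v) = φ v := by
  refine ⟨oneAdd (s ∘ₗ (φ - φ')) ?_, ⟨fun v => ?_, fun a ha => ?_⟩, fun v => ?_⟩
  · ext v; simp [h, h']
  · simpa using hs (φ v - φ' v)
  · simp [hA a ha]
  · simp [h']

/-- Two maps which agree on `A` and are surjective on `K` are conjugate under `Gs K A`, if there
is enough room. -/
lemma exists_Gs_connect [FinDim k V] [FinDim k E] (K A : Submodule k V)
  (φ φ' : V →ₗ[k] E) (hφ : ∀ e, ∃ v ∈ K, φ v = e) (hφ' : ∀ e, ∃ v ∈ K, φ' v = e)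
  (hA : ∀ a ∈ A, φ a = φ' a)
  (hdim : finrank k (K ⊓ A : Submodule k V) + 5 * finrank k E ≤ finrank k K) :
  ∃ g ∈ Gs K A, ∀ v, φ' (g v) = φ v := by
  have sec : ∀ ψ : V →ₗ[k] E, (∀ e, ∃ v ∈ K, ψ v = e) →
      ∃ s : E →ₗ[k] V, (∀ e, s e ∈ K) ∧ ∀ e, ψ (s e) = e := by
    intro ψ hψ
    obtain ⟨r, hr⟩ := (ψ.domRestrict K).exists_rightInverse_of_surjective
      (LinearMap.range_eq_top.2 fun e => by obtain ⟨v, hv, rfl⟩ := hψ e; exact ⟨⟨v, hv⟩, rfl⟩)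
    exact ⟨K.subtype ∘ₗ r, fun e => (r e).2, fun e => LinearMap.congr_fun hr e⟩
  obtain ⟨s, hs, hφs⟩ := sec φ hφ; obtain ⟨s', hs', hφs'⟩ := sec φ' hφ'
  let B : Submodule k V := range s ⊔ range s'
  have hB : B ≤ K := sup_le (by rintro _ ⟨e, rfl⟩; exact hs e) (by rintro _ ⟨e, rfl⟩; exact hs' e)
  let K'' : Submodule k V := (K ⊓ ker φ) ⊓ ker φ'
  have hBdim : finrank k B ≤ 2 * finrank k E := by
    have h1 := Submodule.finrank_add_le_finrank_add_finrank (range s) (range s')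
    have h2 := LinearMap.finrank_range_le s; have h3 := LinearMap.finrank_range_le s'
    change finrank k B ≤ _ at h1; omega
  have hroom : finrank k (K'' ⊓ (A ⊔ B) : Submodule k V) + finrank k E ≤ finrank k K'' := by
    have h1 := finrank_le_inf_ker_add K φ; have h2 := finrank_le_inf_ker_add (K ⊓ ker φ) φ'
    have h3 : K'' ⊓ (A ⊔ B) ≤ (K ⊓ A) ⊔ B := by
      rintro v ⟨hv, hv'⟩; obtain ⟨a, ha, b, hb, rfl⟩ := mem_sup.1 hv'
      refine Submodule.add_mem_sup ⟨?_, ha⟩ hb; have := K.sub_mem hv.1.1 (hB hb)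
      rwa [add_sub_cancel_right] at this
    have h4 := finrank_mono h3; have h5 := Submodule.finrank_add_le_finrank_add_finrank (K ⊓ A) B
    have h7 : finrank k ((K ⊓ A) ⊔ B : Submodule k V) ≤
      finrank k (K ⊓ A : Submodule k V) + finrank k B := h5
    have h6 : finrank k (K ⊓ ker φ : Submodule k V) ≤ finrank k K'' + finrank k E := h2; omega
  obtain ⟨t, τ, ht, hτt, hτ⟩ := exists_room K'' (A ⊔ B) hroom
  have hsB : ∀ e, s e ∈ A ⊔ B := fun e => mem_sup_right (mem_sup_left ⟨e, rfl⟩)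
  have hsB' : ∀ e, s' e ∈ A ⊔ B := fun e => mem_sup_right (mem_sup_right ⟨e, rfl⟩)
  obtain ⟨g, hg, hg'⟩ := exists_Gs_of_common_section K A φ (φ + τ) s hs hφs
    (fun e => by simp [hφs, hτ _ (hsB e)]) (fun a ha => by simp [hτ a (mem_sup_left ha)])
  have ht1 : ∀ e, φ (t e) = 0 := fun e => (ht e).1.2
  have ht2 : ∀ e, φ' (t e) = 0 := fun e => (ht e).2
  obtain ⟨g', hgg, hgg'⟩ := exists_Gs_of_common_section K A (φ + τ) φ' (s' + t ∘ₗ (.id - φ ∘ₗ s'))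
    (fun e => K.add_mem (hs' e) (ht _).1.1)
    (fun e => by simp [ht1, hτt, hτ _ (hsB' e)])
    (fun e => by simp [ht2, hφs'])
    (fun a ha => by simp [hτ a (mem_sup_left ha), hA a ha])
  exact ⟨g' * g, mul_mem hgg hg, fun v => by rw [LinearEquiv.mul_apply, hgg', hg']⟩

end Geometry

/-! ### Functors on vector spaces -/

/-- A functor from `k`-vector spaces to abelian groups. -/
structure VFun (k : Type) [Field k] where
  /-- the values on spaces -/
  obj (V : Type) [AbGrp V] [Module k V] : Type
  /-- the group structure on values -/
  grp (V : Type) [AbGrp V] [Module k V] : AbGrp (obj V)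
  /-- the values on linear maps -/
  map {V W : Type} [AbGrp V] [Module k V] [AbGrp W] [Module k W] (f : V →ₗ[k] W) : obj V →+ obj W
  map_id (V : Type) [AbGrp V] [Module k V] (x : obj V) : map (.id : V →ₗ[k] V) x = x
  map_comp {V W U : Type} [AbGrp V] [Module k V] [AbGrp W] [Module k W]
    [AbGrp U] [Module k U] (g : W →ₗ[k] U) (f : V →ₗ[k] W) (x : obj V) :
    map (g ∘ₗ f) x = map g (map f x)

attribute [instance] VFun.grp

/-- Iterated differences of order `m` vanish. -/
def PD {A B : Type} [AbGrp A] [AbGrp B] : ℕ → (A → B) → Prop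
  | 0, φ => ∀ x, φ x = 0
  | m + 1, φ => ∀ f, PD m (fun h => φ (h + f) - φ h)

section PD

variable {A B C : Type} [AbGrp A] [AbGrp B] [AbGrp C]

lemma PD.comp_hom {m : ℕ} : ∀ {φ : A → B}, PD m φ → ∀ (f : C →+ A) (c : A),
  PD m (fun h => φ (f h + c)) := by
  induction m with
  | zero => intro φ h f c x; exact h _
  | succ m ih =>
    intro φ h f c x; convert ih (h (f x)) f c using 3; simp only [map_add]; congr 1; abel

lemma PD.hom_comp {m : ℕ} : ∀ {φ : A → B}, PD m φ → ∀ (f : B →+ C), PD m (fun h => f (φ h)) := by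
  induction m with
  | zero => intro φ h f x; simp only [h _, map_zero]
  | succ m ih =>
    intro φ h f x; simpa only [map_sub] using ih (h x) f

lemma PD.add {m : ℕ} : ∀ {φ ψ : A → B}, PD m φ → PD m ψ → PD m (fun h => φ h + ψ h) := by
  induction m with
  | zero => intro φ ψ h h' x; simp only [h _, h' _, add_zero]
  | succ m ih =>
    intro φ ψ h h' x; simpa only [add_sub_add_comm] using ih (h x) (h' x)

lemma PD.zero (m : ℕ) : PD m (fun _ : A => (0 : B)) := by
  induction m with
  | zero => intro x; rfl
  | succ m ih => intro x; simpa using ih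

lemma PD.sum {ι : Type*} (s : Finset ι) {m : ℕ} {φ : ι → A → B} (h : ∀ i ∈ s, PD m (φ i)) :
  PD m (fun x => ∑ i ∈ s, φ i x) := by
  classical
  induction s using Finset.induction_on with
  | empty => simpa using PD.zero m
  | insert i s hi ih =>
    simp only [Finset.sum_insert hi]; exact (h i (by simp)).add (ih fun j hj => h j (by simp [hj]))

lemma PD.mono {m : ℕ} : ∀ {φ : A → B}, PD m φ → PD (m + 1) φ := by
  induction m with
  | zero => intro φ h f x; simp [h _]
  | succ m ih => intro φ h f; exact ih (h f)

lemma PD.mono_le {m n : ℕ} (hmn : m ≤ n) {φ : A → B} (h : PD m φ) : PD n φ := by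
  induction hmn with
  | refl => exact h
  | step _ ih => exact ih.mono

lemma PD.mul {R : Type} [CommRing R] {m : ℕ} : ∀ {φ : A → R}, PD m φ → ∀ L : A →+ R,
  PD (m + 1) (fun h => L h * φ h) := by
  induction m with
  | zero => intro φ h L f x; simp [h _]
  | succ m ih =>
    intro φ h L f; have h1 := ih (h f) L
    have h2 : PD (m + 1) (fun x => L f * φ (x + f)) := by
      exact (h.comp_hom (.id A) f).hom_comp (.mulLeft (L f))
    convert h1.add h2 using 2 with x; simp only [map_add]; ring

lemma PD.of_injective {m : ℕ} {f : B →+ C} (hf : Injective f) :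
  ∀ {φ : A → B}, PD m (fun h => f (φ h)) → PD m φ := by
  induction m with
  | zero => intro φ h x; exact hf ((h x).trans (map_zero f).symm)
  | succ m ih =>
    intro φ h x; apply ih; simpa only [map_sub] using h x

end PD

namespace VFun

variable {k : Type} [Field k] (F : VFun k) {V W U : Type} [AbGrp V] [Module k V]
  [AbGrp W] [Module k W] [AbGrp U] [Module k U]

/-- The functor has degree at most `d`. -/
def Poly (d : ℕ) : Prop := ∀ (V W : Type) [AbGrp V] [Module k V] [AbGrp W]
  [Module k W] (x : F.obj V), PD (d + 1) (fun h : V →ₗ[k] W => F.map h x)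

/-- The functor is `p`-torsion. -/
def Tors (p : ℕ) : Prop := ∀ (V : Type) [AbGrp V] [Module k V] (x : F.obj V), p • x = 0

/-- The functor vanishes on zero maps. -/
def Reduced : Prop := ∀ (V W : Type) [AbGrp V] [Module k V] [AbGrp W]
  [Module k W] (x : F.obj V), F.map (0 : V →ₗ[k] W) x = 0

/-- The action of the general linear group on a value of a functor. -/
def rep (V : Type) [AbGrp V] [Module k V] : GMod (V ≃ₗ[k] V) (F.obj V) where
  toFun g := F.map gˡ
  map_one' := AddMonoidHom.ext fun x => F.map_id V x
  map_mul' g h := AddMonoidHom.ext fun x => F.map_comp gˡ hˡ x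

/-- The restriction of `rep` to the subgroup `Gs K A`. -/
def gs (K A : Submodule k V) : GMod (Gs K A) (F.obj V) := (F.rep V).comp (Gs K A).subtype

@[simp] lemma gs_apply (K A : Submodule k V) (g : Gs K A) (x : F.obj V) :
  F.gs K A g x = F.map g.1ˡ x := rfl

lemma Poly.mono {F : VFun k} {d e : ℕ} (h : F.Poly d) (hde : d ≤ e) : F.Poly e :=
  fun V W _ _ _ _ x => (h V W x).mono_le (by omega)

/-- The functor with constant value `B`. -/
abbrev const (k : Type) [Field k] (B : Type) [AbGrp B] : VFun k where
  obj _ _ _ := B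
  grp _ _ _ := inferInstance
  map _ := .id B
  map_id _ _ _ _ := rfl
  map_comp _ _ _ := rfl

lemma const_poly (B : Type) [AbGrp B] (d : ℕ) : (const k B).Poly d := by
  intro V W _ _ _ _ x f
  have : (fun h : V →ₗ[k] W => (const k B).map (h + f) x - (const k B).map h x) = fun _ => 0 := by
    funext h; exact sub_self _
  rw [this]; exact PD.zero d

/-- The subfunctor given by an invariant family of subgroups. -/
abbrev sub (S : ∀ (V : Type) [AbGrp V] [Module k V], AddSubgroup (F.obj V))
  (hS : ∀ {V W : Type} [AbGrp V] [Module k V] [AbGrp W] [Module k W]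
  (f : V →ₗ[k] W), ∀ x ∈ S V, F.map f x ∈ S W) : VFun k where
  obj V _ _ := S V
  grp V _ _ := inferInstance
  map {V W} _ _ _ _ f := ((F.map f).comp (S V).subtype).codRestrict (S W) (fun x => hS f x x.2)
  map_id V _ _ x := Subtype.ext (F.map_id V x)
  map_comp g f x := Subtype.ext (F.map_comp g f x)

lemma sub_poly (S hS) {d : ℕ} (h : F.Poly d) : (F.sub S hS).Poly d := by
  intro V W _ _ _ _ x
  exact PD.of_injective (f := (S W).subtype) Subtype.val_injective (h V W (x : S V).1)

lemma sub_tors (S hS) {p : ℕ} (h : F.Tors p) : (F.sub S hS).Tors p :=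
  fun V _ _ x => Subtype.ext (h V (x : S V).1)

/-- The functor `W ↦ F (W × C)`. -/
abbrev prodRight (C : Type) [AbGrp C] [Module k C] : VFun k where
  obj V _ _ := F.obj (V × C)
  grp V _ _ := inferInstance
  map f := F.map (f.prodMap .id)
  map_id V _ _ x := by
    have : (.id : V →ₗ[k] V).prodMap (.id : C →ₗ[k] C) = .id := by ext <;> simp
    rw [this, F.map_id]
  map_comp g f x := by rw [← F.map_comp]; congr 2

/-- The additive map `h ↦ h ⊕ 0` used to compare degrees. -/
def prodMapZero (C V W : Type) [AbGrp C] [Module k C] [AbGrp V] [Module k V]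
  [AbGrp W] [Module k W] : (V →ₗ[k] W) →+ (V × C →ₗ[k] W × C) where
  toFun h := h.prodMap 0
  map_zero' := by ext <;> simp
  map_add' a b := by ext <;> simp

lemma prodMap_id_eq (C : Type) [AbGrp C] [Module k C] (h : V →ₗ[k] W) :
  h.prodMap (.id : C →ₗ[k] C) =
  prodMapZero C V W h + (0 : V →ₗ[k] W).prodMap .id := by
  ext <;> simp [prodMapZero]

lemma prodRight_poly (C : Type) [AbGrp C] [Module k C] {d : ℕ} (h : F.Poly d) :
  (F.prodRight C).Poly d := by
  intro V W _ _ _ _ x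
  have := (h (V × C) (W × C) x).comp_hom (prodMapZero C V W) ((0 : V →ₗ[k] W).prodMap .id)
  simp only [← prodMap_id_eq] at this; exact this

/-- The subgroup of cross effects in `F (V × C)`. -/
def crossSub (V C : Type) [AbGrp V] [Module k V] [AbGrp C] [Module k C] :
  AddSubgroup (F.obj (V × C)) :=
  (F.map ((.id : V →ₗ[k] V).prodMap (0 : C →ₗ[k] C))).ker ⊓
    (F.map ((0 : V →ₗ[k] V).prodMap (.id : C →ₗ[k] C))).ker

lemma mem_crossSub {C : Type} [AbGrp C] [Module k C] {x : F.obj (V × C)} :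
  x ∈ F.crossSub V C ↔ F.map ((.id : V →ₗ[k] V).prodMap (0 : C →ₗ[k] C)) x = 0 ∧
  F.map ((0 : V →ₗ[k] V).prodMap (.id : C →ₗ[k] C)) x = 0 := Iff.rfl

lemma map_mem_crossSub {C D : Type} [AbGrp C] [Module k C] [AbGrp D] [Module k D]
  (f : V →ₗ[k] W) (g : C →ₗ[k] D)
  {x : F.obj (V × C)} (hx : x ∈ F.crossSub V C) : F.map (f.prodMap g) x ∈ F.crossSub W D := by
  rw [mem_crossSub] at hx ⊢; constructor
  · have : F.map ((.id : W →ₗ[k] W).prodMap (0 : D →ₗ[k] D))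
        (F.map (f.prodMap g) x) = F.map (f.prodMap (0 : C →ₗ[k] D))
        (F.map ((.id : V →ₗ[k] V).prodMap (0 : C →ₗ[k] C)) x) := by
      rw [← F.map_comp, ← F.map_comp]; congr 2
    rw [this, hx.1, map_zero]
  · have : F.map ((0 : W →ₗ[k] W).prodMap (.id : D →ₗ[k] D))
        (F.map (f.prodMap g) x) = F.map ((0 : V →ₗ[k] W).prodMap g)
        (F.map ((0 : V →ₗ[k] V).prodMap (.id : C →ₗ[k] C)) x) := by
      rw [← F.map_comp, ← F.map_comp]; congr 2
    rw [this, hx.2, map_zero]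

/-- The cross effect `W ↦ F (W | C)`. -/
abbrev cross (C : Type) [AbGrp C] [Module k C] : VFun k :=
  (F.prodRight C).sub (fun V _ _ => F.crossSub V C) (fun f _ hx => F.map_mem_crossSub f .id hx)

lemma cross_poly (C : Type) [AbGrp C] [Module k C] {d : ℕ} (h : F.Poly (d + 1)) :
  (F.cross C).Poly d := by
  intro V W _ _ _ _ x; have hx1 := x.2.1
  let x' : F.obj (V × C) := x.1
  refine PD.of_injective (f := AddSubgroup.subtype _) Subtype.val_injective ?_
  have h1 := (h (V × C) (W × C) x' ((0 : V →ₗ[k] W).prodMap .id)).comp_hom (prodMapZero C V W) 0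
  simp only [add_zero, ← prodMap_id_eq] at h1
  have h2 : ∀ g : V →ₗ[k] W, F.map (prodMapZero C V W g) x' = 0 := by
    intro g
    have : prodMapZero C V W g =
        (prodMapZero C V W g) ∘ₗ (.id : V →ₗ[k] V).prodMap (0 : C →ₗ[k] C) := by
      ext <;> simp [prodMapZero]
    rw [this, F.map_comp, hx1, map_zero]
  simp only [h2, sub_zero] at h1; exact h1

lemma cross_reduced (C : Type) [AbGrp C] [Module k C] : (F.cross C).Reduced := by
  intro V W _ _ _ _ x; apply Subtype.ext
  have : (0 : V →ₗ[k] W).prodMap (.id : C →ₗ[k] C) = (0 : V →ₗ[k] W).prodMap (.id : C →ₗ[k] C) ∘ₗ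
        (0 : V →ₗ[k] V).prodMap (.id : C →ₗ[k] C) := by ext <;> simp
  change F.map ((0 : V →ₗ[k] W).prodMap (.id : C →ₗ[k] C)) x.1 = 0
  rw [this, F.map_comp, x.2.2, map_zero]

lemma cross_tors (C : Type) [AbGrp C] [Module k C] {p : ℕ} (h : F.Tors p) :
  (F.cross C).Tors p := sub_tors _ _ _ (fun V _ _ x => h (V × C) x)

/-- The kernel of `F V → F 0`. -/
abbrev red : VFun k :=
  F.sub (fun V _ _ => (F.map (0 : V →ₗ[k] V)).ker) (fun {V W} _ _ _ _ f x hx => by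
    have h : F.map (0 : V →ₗ[k] V) x = 0 := hx; change F.map (0 : W →ₗ[k] W) (F.map f x) = 0
    have e : (0 : W →ₗ[k] W) ∘ₗ f = f ∘ₗ (0 : V →ₗ[k] V) := by simp
    rw [← F.map_comp, e, F.map_comp, h, map_zero])

lemma red_reduced : F.red.Reduced := by
  intro V W _ _ _ _ x; apply Subtype.ext; change F.map (0 : V →ₗ[k] W) x.1 = 0
  have : (0 : V →ₗ[k] W) = (0 : V →ₗ[k] W) ∘ₗ (0 : V →ₗ[k] V) := by simp
  rw [this, F.map_comp, show F.map (0 : V →ₗ[k] V) x.1 = 0 from x.2, map_zero]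

end VFun

/-! ### Stable vanishing: injectivity of restriction to complements -/

section Injectivity

variable {k : Type} [Field k]

/-- Vanishing in degree `i + 1` for functors of degree `d`. -/
def EPos (k : Type) [Field k] (p i d r N : ℕ) : Prop :=
  ∀ F : VFun k, F.Poly d → F.Tors p → ∀ (V : Type) [AbGrp V] [Module k V]
    [FinDim k V] (K A : Submodule k V), Disjoint K A →
    finrank k V ≤ finrank k K + finrank k A + r → N ≤ finrank k K → Van (i + 1) (F.gs K A)

/-- The description of invariants for functors of degree `d`. -/
def EZero (k : Type) [Field k] (p d r N : ℕ) : Prop :=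
  ∀ F : VFun k, F.Poly d → F.Tors p → ∀ (V : Type) [AbGrp V] [Module k V]
    [FinDim k V] (K A : Submodule k V), Disjoint K A →
    finrank k V ≤ finrank k K + finrank k A + r → N ≤ finrank k K →
    ∀ x, (∀ g, F.gs K A g x = x) → ∀ π : V →ₗ[k] V, (∀ a ∈ A, π a = a) → (∀ v ∈ K, π v = 0) →
      (∀ v, π v ∈ A) → F.map π x = x

variable {V : Type} [AbGrp V] [Module k V]

lemma exists_proj {K A : Submodule k V} (h : Disjoint K A) : ∃ π : V →ₗ[k] V,
  (∀ a ∈ A, π a = a) ∧ (∀ v ∈ K, π v = 0) ∧ ∀ v, π v ∈ A := by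
  have hinj : ker (K.mkQ.domRestrict A) = ⊥ := by
    rw [LinearMap.ker_eq_bot']; intro a ha
    have h1 : (a : V) ∈ K := (Submodule.Quotient.mk_eq_zero K).1 ha
    exact Subtype.ext (disjoint_def.1 h _ h1 a.2)
  obtain ⟨l, hl⟩ := (K.mkQ.domRestrict A).exists_leftInverse_of_injective hinj
  refine ⟨A.subtype ∘ₗ l ∘ₗ K.mkQ, fun a ha => ?_, fun v hv => ?_, fun v => (l _).2⟩
  · exact congrArg Subtype.val (LinearMap.congr_fun hl ⟨a, ha⟩)
  · simp [(Submodule.Quotient.mk_eq_zero K).2 hv]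

/-- Retractions of `V` onto `A` vanishing on `A₀`. -/
abbrev Retr (A₀ A : Submodule k V) : Type :=
  {ρ : V →ₗ[k] A // (∀ a : A, ρ a = a) ∧ ∀ a ∈ A₀, ρ a = 0}

variable {K A₀ A : Submodule k V}

lemma inv_apply_of_mem {B : Submodule k V} (g : Gs K B) {a : V} (ha : a ∈ B) :
  (g.1⁻¹) a = a := ((Gs K B).inv_mem g.2).2 a ha

/-- A permutation action from its underlying functions. -/
def actPerm {G X : Type} [Group G] (f : G → X → X) (h1 : ∀ x, f 1 x = x)
  (hm : ∀ g h x, f (g * h) x = f g (f h x)) : G →* Perm X where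
  toFun g := ⟨f g, f g⁻¹, fun x => by rw [← hm, inv_mul_cancel, h1],
    fun x => by rw [← hm, mul_inv_cancel, h1]⟩
  map_one' := Equiv.ext h1
  map_mul' g h := Equiv.ext (hm g h)

/-- The action on retractions. -/
def retrPerm (K A₀ A : Submodule k V) : Gs K (A₀ ⊔ A) →* Perm (Retr A₀ A) :=
  actPerm (fun g ρ => ⟨ρ.1 ∘ₗ (g.1⁻¹)ˡ, fun a => by
      have := inv_apply_of_mem g (mem_sup_right a.2 : (a : V) ∈ A₀ ⊔ A)
      simp only [comp_apply, LinearEquiv.coe_coe, this]; exact ρ.2.1 a, fun a ha => by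
      have := inv_apply_of_mem g (mem_sup_left ha : (a : V) ∈ A₀ ⊔ A)
      simp only [comp_apply, LinearEquiv.coe_coe, this]
      exact ρ.2.2 a ha⟩) (fun ρ => rfl) (fun g h ρ => by
    apply Subtype.ext; ext v; change _ = ((ρ.1 (h.1⁻¹ (g.1⁻¹ v)) : A) : V)
    rw [← LinearEquiv.mul_apply, ← mul_inv_rev]; rfl)

lemma retrPerm_apply (g : Gs K (A₀ ⊔ A)) (ρ : Retr A₀ A) (v : V) :
  (retrPerm K A₀ A g ρ).1 v = ρ.1 (g.1⁻¹ v) := rfl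

/-- The part of `K` killed by all members of a tuple of retractions. -/
def kerTuple (K : Submodule k V) {n : ℕ} (x : Fin n → Retr A₀ A) : Submodule k V :=
  K ⊓ ker (LinearMap.pi fun j => (x j).1)

lemma mem_kerTuple {n : ℕ} {x : Fin n → Retr A₀ A} {v : V} :
  v ∈ kerTuple K x ↔ v ∈ K ∧ ∀ j, (x j).1 v = 0 := by
  simp only [kerTuple, Submodule.mem_inf, mem_ker, funext_iff, LinearMap.pi_apply, Pi.zero_apply]

lemma kerTuple_le {n : ℕ} (x : Fin n → Retr A₀ A) : kerTuple K x ≤ K := inf_le_left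

lemma finrank_kerTuple [FinDim k V] {n : ℕ} (x : Fin n → Retr A₀ A) :
  finrank k K ≤ finrank k (kerTuple K x) + n * finrank k A := by
  have := finrank_le_inf_ker_add K (LinearMap.pi fun j => (x j).1)
  rwa [finrank_pi_fintype, sum_const, Finset.card_univ, Fintype.card_fin, smul_eq_mul] at this

lemma kerTuple_disjoint (hKA : Disjoint K A₀) {n : ℕ} (x : Fin (n + 1) → Retr A₀ A) :
  Disjoint (kerTuple K x) (A₀ ⊔ A) := by
  rw [disjoint_def]; intro v hv hv'; rw [mem_kerTuple] at hv
  obtain ⟨a, ha, b, hb, rfl⟩ := mem_sup.1 hv'; have h := hv.2 0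
  rw [map_add, (x 0).2.2 a ha, zero_add, (x 0).2.1 ⟨b, hb⟩] at h
  have hb0 : b = 0 := congrArg Subtype.val h; subst hb0; rw [add_zero] at hv ⊢
  exact disjoint_def.1 hKA a hv.1 ha

lemma mem_of_fixes_tuple {n : ℕ} (x : Fin n → Retr A₀ A) (g : Gs K (A₀ ⊔ A))
  (hg : tuplePerm (retrPerm K A₀ A) n g x = x) : g.1 ∈ Gs (kerTuple K x) (A₀ ⊔ A) := by
  refine ⟨fun v => mem_kerTuple.2 ⟨g.2.1 v, fun j => ?_⟩, g.2.2⟩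
  have h1 : retrPerm K A₀ A g (x j) = x j := congrFun hg j
  have h2 := retrPerm_apply g (x j) (g.1 v)
  rw [h1, ← LinearEquiv.mul_apply, inv_mul_cancel] at h2; rw [map_sub, h2, sub_eq_zero]; rfl

lemma fixes_tuple {n : ℕ} (x : Fin n → Retr A₀ A) (g : Gs K (A₀ ⊔ A))
  (hg : g.1 ∈ Gs (kerTuple K x) (A₀ ⊔ A)) :
  tuplePerm (retrPerm K A₀ A) n g x = x := by
  funext j; apply Subtype.ext; ext v; change ((retrPerm K A₀ A g (x j)).1 v : V) = _
  rw [retrPerm_apply]; have h := (mem_kerTuple.1 (((Gs _ _).inv_mem hg).1 v)).2 j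
  rw [map_sub, sub_eq_zero] at h; rw [h]

lemma van_tuple {F : VFun k} {i n : ℕ}
  (h : ∀ x : Fin n → Retr A₀ A, Van i (F.gs (kerTuple K x) (A₀ ⊔ A))) :
  Van i (funRep (tuplePerm (retrPerm K A₀ A) n) (F.gs K (A₀ ⊔ A))) := by
  refine van_funRep fun x => ⟨Gs (kerTuple K x) (A₀ ⊔ A), inferInstance,
    inclusion (Gs_mono (kerTuple_le x) le_rfl), Subgroup.inclusion_injective _,
    fun g hg => ⟨⟨g, mem_of_fixes_tuple x g hg⟩, rfl⟩, fun g => fixes_tuple x _ g.2, h x⟩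

lemma retr_row_exact [FinDim k V] {p d r N : ℕ} (hN : EZero k p d r N) (F : VFun k)
  (hF : F.Poly d) (hp : F.Tors p) (hKA : Disjoint K A₀) (n : ℕ)
  (hr : finrank k V + (n + 2) * finrank k A ≤ finrank k K + finrank k A₀ + r)
  (hK : N + (n + 8) * finrank k A ≤ finrank k K)
  (c : (Fin (n + 2) → Retr A₀ A) → F.obj V)
  (hc : ∀ g, funRep (tuplePerm (retrPerm K A₀ A) (n + 2)) (F.gs K (A₀ ⊔ A)) g c = c)
  (hc0 : cech (Retr A₀ A) (F.obj V) (n + 2) c = 0) :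
  ∃ e : (Fin (n + 1) → Retr A₀ A) → F.obj V,
  (∀ g, funRep (tuplePerm (retrPerm K A₀ A) (n + 1)) (F.gs K (A₀ ⊔ A)) g e = e) ∧
  cech (Retr A₀ A) (F.obj V) (n + 1) e = c := by
  have hdimA : finrank k A₀ ≤ finrank k (A₀ ⊔ A : Submodule k V) :=
    finrank_mono le_sup_left
  have hcx : ∀ (x : Fin (n + 2) → Retr A₀ A) (g : Gs K (A₀ ⊔ A)),
      c (tuplePerm (retrPerm K A₀ A) (n + 2) g x) = F.gs K (A₀ ⊔ A) g (c x) := by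
    intro x g
    conv_lhs => rw [← hc g]
    rw [funRep_apply]; congr 2
    rw [← Equiv.Perm.mul_apply, ← map_mul, inv_mul_cancel, map_one, Equiv.Perm.one_apply]
  have htriv : ∀ (x : Fin (n + 2) → Retr A₀ A) (g : Gs K (A₀ ⊔ A)),
      F.gs K (A₀ ⊔ A) g (c x) = c x := by
    intro x g; have hdisj := kerTuple_disjoint hKA x; obtain ⟨π, h1, h2, h3⟩ := exists_proj hdisj
    have hdim := finrank_kerTuple (K := K) x
    have := hN F hF hp V (kerTuple K x) (A₀ ⊔ A) hdisj (by lia) (by lia) (c x) (fun s => by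
      have := hcx x (inclusion (Gs_mono (kerTuple_le x) le_rfl) s)
      rw [fixes_tuple x _ s.2] at this; exact this.symm) π h1 h2 h3
    conv_lhs => rw [← this]
    rw [VFun.gs_apply, ← F.map_comp]; have e : g.1ˡ ∘ₗ π = π := by ext v; exact g.2.2 _ (h3 v)
    rw [e, this]
  let Gen : ∀ {m : ℕ}, (Fin m → Retr A₀ A) → Retr A₀ A → Prop := fun {m} y ρ =>
    ∀ a : A, ∃ v ∈ kerTuple K y, ρ.1 v = a
  have hgen : ∀ {m : ℕ} (y : Fin (m + 1) → Retr A₀ A), m ≤ n + 1 → ∃ ρ, Gen y ρ := by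
    intro m y hm; have hdim := finrank_kerTuple (K := K) y; have hdisj := kerTuple_disjoint hKA y
    have hm' : (m + 1) * finrank k A ≤ (n + 2) * finrank k A := Nat.mul_le_mul_right _ (by omega)
    obtain ⟨t, τ, ht, hτt, hτ⟩ := exists_room (E := A) (kerTuple K y) (A₀ ⊔ A) (by
      rw [disjoint_iff.1 hdisj, finrank_bot]; lia)
    refine ⟨⟨(y 0).1 + τ, fun a => ?_, fun a ha => ?_⟩, fun a => ⟨t a, ht a, ?_⟩⟩
    · rw [LinearMap.add_apply, hτ _ (mem_sup_right a.2), add_zero, (y 0).2.1]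
    · rw [LinearMap.add_apply, hτ _ (mem_sup_left ha), add_zero, (y 0).2.2 a ha]
    · have := (mem_kerTuple.1 (ht a)).2 0; simp [this, hτt]
  have huniq : ∀ (y : Fin (n + 1) → Retr A₀ A) (ρ ρ' : Retr A₀ A), Gen y ρ → Gen y ρ' →
      c (Fin.cons ρ y) = c (Fin.cons ρ' y) := by
    intro y ρ ρ' h h'; have hdim := finrank_kerTuple (K := K) y
    have hdisj := kerTuple_disjoint hKA y
    obtain ⟨g, hg, hgg⟩ := exists_Gs_connect (kerTuple K y) (A₀ ⊔ A) ρ.1 ρ'.1 h h' (fun a ha => by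
      obtain ⟨b, hb, b', hb', rfl⟩ := mem_sup.1 ha
      rw [map_add, map_add, ρ.2.2 b hb, ρ'.2.2 b hb, ρ.2.1 ⟨b', hb'⟩, ρ'.2.1 ⟨b', hb'⟩])
      (by rw [disjoint_iff.1 hdisj, finrank_bot]; lia)
    let g' : Gs K (A₀ ⊔ A) := ⟨g, Gs_mono (kerTuple_le y) le_rfl hg⟩
    have h1 := hcx (Fin.cons ρ y) g'; rw [htriv] at h1; rw [← h1]; congr 1; funext j
    refine Fin.cases ?_ (fun j => ?_) j
    · apply Subtype.ext; ext v; change ((retrPerm K A₀ A g' ρ).1 v : V) = (ρ'.1 v : V)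
      rw [retrPerm_apply, ← hgg, ← LinearEquiv.mul_apply]; change ((ρ'.1 ((g * g⁻¹) v) : A) : V) = _
      rw [mul_inv_cancel]; rfl
    · exact congrFun (fixes_tuple y g' hg) j
  choose s hs using fun y : Fin (n + 1) → Retr A₀ A => hgen y (by omega)
  refine ⟨fun y => c (Fin.cons (s y) y), fun g => ?_, ?_⟩
  · funext y; rw [funRep_apply, htriv]; set y' := tuplePerm (retrPerm K A₀ A) (n + 1) g⁻¹ y with hy'
    have hgy : tuplePerm (retrPerm K A₀ A) (n + 1) g y' = y := by
      rw [hy', ← Equiv.Perm.mul_apply, ← map_mul, mul_inv_cancel, map_one, Equiv.Perm.one_apply]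
    have h1 := hcx (Fin.cons (s y') y') g; rw [htriv] at h1; rw [← h1]
    have h2 : tuplePerm (retrPerm K A₀ A) (n + 2) g (Fin.cons (s y') y') =
        Fin.cons (retrPerm K A₀ A g (s y')) y := by
      funext j; refine Fin.cases rfl (fun j => ?_) j; exact congrFun hgy j
    rw [h2]; refine huniq y _ _ (fun a => ?_) (hs y); obtain ⟨v, hv, hva⟩ := hs y' a
    rw [mem_kerTuple] at hv; refine ⟨g.1 v, mem_kerTuple.2 ⟨?_, fun j => ?_⟩, ?_⟩
    · have := K.add_mem (g.2.1 v) hv.1; rwa [sub_add_cancel] at this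
    · refine Eq.trans ?_ (hv.2 j); change (y j).1 _ = (retrPerm K A₀ A g⁻¹ (y j)).1 v
      rw [retrPerm_apply]; simp
    · rw [retrPerm_apply, ← LinearEquiv.mul_apply, inv_mul_cancel]; exact hva
  · funext x; obtain ⟨ρ, hρ⟩ := hgen x (by omega); have h1 := congrFun hc0 (Fin.cons ρ x)
    rw [cech_cons, Pi.zero_apply, sub_eq_zero] at h1; rw [h1]
    have key : ∀ c' : (Fin (n + 1) → Retr A₀ A) → F.obj V, cech (Retr A₀ A) (F.obj V) (n + 1) c' x =
          cech (Fin (n + 2)) (F.obj V) (n + 1) (fun z => c' (x ∘ z)) id := fun c' =>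
      (cech_natural (.id _) x (n + 1) c' id).symm
    rw [key, key]
    refine congrArg (fun w => cech (Fin (n + 2)) (F.obj V) (n + 1) w id) (funext fun z => ?_)
    refine huniq _ _ _ (hs _) fun a => ?_
    obtain ⟨v, hv, hva⟩ := hρ a; rw [mem_kerTuple] at hv
    exact ⟨v, mem_kerTuple.2 ⟨hv.1, fun j => hv.2 _⟩, hva⟩

/-- Restriction to the subgroups fixing a retraction is injective on cohomology. -/
lemma isCob_of_retr [FinDim k V] {p d r i N : ℕ} {M : ℕ}
  (hE : ∀ x < i, EPos k p x d r N) (hN : EZero k p d r M) (F : VFun k)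
  (hF : F.Poly d) (hp : F.Tors p) (hKA : Disjoint K A₀) (hAK : A ≤ K)
  (hr : finrank k V + (i + 2) * finrank k A ≤ finrank k K + finrank k A₀ + r)
  (hK : N + M + (i + 8) * finrank k A ≤ finrank k K)
  (z : (Fin (i + 1) → Gs K (A₀ ⊔ A)) → F.obj V) (hz : cd (F.gs K (A₀ ⊔ A)) (i + 1) z = 0)
  (h : ∀ ρ : Retr A₀ A, IsCob (F.gs (kerTuple K fun _ : Fin 1 => ρ) (A₀ ⊔ A)) (i + 1)
  (res (inclusion (Gs_mono (kerTuple_le _) le_rfl)) (i + 1) z)) :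
  IsCob (F.gs K (A₀ ⊔ A)) (i + 1) z := by
  have hdimA : finrank k A₀ ≤ finrank k (A₀ ⊔ A : Submodule k V) :=
    finrank_mono le_sup_left
  have hne : Nonempty (Retr A₀ A) := by
    obtain ⟨π, h1, h2, h3⟩ := exists_proj (K := A₀) (A := A) (hKA.symm.mono_right hAK)
    exact ⟨⟨π.codRestrict A h3, fun a => Subtype.ext (h1 a a.2), fun a ha => Subtype.ext (h2 a ha)⟩⟩
  refine isCob_of_isCob_const (retrPerm K A₀ A) (F.gs K (A₀ ⊔ A)) i ?_ ?_ z ?_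
  · intro b x hx; refine van_tuple fun y => ?_
    have hdim := finrank_kerTuple (K := K) y
    have hm' : (b + 2) * finrank k A ≤ (i + 2) * finrank k A := Nat.mul_le_mul_right _ (by omega)
    refine hE x (by omega) F hF hp V _ _ (kerTuple_disjoint hKA y) (by lia) (by lia)
  · intro c hc hc0; exact retr_row_exact hN F hF hp hKA i hr (by lia) c hc hc0
  · have hE : Equi (.id _) (F.gs K (A₀ ⊔ A)) (funRep (retrPerm K A₀ A) (F.gs K (A₀ ⊔ A)))
      (⟨⟨fun m _ => m, rfl⟩, fun _ _ => rfl⟩ : F.obj V →+ (Retr A₀ A → F.obj V)) := fun _ _ => rfl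
    have hcoc : cd (funRep (retrPerm K A₀ A) (F.gs K (A₀ ⊔ A))) (i + 1) (fun g _ => z g) = 0 := by
      have := cd_pull hE (i + 1) z; rwa [hz, map_zero] at this
    refine isCob_funRep hcoc fun ρ => ⟨_, inferInstance,
      inclusion (Gs_mono (kerTuple_le fun _ : Fin 1 => ρ) le_rfl),
      Subgroup.inclusion_injective _, fun g hg => ⟨⟨g, mem_of_fixes_tuple _ g ?_⟩, rfl⟩, h ρ⟩
    funext j; exact hg

end Injectivity

section Conj

variable {G H M : Type} [Group G] [Group H] [AbGrp M]

lemma isCob_res_conj (ρ : GMod G M) {i : ℕ} {z : (Fin i → G) → M} (hz : cd ρ i z = 0) (c : G)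
  (f : H →* G) (h : IsCob (ρ.comp f) i (res f i z)) :
  IsCob (ρ.comp ((MulAut.conj c).toMonoidHom.comp f)) i
  (res ((MulAut.conj c).toMonoidHom.comp f) i z) := by
  have e : Equi (.id H) (ρ.comp f) (ρ.comp ((MulAut.conj c).toMonoidHom.comp f)) (ρ.hom c) := by
    intro q m; change ρ c (ρ (f q) m) = ρ (c * f q * c⁻¹) (ρ c m)
    rw [← GMod.mul_apply, ← GMod.mul_apply]; congr 2; group
  have hc := ((isCob_conj i ρ c⁻¹ z hz).push (equi_res f ρ)).add h; convert hc.push e using 1; ext g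
  simp only [pull_apply, Pi.sub_apply, Pi.add_apply, AddMonoidHom.id_apply, inv_inv,
    sub_add_cancel, GMod.hom_apply]
  rw [GMod.apply_inv_self]; rfl

lemma van_of_subsingleton [Subsingleton G] (ρ : GMod G M) (n : ℕ) : Van (n + 1) ρ := by
  refine Van.of_retract (σ := funRep (leftPerm G) ρ)
    (i := (⟨⟨fun m _ => m, rfl⟩, fun _ _ => rfl⟩ : M →+ (G → M))) (r := evHom M (1 : G))
    (fun _ _ => rfl) (fun g F => ?_) (fun _ => rfl) (funRep_van _ _ (fun x => x) (fun _ _ => rfl) n)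
  have hg : g = 1 := Subsingleton.elim _ _; subst hg; simp

end Conj

section Fixed

variable {k : Type} [Field k] [Finite k] {V : Type} [AbGrp V] [Module k V]
  [FinDim k V]

lemma finite_gl : Finite (V ≃ₗ[k] V) := by
  have : Finite V := Module.finite_of_finite k
  exact Finite.of_injective (fun g : V ≃ₗ[k] V => (g : V → V)) DFunLike.coe_injective

/-- A `p`-group acting on a nonzero space in characteristic `p` has a nonzero fixed vector. -/
lemma exists_fixed_vector (p : ℕ) [Fact p.Prime] [CharP k p] {Γ : Type} [Group Γ]
  (hΓ : IsPGroup p Γ) (f : Γ →* (V ≃ₗ[k] V)) (K : Submodule k V)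
  (hK : ∀ γ, ∀ v ∈ K, f γ v ∈ K) (hne : 0 < finrank k K) :
  ∃ v ∈ K, v ≠ 0 ∧ ∀ γ, f γ v = v := by
  have : Finite V := Module.finite_of_finite k
  let act : MulAction Γ K :=
    { smul := fun γ v => ⟨f γ v, hK γ v v.2⟩
      one_smul := fun v => Subtype.ext (by change f 1 (v : V) = v; rw [map_one]; rfl)
      mul_smul := fun a b v => Subtype.ext (by
        change f (a * b) (v : V) = f a (f b v); rw [map_mul]; rfl) }
  have hdvd : p ∣ Nat.card K := by
    have h1 : Nat.card K = Nat.card k ^ finrank k K := by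
      have := Fintype.ofFinite k; have := Fintype.ofFinite K
      rw [Nat.card_eq_fintype_card, Nat.card_eq_fintype_card, Module.card_eq_pow_finrank (K := k)]
    have := Fintype.ofFinite k; obtain ⟨n, _, hn⟩ := FiniteField.card k p
    rw [h1, Nat.card_eq_fintype_card, hn]; exact dvd_pow (dvd_pow_self p n.ne_zero) hne.ne'
  obtain ⟨b, hb, hb0⟩ := hΓ.exists_fixed_point_of_prime_dvd_card_of_fixed_point K hdvd
    (a := (0 : K)) (fun γ => Subtype.ext (map_zero (f γ)))
  exact ⟨b, b.2, fun h => hb0 (Subtype.ext h.symm), fun γ => congrArg Subtype.val (hb γ)⟩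

end Fixed

section Detection

variable {k : Type} [Field k] [Finite k] (p : ℕ) [Fact p.Prime] [CharP k p]

/-- The retractions are all conjugate, so one of them suffices to detect classes. -/
lemma isCob_of_one_retr {V : Type} [AbGrp V] [Module k V] {K A₀ A : Submodule k V}
  [FinDim k V] {d r i N : ℕ} {M : ℕ}
  (hE : ∀ x < i, EPos k p x d r N) (hN : EZero k p d r M) (F : VFun k)
  (hF : F.Poly d) (hp : F.Tors p) (hKA : Disjoint K A₀) (hAK : A ≤ K)
  (hr : finrank k V + (i + 2) * finrank k A ≤ finrank k K + finrank k A₀ + r)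
  (hK : N + M + (i + 8) * finrank k A ≤ finrank k K)
  (z : (Fin (i + 1) → Gs K (A₀ ⊔ A)) → F.obj V) (hz : cd (F.gs K (A₀ ⊔ A)) (i + 1) z = 0)
  (ρ : Retr A₀ A) (h : IsCob (F.gs (K ⊓ ker ρ.1) (A₀ ⊔ A)) (i + 1)
  (res (inclusion (Gs_mono inf_le_left le_rfl)) (i + 1) z)) :
  IsCob (F.gs K (A₀ ⊔ A)) (i + 1) z := by
  refine isCob_of_retr hE hN F hF hp hKA hAK hr hK z hz fun ρ' => ?_
  obtain ⟨g, hg, hgg⟩ := exists_Gs_of_common_section K (A₀ ⊔ A) ρ.1 ρ'.1 A.subtype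
    (fun e => hAK e.2) ρ.2.1 ρ'.2.1 (fun a ha => by
      obtain ⟨b, hb, b', hb', rfl⟩ := mem_sup.1 ha
      rw [map_add, map_add, ρ.2.2 b hb, ρ'.2.2 b hb, ρ.2.1 ⟨b', hb'⟩, ρ'.2.1 ⟨b', hb'⟩])
  let incl : Gs (K ⊓ ker ρ.1) (A₀ ⊔ A) →* Gs K (A₀ ⊔ A) :=
    inclusion (Gs_mono inf_le_left le_rfl)
  have h1 := isCob_res_conj (F.gs K (A₀ ⊔ A)) hz ⟨g, hg⟩ incl h
  refine IsCob.res_of_range ?_ ?_ ?_ h1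
  · exact (MulAut.conj _).injective.comp (Subgroup.inclusion_injective _)
  · intro x; refine ⟨⟨g⁻¹ * x * g, fun v => ⟨?_, ?_⟩, ?_⟩, ?_⟩
    · have hx := Gs_mono (kerTuple_le _) le_rfl x.2
      exact ((Gs K (A₀ ⊔ A)).mul_mem ((Gs K (A₀ ⊔ A)).mul_mem ((Gs _ _).inv_mem hg) hx) hg).1 v
    · have hx := (mem_kerTuple.1 (x.2.1 (g v))).2 0; change ρ.1 ((g⁻¹ * x * g) v - v) = 0
      rw [map_sub, sub_eq_zero, ← hgg, ← hgg, ← LinearEquiv.mul_apply,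
        ← mul_assoc, ← mul_assoc, mul_inv_cancel, one_mul]
      rwa [map_sub, sub_eq_zero] at hx
    · have hx := Gs_mono (kerTuple_le _) le_rfl x.2
      exact ((Gs K (A₀ ⊔ A)).mul_mem ((Gs K (A₀ ⊔ A)).mul_mem ((Gs _ _).inv_mem hg) hx) hg).2
    · apply Subtype.ext; change g * (g⁻¹ * x * g) * g⁻¹ = x; group
  · intro x y hxy; exact congrArg (F.rep V) (congrArg Subtype.val hxy)

/-- Classes are detected on the subgroups `Gs K' A'` with `A'` larger. -/
lemma isCob_of_detect {d r i N M : ℕ}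
  (hE : ∀ x < i, EPos k p x d (r + (i + 2)) N) (hN : EZero k p d (r + (i + 2)) M) (F : VFun k)
  (hF : F.Poly d) (hp : F.Tors p) (c : ℕ) : ∀ {V : Type} [AbGrp V] [Module k V]
  [FinDim k V] {K A₀ : Submodule k V} (_ : Disjoint K A₀)
  (_ : finrank k V ≤ finrank k K + finrank k A₀ + r)
  (_ : N + M + (i + 8) + c ≤ finrank k K)
  (z : (Fin (i + 1) → Gs K A₀) → F.obj V) (_ : cd (F.gs K A₀) (i + 1) z = 0)
  (_ : ∀ (K' A' : Submodule k V) (hK' : K' ≤ K) (hA' : A₀ ≤ A'), A' ≤ A₀ ⊔ K → Disjoint K' A' →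
  finrank k K' + c = finrank k K → finrank k A' = finrank k A₀ + c →
  IsCob (F.gs K' A') (i + 1) (res (inclusion (Gs_mono hK' hA')) (i + 1) z)),
  IsCob (F.gs K A₀) (i + 1) z := by
  induction c with
  | zero =>
    intro V _ _ _ K A₀ hd _ _ z hz h; exact h K A₀ le_rfl le_rfl le_sup_left hd rfl rfl
  | succ c ih =>
    intro V _ _ _ K A₀ hd hr hK z hz h; have : Finite (V ≃ₗ[k] V) := finite_gl
    let P : Sylow p (Gs K A₀) := default
    refine isCob_of_res_index p (F.gs K A₀) (hp V) P.1 (P.not_dvd_index) hz ?_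
    obtain ⟨v, hv, hv0, hfix⟩ := exists_fixed_vector (k := k) p P.2
      ((Gs K A₀).subtype.comp P.1.subtype) K (fun γ v hv => by
        have := K.add_mem (γ.1.2.1 v) hv; rwa [sub_add_cancel] at this) (by omega)
    let A : Submodule k V := span k {v}
    have hA1 : finrank k A = 1 := finrank_span_singleton hv0
    have hAK : A ≤ K := by rw [Submodule.span_le]; rintro _ rfl; exact hv
    have hle : Gs K (A₀ ⊔ A) ≤ Gs K A₀ := Gs_mono le_rfl le_sup_left
    have hPle : ∀ γ : P.1, ((γ : Gs K A₀) : V ≃ₗ[k] V) ∈ Gs K (A₀ ⊔ A) := by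
      intro γ; refine ⟨γ.1.2.1, fun a ha => ?_⟩; obtain ⟨b, hb, b', hb', rfl⟩ := mem_sup.1 ha
      obtain ⟨t, rfl⟩ := mem_span_singleton.1 hb'
      have : ((γ : Gs K A₀) : V ≃ₗ[k] V) v = v := hfix γ; rw [map_add, map_smul, this, γ.1.2.2 b hb]
    have hz1 : cd (F.gs K (A₀ ⊔ A)) (i + 1) (res (inclusion hle) (i + 1) z) = 0 := by
      have := cd_pull (equi_res (inclusion hle) (F.gs K A₀)) (i + 1) z; rwa [hz, map_zero] at this
    have key : IsCob (F.gs K (A₀ ⊔ A)) (i + 1) (res (inclusion hle) (i + 1) z) := by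
      refine isCob_of_retr hE hN F hF hp hd hAK (by rw [hA1]; omega) (by rw [hA1]; omega) _ hz1
        fun ρ => ?_
      have hdisj := kerTuple_disjoint hd (fun _ : Fin 1 => ρ)
      have hdim := finrank_kerTuple (K := K) (fun _ : Fin 1 => ρ)
      have hsup : finrank k (A₀ ⊔ A : Submodule k V) = finrank k A₀ + 1 := by
        have := Submodule.finrank_sup_add_finrank_inf_eq A₀ A
        rwa [disjoint_iff.1 (hd.symm.mono_right hAK), finrank_bot, hA1] at this
      have hlt : finrank k (kerTuple K (fun _ : Fin 1 => ρ)) < finrank k K := by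
        apply Submodule.finrank_lt_finrank_of_lt
        refine lt_of_le_of_ne (kerTuple_le _) fun he => hv0 ?_
        have h1 : v ∈ kerTuple K (fun _ : Fin 1 => ρ) := by rw [he]; exact hv
        exact disjoint_def.1 hdisj v h1 (mem_sup_right (Submodule.mem_span_singleton_self v))
      rw [hA1] at hdim
      have hz2 : cd (F.gs (kerTuple K (fun _ : Fin 1 => ρ)) (A₀ ⊔ A)) (i + 1)
          (res (inclusion (Gs_mono (kerTuple_le _) le_rfl)) (i + 1)
            (res (inclusion hle) (i + 1) z)) = 0 := by
        have := cd_pull (equi_res (inclusion (Gs_mono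
          (kerTuple_le (fun _ : Fin 1 => ρ)) le_rfl)) (F.gs K (A₀ ⊔ A))) (i + 1)
            (res (inclusion hle) (i + 1) z)
        rwa [hz1, map_zero] at this
      refine ih hdisj (by omega) (by omega) _ hz2 ?_
      intro K' A' hK' hA' hA'' hd' hKd hAd
      exact h K' A' (hK'.trans (kerTuple_le _)) (le_sup_left.trans hA')
        (hA''.trans (sup_le (sup_le le_sup_left (hAK.trans le_sup_right))
          ((kerTuple_le _).trans le_sup_right))) hd' (by omega) (by omega)
    let f : P.1 →* Gs K (A₀ ⊔ A) :=
      { toFun := fun γ => ⟨_, hPle γ⟩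
        map_one' := rfl
        map_mul' := fun _ _ => rfl }
    exact key.push (σ := (F.gs K A₀).comp P.1.subtype) (f := f) (φ := .id _) (fun _ _ => rfl)

end Detection

/-! ### Transport along decompositions -/

section Transport

variable {k : Type} [Field k] {V W C : Type} [AbGrp V] [Module k V]
  [AbGrp W] [Module k W] [AbGrp C] [Module k C]

/-- The product of two automorphisms. -/
def prodAut (g : W ≃ₗ[k] W) (h : C ≃ₗ[k] C) : (W × C) ≃ₗ[k] (W × C) := g.prodCongr h

@[simp] lemma prodAut_apply (g : W ≃ₗ[k] W) (h : C ≃ₗ[k] C) (x : W × C) :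
  prodAut g h x = (g x.1, h x.2) := rfl

/-- Conjugation by an isomorphism. -/
def conjAut (e : W ≃ₗ[k] V) : (W ≃ₗ[k] W) ≃* (V ≃ₗ[k] V) where
  toFun g := e.symm.trans (g.trans e)
  invFun g := e.trans (g.trans e.symm)
  left_inv g := by ext; simp
  right_inv g := by ext; simp
  map_mul' g h := by ext; simp

@[simp] lemma conjAut_apply (e : W ≃ₗ[k] V) (g : W ≃ₗ[k] W) (v : V) :
  conjAut e g v = e (g (e.symm v)) := rfl

lemma exists_gs_equiv (e : (W × C) ≃ₗ[k] V) (K : Submodule k W) : ∃ E : Gs K (⊥ : Submodule k W) ≃*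
  Gs (K.map (eˡ ∘ₗ inl k W C)) (range (eˡ ∘ₗ inr k W C)),
  ∀ g v, (E g).1 v = e (prodAut g.1 1 (e.symm v)) := by
  set K' := K.map (eˡ ∘ₗ inl k W C); set A' := range (eˡ ∘ₗ inr k W C)
  let f : Gs K (⊥ : Submodule k W) →* Gs K' A' :=
    { toFun := fun g => ⟨conjAut e (prodAut g.1 1), fun v => by
          refine ⟨(g : W ≃ₗ[k] W) (e.symm v).1 - (e.symm v).1, g.2.1 _, ?_⟩; apply e.symm.injective
          ext <;> simp, by
          rintro _ ⟨c, rfl⟩; simp⟩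
      map_one' := by apply Subtype.ext; ext v; change e (prodAut 1 1 (e.symm v)) = v; simp
      map_mul' := fun g h => by apply Subtype.ext; ext v; simp [prodAut] }
  have hinj : Injective f := by
    intro g h hgh; apply Subtype.ext; ext w
    simpa [f] using congrArg (fun x : Gs K' A' => (e.symm ((x : V ≃ₗ[k] V) (e (w, 0)))).1) hgh
  have hsurj : Surjective f := by
    intro g
    have h2 : ∀ (g : Gs K' A') w, (e.symm ((g : V ≃ₗ[k] V) (e (w, 0)))).2 = 0 ∧
        (e.symm ((g : V ≃ₗ[k] V) (e (w, 0)))).1 - w ∈ K := by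
      intro g w; obtain ⟨κ, hκ, he⟩ := g.2.1 (e (w, 0))
      have h3 : (g : V ≃ₗ[k] V) (e (w, 0)) = e (κ + w, 0) := by
        rw [← sub_add_cancel ((g : V ≃ₗ[k] V) (e (w, 0))) (e (w, 0)), ← he]; simp [← map_add]
      rw [h3]; simpa using hκ
    have h4 : ∀ (g : Gs K' A') w, (g : V ≃ₗ[k] V) (e (w, 0)) =
        e ((e.symm ((g : V ≃ₗ[k] V) (e (w, 0)))).1, 0) := by
      intro g w; apply e.symm.injective; ext
      · simp
      · simpa using (h2 g w).1
    let φ : Gs K' A' → (W →ₗ[k] W) := fun g =>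
      fst k W C ∘ₗ e.symmˡ ∘ₗ g.1ˡ ∘ₗ eˡ ∘ₗ inl k W C
    have hφ : ∀ g w, φ g w = (e.symm ((g : V ≃ₗ[k] V) (e (w, 0)))).1 := fun _ _ => rfl
    have hφφ : ∀ g h w, g * h = 1 → φ g (φ h w) = w := by
      intro g h w hgh; rw [hφ, hφ, ← h4 h w]
      have : (g : V ≃ₗ[k] V) ((h : V ≃ₗ[k] V) (e (w, 0))) = e (w, 0) := by
        rw [← LinearEquiv.mul_apply, ← Subgroup.coe_mul, hgh]; rfl
      rw [this]; simp
    let g' : W ≃ₗ[k] W := LinearEquiv.ofLinear (φ g) (φ g⁻¹)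
      (by ext w; exact hφφ _ _ w (mul_inv_cancel g)) (by ext w; exact hφφ _ _ w (inv_mul_cancel g))
    refine ⟨⟨g', fun w => (h2 g w).2, map_mem_bot _⟩, ?_⟩
    apply Subtype.ext; ext v; obtain ⟨⟨w, c⟩, rfl⟩ := e.surjective v
    change e (prodAut g' 1 (e.symm (e (w, c)))) = _
    have hwc : ((w, c) : W × C) = (w, 0) + (0, c) := by simp
    rw [e.symm_apply_apply, hwc, map_add e, map_add g.1, h4 g w,
      g.2.2 (e (0, c)) ⟨c, rfl⟩, ← map_add]
    simp [g', hφ]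
  exact ⟨MulEquiv.ofBijective f ⟨hinj, hsurj⟩, fun g v => rfl⟩

/-- Values of a functor on isomorphic spaces. -/
def VFun.mapEquiv (F : VFun k) (e : W ≃ₗ[k] V) : F.obj W ≃+ F.obj V where
  toFun := F.map eˡ
  invFun := F.map e.symmˡ
  left_inv x := by
    rw [← F.map_comp]; have : e.symmˡ ∘ₗ eˡ = .id := by ext; simp
    rw [this, F.map_id]
  right_inv x := by
    rw [← F.map_comp]; have : eˡ ∘ₗ e.symmˡ = .id := by ext; simp
    rw [this, F.map_id]
  map_add' := map_add _

lemma van_gs_transport (F : VFun k) (e : (W × C) ≃ₗ[k] V) (K : Submodule k W) {i : ℕ}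
  (h : Van i ((F.prodRight C).gs K ⊥)) :
  Van i (F.gs (K.map (eˡ ∘ₗ inl k W C)) (range (eˡ ∘ₗ inr k W C))) := by
  obtain ⟨E, hE⟩ := exists_gs_equiv e K; refine Van.of_equiv E (F.mapEquiv e.symm) ?_ h; intro g x
  change F.map e.symmˡ (F.map (E g).1ˡ x) = F.map (g.1ˡ.prodMap .id) (F.map e.symmˡ x)
  rw [← F.map_comp, ← F.map_comp]; congr 2; ext v
  · simp [hE]
  · simp [hE]

lemma exists_split [FinDim k V] {K A : Submodule k V} (h : Disjoint K A) :
  ∃ (W : Submodule k V) (e : (W × A) ≃ₗ[k] V) (K' : Submodule k W),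
  K'.map (eˡ ∘ₗ inl k W A) = K ∧
  range (eˡ ∘ₗ inr k W A) = A ∧
  finrank k K' = finrank k K ∧ finrank k V = finrank k W + finrank k A ∧
  (∀ a : A, e (0, a) = a) ∧ ∀ w : W, e (w, 0) = w := by
  obtain ⟨π, h1, h2, h3⟩ := exists_proj h
  have hc : IsCompl (ker π) A := by
    constructor
    · rw [disjoint_def]; intro v hv hv'; rw [← h1 v hv']; exact hv
    · rw [codisjoint_iff, eq_top_iff]; intro v _; have : v = (v - π v) + π v := by simp
      rw [this]; refine Submodule.add_mem_sup ?_ (h3 v)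
      rw [mem_ker, map_sub, h1 _ (h3 v), sub_self]
  have hKW : K ≤ ker π := fun v hv => h2 v hv
  let e := prodEquivOfIsCompl _ _ hc
  have he1 : ∀ w : ker π, e (w, 0) = w := fun w => by simp [e]
  have he2 : ∀ a : A, e (0, a) = a := fun a => by simp [e]
  refine ⟨ker π, e, K.comap (ker π).subtype, ?_, ?_, ?_, ?_, he2, he1⟩
  · ext v; constructor
    · rintro ⟨w, hw, rfl⟩; simpa [he1] using hw
    · intro hv; exact ⟨⟨v, hKW hv⟩, hv, he1 _⟩
  · ext v; constructor
    · rintro ⟨a, rfl⟩; simp [he2]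
    · intro hv; exact ⟨⟨v, hv⟩, he2 _⟩
  · rw [← Submodule.finrank_map_subtype_eq, map_comap_subtype, inf_eq_right.2 hKW]
  · rw [← e.finrank_eq, finrank_prod]

/-- Reduction of vanishing to the case of a trivial fixed subspace. -/
lemma van_gs_of_bot {i r N : ℕ} (F : VFun k) (H : ∀ (C W : Type) [AbGrp C] [Module k C] [FinDim k C]
  [AbGrp W] [Module k W] [FinDim k W]
  (K : Submodule k W), finrank k W ≤ finrank k K + r → N ≤ finrank k K →
  Van i ((F.prodRight C).gs K ⊥))
  [FinDim k V] (K A : Submodule k V) (hd : Disjoint K A)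
  (hr : finrank k V ≤ finrank k K + finrank k A + r) (hN : N ≤ finrank k K) :
  Van i (F.gs K A) := by
  obtain ⟨W, e, K', h1, h2, h3, h4, -, -⟩ := exists_split hd
  have := van_gs_transport F e K' (H A W K' (by omega) (by omega)); rwa [h1, h2] at this

end Transport

/-! ### Constant coefficients -/

section Constants

variable {k : Type} [Field k]

variable {V : Type} [AbGrp V] [Module k V]

/-- The automorphism induced on a quotient by a fixed subspace. -/
def quotAut (A : Submodule k V) : Gs (⊤ : Submodule k V) A →* ((V ⧸ A) ≃ₗ[k] (V ⧸ A)) where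
  toFun g := Submodule.Quotient.equiv A A (g : V ≃ₗ[k] V) (by
    ext v; constructor
    · rintro ⟨a, ha, rfl⟩; have : g.1 a = a := g.2.2 a ha; simpa [this] using ha
    · intro hv; exact ⟨v, hv, g.2.2 v hv⟩)
  map_one' := by ext v; obtain ⟨v, rfl⟩ := Submodule.Quotient.mk_surjective A v; rfl
  map_mul' g h := by ext v; obtain ⟨v, rfl⟩ := Submodule.Quotient.mk_surjective A v; rfl

lemma quotAut_mk (A : Submodule k V) (g : Gs (⊤ : Submodule k V) A) (v : V) :
  quotAut A g (A.mkQ v) = A.mkQ (g.1 v) := rfl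

lemma exists_quotAut_split {A : Submodule k V} (ρ : Retr ⊥ A) :
  ∃ j : ((V ⧸ A) ≃ₗ[k] (V ⧸ A)) →* (V ≃ₗ[k] V),
  ∀ g (hg : g ∈ Gs (⊤ : Submodule k V) A), (∀ v, ρ.1 (g v) = ρ.1 v) →
  j (quotAut A ⟨g, hg⟩) = g := by
  let P : V →ₗ[k] V := .id - A.subtype ∘ₗ ρ.1
  have hP : ∀ v, P v = v - ρ.1 v := fun _ => rfl
  have hPA : A ≤ ker P := fun a ha => by rw [mem_ker, hP, ρ.2.1 ⟨a, ha⟩, sub_self]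
  let σ : (V ⧸ A) →ₗ[k] V := A.liftQ P hPA
  have hσ : ∀ v, σ (A.mkQ v) = v - ρ.1 v := fun v => rfl
  have hρσ : ∀ q, ρ.1 (σ q) = 0 := fun q => by
    obtain ⟨v, rfl⟩ := A.mkQ_surjective q; rw [hσ, map_sub, ρ.2.1, sub_self]
  have hmσ : ∀ q, A.mkQ (σ q) = q := fun q => by
    obtain ⟨v, rfl⟩ := A.mkQ_surjective q; rw [hσ, map_sub, sub_eq_self]
    exact (Submodule.Quotient.mk_eq_zero A).2 (ρ.1 v).2
  have hmA : ∀ a : A, A.mkQ (a : V) = 0 := fun a => (Submodule.Quotient.mk_eq_zero A).2 a.2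
  let J : ((V ⧸ A) →ₗ[k] (V ⧸ A)) → (V →ₗ[k] V) := fun h =>
    A.subtype ∘ₗ ρ.1 + σ ∘ₗ h ∘ₗ A.mkQ
  have hJ : ∀ h v, J h v = ρ.1 v + σ (h (A.mkQ v)) := fun _ _ => rfl
  have hJm : ∀ h h' v, J h (J h' v) = J (h ∘ₗ h') v := by
    intro h h' v; rw [hJ, hJ, hJ, map_add, map_add, hρσ, hmσ, hmA, ρ.2.1, add_zero, zero_add]; rfl
  have hJ1 : ∀ v, J .id v = v := fun v => by rw [hJ, LinearMap.id_apply, hσ]; simp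
  refine ⟨{ toFun := fun h => LinearEquiv.ofLinear (J h) (J h.symm) ?_ ?_
            map_one' := ?_
            map_mul' := ?_ }, ?_⟩
  · ext v; rw [comp_apply, hJm]; have : hˡ ∘ₗ h.symmˡ = .id := by ext; simp
    rw [this, hJ1]; rfl
  · ext v; rw [comp_apply, hJm]; have : h.symmˡ ∘ₗ hˡ = .id := by ext; simp
    rw [this, hJ1]; rfl
  · ext v; exact hJ1 v
  · intro g h; ext v; exact (hJm gˡ hˡ v).symm
  · intro g hg hρ; ext v; change J (quotAut A ⟨g, hg⟩)ˡ v = g v; rw [hJ]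
    change _ + σ (quotAut A ⟨g, hg⟩ (A.mkQ v)) = _; rw [quotAut_mk, hσ, hρ]; simp

variable [Finite k] (p : ℕ) [Fact p.Prime] [CharP k p]

/-- Classes of the general linear group with constant coefficients vanish on `p`-groups acting
trivially modulo a subspace of large codimension. -/
lemma isCob_pgroup {i r N M : ℕ} (hE : ∀ x < i, EPos k p x 0 r N) (hN : EZero k p 0 r M)
  (hr : i + 3 ≤ r) (B : Type) [AbGrp B] (hB : ∀ b : B, p • b = 0) {Γ : Type} [Group Γ]
  (hΓ : IsPGroup p Γ) (m : ℕ) :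
  ∀ (V : Type) [AbGrp V] [Module k V] [FinDim k V] (V₁ : Submodule k V),
  finrank k V₁ = m → finrank k V₁ + (N + M + (i + 8)) ≤ finrank k V →
  ∀ f : Γ →* (V ≃ₗ[k] V), (∀ γ v, f γ v - v ∈ V₁) →
  ∀ z : (Fin (i + 1) → (V ≃ₗ[k] V)) → B, cd (1 : GMod (V ≃ₗ[k] V) B) (i + 1) z = 0 →
  IsCob (1 : GMod Γ B) (i + 1) (res f (i + 1) z) := by
  induction m with
  | zero =>
    intro V _ _ _ V₁ hV₁ _ f hf z hz
    have hf1 : f = 1 := by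
      ext γ v; have := hf γ v; rwa [Submodule.finrank_eq_zero.1 hV₁, mem_bot, sub_eq_zero] at this
    have h1 : IsCob (1 : GMod Unit B) (i + 1) (res (1 : Unit →* (V ≃ₗ[k] V)) (i + 1) z) := by
      refine van_of_subsingleton _ i _ ?_
      rw [cd_pull (ρ := (1 : GMod (V ≃ₗ[k] V) B)) (fun _ _ => rfl), hz, map_zero]
    have h2 := h1.push (f := (1 : Γ →* Unit)) (σ := (1 : GMod Γ B)) (φ := .id B) (fun _ _ => rfl)
    rw [hf1]; exact h2
  | succ m ih =>
    intro V _ _ _ V₁ hV₁ hdim f hf z hz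
    obtain ⟨v, hv, hv0, hfix⟩ := exists_fixed_vector (k := k) p hΓ f V₁ (fun γ v hv => by
        have := V₁.add_mem (hf γ v) hv; rwa [sub_add_cancel] at this) (by omega)
    let A : Submodule k V := span k {v}
    have hA1 : finrank k A = 1 := finrank_span_singleton hv0
    have hAV : A ≤ V₁ := by rw [Submodule.span_le]; rintro _ rfl; exact hv
    obtain ⟨ρ⟩ : Nonempty (Retr ⊥ A) := by
      obtain ⟨π, h1, h2, h3⟩ := exists_proj (K := ⊥) (A := A) disjoint_bot_left
      exact ⟨⟨π.codRestrict A h3, fun a => Subtype.ext (h1 a a.2),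
        fun a ha => Subtype.ext (h2 a ha)⟩⟩
    obtain ⟨j, hj⟩ := exists_quotAut_split ρ
    have hsub : Gs (⊤ : Submodule k V) (⊥ ⊔ A) = Gs ⊤ A := by rw [bot_sup_eq]
    let f' : Γ →* Gs (⊤ : Submodule k V) A :=
      { toFun := fun γ => ⟨f γ, fun _ => trivial, fun a ha => by
          obtain ⟨t, rfl⟩ := mem_span_singleton.1 ha; rw [map_smul, hfix]⟩
        map_one' := Subtype.ext (map_one f)
        map_mul' := fun a b => Subtype.ext (map_mul f a b) }
    let S := Gs (⊤ : Submodule k V) (⊥ ⊔ A)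
    let q : S →* ((V ⧸ A) ≃ₗ[k] (V ⧸ A)) := (quotAut A).comp (inclusion hsub.le)
    let w : (Fin (i + 1) → S) → B := res S.subtype (i + 1) z - res (j.comp q) (i + 1) z
    have hw : cd (1 : GMod S B) (i + 1) w = 0 := by
      rw [map_sub, cd_pull (ρ := (1 : GMod (V ≃ₗ[k] V) B)) (fun _ _ => rfl),
        cd_pull (ρ := (1 : GMod (V ≃ₗ[k] V) B)) (fun _ _ => rfl), hz, map_zero, map_zero, sub_zero]
    have hwc : IsCob (1 : GMod S B) (i + 1) w := by
      refine isCob_of_one_retr p hE hN (VFun.const k B) (VFun.const_poly B 0) (fun _ _ _ => hB)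
        disjoint_bot_right le_top (by rw [hA1, finrank_top]; omega)
        (by rw [hA1, finrank_top]; omega) w hw ρ ?_
      convert IsCob.zero _ _
      ext g; change z _ - z _ = 0; rw [sub_eq_zero]; congr 1; funext t
      refine (hj _ _ fun v => ?_).symm; have : ρ.1 (((g t).1) v - v) = 0 := ((g t).2.1 v).2
      rwa [map_sub, sub_eq_zero] at this
    have h1 := hwc.push (f := (inclusion hsub.ge).comp f') (σ := (1 : GMod Γ B))
      (φ := .id B) (fun _ _ => rfl)
    have hfr : finrank k (V ⧸ A) + 1 = finrank k V := by
      have := A.finrank_quotient_add_finrank; omega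
    have hfr1 : finrank k (V₁.map A.mkQ) + 1 = finrank k V₁ := by
      have h3 := finrank_range_add_finrank_ker (A.mkQ.domRestrict V₁)
      have h4 : range (A.mkQ.domRestrict V₁) = V₁.map A.mkQ := by rw [LinearMap.range_domRestrict]
      have h5 : finrank k (ker (A.mkQ.domRestrict V₁)) = 1 := by
        have : ker (A.mkQ.domRestrict V₁) = A.comap V₁.subtype := by ext x; simp
        rw [this, ← Submodule.finrank_map_subtype_eq V₁, map_comap_subtype, inf_eq_right.2 hAV, hA1]
      rwa [h4, h5] at h3
    have h2 := ih (V ⧸ A) (V₁.map A.mkQ) (by omega) (by omega) ((quotAut A).comp f') (fun γ q => by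
        obtain ⟨v, rfl⟩ := A.mkQ_surjective q
        exact ⟨f γ v - v, hf γ v, map_sub _ _ _⟩) (res j (i + 1) z)
      (by rw [cd_pull (ρ := (1 : GMod (V ≃ₗ[k] V) B)) (fun _ _ => rfl), hz, map_zero])
    convert h1.add h2 using 1
    ext g; change z _ = (z _ - z _) + z _; exact (sub_add_cancel _ _).symm

/-- Vanishing of cohomology of the general linear group with constant coefficients. -/
lemma van_const_gl {i N M : ℕ} (hE : ∀ x < i, EPos k p x 0 (i + 3) N)
    (hN : EZero k p 0 (i + 3) M) (B : Type) [AbGrp B] (hB : ∀ b : B, p • b = 0)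
    (V : Type) [AbGrp V] [Module k V] [FinDim k V]
    (hV : 2 * (N + M + (i + 8)) ≤ finrank k V) :
    Van (i + 1) (1 : GMod (Gs (⊤ : Submodule k V) ⊥) B) := by
  intro z hz
  refine isCob_of_detect (r := 1) p (d := 0) (i := i) (N := N) (M := M)
    (fun x hx => by rw [show 1 + (i + 2) = i + 3 by omega]; exact hE x hx)
    (by rw [show 1 + (i + 2) = i + 3 by omega]; exact hN)
    (VFun.const k B) (VFun.const_poly B 0) (fun _ _ _ => hB) (N + M + (i + 8)) disjoint_bot_right
    (by rw [finrank_top]; omega) (by rw [finrank_top]; omega) z hz ?_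
  intro K' A' hK' hA' _ _ hKd _
  have : Finite (V ≃ₗ[k] V) := finite_gl
  rw [finrank_top] at hKd
  let P : Sylow p (Gs K' A') := default
  let e : (V ≃ₗ[k] V) →* Gs (⊤ : Submodule k V) ⊥ :=
    { toFun := fun g => ⟨g, fun _ => trivial, map_mem_bot _⟩
      map_one' := rfl
      map_mul' := fun _ _ => rfl }
  have h1 := isCob_pgroup p hE hN le_rfl B hB P.2 (finrank k K') V K' rfl (by omega)
    ((Gs K' A').subtype.comp P.1.subtype) (fun γ v => γ.1.2.1 v) (res e (i + 1) z)
    (by rw [cd_pull (ρ := (1 : GMod (Gs (⊤ : Submodule k V) ⊥) B)) (fun _ _ => rfl)]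
        erw [hz]
        rw [map_zero])
  refine isCob_of_res_index p ((VFun.const k B).gs K' A') hB P.1 (P.not_dvd_index) ?_ h1
  have := cd_pull (equi_res (inclusion (Gs_mono hK' hA'))
    (1 : GMod (Gs (⊤ : Submodule k V) ⊥) B)) (i + 1) z
  rw [hz, map_zero] at this
  exact this

end Constants

section Duality

variable {k : Type} [Field k] [Finite k] {V : Type} [AbGrp V] [Module k V]
  [FinDim k V]

/-- The contragredient. -/
def dualAut (k V : Type) [Field k] [AbGrp V] [Module k V] :
  (V ≃ₗ[k] V) →* (Dual k V ≃ₗ[k] Dual k V) where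
  toFun g := g⁻¹.dualMap
  map_one' := by ext; rfl
  map_mul' g h := by ext φ v; simp only [mul_inv_rev]; rfl

lemma dualAut_apply (g : V ≃ₗ[k] V) (φ : Dual k V) (v : V) : dualAut k V g φ v = φ (g⁻¹ v) := rfl

lemma dualAut_bijective : Function.Bijective (dualAut k V) := by
  have hinj : Injective (dualAut k V) := by
    intro g h hgh; rw [← inv_inj]; ext v
    rw [← sub_eq_zero, ← Module.forall_dual_apply_eq_zero_iff k]; intro φ
    rw [map_sub, sub_eq_zero, ← dualAut_apply, ← dualAut_apply, hgh]
  have e : V ≃ₗ[k] Dual k V := LinearEquiv.ofFinrankEq _ _ (Subspace.dual_finrank_eq).symm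
  have : Finite (V ≃ₗ[k] V) := finite_gl
  exact ⟨hinj, (Finite.injective_iff_surjective_of_equiv (conjAut e).toEquiv).1 hinj⟩

lemma dualAut_mem_iff (K : Submodule k V) (g : V ≃ₗ[k] V) :
  dualAut k V g ∈ Gs (⊤ : Submodule k (Dual k V)) K.dualAnnihilator ↔ g ∈ Gs K ⊥ := by
  constructor
  · intro h; rw [← inv_mem_iff]; refine ⟨fun v => ?_, map_mem_bot _⟩
    rw [← Subspace.forall_mem_dualAnnihilator_apply_eq_zero_iff]; intro φ hφ
    rw [map_sub, sub_eq_zero, ← dualAut_apply, h.2 φ hφ]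
  · intro h; refine ⟨fun _ => trivial, fun φ hφ => ?_⟩; ext v
    rw [dualAut_apply, ← sub_eq_zero, ← map_sub]
    exact (Submodule.mem_dualAnnihilator φ).1 hφ _ (((Gs K ⊥).inv_mem h).1 v)

lemma exists_gs_dual (K : Submodule k V) :
  ∃ E : Gs K (⊥ : Submodule k V) ≃* Gs (⊤ : Submodule k (Dual k V)) K.dualAnnihilator,
  ∀ g, (E g : Dual k V ≃ₗ[k] Dual k V) = dualAut k V g := by
  let f : Gs K (⊥ : Submodule k V) →* Gs (⊤ : Submodule k (Dual k V)) K.dualAnnihilator :=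
    { toFun := fun g => ⟨dualAut k V g, (dualAut_mem_iff K _).2 g.2⟩
      map_one' := Subtype.ext (map_one _)
      map_mul' := fun a b => Subtype.ext (map_mul _ _ _) }
  refine ⟨MulEquiv.ofBijective f ⟨fun a b h => ?_, fun h => ?_⟩, fun _ => rfl⟩
  · exact Subtype.ext (dualAut_bijective.1 (congrArg Subtype.val h))
  · obtain ⟨g, hg⟩ := dualAut_bijective.2 h.1
    exact ⟨⟨g, (dualAut_mem_iff K g).1 (by rw [hg]; exact h.2)⟩, Subtype.ext hg⟩

variable (p : ℕ) [Fact p.Prime] [CharP k p]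

variable {i r N M : ℕ} (hE : ∀ x < i, EPos k p x 0 ((i + 3) * (r + 1)) N)
  (hN : EZero k p 0 ((i + 3) * (r + 1)) M)
  (hE' : ∀ x < i, EPos k p x 0 (i + 3) N) (hN' : EZero k p 0 (i + 3) M)
  (B : Type) [AbGrp B] (hB : ∀ b : B, p • b = 0)
include hE hN hE' hN' hB

lemma van_const_gs_top (A : Submodule k V) (hA : finrank k A ≤ r)
  (hV : 2 * (N + M + (i + 8)) + (i + 9) * r ≤ finrank k V) :
  Van (i + 1) (1 : GMod (Gs (⊤ : Submodule k V) A) B) := by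
  rw [← bot_sup_eq A]; intro z hz
  obtain ⟨ρ⟩ : Nonempty (Retr ⊥ A) := by
    obtain ⟨π, h1, h2, h3⟩ := exists_proj (K := ⊥) (A := A) disjoint_bot_left
    exact ⟨⟨π.codRestrict A h3, fun a => Subtype.ext (h1 a a.2), fun a ha => Subtype.ext (h2 a ha)⟩⟩
  have e1 : (i + 2) * finrank k A ≤ (i + 2) * r := Nat.mul_le_mul_left _ hA
  have e2 : (i + 8) * finrank k A ≤ (i + 8) * r := Nat.mul_le_mul_left _ hA
  refine isCob_of_one_retr p hE hN (VFun.const k B) (VFun.const_poly B 0) (fun _ _ _ => hB)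
    disjoint_bot_right le_top (by rw [finrank_top, finrank_bot]; lia)
    (by rw [finrank_top]; lia) z hz ρ ?_
  have hdisj : Disjoint (⊤ ⊓ ker ρ.1) (⊥ ⊔ A) := by
    rw [disjoint_def]; rintro v ⟨-, hv⟩ hv'; rw [bot_sup_eq] at hv'; have h1 : ρ.1 v = 0 := hv
    rw [ρ.2.1 ⟨v, hv'⟩] at h1; exact congrArg Subtype.val h1
  have hdim := finrank_le_inf_ker_add ⊤ ρ.1; rw [finrank_top] at hdim
  have key := van_gs_of_bot (i := i + 1) (r := 0) (N := 2 * (N + M + (i + 8))) (VFun.const k B)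
    (fun C W _ _ _ _ _ _ K hK hKN => by
      have hK : K = ⊤ := Submodule.eq_top_of_finrank_eq (le_antisymm K.finrank_le hK); subst hK
      rw [finrank_top] at hKN
      exact van_const_gl p hE' hN' B hB W hKN) _ _ hdisj (by rw [bot_sup_eq]; omega) (by lia)
  refine key _ ?_
  have := cd_pull (equi_res (inclusion (Gs_mono (inf_le_left : ⊤ ⊓ ker ρ.1 ≤ ⊤)
    (le_refl (⊥ ⊔ A)))) (1 : GMod (Gs (⊤ : Submodule k V) (⊥ ⊔ A)) B)) (i + 1) z
  rwa [hz, map_zero] at this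

lemma van_const_gs (K : Submodule k V) (hr : finrank k V ≤ finrank k K + r)
  (hV : 2 * (N + M + (i + 8)) + (i + 9) * r ≤ finrank k K) :
  Van (i + 1) (1 : GMod (Gs K ⊥) B) := by
  obtain ⟨E, -⟩ := exists_gs_dual K; have hK := K.finrank_le
  have hd : finrank k K.dualAnnihilator ≤ r := by
    have := Subspace.finrank_add_finrank_dualAnnihilator_eq K; omega
  exact Van.of_equiv E.symm (.refl B) (fun _ _ => rfl)
    (van_const_gs_top p hE hN hE' hN' B hB K.dualAnnihilator hd
      (by rw [Subspace.dual_finrank_eq]; omega))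

end Duality

/-! ### The diagonal argument for reduced functors -/

section Core

variable {k : Type} [Field k] {W D C : Type} [AbGrp W] [Module k W]
  [AbGrp D] [Module k D] [AbGrp C] [Module k C]

lemma van_prod_inl {G₁ G₂ M : Type} [Group G₁] [Group G₂] [AbGrp M] (ρ : GMod (G₁ × G₂) M) (i : ℕ)
  (h : ∀ j ≤ i, Van j (ρ.comp (.inl G₁ G₂))) : Van i ρ :=
  Van.of_equiv (MulEquiv.prodComm (M := G₂) (N := G₁)) (.refl M)
    (σ := ρ.comp (MulEquiv.prodComm (M := G₂) (N := G₁)).toMonoidHom) (fun _ _ => rfl)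
    (van_prod _ i h)

lemma crossSub_dev (F : VFun k) (hred : F.Reduced) (x : F.obj (W × C)) :
  x - F.map ((.id : W →ₗ[k] W).prodMap (0 : C →ₗ[k] C)) x -
  F.map ((0 : W →ₗ[k] W).prodMap (.id : C →ₗ[k] C)) x ∈ F.crossSub W C := by
  rw [VFun.mem_crossSub]; set i₁ : W × C →ₗ[k] W × C := (.id : W →ₗ[k] W).prodMap (0 : C →ₗ[k] C)
  set i₂ : W × C →ₗ[k] W × C := (0 : W →ₗ[k] W).prodMap (.id : C →ₗ[k] C)
  have h11 : i₁ ∘ₗ i₁ = i₁ := by ext <;> simp [i₁]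
  have h22 : i₂ ∘ₗ i₂ = i₂ := by ext <;> simp [i₂]
  have h12 : i₁ ∘ₗ i₂ = 0 := by ext <;> simp [i₁, i₂]
  have h21 : i₂ ∘ₗ i₁ = 0 := by ext <;> simp [i₁, i₂]
  rw [map_sub, map_sub, map_sub, map_sub, ← F.map_comp, ← F.map_comp, ← F.map_comp,
    ← F.map_comp, h11, h22, h12, h21, hred]
  simp

/-- The block diagonal embedding with an automorphism of the first summand. -/
def blockHom {K₁ : Submodule k W} {K : Submodule k (W × C)} (h1 : ∀ w ∈ K₁, ((w, 0) : W × C) ∈ K) :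
  Gs K₁ (⊥ : Submodule k W) →* Gs K (⊥ : Submodule k (W × C)) where
  toFun g := ⟨prodAut g.1 1, fun v => by
      have : prodAut g.1 1 v - v = (g.1 v.1 - v.1, (0 : C)) := by ext <;> simp
      rw [this]; exact h1 _ (g.2.1 _), map_mem_bot _⟩
  map_one' := rfl
  map_mul' _ _ := rfl

lemma isCob_fst (F : VFun k) (hred : F.Reduced) {K₁ : Submodule k W}
  {K : Submodule k (W × (W × D))} (h1 : ∀ w ∈ K₁, ((w, 0) : W × (W × D)) ∈ K)
  (h2 : ∀ w : W, ((0, (w, 0)) : W × (W × D)) ∈ K) (j : ℕ)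
  (hX : ∀ y ≤ j, Van y ((F.cross W).gs K₁ ⊥))
  (hc : ∀ y < j, Van (y + 1) (1 : GMod (W ≃ₗ[k] W) (F.obj W)))
  (z : (Fin j → Gs K ⊥) → F.obj (W × (W × D))) (hz : cd (F.gs K ⊥) j z = 0) :
  IsCob (F.gs K₁ ⊥) j (pull (blockHom h1) (F.map (fst k W (W × D))) j z) := by
  let H := Gs K₁ (⊥ : Submodule k W)
  let P := H × (W ≃ₗ[k] W)
  let Φ : P →* Gs K (⊥ : Submodule k (W × (W × D))) :=
    { toFun := fun g => ⟨prodAut g.1.1 (prodAut g.2 1), fun v => by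
        have : prodAut g.1.1 (prodAut g.2 (1 : D ≃ₗ[k] D)) v - v =
            (g.1.1 v.1 - v.1, 0) + (0, (g.2 v.2.1 - v.2.1, 0)) := by
          ext <;> simp
        rw [this]; exact K.add_mem (h1 _ (g.1.2.1 _)) (h2 _), map_mem_bot _⟩
      map_one' := rfl
      map_mul' := fun _ _ => rfl }
  let q : W × (W × D) →ₗ[k] W × W := (.id : W →ₗ[k] W).prodMap (fst k W D)
  let σ : GMod P (F.obj (W × W)) :=
    { toFun := fun g => F.map (prodAut g.1.1 g.2)ˡ
      map_one' := AddMonoidHom.ext fun x => F.map_id _ x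
      map_mul' := fun g h => AddMonoidHom.ext fun x => F.map_comp
        (prodAut g.1.1 g.2)ˡ (prodAut h.1.1 h.2)ˡ x }
  have hσ : ∀ g x, σ g x = F.map (g.1.1ˡ.prodMap g.2ˡ) x := fun _ _ => rfl
  have hq : Equi Φ (F.gs K ⊥) σ (F.map q) := by
    intro g x; change F.map q (F.map (prodAut g.1.1 (prodAut g.2 1))ˡ x) = F.map _ _
    rw [← F.map_comp, ← F.map_comp]; rfl
  -- the cross effect part vanishes
  let σX : GMod P (F.crossSub W W) :=
    { toFun := fun g => ((F.map (g.1.1ˡ.prodMap g.2ˡ)).comp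
        (F.crossSub W W).subtype).codRestrict _ (fun x => F.map_mem_crossSub _ _ x.2)
      map_one' := AddMonoidHom.ext fun x => Subtype.ext (F.map_id _ _)
      map_mul' := fun g h => AddMonoidHom.ext fun x => Subtype.ext (F.map_comp
        (prodAut g.1.1 g.2)ˡ (prodAut h.1.1 h.2)ˡ _) }
  have hvX : Van j σX := van_prod_inl σX j fun y hy => hX y hy
  let i₁ : W × W →ₗ[k] W × W := (.id : W →ₗ[k] W).prodMap (0 : W →ₗ[k] W)
  let i₂ : W × W →ₗ[k] W × W := (0 : W →ₗ[k] W).prodMap (.id : W →ₗ[k] W)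
  let dev : F.obj (W × W) →+ F.crossSub W W :=
    (AddMonoidHom.id _ - F.map i₁ - F.map i₂).codRestrict _ (crossSub_dev F hred)
  have hdev : Equi (MonoidHom.id P) σ σX dev := by
    intro g x; apply Subtype.ext
    change σ g x - F.map i₁ (σ g x) - F.map i₂ (σ g x) = σ g (x - F.map i₁ x - F.map i₂ x)
    have e₁ : i₁ ∘ₗ g.1.1ˡ.prodMap g.2ˡ = g.1.1ˡ.prodMap g.2ˡ ∘ₗ i₁ := by ext <;> simp [i₁]
    have e₂ : i₂ ∘ₗ g.1.1ˡ.prodMap g.2ˡ = g.1.1ˡ.prodMap g.2ˡ ∘ₗ i₂ := by ext <;> simp [i₂]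
    rw [map_sub, map_sub, hσ, hσ, hσ, ← F.map_comp, ← F.map_comp, ← F.map_comp, ← F.map_comp,
      e₁, e₂]
  let δ : H →* P := (MonoidHom.id H).prod (Gs K₁ (⊥ : Submodule k W)).subtype
  let q₁ := fst k W W
  let q₂ := snd k W W
  have hsum : Equi δ σX (F.gs K₁ ⊥) ((F.map (q₁ + q₂)).comp (F.crossSub W W).subtype) := by
    intro h x
    change F.map (q₁ + q₂) (F.map (h.1ˡ.prodMap h.1ˡ) x.1) = F.map h.1ˡ (F.map (q₁ + q₂) x.1)
    rw [← F.map_comp, ← F.map_comp]; congr 2; ext <;> simp [q₁, q₂]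
  let y := pull Φ (F.map q) j z
  have hy : cd σ j y = 0 := by rw [cd_pull hq, hz, map_zero]
  have c1 := (hvX (push dev j y) (by rw [cd_pull hdev, hy, map_zero])).push hsum
  -- conjugation
  let n : W × (W × D) →ₗ[k] W × (W × D) := inr k W (W × D) ∘ₗ inl k W D ∘ₗ fst k W (W × D)
  have hn : n ∘ₗ n = 0 := by ext <;> simp [n]
  let c : Gs K (⊥ : Submodule k (W × (W × D))) := ⟨oneAdd n hn, fun v => by
    simpa [n] using h2 v.1, map_mem_bot _⟩
  have hδ₂ : Equi (Φ.comp δ) (F.gs K ⊥) (F.gs K₁ ⊥) (F.map (q₂ ∘ₗ q)) := by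
    intro h x; change F.map _ (F.map (prodAut h.1 (prodAut h 1))ˡ x) = F.map _ _
    rw [← F.map_comp, ← F.map_comp]; rfl
  have c2 := (isCob_conj j (F.gs K ⊥) c z hz).push hδ₂
  have hcomm : ∀ h, MulAut.conj c⁻¹ (Φ (δ h)) = Φ (δ h) := by
    intro h; rw [MulAut.conj_apply, inv_inv, mul_assoc, inv_mul_eq_iff_eq_mul]; apply Subtype.ext
    apply LinearEquiv.ext; intro v
    change prodAut h.1 (prodAut h.1 (1 : D ≃ₗ[k] D)) (oneAdd n hn v) =
      oneAdd n hn (prodAut h.1 (prodAut h.1 (1 : D ≃ₗ[k] D)) v)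
    ext <;> simp [n]
  have c3 : IsCob (F.gs K₁ ⊥) j (pull (Φ.comp δ) (F.map (q₁ ∘ₗ q)) j z) := by
    convert c2.sub c1 using 1; ext h
    simp only [pull_apply, Pi.sub_apply, map_sub, AddMonoidHom.comp_apply]
    have e1 : (MulEquiv.toMonoidHom (MulAut.conj c⁻¹)) ∘ (Φ.comp δ) ∘ h = Φ.comp δ ∘ h := by
      funext t; exact hcomm (h t)
    rw [e1]
    change F.map (q₁ ∘ₗ q) (z (Φ.comp δ ∘ h)) = F.map (q₂ ∘ₗ q) (F.map c.1ˡ (z (Φ.comp δ ∘ h))) -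
      F.map (q₂ ∘ₗ q) (z (Φ.comp δ ∘ h)) - F.map (q₁ + q₂) (F.map q (z (Φ.comp δ ∘ h)) -
        F.map i₁ (F.map q (z (Φ.comp δ ∘ h))) - F.map i₂ (F.map q (z (Φ.comp δ ∘ h))))
    set u := z (Φ.comp δ ∘ h); rw [map_sub, map_sub]; simp only [← F.map_comp]
    have e2 : (q₁ + q₂) ∘ₗ i₁ ∘ₗ q = q₁ ∘ₗ q := by ext <;> simp [q₁, q₂, i₁, q]
    have e3 : (q₁ + q₂) ∘ₗ i₂ ∘ₗ q = q₂ ∘ₗ q := by ext <;> simp [q₁, q₂, i₂, q]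
    have e4 : (q₂ ∘ₗ q) ∘ₗ c.1ˡ = (q₁ + q₂) ∘ₗ q := by ext <;> simp [q₁, q₂, q, c, n]
    rw [e2, e3, e4]; abel
  -- comparison of the diagonal with the first factor
  let τ : GMod P (F.obj W) := (F.gs K₁ ⊥).comp (.fst H _)
  have hτ : Equi Φ (F.gs K ⊥) τ (F.map (q₁ ∘ₗ q)) := by
    intro g x; change F.map _ (F.map (prodAut g.1.1 (prodAut g.2 1))ˡ x) = F.map _ _
    rw [← F.map_comp, ← F.map_comp]; rfl
  let y₁ := pull Φ (F.map (q₁ ∘ₗ q)) j z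
  have hy₁ : cd τ j y₁ = 0 := by rw [cd_pull hτ, hz, map_zero]
  let t := res (.inl H _) j y₁
  have hinl : Equi (.inl H _) τ (F.gs K₁ ⊥) (.id _) := fun _ _ => rfl
  have hfst : Equi (.fst H _) (F.gs K₁ ⊥) τ (.id _) := fun _ _ => rfl
  have ht : cd (F.gs K₁ ⊥) j t = 0 := by rw [cd_pull hinl, hy₁, map_zero]
  have c4 : IsCob τ j (y₁ - res (.fst H _) j t) := by
    refine isCob_prod_of_res_inl τ (fun g m => F.map_id _ m) j (fun y hy => ?_) _ ?_ ?_
    · have : τ.comp (.inr H _) = 1 := by ext g x; exact F.map_id _ x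
      rw [this]; exact hc y hy
    · rw [map_sub, hy₁, cd_pull hfst, ht, map_zero, sub_zero]
    · convert IsCob.zero _ _
      ext h; exact sub_self _
  have hδ₃ : Equi δ τ (F.gs K₁ ⊥) (.id _) := fun _ _ => rfl
  convert c3.sub (c4.push hδ₃) using 1; ext h
  change _ = F.map (q₁ ∘ₗ q) (z (Φ.comp δ ∘ h)) - (F.map (q₁ ∘ₗ q) (z (Φ.comp δ ∘ h)) -
    F.map (q₁ ∘ₗ q) (z _))
  rw [sub_sub_cancel]; rfl

/-- The restriction of a class to a block equals its component from the complementary block. -/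
lemma isCob_block (F : VFun k) (hred : F.Reduced) {K₁ : Submodule k W}
  {K : Submodule k (W × C)} (h1 : ∀ w ∈ K₁, ((w, 0) : W × C) ∈ K) (j : ℕ)
  (hX : Van j ((F.cross C).gs K₁ ⊥))
  (z : (Fin j → Gs K ⊥) → F.obj (W × C)) (hz : cd (F.gs K ⊥) j z = 0)
  (hfst : IsCob (F.gs K₁ ⊥) j (pull (blockHom h1) (F.map (fst k W C)) j z)) :
  IsCob ((F.gs K ⊥).comp (blockHom h1)) j (pull (blockHom h1) (.id _ -
  F.map ((0 : W →ₗ[k] W).prodMap (.id : C →ₗ[k] C))) j z) := by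
  set i₁ : W × C →ₗ[k] W × C := (.id : W →ₗ[k] W).prodMap (0 : C →ₗ[k] C) with hi₁
  set i₂ : W × C →ₗ[k] W × C := (0 : W →ₗ[k] W).prodMap (.id : C →ₗ[k] C) with hi₂
  let σ := (F.gs K ⊥).comp (blockHom h1)
  let dev : F.obj (W × C) →+ F.crossSub W C :=
    (.id _ - F.map i₁ - F.map i₂).codRestrict _ (crossSub_dev F hred)
  have hgs : ∀ g x, (F.gs K ⊥ (blockHom h1 g)) x = F.map (g.1ˡ.prodMap .id) x := fun _ _ => rfl
  have hdev : Equi (blockHom h1) (F.gs K ⊥) ((F.cross C).gs K₁ ⊥) dev := by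
    intro g x; apply Subtype.ext
    change F.gs K ⊥ (blockHom h1 g) x - F.map i₁ (F.gs K ⊥ (blockHom h1 g) x) -
      F.map i₂ (F.gs K ⊥ (blockHom h1 g) x) =
      F.map (g.1ˡ.prodMap .id) (x - F.map i₁ x - F.map i₂ x)
    have e₁ : i₁ ∘ₗ g.1ˡ.prodMap .id = g.1ˡ.prodMap .id ∘ₗ i₁ := by ext <;> simp [i₁]
    have e₂ : i₂ ∘ₗ g.1ˡ.prodMap .id = g.1ˡ.prodMap .id ∘ₗ i₂ := by ext <;> simp [i₂]
    rw [map_sub, map_sub, hgs, ← F.map_comp, ← F.map_comp, ← F.map_comp, ← F.map_comp, e₁, e₂]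
  have c1 : IsCob ((F.cross C).gs K₁ ⊥) j (pull (blockHom h1) dev j z) :=
    hX _ (by rw [cd_pull hdev, hz, map_zero])
  have c2 := c1.push (f := .id _) (σ := σ) (φ := (F.crossSub W C).subtype) (fun _ _ => rfl)
  have c3 := hfst.push (f := .id _) (σ := σ) (φ := F.map (inl k W C)) (fun g x => by
      change F.map _ (F.map _ x) = F.gs K ⊥ (blockHom h1 g) (F.map _ x)
      rw [hgs, ← F.map_comp, ← F.map_comp]; congr 2)
  convert c2.add c3 using 1
  ext g
  change z _ - F.map i₂ (z _) = (z _ - F.map i₁ (z _) - F.map i₂ (z _)) + F.map _ (F.map _ (z _))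
  rw [← F.map_comp]; have : inl k W C ∘ₗ fst k W C = i₁ := by ext <;> simp [i₁]
  rw [this]; abel

end Core

/-! ### Stable vanishing for polynomial functors -/

section Reduced

variable {k : Type} [Field k] {V W C D : Type} [AbGrp V] [Module k V]
  [AbGrp W] [Module k W] [AbGrp C] [Module k C] [AbGrp D] [Module k D]

/-- Conjugation by an isomorphism on the subgroups `Gs K ⊥`. -/
def gsConj (e : W ≃ₗ[k] V) (K : Submodule k V) :
  Gs (K.comap eˡ) (⊥ : Submodule k W) →* Gs K (⊥ : Submodule k V) where
  toFun g := ⟨conjAut e g, fun v => by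
    have := g.2.1 (e.symm v); rw [Submodule.mem_comap, map_sub] at this
    simpa using this, map_mem_bot _⟩
  map_one' := Subtype.ext (map_one (conjAut e))
  map_mul' g h := Subtype.ext (map_mul (conjAut e) _ _)

lemma equi_gsConj (F : VFun k) (e : W ≃ₗ[k] V) (K : Submodule k V) :
  Equi (gsConj e K) (F.gs K ⊥) (F.gs (K.comap eˡ) ⊥) (F.map e.symmˡ) := by
  intro g x; change F.map _ (F.map (conjAut e g.1)ˡ x) = F.map g.1ˡ (F.map _ x)
  rw [← F.map_comp, ← F.map_comp]; congr 2; ext v; simp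

variable [FinDim k W] [FinDim k C]

lemma isCob_fst_of_finrank_le (F : VFun k) (hred : F.Reduced) {K₁ : Submodule k W}
  {K : Submodule k (W × C)} (h1 : ∀ w ∈ K₁, ((w, 0) : W × C) ∈ K)
  (h2 : ∀ c : C, ((0, c) : W × C) ∈ K) (hWC : finrank k W ≤ finrank k C) (j : ℕ)
  (hX : ∀ y ≤ j, Van y ((F.cross W).gs K₁ ⊥))
  (hc : ∀ y < j, Van (y + 1) (1 : GMod (W ≃ₗ[k] W) (F.obj W)))
  (z : (Fin j → Gs K ⊥) → F.obj (W × C)) (hz : cd (F.gs K ⊥) j z = 0) :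
  IsCob (F.gs K₁ ⊥) j (pull (blockHom h1) (F.map (fst k W C)) j z) := by
  have hD : finrank k (W × (Fin (finrank k C - finrank k W) → k)) = finrank k C := by
    rw [finrank_prod, finrank_fin_fun]; omega
  let e' := LinearEquiv.ofFinrankEq _ _ hD
  let e := (LinearEquiv.refl k W).prodCongr e'
  have h1' : ∀ w ∈ K₁, ((w, 0) : W × (W × (Fin (finrank k C - finrank k W) → k))) ∈
      K.comap eˡ := fun w hw => by
    have : e (w, 0) = (w, 0) := by simp [e]
    change e (w, 0) ∈ K; rw [this]; exact h1 w hw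
  have := isCob_fst F hred h1' (fun w => h2 _) j hX hc (pull (gsConj e K) (F.map e.symmˡ) j z)
    (by rw [cd_pull (equi_gsConj F e K), hz, map_zero])
  convert this using 1
  ext g; change F.map _ (z _) = F.map _ (F.map _ (z _)); rw [← F.map_comp]
  have e1 : fst k W _ ∘ₗ e.symmˡ = fst k W C := by ext <;> simp [e]
  rw [e1]; congr 2; funext t; apply Subtype.ext; apply LinearEquiv.ext; intro v
  change prodAut _ _ v = e (prodAut _ _ (e.symm v)); ext <;> simp [e]

/-- The embedding of `Gs K₁ ⊥` determined by a decomposition. -/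
def splitHom (e : (W × C) ≃ₗ[k] V) {K₁ : Submodule k W} {K : Submodule k V}
  (h1 : ∀ w ∈ K₁, e (w, 0) ∈ K) : Gs K₁ (⊥ : Submodule k W) →* Gs K (⊥ : Submodule k V) :=
  (gsConj e K).comp (blockHom (K := K.comap eˡ) h1)

lemma splitHom_apply (e : (W × C) ≃ₗ[k] V) {K₁ : Submodule k W} {K : Submodule k V}
  (h1 : ∀ w ∈ K₁, e (w, 0) ∈ K) (g : Gs K₁ (⊥ : Submodule k W)) (v : V) :
  (splitHom e h1 g).1 v = e (prodAut g.1 1 (e.symm v)) := rfl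

/-- The projection to the second summand of a decomposition. -/
def splitProj (e : (W × C) ≃ₗ[k] V) : V →ₗ[k] V :=
  eˡ ∘ₗ ((0 : W →ₗ[k] W).prodMap (.id : C →ₗ[k] C)) ∘ₗ e.symmˡ

lemma isCob_split (F : VFun k) (hred : F.Reduced) (e : (W × C) ≃ₗ[k] V) {K₁ : Submodule k W}
  {K : Submodule k V} (h1 : ∀ w ∈ K₁, e (w, 0) ∈ K)
  (h2 : ∀ c : C, e (0, c) ∈ K) (hWC : finrank k W ≤ finrank k C) (j : ℕ)
  (hX : ∀ y ≤ j, ∀ (U : Type) [AbGrp U] [Module k U], Van y ((F.cross U).gs K₁ ⊥))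
  (hc : ∀ y < j, Van (y + 1) (1 : GMod (W ≃ₗ[k] W) (F.obj W)))
  (z : (Fin j → Gs K ⊥) → F.obj V) (hz : cd (F.gs K ⊥) j z = 0) :
  IsCob ((F.gs K ⊥).comp (splitHom e h1)) j
  (pull (splitHom e h1) (.id _ - F.map (splitProj e)) j z) := by
  let z' := pull (gsConj e K) (F.map e.symmˡ) j z
  have hz' : cd (F.gs (K.comap eˡ) ⊥) j z' = 0 := by rw [cd_pull (equi_gsConj F e K), hz, map_zero]
  have := isCob_block F hred (K := K.comap eˡ) h1 j (hX j le_rfl C) z' hz'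
    (isCob_fst_of_finrank_le F hred h1 h2 hWC j (fun y hy => hX y hy W) hc z' hz')
  have h3 := this.push (f := .id _) (σ := (F.gs K ⊥).comp (splitHom e h1))
    (φ := F.map eˡ) (fun g x => by
      change F.map _ (F.map (prodAut g.1 1)ˡ x) = F.map (splitHom e h1 g).1ˡ (F.map _ x)
      rw [← F.map_comp, ← F.map_comp]; congr 2; apply LinearMap.ext; intro v
      change _ = (splitHom e h1 g).1 (e v); rw [splitHom_apply, e.symm_apply_apply]; rfl)
  convert h3 using 1
  ext g; change z _ - F.map _ (z _) = F.map _ (F.map _ (z _) - F.map _ (F.map _ (z _)))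
  rw [map_sub, ← F.map_comp, ← F.map_comp, ← F.map_comp]
  have e1 : eˡ ∘ₗ e.symmˡ = .id := by ext; simp
  rw [e1, F.map_id]; rfl

end Reduced

section Stable

variable {k : Type} [Field k]

/-- Vanishing in degree `j` for reduced functors of degree `d`. -/
def ERed (k : Type) [Field k] (p j d r N : ℕ) : Prop :=
  ∀ F : VFun k, F.Reduced → F.Poly d → F.Tors p → ∀ (V : Type) [AbGrp V] [Module k V]
    [FinDim k V] (K : Submodule k V),
    finrank k V ≤ finrank k K + r → N ≤ finrank k K → Van j (F.gs K ⊥)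

lemma ERed.mono {p j d r N N' : ℕ} (h : ERed k p j d r N) (hN : N ≤ N') : ERed k p j d r N' :=
  fun F h1 h2 h3 V _ _ _ K h4 h5 => h F h1 h2 h3 V K h4 (hN.trans h5)

lemma EPos.mono {p i d r N N' : ℕ} (h : EPos k p i d r N) (hN : N ≤ N') : EPos k p i d r N' :=
  fun F h2 h3 V _ _ _ K A h h4 h5 => by exact ‹EPos k p i d r N› F h2 h3 V K A h h4 (hN.trans h5)

lemma EZero.mono {p d r N N' : ℕ} (h : EZero k p d r N) (hN : N ≤ N') : EZero k p d r N' :=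
  fun F h2 h3 V _ _ _ K A h h4 h5 => by exact ‹EZero k p d r N› F h2 h3 V K A h h4 (hN.trans h5)

lemma eRed_zero (p j r : ℕ) : ERed k p j 0 r 0 := by
  intro F hred hF _ V _ _ _ K _ _ z _
  have hsub : ∀ x : F.obj V, x = 0 := by
    intro x; have := hF V V x .id 0; simp only [zero_add, F.map_id] at this
    rwa [hred V V x, sub_zero] at this
  have : z = 0 := funext fun g => hsub _; rw [this]; exact IsCob.zero _ _

lemma map_splitProj {p d N : ℕ} (F : VFun k)
  (hred : F.Reduced) (hF : F.Poly (d + 1)) (hp : F.Tors p) {V W C : Type} [AbGrp V]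
  [Module k V] [AbGrp W] [Module k W] [AbGrp C] [Module k C]
  [FinDim k W] [FinDim k C] (e : (W × C) ≃ₗ[k] V)
  {r : ℕ} (hE : ERed k p 0 d r N) {K₁ : Submodule k W} {K : Submodule k V}
  (h1 : ∀ w ∈ K₁, e (w, 0) ∈ K) (h2 : ∀ c : C, e (0, c) ∈ K) (hWC : finrank k W ≤ finrank k C)
  (hr : finrank k W ≤ finrank k K₁ + r) (hN : N ≤ finrank k K₁)
  (x : F.obj V) (hx : ∀ g, F.gs K ⊥ g x = x) : F.map (splitProj e) x = x := by
  have := isCob_split F hred e h1 h2 hWC 0 (fun y hy U _ _ => by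
    obtain rfl : y = 0 := by omega
    exact hE _ (F.cross_reduced U) (F.cross_poly U hF) (F.cross_tors U hp) W K₁ hr hN)
    (fun y hy => absurd hy (by omega)) (fun _ => x) ((cd_zero_iff _ _).2 hx)
  have := congrFun (show _ = 0 from this) Fin.elim0; exact (sub_eq_zero.1 this).symm

lemma exists_subspace_pair {V : Type} [AbGrp V] [Module k V] [FinDim k V]
  (K : Submodule k V) {a b : ℕ} (h : a + b = finrank k K) :
  ∃ K' A' : Submodule k V, K' ≤ K ∧ A' ≤ K ∧ Disjoint K' A' ∧ finrank k K' = a ∧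
  finrank k A' = b := by
  have hD : finrank k ((Fin a → k) × (Fin b → k)) = finrank k K := by
    rw [finrank_prod, finrank_fin_fun, finrank_fin_fun]; omega
  let e := LinearEquiv.ofFinrankEq _ _ hD
  let f := K.subtype ∘ₗ eˡ
  have hf : Injective f := K.injective_subtype.comp e.injective
  refine ⟨range (f ∘ₗ inl k _ _), range (f ∘ₗ inr k _ _), ?_, ?_, ?_, ?_, ?_⟩
  · rintro _ ⟨x, rfl⟩; exact (e _).2
  · rintro _ ⟨x, rfl⟩; exact (e _).2
  · rw [disjoint_def]; rintro _ ⟨x, rfl⟩ ⟨y, hy⟩; have := hf hy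
    simp only [LinearMap.inr_apply, LinearMap.inl_apply, Prod.mk.injEq] at this; rw [← this.1]
    exact map_zero (f ∘ₗ inl k _ _)
  · rw [LinearMap.finrank_range_of_inj, finrank_fin_fun]; exact hf.comp LinearMap.inl_injective
  · rw [LinearMap.finrank_range_of_inj, finrank_fin_fun]; exact hf.comp LinearMap.inr_injective

lemma eRed_zero_succ {p d r N M : ℕ} (h0 : ERed k p 0 d 0 N) (h : ERed k p 0 d r M) :
  ERed k p 0 (d + 1) r (2 * M + r + 3 * N + 6) := by
  intro F hred hF hp V _ _ _ K hr hK; rw [van_zero_iff]; intro x hx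
  have top : ∀ (U : Type) [AbGrp U] [Module k U] [FinDim k U],
      3 * N + 6 ≤ finrank k U → ∀ y : F.obj U, (∀ g : U ≃ₗ[k] U, F.map gˡ y = y) → y = 0 := by
    intro U _ _ _ hU y hy
    let a := finrank k U / 3
    let X := Fin a → k
    let Z := Fin (finrank k U - 2 * a) → k
    have hX : finrank k X = a := finrank_fin_fun k
    have hZ : finrank k Z = finrank k U - 2 * a := finrank_fin_fun k
    have main : ∀ (A B : Type) [AbGrp A] [Module k A] [FinDim k A]
        [AbGrp B] [Module k B] [FinDim k B] (e : (A × B) ≃ₗ[k] U),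
        N ≤ finrank k A → finrank k A ≤ finrank k B → F.map (splitProj e) y = y := by
      intro A B _ _ _ _ _ _ e hA hAB
      exact map_splitProj F hred hF hp e h0 (K₁ := ⊤) (K := ⊤) (fun _ _ => trivial)
        (fun _ => trivial) hAB (by rw [finrank_top]; omega) (by rw [finrank_top]; omega) y
        (fun g => hy _)
    have hD : finrank k (X × (X × Z)) = finrank k U := by rw [finrank_prod, finrank_prod]; omega
    let e₁ : (X × (X × Z)) ≃ₗ[k] U := LinearEquiv.ofFinrankEq _ _ hD
    let s₂ : (X × (X × Z)) ≃ₗ[k] (X × (X × Z)) := (LinearEquiv.prodAssoc k X X Z).symm ≪≫ₗ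
      (LinearEquiv.prodComm k X X).prodCongr (.refl k Z) ≪≫ₗ .prodAssoc k X X Z
    let s₃ := LinearEquiv.prodComm k Z (X × X) ≪≫ₗ .prodAssoc k X X Z
    have m₁ := main X (X × Z) e₁ (by omega) (by rw [finrank_prod]; omega)
    have m₂ := main X (X × Z) (s₂.trans e₁) (by omega) (by rw [finrank_prod]; omega)
    have m₃ := main Z (X × X) (s₃.trans e₁) (by omega) (by rw [finrank_prod]; omega)
    have hcomp : splitProj e₁ ∘ₗ splitProj (s₂.trans e₁) ∘ₗ splitProj (s₃.trans e₁) = 0 := by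
      apply LinearMap.ext; intro v; simp [splitProj, s₂, s₃]; exact ⟨rfl, rfl⟩
    rw [← m₁, ← m₂, ← m₃, ← F.map_comp, ← F.map_comp, LinearMap.comp_assoc, hcomp, hred]
  obtain ⟨K', A', hK', hA', hd, hfK, hfA⟩ := exists_subspace_pair K
    (a := M) (b := finrank k K - M) (by omega)
  obtain ⟨W, e, K₁, e1, e2, e3, e4, e5, e6⟩ := exists_split hd
  have m := map_splitProj F hred hF hp e h (K₁ := K₁) (K := K) (fun w hw => hK' (by
      rw [← e1]; exact ⟨w, hw, rfl⟩)) (fun c => hA' (by rw [e5]; exact c.2))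
      (by omega) (by omega) (by omega) x hx
  let ρ : V →ₗ[k] A' := snd k W A' ∘ₗ e.symmˡ
  have hy : F.map ρ x = 0 := by
    refine top A' (by omega) _ fun g => ?_
    let G : Gs K (⊥ : Submodule k V) := ⟨conjAut e (prodAut 1 g), fun v => by
      have : conjAut e (prodAut 1 g) v - v = e (0, g (e.symm v).2 - (e.symm v).2) := by
        apply e.symm.injective; ext <;> simp
      rw [this]; exact hA' (by rw [e5]; exact Subtype.prop _), map_mem_bot _⟩
    conv_rhs => rw [← hx G]
    rw [VFun.gs_apply, ← F.map_comp, ← F.map_comp]; congr 2; apply LinearMap.ext; intro v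
    simp [ρ, G]
  rw [← m]
  have : splitProj e = (eˡ ∘ₗ inr k W A') ∘ₗ ρ := by
    apply LinearMap.ext; intro v; simp [splitProj, ρ]
  rw [this, F.map_comp, hy, map_zero]

lemma exists_eRed_zero (p d : ℕ) : ∀ r, ∃ N, ERed k p 0 d r N := by
  induction d with
  | zero => exact fun r => ⟨0, eRed_zero p 0 r⟩
  | succ d ih =>
    intro r; obtain ⟨N, hN⟩ := ih 0; obtain ⟨M, hM⟩ := ih r; exact ⟨_, eRed_zero_succ hN hM⟩

section

variable (F : VFun k) {V W U : Type} [AbGrp V] [Module k V] [AbGrp W] [Module k W] [AbGrp U]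
  [Module k U] (x : F.obj V)

lemma VFun.map_zero_map (f : V →ₗ[k] W) : F.map (0 : W →ₗ[k] U) (F.map f x) = F.map 0 x := by
  rw [← F.map_comp, LinearMap.zero_comp]

lemma VFun.map_map_zero (f : W →ₗ[k] U) : F.map f (F.map (0 : V →ₗ[k] W) x) = F.map 0 x := by
  rw [← F.map_comp, LinearMap.comp_zero]

end

/-- The projection to the reduced part. -/
def VFun.toRed (F : VFun k) (V : Type) [AbGrp V] [Module k V] : F.obj V →+ F.red.obj V :=
  (.id _ - F.map (0 : V →ₗ[k] V)).codRestrict _ (fun x => by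
    change F.map (0 : V →ₗ[k] V) (x - F.map (0 : V →ₗ[k] V) x) = 0
    rw [map_sub, F.map_zero_map, sub_self])

lemma exists_eZero (p d r : ℕ) : ∃ N, EZero k p d r N := by
  obtain ⟨N, hN⟩ := exists_eRed_zero (k := k) p d r
  refine ⟨N, fun F hF hp V _ _ _ K A hd hr hK x hx π h1 h2 h3 => ?_⟩
  obtain ⟨W, e, K₁, e1, e2, e3, e4, e5, e6⟩ := exists_split hd; have hE := exists_gs_equiv e K₁
  rw [e1, e2] at hE; obtain ⟨E, hE⟩ := hE
  let Q := F.prodRight A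
  let y : Q.obj W := F.map e.symmˡ x
  have hy : ∀ g : Gs K₁ (⊥ : Submodule k W), Q.map g.1ˡ y = y := by
    intro g; change F.map _ (F.map _ x) = F.map _ x
    conv_rhs => rw [← hx (E g)]
    rw [VFun.gs_apply, ← F.map_comp, ← F.map_comp]; congr 2; apply LinearMap.ext; intro v
    simp only [comp_apply, LinearEquiv.coe_coe, hE, LinearEquiv.symm_apply_apply]; rfl
  have h0 : Q.toRed W y = 0 := by
    refine (van_zero_iff _).1 (hN Q.red Q.red_reduced (Q.sub_poly _ _ (F.prodRight_poly A hF))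
      (Q.sub_tors _ _ (fun V _ _ x => hp _ x)) W K₁ (by omega) (by omega)) _ fun g => ?_
    apply Subtype.ext; change Q.map g.1ˡ (y - Q.map (0 : W →ₗ[k] W) y) = y - Q.map (0 : W →ₗ[k] W) y
    rw [map_sub, hy, Q.map_map_zero]
  have h0' : y - Q.map (0 : W →ₗ[k] W) y = 0 := congrArg Subtype.val h0
  have hx0 : F.map (splitProj e) x = x := by
    have := congrArg (F.map eˡ) (sub_eq_zero.1 h0')
    change F.map _ (F.map _ x) = F.map _ (F.map _ (F.map _ x)) at this
    rw [← F.map_comp, ← F.map_comp, ← F.map_comp] at this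
    have e' : eˡ ∘ₗ e.symmˡ = .id := by ext; simp
    rw [e', F.map_id] at this; exact this.symm
  rw [← hx0, ← F.map_comp]; congr 2; apply LinearMap.ext; intro v
  change π (e (0, (e.symm v).2)) = e (0, (e.symm v).2)
  exact h1 _ (by rw [e5]; exact Subtype.prop _)

/-- Vanishing of constant coefficients in degree `i`. -/
def ECst (k : Type) [Field k] (p i r N : ℕ) : Prop :=
  ∀ (B : Type) [AbGrp B], (∀ b : B, p • b = 0) → ∀ (V : Type) [AbGrp V] [Module k V]
    [FinDim k V] (K : Submodule k V), finrank k V ≤ finrank k K + r →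
    N ≤ finrank k K → Van (i + 1) (1 : GMod (Gs K ⊥) B)

lemma exists_uniform {P : ℕ → ℕ → Prop} (hm : ∀ x N N', N ≤ N' → P x N → P x N') (i : ℕ)
  (h : ∀ x < i, ∃ N, P x N) : ∃ N, ∀ x < i, P x N := by
  induction i with
  | zero => exact ⟨0, fun x hx => absurd hx (by omega)⟩
  | succ i ih =>
    obtain ⟨N, hN⟩ := ih fun x hx => h x (by omega); obtain ⟨M, hM⟩ := h i (by omega)
    refine ⟨max N M, fun x hx => ?_⟩; rcases Nat.lt_succ_iff_lt_or_eq.1 hx with h | rfl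
    · exact hm _ _ _ (le_max_left _ _) (hN x h)
    · exact hm _ _ _ (le_max_right _ _) hM

variable [Finite k] (p : ℕ) [Fact p.Prime] [CharP k p]

lemma exists_eCst {i : ℕ} (h : ∀ x < i, ∀ d r, ∃ N, EPos k p x d r N) (r : ℕ) :
  ∃ N, ECst k p i r N := by
  obtain ⟨N₁, h₁⟩ := exists_uniform (P := fun x N => EPos k p x 0 ((i + 3) * (r + 1)) N)
    (fun _ _ _ hN h => h.mono hN) i (fun x hx => h x hx _ _)
  obtain ⟨N₂, h₂⟩ := exists_uniform (P := fun x N => EPos k p x 0 (i + 3) N)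
    (fun _ _ _ hN h => h.mono hN) i (fun x hx => h x hx _ _)
  obtain ⟨M₁, g₁⟩ := exists_eZero (k := k) p 0 ((i + 3) * (r + 1))
  obtain ⟨M₂, g₂⟩ := exists_eZero (k := k) p 0 (i + 3)
  refine ⟨2 * ((max N₁ N₂) + max M₁ M₂ + (i + 8)) + (i + 9) * r, ?_⟩; intro B _ hB V _ _ _ K hr hK
  exact van_const_gs p (fun x hx => (h₁ x hx).mono (le_max_left _ _)) (g₁.mono (le_max_left _ _))
    (fun x hx => (h₂ x hx).mono (le_max_right _ _)) (g₂.mono (le_max_right _ _)) B hB K hr hK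

lemma van_const_full {i N : ℕ} (h : ECst k p i 0 N) (B : Type) [AbGrp B]
  (hB : ∀ b : B, p • b = 0) (V : Type) [AbGrp V] [Module k V] [FinDim k V]
  (hV : N ≤ finrank k V) : Van (i + 1) (1 : GMod (V ≃ₗ[k] V) B) := by
  let f : (V ≃ₗ[k] V) ≃* Gs (⊤ : Submodule k V) ⊥ :=
    { toFun := fun g => ⟨g, fun _ => trivial, map_mem_bot _⟩
      invFun := fun g => g
      left_inv := fun _ => rfl
      right_inv := fun _ => rfl
      map_mul' := fun _ _ => rfl }
  exact Van.of_equiv f.symm (.refl B) (fun _ _ => rfl)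
    (h B hB V ⊤ (by rw [finrank_top]; omega) (by rw [finrank_top]; omega))

lemma eRed_succ {i d r N M Q : ℕ} (hE : ∀ x < i, EPos k p x (d + 1) (r + (i + 2)) N)
  (hN : EZero k p (d + 1) (r + (i + 2)) M) (hred : ∀ y ≤ i + 1, ERed k p y d r Q)
  (hc : ∀ y ≤ i, ECst k p y 0 Q) (hc' : ECst k p i r Q) :
  ERed k p (i + 1) (d + 1) r (2 * (N + M + (i + 8) + Q) + r) := by
  intro F hr hF hp V _ _ _ K hV hK z hz
  refine isCob_of_detect p hE hN F hF hp (finrank k K - (N + M + (i + 8) + Q)) disjoint_bot_right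
    (by rw [finrank_bot]; omega) (by omega) z hz ?_
  intro K' A' hK' hA₀ hA' hd hfK hfA; rw [bot_sup_eq] at hA'; rw [finrank_bot] at hfA
  obtain ⟨W, e, K₁, e1, e2, e3, e4, e5, e6⟩ := exists_split hd; have hE := exists_gs_equiv e K₁
  rw [e1, e2] at hE; obtain ⟨E, hE⟩ := hE; have hKW := K₁.finrank_le
  have h1 : ∀ w ∈ K₁, e (w, 0) ∈ K := fun w hw => hK' (by rw [← e1]; exact ⟨w, hw, rfl⟩)
  have c1 := isCob_split F hr e h1 (fun c => hA' (by rw [e5]; exact c.2)) (by omega) (i + 1)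
    (fun y hy U _ _ => hred y hy _ (F.cross_reduced U) (F.cross_poly U hF) (F.cross_tors U hp) W K₁
      (by omega) (by omega))
    (fun y hy => van_const_full p (hc y (by omega)) (F.obj W) (hp W) W (by omega)) z hz
  have c2 := hc' (F.obj A') (hp A') W K₁ (by omega) (by omega)
    (pull (splitHom e h1) (F.map (snd k W A' ∘ₗ e.symmˡ)) (i + 1) z) (by
      rw [cd_pull (ρ := F.gs K ⊥), hz, map_zero]; intro g x
      change F.map _ (F.map (splitHom e h1 g).1ˡ x) = F.map _ x
      rw [← F.map_comp]; congr 2; apply LinearMap.ext; intro v; simp [splitHom_apply])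
  have c3 := c2.push (f := .id _) (σ := (F.gs K ⊥).comp (splitHom e h1))
    (φ := F.map (eˡ ∘ₗ inr k W A')) (fun g x => by
      change F.map _ x = F.map (splitHom e h1 g).1ˡ (F.map _ x)
      rw [← F.map_comp]; congr 2; apply LinearMap.ext; intro v; simp [splitHom_apply])
  have c4 := (c1.add c3).push (f := E.symm.toMonoidHom) (σ := F.gs K' A') (φ := .id _)
    (fun g x => by
      change F.map (splitHom e h1 (E.symm g) : V ≃ₗ[k] V)ˡ x = F.map g.1ˡ x
      congr 2; apply LinearMap.ext; intro v; change (splitHom e h1 (E.symm g) : V ≃ₗ[k] V) v = g.1 v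
      rw [splitHom_apply, ← hE, MulEquiv.apply_symm_apply])
  convert c4 using 1
  ext g; change z _ = (z _ - F.map _ (z _)) + F.map _ (F.map _ (z _)); rw [← F.map_comp]
  have hs : (eˡ ∘ₗ inr k W A') ∘ₗ snd k W A' ∘ₗ e.symmˡ = splitProj e := by
    apply LinearMap.ext; intro v; simp [splitProj]
  rw [hs]
  have hg : inclusion (Gs_mono hK' hA₀) ∘ g = splitHom e h1 ∘ E.symm.toMonoidHom ∘ g := by
    funext t; apply Subtype.ext; apply LinearEquiv.ext; intro v
    change (g t).1 v = (splitHom e h1 (E.symm (g t)) : V ≃ₗ[k] V) v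
    rw [splitHom_apply, ← hE, MulEquiv.apply_symm_apply]
  change z (inclusion (Gs_mono hK' hA₀) ∘ g) = _; rw [hg]; exact (sub_add_cancel _ _).symm

lemma EPos.eRed {i d r N : ℕ} (h : EPos k p i d r N) : ERed k p (i + 1) d r N :=
  fun F _ hF hp V _ _ _ K hr hK => h F hF hp V K ⊥ disjoint_bot_right
    (by rw [finrank_bot]; omega) hK

lemma exists_eRed_succ {i : ℕ} (h : ∀ x < i, ∀ d r, ∃ N, EPos k p x d r N) (d : ℕ) :
  ∀ r, ∃ N, ERed k p (i + 1) d r N := by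
  induction d with
  | zero => exact fun r => ⟨0, eRed_zero p _ r⟩
  | succ d ih =>
    intro r
    obtain ⟨N, hN⟩ := exists_uniform (P := fun x N => EPos k p x (d + 1) (r + (i + 2)) N)
      (fun _ _ _ hN h => h.mono hN) i (fun x hx => h x hx _ _)
    obtain ⟨M, hM⟩ := exists_eZero (k := k) p (d + 1) (r + (i + 2))
    obtain ⟨Q₁, h₁⟩ := exists_uniform (P := fun x N => ERed k p x d r N)
      (fun _ _ _ hN h => h.mono hN) (i + 2) (fun x hx => by
        rcases x with _ | x
        · exact exists_eRed_zero p d r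
        · rcases Nat.lt_succ_iff_lt_or_eq.1 (Nat.lt_of_succ_lt_succ hx) with h' | rfl
          · obtain ⟨N, hN⟩ := h x h' d r; exact ⟨N, hN.eRed⟩
          · exact ih r)
    have hmono : ∀ x r N N', N ≤ N' → ECst k p x r N → ECst k p x r N' :=
      fun x r N N' hN h B _ hB V _ _ _ K hr hK => h B hB V K hr (hN.trans hK)
    obtain ⟨Q₂, h₂⟩ := exists_uniform (P := fun x N => ECst k p x 0 N) (fun x => hmono x 0) (i + 1)
      (fun x hx => exists_eCst p (fun y hy => h y (by omega)) 0)
    obtain ⟨Q₃, h₃⟩ := exists_eCst p h r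
    refine ⟨_, eRed_succ (Q := max Q₁ (max Q₂ Q₃)) p hN hM (fun y hy => (h₁ y (by omega)).mono ?_)
      (fun y hy => hmono _ _ _ _ ?_ (h₂ y (by omega))) (hmono _ _ _ _ ?_ h₃)⟩ <;> simp

/-- Stable vanishing of the cohomology with polynomial coefficients. -/
lemma exists_ePos (i : ℕ) : ∀ d r, ∃ N, EPos k p i d r N := by
  induction i using Nat.strong_induction_on with
  | h i ih =>
  intro d r; obtain ⟨N, hN⟩ := exists_eRed_succ p ih d r; obtain ⟨M, hM⟩ := exists_eCst p ih r
  refine ⟨max N M, fun F hF hp V _ _ _ K A hd hr hK => ?_⟩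
  refine van_gs_of_bot (N := max N M) (r := r) F (fun C W _ _ _ _ _ _ K hr hK => ?_) K A hd hr hK
  let Q := F.prodRight C
  have hQp : Q.Tors p := fun V _ _ x => hp _ x; intro z hz
  have c1 := hN Q.red Q.red_reduced (Q.sub_poly _ _ (F.prodRight_poly C hF))
    (Q.sub_tors _ _ hQp) W K hr ((le_max_left _ _).trans hK) (push (Q.toRed W) (i + 1) z) (by
      rw [cd_pull (ρ := Q.gs K ⊥), hz, map_zero]; intro g x; apply Subtype.ext
      change Q.map g.1ˡ x - Q.map (0 : W →ₗ[k] W) (Q.map _ x) =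
        Q.map g.1ˡ (x - Q.map (0 : W →ₗ[k] W) x)
      rw [map_sub, Q.map_zero_map, Q.map_map_zero])
  have c2 := hM (Q.obj W) (hQp W) W K hr ((le_max_right _ _).trans hK)
    (push (Q.map (0 : W →ₗ[k] W)) (i + 1) z) (by
      rw [cd_pull (ρ := Q.gs K ⊥), hz, map_zero]; intro g x; exact Q.map_zero_map x _)
  have c3 := c1.push (f := .id _) (σ := Q.gs K ⊥)
    (φ := (Q.map (0 : W →ₗ[k] W)).ker.subtype) (fun g x => rfl)
  have c4 := c2.push (f := .id _) (σ := Q.gs K ⊥) (φ := Q.map (0 : W →ₗ[k] W))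
    (fun g x => (Q.map_map_zero x _).symm)
  convert c3.add c4 using 1
  ext g
  change z _ = (z _ - Q.map (0 : W →ₗ[k] W) (z _)) + Q.map (0 : W →ₗ[k] W)
    (Q.map (0 : W →ₗ[k] W) (z _))
  rw [Q.map_zero_map]; exact (sub_add_cancel _ _).symm

end Stable

/-! ### The cubical complex -/

section Cube

/-- The `2 ^ b`-fold power of a set, as an iterated square. -/
def Cube : ℕ → Type → Type
  | 0, V => V
  | b + 1, V => Cube b (V × V)

instance Cube.finite (b : ℕ) : ∀ (V : Type) [Finite V], Finite (Cube b V) := by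
  induction b with
  | zero => intro V h; exact h
  | succ b ih => intro V h; exact ih (V × V)

/-- Functoriality of cubes. -/
def cmap : (b : ℕ) → {V W : Type} → (V → W) → Cube b V → Cube b W
  | 0, _, _, f => f
  | b + 1, _, _, f => cmap b (Prod.map f f)

lemma cmap_id (b : ℕ) : ∀ {V : Type} (x : Cube b V), cmap b id x = x := by
  induction b with
  | zero => intro V x; rfl
  | succ b ih =>
    intro V x; change cmap b (Prod.map id id) x = x; rw [Prod.map_id]; exact ih x

lemma cmap_comp (b : ℕ) : ∀ {V W U : Type} (g : W → U) (f : V → W) (x : Cube b V),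
  cmap b (g ∘ f) x = cmap b g (cmap b f x) := by
  induction b with
  | zero => intro V W U g f x; rfl
  | succ b ih =>
    intro V W U g f x; change cmap b (Prod.map (g ∘ f) (g ∘ f)) x = _; rw [← Prod.map_comp_map]
    exact ih _ _ x

variable {N : Type} [AbGrp N]

/-- Restriction of functions on cubes along a map. -/
def cpull (b : ℕ) (N : Type) [AbGrp N] {V W : Type} (f : V → W) :
  (Cube b W → N) →+ (Cube b V → N) where
  toFun c x := c (cmap b f x)
  map_zero' := rfl
  map_add' _ _ := rfl

@[simp] lemma cpull_apply (b : ℕ) {V W : Type} (f : V → W) (c : Cube b W → N) (x : Cube b V) :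
  cpull b N f c x = c (cmap b f x) := rfl

/-- The deviation of functions on cubes from additivity. -/
def cdev (b : ℕ) (V N : Type) [AbGrp V] [AbGrp N] : (Cube b V → N) →+ (Cube b (V × V) → N) :=
  cpull b N (fun x : V × V => x.1 + x.2) - cpull b N Prod.fst - cpull b N Prod.snd

/-- Reading a function on the cubes of `V` as a function on the cubes of `V × V`. -/
def csq (b : ℕ) (V N : Type) [AbGrp N] : (Cube (b + 1) V → N) →+ (Cube b (V × V) → N) :=
  .id _

/-- The inverse of `csq`. -/
def cunsq (b : ℕ) (V N : Type) [AbGrp N] : (Cube b (V × V) → N) →+ (Cube (b + 1) V → N) :=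
  .id _

/-- The differential of the cubical complex. -/
def cdel : (b : ℕ) → (V N : Type) → [AbGrp V] → [AbGrp N] → ((Cube b V → N) →+ (Cube (b + 1) V → N))
  | 0, V, N, _, _ => (cunsq 0 V N).comp (cdev 0 V N)
  | b + 1, V, N, _, _ =>
    (cunsq (b + 1) V N).comp (cdev (b + 1) V N - (cdel b (V × V) N).comp (csq b V N))

lemma cdel_succ_apply {V : Type} [AbGrp V] (b : ℕ) (c : Cube (b + 1) V → N)
  (x : Cube (b + 2) V) : cdel (b + 1) V N c x =
  cdev (b + 1) V N c x - cdel b (V × V) N (csq b V N c) x := rfl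

lemma cdev_apply {V : Type} [AbGrp V] (b : ℕ) (c : Cube b V → N) (x : Cube b (V × V)) :
  cdev b V N c x = c (cmap b (fun x : V × V => x.1 + x.2) x) - c (cmap b Prod.fst x) -
  c (cmap b Prod.snd x) := rfl

lemma csq_cdel {V : Type} [AbGrp V] (b : ℕ) (c : Cube (b + 1) V → N) :
  csq (b + 1) V N (cdel (b + 1) V N c) =
  cdev (b + 1) V N c - cdel b (V × V) N (csq b V N c) := rfl

variable {V W : Type} [AbGrp V] [AbGrp W]

lemma cdev_cpull (b : ℕ) (f : V →+ W) (c : Cube b W → N) :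
  cdev b V N (cpull b N f c) = cpull b N (Prod.map f f) (cdev b W N c) := by
  ext x; simp only [cdev, AddMonoidHom.sub_apply, Pi.sub_apply, cpull_apply, ← cmap_comp]; congr 3
  congr 1; funext y; simp

lemma cdel_cpull (b : ℕ) : ∀ {V W : Type} [AbGrp V] [AbGrp W] (f : V →+ W)
  (c : Cube b W → N), cdel b V N (cpull b N f c) = cpull (b + 1) N f (cdel b W N c) := by
  induction b with
  | zero => intro V W _ _ f c; exact cdev_cpull 0 f c
  | succ b ih =>
    intro V W _ _ f c; ext x; rw [cdel_succ_apply, cdev_cpull]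
    have : csq b V N (cpull (b + 1) N f c) = cpull b N (f.prodMap f) (csq b W N c) := rfl
    rw [this, ih]; rfl

lemma cdel_push (b : ℕ) : ∀ {V M N : Type} [AbGrp V] [AbGrp M] [AbGrp N]
  (φ : M →+ N) (c : Cube b V → M) (x : Cube (b + 1) V),
  cdel b V N (fun y => φ (c y)) x = φ (cdel b V M c x) := by
  have hdev : ∀ (b : ℕ) {V M N : Type} [AbGrp V] [AbGrp M] [AbGrp N]
      (φ : M →+ N) (c : Cube b V → M) (x : Cube b (V × V)),
      cdev b V N (fun y => φ (c y)) x = φ (cdev b V M c x) := by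
    intro b V M N _ _ _ φ c x; rw [cdev_apply, cdev_apply, map_sub, map_sub]
  induction b with
  | zero => intro V M N _ _ _ φ c x; exact hdev 0 φ c x
  | succ b ih =>
    intro V M N _ _ _ φ c x; rw [cdel_succ_apply, cdel_succ_apply, map_sub]
    exact congrArg₂ (· - ·) (hdev (b + 1) φ c x) (ih φ (csq b V M c) x)

lemma cdel_cdel (b : ℕ) : ∀ {V : Type} [AbGrp V] (c : Cube b V → N),
  cdel (b + 1) V N (cdel b V N c) = 0 := by
  induction b with
  | zero =>
    intro V _ c
    have e : ∀ (c : V → N) (x : (V × V) × (V × V)), cdel 1 V N (cdel 0 V N c) x = 0 := by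
      intro c x
      change ((c ((x.1.1 + x.1.2) + (x.2.1 + x.2.2)) - c (x.1.1 + x.1.2) - c (x.2.1 + x.2.2)) -
        (c (x.1.1 + x.2.1) - c x.1.1 - c x.2.1) - (c (x.1.2 + x.2.2) - c x.1.2 - c x.2.2)) -
        ((c ((x.1.1 + x.2.1) + (x.1.2 + x.2.2)) - c (x.1.1 + x.2.1) - c (x.1.2 + x.2.2)) -
        (c (x.1.1 + x.1.2) - c x.1.1 - c x.1.2) - (c (x.2.1 + x.2.2) - c x.2.1 - c x.2.2)) = 0
      rw [add_add_add_comm x.1.1 x.2.1]; abel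
    exact funext (e c)
  | succ b ih =>
    intro V _ c; ext x; rw [cdel_succ_apply, csq_cdel, map_sub, ih (V := V × V), sub_zero]
    let m : V × V →+ V := (AddMonoidHom.fst V V) + AddMonoidHom.snd V V
    have : cdel (b + 1) (V × V) N (cdev (b + 1) V N c) =
        cpull (b + 2) N m (cdel (b + 1) V N c) - cpull (b + 2) N (AddMonoidHom.fst V V)
          (cdel (b + 1) V N c) - cpull (b + 2) N (AddMonoidHom.snd V V) (cdel (b + 1) V N c) := by
      rw [← cdel_cpull (b + 1) m c, ← cdel_cpull (b + 1) (AddMonoidHom.fst V V) c,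
        ← cdel_cpull (b + 1) (AddMonoidHom.snd V V) c, ← map_sub, ← map_sub]
      rfl
    rw [this]; exact sub_self _

lemma cocycle_add (b : ℕ) (c : Cube (b + 1) W → N) (hc : cdel (b + 1) W N c = 0) (f g : V →+ W) :
  cpull (b + 1) N (f + g) c - cpull (b + 1) N f c - cpull (b + 1) N g c =
  cdel b V N (cpull b N (f.prod g) (csq b W N c)) := by
  have h2 : cdev (b + 1) W N c = cdel b (W × W) N (csq b W N c) := by
    rw [← sub_eq_zero, ← csq_cdel, hc, map_zero]
  rw [cdel_cpull b (f.prod g), ← h2]; ext x; simp only [cdev_apply, Pi.sub_apply, cpull_apply]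
  have e : ∀ h : W × W → W, cmap (b + 1) h (cmap (b + 1) (f.prod g) x) =
      cmap (b + 1) (h ∘ f.prod g) x := fun h => (cmap_comp _ _ _ _).symm
  rw [e, e, e]; rfl

lemma cdel_congr_range (b : ℕ) : ∀ {V : Type} [AbGrp V]
  {c c' : Cube b V → N} (x : Cube (b + 1) V) (S : AddSubgroup V)
  (_ : ∃ x' : Cube (b + 1) S, cmap (b + 1) S.subtype x' = x)
  (_ : ∀ y : Cube b S, c (cmap b S.subtype y) = c' (cmap b S.subtype y)),
  cdel b V N c x = cdel b V N c' x := by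
  rintro V _ c c' _ S ⟨x, rfl⟩ h; have h1 := congrFun (cdel_cpull (N := N) b S.subtype c) x
  have h2 := congrFun (cdel_cpull (N := N) b S.subtype c') x
  have : cpull b N S.subtype c = cpull b N S.subtype c' := funext h; rw [this] at h1
  exact h1.symm.trans h2

end Cube

/-! ### Splitting the cubical complex over the prime field -/

section Split

variable {F : Type} [Field F] {X Y Z N : Type} [Finite X] [Finite Y] [AbGrp N] [Module F N]

/-- Extension of a linear map between function spaces to functions with values in a module. -/
def extN (N : Type) [AbGrp N] [Module F N] (L : (X → F) →ₗ[F] (Y → F)) : (X → N) →ₗ[F] (Y → N) :=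
  letI := Fintype.ofFinite X
  letI := Classical.decEq X
  { toFun := fun c y => ∑ x, L (Pi.single x 1) y • c x
    map_add' := fun a b => by ext y; simp [sum_add_distrib]
    map_smul' := fun r a => by
      ext y; simp only [Pi.smul_apply, RingHom.id_apply, Finset.smul_sum]
      exact sum_congr rfl fun x _ => smul_comm _ _ _ }

lemma extN_dual (L : (X → F) →ₗ[F] (Y → F)) (f : N →ₗ[F] F) (c : X → N) (y : Y) :
  f (extN N L c y) = L (fun x => f (c x)) y := by
  classical
  letI := Fintype.ofFinite X
  have h : (fun x => f (c x)) = ∑ x, f (c x) • (Pi.single x 1 : X → F) := by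
    ext x'; simp [Finset.sum_apply, Pi.single_apply]
  rw [h, map_sum, Finset.sum_apply]; simp only [map_smul, Pi.smul_apply, smul_eq_mul]
  change f (∑ x, L (Pi.single x 1) y • c x) = _; simp only [map_sum, map_smul, smul_eq_mul]
  exact Finset.sum_congr rfl fun x _ => by rw [mul_comm]

lemma eq_of_dual {a b : N} (h : ∀ f : N →ₗ[F] F, f a = f b) : a = b := by
  rw [← sub_eq_zero, ← Module.forall_dual_apply_eq_zero_iff F]; intro f; rw [map_sub, h, sub_self]

lemma extN_comp [Finite Z] (L : (X → F) →ₗ[F] (Y → F)) (M : (Y → F) →ₗ[F] (Z → F)) (c : X → N) :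
  extN N (M ∘ₗ L) c = extN N M (extN N L c) := by
  ext z; refine eq_of_dual (F := F) fun f => ?_
  rw [extN_dual, extN_dual]; simp only [extN_dual, comp_apply]

lemma extN_add (L M : (X → F) →ₗ[F] (Y → F)) (c : X → N) :
  extN N (L + M) c = extN N L c + extN N M c := by
  ext z; refine eq_of_dual (F := F) fun f => ?_
  simp only [extN_dual, Pi.add_apply, map_add, LinearMap.add_apply]

lemma extN_id (c : X → N) : extN N (.id : (X → F) →ₗ[F] (X → F)) c = c := by
  ext z; refine eq_of_dual (F := F) fun f => ?_
  rw [extN_dual]; rfl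

lemma extN_zero (c : X → N) : extN N (0 : (X → F) →ₗ[F] (Y → F)) c = 0 := by
  ext z; refine eq_of_dual (F := F) fun f => ?_
  rw [extN_dual]; simp

lemma extN_push {M : Type} [AbGrp M] [Module F M] (L : (X → F) →ₗ[F] (Y → F))
  (φ : M →ₗ[F] N) (c : X → M) (y : Y) :
  extN N L (fun x => φ (c x)) y = φ (extN M L c y) := by
  refine eq_of_dual (F := F) fun f => ?_
  rw [extN_dual]; exact (extN_dual L (f ∘ₗ φ) c y).symm

lemma exists_generalized_inverse {A B : Type} [AbGrp A] [Module F A] [AbGrp B]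
  [Module F B] (δ : A →ₗ[F] B) : ∃ S : B →ₗ[F] A, δ ∘ₗ S ∘ₗ δ = δ := by
  obtain ⟨s, hs⟩ := δ.rangeRestrict.exists_rightInverse_of_surjective δ.range_rangeRestrict
  obtain ⟨l, hl⟩ := (range δ).subtype.exists_leftInverse_of_injective (Submodule.ker_subtype _)
  refine ⟨s ∘ₗ l, ?_⟩; ext a
  have h1 : l (δ a) = δ.rangeRestrict a := LinearMap.congr_fun hl (δ.rangeRestrict a)
  have h2 := congrArg Subtype.val (LinearMap.congr_fun hs (δ.rangeRestrict a))
  simp only [comp_apply, h1]; exact h2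

lemma exists_splitting {A B C : Type} [AbGrp A] [Module F A] [AbGrp B]
  [Module F B] [AbGrp C] [Module F C] (δ : A →ₗ[F] B) (δ' : B →ₗ[F] C)
  (h : δ' ∘ₗ δ = 0) : ∃ (e : B →ₗ[F] B) (U : B →ₗ[F] A) (S : C →ₗ[F] B),
  e ∘ₗ δ = 0 ∧ δ' ∘ₗ e = 0 ∧ e ∘ₗ e = e ∧ .id = e + δ ∘ₗ U + S ∘ₗ δ' := by
  obtain ⟨S', hS'⟩ := exists_generalized_inverse δ; obtain ⟨S, hS⟩ := exists_generalized_inverse δ'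
  have h' : ∀ a, δ' (δ a) = 0 := fun a => LinearMap.congr_fun h a
  have h1 : ∀ a, δ (S' (δ a)) = δ a := fun a => LinearMap.congr_fun hS' a
  have h2 : ∀ a, δ' (S (δ' a)) = δ' a := fun a => LinearMap.congr_fun hS a
  refine ⟨(.id - δ ∘ₗ S') ∘ₗ (.id - S ∘ₗ δ'), S' ∘ₗ (.id - S ∘ₗ δ'), S, ?_, ?_, ?_, ?_⟩
  all_goals ext a; all_goals simp [h', h1, h2]

end Split

/-! ### Additive maps and the cubical complex -/

section Additive

variable {k : Type} [Field k] {V N : Type} [AbGrp V] [Module k V] [AbGrp N]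

/-- The conjugation action on additive maps. -/
def adRep (ρ : GMod (V ≃ₗ[k] V) N) : GMod (V ≃ₗ[k] V) (V →+ N) where
  toFun g :=
    { toFun := fun η => (ρ.hom g).comp (η.comp (g⁻¹ : V ≃ₗ[k] V)ˡ.toAddMonoidHom)
      map_zero' := by ext; simp
      map_add' := fun a b => by ext; simp }
  map_one' := by ext η v; exact ρ.one_apply _
  map_mul' g h := by
    ext η v; change ρ (g * h) (η ((g * h)⁻¹ v)) = ρ g (ρ h (η (h⁻¹ (g⁻¹ v))))
    rw [ρ.mul_apply, mul_inv_rev]; rfl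

/-- The action on vectors. -/
def vecPerm (k V : Type) [Field k] [AbGrp V] [Module k V] : (V ≃ₗ[k] V) →* Perm V :=
  actPerm (fun g v => g v) (fun _ => rfl) (fun _ _ _ => rfl)

/-- The action on cubes. -/
def cubePerm (k V : Type) [Field k] [AbGrp V] [Module k V] (b : ℕ) :
  (V ≃ₗ[k] V) →* Perm (Cube b V) :=
  actPerm (fun g => cmap b g) (fun x => cmap_id b x) (fun g h x => cmap_comp b g h x)

/-- Functions on cubes as a module. -/
abbrev cubeRep (ρ : GMod (V ≃ₗ[k] V) N) (b : ℕ) : GMod (V ≃ₗ[k] V) (Cube b V → N) :=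
  funRep (cubePerm k V b) ρ

lemma cubeRep_apply (ρ : GMod (V ≃ₗ[k] V) N) (b : ℕ) (g : V ≃ₗ[k] V) (c : Cube b V → N)
  (x : Cube b V) : cubeRep ρ b g c x = ρ g (c (cmap b (g⁻¹ : V ≃ₗ[k] V) x)) := rfl

lemma equi_cdel (ρ : GMod (V ≃ₗ[k] V) N) (b : ℕ) :
  Equi (.id _) (cubeRep ρ b) (cubeRep ρ (b + 1)) (cdel b V N) := by
  intro g c; ext x
  have h1 := cdel_push b (ρ.hom g) (cpull b N (g⁻¹ : V ≃ₗ[k] V)ˡ.toAddMonoidHom c) x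
  rwa [cdel_cpull] at h1

/-- Additive maps as functions on zero-dimensional cubes. -/
def addCoe (V N : Type) [AbGrp V] [AbGrp N] : (V →+ N) →+ (Cube 0 V → N) where
  toFun η := η
  map_zero' := rfl
  map_add' _ _ := rfl

lemma addCoe_injective (V N : Type) [AbGrp V] [AbGrp N] :
  Injective (addCoe V N) := DFunLike.coe_injective

lemma equi_addCoe (ρ : GMod (V ≃ₗ[k] V) N) :
  Equi (.id _) (adRep ρ) (cubeRep ρ 0) (addCoe V N) := fun _ _ => rfl

lemma cdel_addCoe (η : V →+ N) : cdel 0 V N (addCoe V N η) = 0 := by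
  ext x
  have : ∀ x : V × V, cdel 0 V N (addCoe V N η) x = 0 := by
    intro x; change η (x.1 + x.2) - η x.1 - η x.2 = 0; rw [map_add]; abel
  exact this x

lemma exists_addCoe (c : Cube 0 V → N) (hc : cdel 0 V N c = 0) : ∃ η, addCoe V N η = c := by
  refine ⟨AddMonoidHom.mk' (c : V → N) fun a b => ?_, rfl⟩
  have : c (a + b : V) - c a - c b = 0 := congrFun hc ((a, b) : V × V)
  rwa [sub_sub, sub_eq_zero] at this

/-- Additivity of the class of the restriction of a cocycle. -/
def classHom {V W N : Type} [AbGrp V] [AbGrp W] [AbGrp N] (b : ℕ)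
  (c : Cube (b + 1) W → N) (hc : cdel (b + 1) W N c = 0) :
  (V →+ W) →+ (Cube (b + 1) V → N) ⧸ (cdel b V N).range :=
  AddMonoidHom.mk' (fun f => QuotientAddGroup.mk (cpull (b + 1) N f c)) fun f g => by
    rw [← QuotientAddGroup.mk_add, QuotientAddGroup.eq]
    refine ⟨-cpull b N (f.prod g) (csq b W N c), ?_⟩; rw [map_neg, ← cocycle_add b c hc f g]; abel

variable {p : ℕ} [Fact p.Prime] [Module (ZMod p) V] [Module (ZMod p) N]

/-- Multiples of a vector. -/
def smHom (p : ℕ) {V : Type} [AbGrp V] [Module (ZMod p) V] (v : V) : ZMod p →+ V :=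
  (LinearMap.toSpanSingleton (ZMod p) V v).toAddMonoidHom

lemma smHom_apply (v : V) (a : ZMod p) : smHom p v a = a • v := rfl

/-- The differential over the prime field as a linear map. -/
def cdelLin (p b : ℕ) [Fact p.Prime] :
  (Cube b (ZMod p) → ZMod p) →ₗ[ZMod p] (Cube (b + 1) (ZMod p) → ZMod p) :=
  (cdel b (ZMod p) (ZMod p)).toZModLinearMap p

lemma extN_cdelLin (b : ℕ) (c : Cube b (ZMod p) → N) :
  extN N (cdelLin p b) c = cdel b (ZMod p) N c := by
  ext x; refine eq_of_dual (F := ZMod p) fun f => ?_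
  rw [extN_dual]; exact cdel_push b f.toAddMonoidHom c x

/-- The test map on functions on cubes defined by an endomorphism over the prime field. -/
def testHom (p b : ℕ) [Fact p.Prime] (V N : Type) [AbGrp V] [AbGrp N]
  [Module (ZMod p) V] [Module (ZMod p) N]
  (e : (Cube (b + 1) (ZMod p) → ZMod p) →ₗ[ZMod p] (Cube (b + 1) (ZMod p) → ZMod p)) :
  (Cube (b + 1) V → N) →+ (V → Cube (b + 1) (ZMod p) → N) where
  toFun c v := extN N e (cpull (b + 1) N (smHom p v) c)
  map_zero' := by ext v; simp
  map_add' c c' := by ext v; simp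

variable {b : ℕ} {e : (Cube (b + 1) (ZMod p) → ZMod p) →ₗ[ZMod p] (Cube (b + 1) (ZMod p) → ZMod p)}

lemma equi_testHom (ρ : GMod (V ≃ₗ[k] V) N) :
  Equi (.id _) (cubeRep ρ (b + 1)) (funRep (vecPerm k V) (funRep 1 ρ)) (testHom p b V N e) := by
  intro g c; funext v; funext ξ
  have h1 := extN_push e ((ρ.hom g).toZModLinearMap p)
    (cpull (b + 1) N (smHom p ((g⁻¹ : V ≃ₗ[k] V) v)) c) ξ
  refine Eq.trans (congrFun (congrArg (extN N e) ?_) ξ) h1; funext ζ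
  change ρ g (c (cmap (b + 1) (g⁻¹ : V ≃ₗ[k] V) (cmap (b + 1) (smHom p v) ζ))) =
    ρ g (c (cmap (b + 1) (smHom p ((g⁻¹ : V ≃ₗ[k] V) v)) ζ))
  rw [← cmap_comp]; congr 3; funext a; exact ZMod.map_smul (g⁻¹ : V ≃ₗ[k] V) a v

lemma extN_range (he : e ∘ₗ cdelLin p b = 0) {c : Cube (b + 1) (ZMod p) → N}
  (hc : c ∈ (cdel b (ZMod p) N).range) : extN N e c = 0 := by
  obtain ⟨u, rfl⟩ := hc; rw [← extN_cdelLin, ← extN_comp, he, extN_zero]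

lemma testHom_cdel (he : e ∘ₗ cdelLin p b = 0) (u : Cube b V → N) :
  testHom p b V N e (cdel b V N u) = 0 := by
  funext v; refine extN_range he ⟨cpull b N (smHom p v) u, ?_⟩; rw [cdel_cpull]

lemma testHom_add (he : e ∘ₗ cdelLin p b = 0) (c : Cube (b + 1) V → N)
  (hc : cdel (b + 1) V N c = 0) (v w : V) :
  testHom p b V N e c (v + w) = testHom p b V N e c v + testHom p b V N e c w := by
  have h := extN_range (N := N) he ⟨_, (cocycle_add b c hc (smHom p v) (smHom p w)).symm⟩
  rw [map_sub, map_sub, sub_sub, sub_eq_zero] at h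
  have hs : smHom p (v + w) = smHom p v + smHom p w := by ext a; simp [smHom_apply]
  change extN N e (cpull (b + 1) N (smHom p (v + w)) c) = _; rw [hs]; exact h

variable {U : (Cube (b + 1) (ZMod p) → ZMod p) →ₗ[ZMod p] (Cube b (ZMod p) → ZMod p)}
  {S : (Cube (b + 2) (ZMod p) → ZMod p) →ₗ[ZMod p] (Cube (b + 1) (ZMod p) → ZMod p)}

lemma extN_split (h : .id = e + cdelLin p b ∘ₗ U + S ∘ₗ cdelLin p (b + 1))
  (c : Cube (b + 1) (ZMod p) → N) (hc : cdel (b + 1) (ZMod p) N c = 0) :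
  c = extN N e c + cdel b (ZMod p) N (extN N U c) := by
  conv_lhs => rw [← extN_id (F := ZMod p) c, h, extN_add, extN_add, extN_comp, extN_comp,
    extN_cdelLin, extN_cdelLin, hc, map_zero, add_zero]

variable [Finite V]

lemma cob_of_testHom (h : .id = e + cdelLin p b ∘ₗ U + S ∘ₗ cdelLin p (b + 1))
  (c : Cube (b + 1) V → N) (hc : cdel (b + 1) V N c = 0) (h0 : testHom p b V N e c = 0) :
  ∃ u, cdel b V N u = c := by
  have : Module.Finite (ZMod p) V := Module.Finite.of_finite
  let B := Module.finBasis (ZMod p) V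
  have h1 : (.id V) = ∑ j, (smHom p (B j)).comp (B.coord j).toAddMonoidHom := by
    ext v; simp [smHom_apply, B.sum_repr]
  have h2 := congrArg (classHom b c hc) h1; rw [map_sum] at h2
  have h3 : ∀ j, classHom b c hc ((smHom p (B j)).comp (B.coord j).toAddMonoidHom) = 0 := by
    intro j; refine (eq_zero_iff _).2 ?_
    have h4 := extN_split h (cpull (b + 1) N (smHom p (B j)) c) (by rw [cdel_cpull, hc, map_zero])
    rw [show extN N e (cpull (b + 1) N (smHom p (B j)) c) = 0 from congrFun h0 (B j),
      zero_add] at h4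
    refine ⟨cpull b N (B.coord j).toAddMonoidHom (extN N U (cpull (b + 1) N (smHom p (B j)) c)), ?_⟩
    rw [cdel_cpull, ← h4]; ext x; simp only [cpull_apply, ← cmap_comp]; rfl
  rw [sum_eq_zero fun j _ => h3 j] at h2; have h5 := (eq_zero_iff _).1 h2
  obtain ⟨u, hu⟩ := h5; refine ⟨u, hu.trans ?_⟩; ext x; exact congrArg c (cmap_id _ x)

lemma exists_test_section (he : e ∘ₗ cdelLin p b = 0) (he' : cdelLin p (b + 1) ∘ₗ e = 0)
  (hee : e ∘ₗ e = e) (η : Cube (b + 1) (ZMod p) → V →+ N) :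
  ∃ c, cdel (b + 1) V N c = 0 ∧ ∀ v : V, testHom p b V N e c v = extN N e (fun ξ => η ξ v) := by
  have : Module.Finite (ZMod p) V := Module.Finite.of_finite
  let B := Module.finBasis (ZMod p) V
  let d : Fin (finrank (ZMod p) V) → (Cube (b + 1) (ZMod p) → N) :=
    fun j => extN N e (fun ξ => η ξ (B j))
  have hd : ∀ j, cdel (b + 1) (ZMod p) N (d j) = 0 := fun j => by
    rw [← extN_cdelLin, ← extN_comp, he', extN_zero]
  refine ⟨∑ j, cpull (b + 1) N (B.coord j).toAddMonoidHom (d j), ?_, fun v => ?_⟩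
  · rw [map_sum]; refine Finset.sum_eq_zero fun j _ => ?_
    rw [cdel_cpull, hd, map_zero]
  · have key : ∀ (a : ZMod p) j, extN N e (cpull (b + 1) N (smHom p a) (d j)) =
        a • extN N e (fun ξ => η ξ (B j)) := by
      intro a j; obtain ⟨n, rfl⟩ := ZMod.natCast_zmod_surjective a
      have h1 : smHom p (n : ZMod p) = n • AddMonoidHom.id (ZMod p) := by
        ext; simp [smHom_apply, mul_comm]
      have h2 := map_nsmul (classHom b (d j) (hd j)) n (AddMonoidHom.id (ZMod p)); rw [← h1] at h2
      have h3 := extN_range (N := N) he (QuotientAddGroup.eq.1 h2.symm)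
      rw [map_add, map_neg, neg_add_eq_zero] at h3; rw [← h3]
      have h4 : cpull (b + 1) N (AddMonoidHom.id (ZMod p)) (d j) = d j := by
        ext x; exact congrArg (d j) (cmap_id _ x)
      change extN N e (n • cpull (b + 1) N (AddMonoidHom.id (ZMod p)) (d j)) = _
      rw [h4, map_nsmul, ← extN_comp, hee, Nat.cast_smul_eq_nsmul]
    have h1 : testHom p b V N e (∑ j, cpull (b + 1) N (B.coord j).toAddMonoidHom (d j)) v =
        ∑ j, extN N e (cpull (b + 1) N (smHom p (B.coord j v)) (d j)) := by
      rw [map_sum, Finset.sum_apply]; refine Finset.sum_congr rfl fun j _ => ?_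
      refine congrArg (extN N e) ?_
      ext x; simp only [cpull_apply, ← cmap_comp]; congr 2; funext a
      change B.coord j (a • v) = a • B.coord j v; rw [map_smul]
    rw [h1]; simp only [key]
    rw [← Finset.sum_congr rfl fun j _ => map_smul (extN N e) _ _, ← map_sum]; congr 1; ext ξ
    rw [Finset.sum_apply]
    conv_rhs => rw [← B.sum_repr v]
    rw [map_sum]; refine Finset.sum_congr rfl fun j _ => ?_
    rw [ZMod.map_smul]; rfl

lemma cube_fill (p : ℕ) [Fact p.Prime] [Module (ZMod p) V] [Module (ZMod p) N]
  (ρ : GMod (V ≃ₗ[k] V) N) (b x : ℕ) (hvan : Van x (adRep ρ))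
  (v : (Fin x → (V ≃ₗ[k] V)) → Cube (b + 1) V → N) (hv : push (cdel (b + 1) V N) x v = 0)
  (hu : ∃ u, push (cdel b V N) (x + 1) u = cd (cubeRep ρ (b + 1)) x v) :
  ∃ v', cd (cubeRep ρ (b + 1)) x (push (cdel b V N) x v') = cd (cubeRep ρ (b + 1)) x v := by
  obtain ⟨e, U, S, he, he', hee, hid⟩ := exists_splitting (cdelLin p b) (cdelLin p (b + 1)) (by
    apply LinearMap.ext; intro c; exact cdel_cdel b c)
  obtain ⟨u, hu⟩ := hu
  let σ : GMod (V ≃ₗ[k] V) (V → Cube (b + 1) (ZMod p) → N) := funRep (vecPerm k V) (funRep 1 ρ)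
  have hT := equi_testHom (b := b) (e := e) ρ
  have hcyc : ∀ g, cdel (b + 1) V N (v g) = 0 := fun g => congrFun hv g
  have finish : ∀ v' : (Fin x → (V ≃ₗ[k] V)) → Cube (b + 1) V → N,
      (∀ g, cdel (b + 1) V N (v' g) = 0) → (∀ g, testHom p b V N e (v' g) = 0) →
      ∃ v'', push (cdel b V N) x v'' = v' := by
    intro v' h1 h2; choose w hw using fun g => cob_of_testHom hid (v' g) (h1 g) (h2 g)
    exact ⟨w, funext hw⟩
  let θ : Cube (b + 1) (ZMod p) → (Fin x → (V ≃ₗ[k] V)) → (V →+ N) := fun ξ g =>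
    AddMonoidHom.mk' (fun w => testHom p b V N e (v g) w ξ)
      (fun a c => congrFun (testHom_add he (v g) (hcyc g) a c) ξ)
  have hTv : push (testHom p b V N e) (x + 1) (cd (cubeRep ρ (b + 1)) x v) = 0 := by
    rw [← hu]
    ext1 g
    exact testHom_cdel he (u g)
  have hTv' : cd σ x (push (testHom p b V N e) x v) = 0 := by rw [cd_pull hT, hTv]
  let E : Cube (b + 1) (ZMod p) → (V → Cube (b + 1) (ZMod p) → N) →+ (Cube 0 V → N) := fun ξ =>
    { toFun := fun f w => f w ξ
      map_zero' := rfl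
      map_add' := fun _ _ => rfl }
  have hE : ∀ ξ, Equi (.id _) σ (cubeRep ρ 0) (E ξ) := fun ξ g f => rfl
  have hθ : ∀ ξ, cd (adRep ρ) x (θ ξ) = 0 := by
    intro ξ
    have h1 : push (addCoe V N) x (θ ξ) = push (E ξ) x (push (testHom p b V N e) x v) := rfl
    have h2 := cd_pull (equi_addCoe ρ) x (θ ξ); rw [h1, cd_pull (hE ξ), hTv', map_zero] at h2
    ext1 g
    exact addCoe_injective V N (congrFun h2.symm g)
  rcases x with _ | x
  · have h0 : ∀ ξ, θ ξ = 0 := fun ξ => hvan _ (hθ ξ)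
    obtain ⟨v'', hv''⟩ := finish v hcyc (fun g => by
      funext w; funext ξ; exact DFunLike.congr_fun (congrFun (h0 ξ) g) w)
    exact ⟨v'', by rw [hv'']⟩
  · choose w hw using fun ξ => hvan _ (hθ ξ)
    choose ŵ hŵ1 hŵ2 using fun g => exists_test_section (N := N) he he' hee (fun ξ => w ξ g)
    let W : (Fin x → (V ≃ₗ[k] V)) → V → Cube (b + 1) (ZMod p) → N := fun g a ξ => w ξ g a
    have hW : cd σ x W = push (testHom p b V N e) (x + 1) v := by
      ext g a ξ; have h1 := cd_pull (hE ξ) x W; have h2 := cd_pull (equi_addCoe ρ) x (w ξ)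
      have h3 : push (E ξ) x W = push (addCoe V N) x (w ξ) := rfl; rw [← h3, h1, hw ξ] at h2
      exact congrFun (congrFun h2 g) a
    let L : (V → Cube (b + 1) (ZMod p) → N) →+ (V → Cube (b + 1) (ZMod p) → N) :=
      { toFun := fun f a => extN N e (f a)
        map_zero' := by ext a; simp
        map_add' := fun f f' => by ext a; simp }
    have hL : Equi (.id _) σ σ L := by
      intro g f; funext a; funext ξ
      exact extN_push e ((ρ.hom g).toZModLinearMap p) (f ((g⁻¹ : V ≃ₗ[k] V) a)) ξ
    have hLT : ∀ c, L (testHom p b V N e c) = testHom p b V N e c := by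
      intro c; funext a; change extN N e (extN N e _) = extN N e _; rw [← extN_comp, hee]
    have h4 : push (testHom p b V N e) x ŵ = push L x W := by
      ext1 g
      funext a; exact hŵ2 g a
    have h5 : push (testHom p b V N e) (x + 1) (cd (cubeRep ρ (b + 1)) x ŵ) =
        push (testHom p b V N e) (x + 1) v := by
      rw [← cd_pull hT, h4, cd_pull hL, hW]
      ext1 g
      exact hLT _
    have h6 : push (cdel (b + 1) V N) (x + 1) (cd (cubeRep ρ (b + 1)) x ŵ) = 0 := by
      rw [← cd_pull (equi_cdel ρ (b + 1))]; have : push (cdel (b + 1) V N) x ŵ = 0 := funext hŵ1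
      rw [this, map_zero]
    obtain ⟨v'', hv''⟩ := finish (v - cd (cubeRep ρ (b + 1)) x ŵ) (fun g => by
        rw [Pi.sub_apply, map_sub, hcyc, zero_sub, neg_eq_zero]; exact congrFun h6 g)
      (fun g => by rw [Pi.sub_apply, map_sub, sub_eq_zero]; exact (congrFun h5 g).symm)
    exact ⟨v'', by rw [hv'', map_sub, cd_cd, sub_zero]⟩

/-- Vanishing of cohomology of additive maps from exactness of the invariant cubical complex. -/
lemma van_adRep (p : ℕ) [Fact p.Prime] [Module (ZMod p) V] [Module (ZMod p) N]
  (ρ : GMod (V ≃ₗ[k] V) N) (i : ℕ)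
  (hv : ∀ b x, x + b ≤ i → Van (x + 1) (cubeRep ρ b))
  (h0 : ∀ η : V →+ N, (∀ g, adRep ρ g η = η) → η = 0)
  (hrow : ∀ b < i, ∀ c : Cube (b + 1) V → N, (∀ g, cubeRep ρ (b + 1) g c = c) →
  cdel (b + 1) V N c = 0 → ∃ e : Cube b V → N, (∀ g, cubeRep ρ b g e = e) ∧ cdel b V N e = c) :
  ∀ x ≤ i, Van x (adRep ρ) := by
  intro x
  induction x using Nat.strong_induction_on with
  | h x ih =>
  intro hx; rcases x with _ | j
  · exact (van_zero_iff _).2 h0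
  · intro z hz
    obtain ⟨u, hu⟩ := hv 0 j (by omega) (push (addCoe V N) (j + 1) z)
      (by rw [cd_pull (equi_addCoe ρ), hz, map_zero])
    obtain ⟨u', hu'0, hu'1⟩ := zigzag j (fun b => Cube b V → N) (cubeRep ρ) (fun b => cdel b V N)
      (equi_cdel ρ) (fun b c => cdel_cdel b c) (fun b x h => hv (b + 1) x (by omega))
      (fun b x h v hv hu => cube_fill p ρ b x (ih x (by omega) (by omega)) v hv hu)
      (fun c h1 h2 => hrow j (by omega) c h1 h2) u (by
        rw [hu]
        ext1 g
        exact cdel_addCoe (z g))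
    choose w hw using fun g => exists_addCoe (u' g) (congrFun hu'0 g); refine ⟨w, ?_⟩
    have h1 : push (addCoe V N) j w = u' := funext hw; have h2 := cd_pull (equi_addCoe ρ) j w
    rw [h1, hu'1, hu] at h2
    ext1 g
    exact addCoe_injective V N (congrFun h2.symm g)

end Additive

/-! ### Spans of cubes -/

section Span

variable {k : Type} [Field k]

/-- The span of the coordinates of a cube. -/
def csp (k : Type) [Field k] :
  (b : ℕ) → {V : Type} → [AbGrp V] → [Module k V] → Cube b V → Submodule k V
  | 0, _, _, _, x => span k {x}
  | b + 1, V, _, _, x =>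
    (csp k b (V := V × V) x).map (fst k V V) ⊔ (csp k b (V := V × V) x).map (snd k V V)

lemma finrank_csp_le (b : ℕ) : ∀ {V : Type} [AbGrp V] [Module k V] [FinDim k V]
  (x : Cube b V), finrank k (csp k b x) ≤ 2 ^ b := by
  induction b with
  | zero =>
    intro V _ _ _ x
    have h : ∀ x : V, finrank k (span k {x}) ≤ 1 := fun x =>
      (finrank_span_le_card ({x} : Set V)).trans (by simp)
    exact h x
  | succ b ih =>
    intro V _ _ _ x; have h := ih (V := V × V) x
    have h1 := Submodule.finrank_add_le_finrank_add_finrank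
      ((csp k b (V := V × V) x).map (fst k V V))
      ((csp k b (V := V × V) x).map (snd k V V))
    have h2 := Submodule.finrank_map_le (fst k V V) (csp k b (V := V × V) x)
    have h3 := Submodule.finrank_map_le (snd k V V) (csp k b (V := V × V) x)
    have h4 : finrank k (csp k (b + 1) x) ≤ _ := h1; rw [pow_succ]; omega

lemma cmap_congr (b : ℕ) : ∀ {V W : Type} [AbGrp V] [Module k V] (x : Cube b V)
  {f g : V → W}, (∀ a ∈ csp k b x, f a = g a) → cmap b f x = cmap b g x := by
  induction b with
  | zero => intro V W _ _ x f g h; exact h x (Submodule.mem_span_singleton_self _)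
  | succ b ih =>
    intro V W _ _ x f g h; refine ih (V := V × V) x fun a ha => ?_
    exact Prod.ext (h _ (mem_sup_left ⟨a, ha, rfl⟩)) (h _ (mem_sup_right ⟨a, ha, rfl⟩))

lemma eq_of_cmap_eq (b : ℕ) : ∀ {V W : Type} [AbGrp V] [Module k V] [AbGrp W]
  [Module k W] (x : Cube b V) (f g : V →ₗ[k] W), cmap b f x = cmap b g x →
  ∀ a ∈ csp k b x, f a = g a := by
  induction b with
  | zero =>
    intro V W _ _ _ _ x f g h a ha
    have h1 : ∀ x : V, f x = g x → ∀ a ∈ span k {x}, f a = g a := by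
      intro x hx a ha; obtain ⟨t, rfl⟩ := mem_span_singleton.1 ha; rw [map_smul, map_smul, hx]
    exact h1 x h a ha
  | succ b ih =>
    intro V W _ _ _ _ x f g h a₀ ha₀; have h1 := ih (V := V × V) x (f.prodMap f) (g.prodMap g) h
    obtain ⟨_, ⟨a, ha, rfl⟩, _, ⟨a', ha', rfl⟩, rfl⟩ := mem_sup.1 ha₀; rw [map_add, map_add]
    exact congrArg₂ (· + ·) (congrArg Prod.fst (h1 a ha)) (congrArg Prod.snd (h1 a' ha'))

lemma csp_cmap (b : ℕ) : ∀ {V W : Type} [AbGrp V] [Module k V] [AbGrp W]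
  [Module k W] (x : Cube b V) (f : V →ₗ[k] W), csp k b (cmap b f x) = (csp k b x).map f := by
  induction b with
  | zero =>
    intro V W _ _ _ _ x f
    have h : ∀ x : V, span k {f x} = (span k {x}).map f := fun x => by
      rw [Submodule.map_span, Set.image_singleton]
    exact h x
  | succ b ih =>
    intro V W _ _ _ _ x f; have h := ih (V := V × V) x (f.prodMap f)
    change (csp k b (cmap b (f.prodMap f) (x : Cube b (V × V)))).map _ ⊔
      (csp k b (cmap b (f.prodMap f) (x : Cube b (V × V)))).map _ = Submodule.map f (_ ⊔ _)
    rw [h, Submodule.map_sup, ← Submodule.map_comp, ← Submodule.map_comp, ← Submodule.map_comp,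
      ← Submodule.map_comp]
    rfl

lemma exists_cmap_subtype (b : ℕ) : ∀ {V : Type} [AbGrp V] [Module k V] (S : Submodule k V)
  (x : Cube b V), csp k b x ≤ S → ∃ x' : Cube b S, cmap b S.subtype x' = x := by
  induction b with
  | zero =>
    intro V _ _ S x h; exact ⟨(⟨x, h (Submodule.mem_span_singleton_self _)⟩ : S), rfl⟩
  | succ b ih =>
    intro V _ _ S x h
    obtain ⟨x', hx'⟩ := ih (V := V × V) (S.prod S) x (fun a ha =>
      ⟨h (mem_sup_left ⟨a, ha, rfl⟩), h (mem_sup_right ⟨a, ha, rfl⟩)⟩)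
    refine ⟨cmap b (fun y : S.prod S => ((⟨y.1.1, y.2.1⟩ : S), (⟨y.1.2, y.2.2⟩ : S))) x', ?_⟩
    change cmap b (Prod.map S.subtype S.subtype) (cmap b _ x') = x; rw [← cmap_comp]; exact hx'

lemma csp_pair (b : ℕ) {V W : Type} [AbGrp V] [Module k V] [AbGrp W]
  [Module k W] (x : Cube b V) (f g : V →ₗ[k] W) :
  csp k (b + 1) (V := W) (cmap b (f.prod g) x) = (csp k b x).map f ⊔ (csp k b x).map g := by
  change (csp k b (cmap b (f.prod g) x)).map _ ⊔ (csp k b (cmap b (f.prod g) x)).map _ = _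
  rw [csp_cmap, ← Submodule.map_comp, ← Submodule.map_comp]; rfl

end Span

/-! ### Vanishing for functions on cubes -/

section CubeVan

variable {k : Type} [Field k] [Finite k] (p : ℕ) [Fact p.Prime] [CharP k p]

lemma exists_van_gs (i d r a : ℕ) : ∃ N, ∀ F : VFun k, F.Poly d → F.Tors p → ∀ (V : Type)
  [AbGrp V] [Module k V] [FinDim k V] (K A : Submodule k V),
  finrank k A ≤ a → finrank k V ≤ finrank k K + r → N ≤ finrank k K → Van (i + 1) (F.gs K A) := by
  obtain ⟨N, hN⟩ := exists_uniform (P := fun x N => EPos k p x d (r + (i + 3) * a) N)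
    (fun _ _ _ hN h => h.mono hN) (i + 1) (fun x hx => exists_ePos p x _ _)
  obtain ⟨M, hM⟩ := exists_eZero (k := k) p d (r + (i + 3) * a)
  refine ⟨N + M + (i + 9) * a, fun F hF hp V _ _ _ K A hA hr hK => ?_⟩
  obtain ⟨A₀', hA₀'⟩ := exists_isCompl ((K ⊓ A).comap A.subtype)
  let A₀ : Submodule k V := A₀'.map A.subtype
  have hA₀A : A₀ ≤ A := Submodule.map_subtype_le A A₀'
  have hsup : A₀ ⊔ (K ⊓ A) = A := by
    have h1 := congrArg (Submodule.map A.subtype) hA₀'.sup_eq_top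
    rw [Submodule.map_sup, Submodule.map_subtype_top, map_comap_subtype] at h1
    rw [inf_eq_right.2 (inf_le_right : K ⊓ A ≤ A)] at h1; rw [sup_comm]; exact h1
  have hdisj : Disjoint A₀ (K ⊓ A) := by
    rw [disjoint_def]; rintro _ ⟨y, hy, rfl⟩ hy'; have := disjoint_def.1 hA₀'.disjoint y hy' hy
    rw [this]; rfl
  have hKA : Disjoint K A₀ := by
    rw [disjoint_def]; exact fun y hy hy' => disjoint_def.1 hdisj y hy' ⟨hy, hA₀A hy'⟩
  have d1 : finrank k (K ⊓ A : Submodule k V) ≤ a :=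
    (finrank_mono inf_le_right).trans hA
  have e1 : (i + 2) * finrank k (K ⊓ A : Submodule k V) ≤ (i + 2) * a := Nat.mul_le_mul_left _ d1
  have e2 : (i + 8) * finrank k (K ⊓ A : Submodule k V) ≤ (i + 8) * a := Nat.mul_le_mul_left _ d1
  have main : Van (i + 1) (F.gs K (A₀ ⊔ (K ⊓ A))) := by
    intro z hz; obtain ⟨π, h1, h2, h3⟩ := exists_proj hdisj
    obtain ⟨ρ⟩ : Nonempty (Retr A₀ (K ⊓ A)) := ⟨⟨π.codRestrict _ h3,
      fun a => Subtype.ext (h1 a a.2), fun a ha => Subtype.ext (h2 a ha)⟩⟩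
    have e3 : (i + 3) * a = (i + 2) * a + a := by ring
    have e4 : (i + 9) * a = (i + 8) * a + a := by ring
    have hker := finrank_le_inf_ker_add K ρ.1
    refine isCob_of_one_retr p (fun x hx => hN x (by omega)) hM F hF hp hKA inf_le_left
      (by lia) (by lia) z hz ρ ?_
    refine hN i (by omega) F hF hp V _ _ ?_ (by lia) (by lia) _ ?_
    · rw [disjoint_def]; rintro v ⟨hv, hv0⟩ hv'; obtain ⟨a₀, ha₀, a₁, ha₁, rfl⟩ := mem_sup.1 hv'
      have h4 : ρ.1 (a₀ + a₁) = 0 := hv0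
      rw [map_add, ρ.2.2 a₀ ha₀, zero_add, ρ.2.1 ⟨a₁, ha₁⟩] at h4
      have h5 : a₁ = 0 := congrArg Subtype.val h4; rw [h5, add_zero] at hv ⊢
      exact disjoint_def.1 hKA _ hv ha₀
    · have := cd_pull (equi_res (inclusion (Gs_mono
        (inf_le_left : K ⊓ ker ρ.1 ≤ K) (le_refl (A₀ ⊔ (K ⊓ A))))) (F.gs K _)) (i + 1) z
      rwa [hz, map_zero] at this
  rwa [hsup] at main

lemma cmap_eq_iff_mem_Gs {V : Type} [AbGrp V] [Module k V] (b : ℕ) (g : V ≃ₗ[k] V)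
  (x : Cube b V) : cmap b g x = x ↔ g ∈ Gs ⊤ (csp k b x) := by
  constructor
  · intro h; refine ⟨fun _ => trivial, eq_of_cmap_eq b x gˡ .id ?_⟩
    exact h.trans (cmap_id b x).symm
  · intro h; exact (cmap_congr (k := k) b x h.2).trans (cmap_id b x)

/-- Vanishing for functions on cubes with polynomial coefficients. -/
lemma exists_van_cubeRep (i d b : ℕ) : ∃ N, ∀ F : VFun k, F.Poly d → F.Tors p → ∀ (V : Type)
  [AbGrp V] [Module k V] [FinDim k V], N ≤ finrank k V →
  Van (i + 1) (cubeRep (F.rep V) b) := by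
  obtain ⟨N, hN⟩ := exists_van_gs (k := k) p i d 0 (2 ^ b); refine ⟨N, fun F hF hp V _ _ _ hV => ?_⟩
  refine van_funRep fun x => ⟨Gs ⊤ (csp k b x), inferInstance, (Gs ⊤ (csp k b x)).subtype,
    Subtype.val_injective, fun g hg => ⟨⟨g, (cmap_eq_iff_mem_Gs b g x).1 hg⟩, rfl⟩,
    fun h => (cmap_eq_iff_mem_Gs b h.1 x).2 h.2, ?_⟩
  exact hN F hF hp V ⊤ _ (finrank_csp_le b x) (by simp) (by rwa [finrank_top])

lemma exists_map_proj (d b : ℕ) : ∃ N, ∀ F : VFun k, F.Poly d → F.Tors p → ∀ (V : Type)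
  [AbGrp V] [Module k V] [FinDim k V], N ≤ finrank k V →
  ∀ c : Cube b V → F.obj V, (∀ g, cubeRep (F.rep V) b g c = c) → ∀ (x : Cube b V)
  (π : V →ₗ[k] V), (∀ a ∈ csp k b x, π a = a) → (∀ v, π v ∈ csp k b x) →
  F.map π (c x) = c x := by
  obtain ⟨N, hN⟩ := exists_eZero (k := k) p d 0
  refine ⟨N + 2 ^ b, fun F hF hp V _ _ _ hV c hc x π h1 h2 => ?_⟩
  have hb := finrank_csp_le (k := k) b x; have hker := finrank_range_add_finrank_ker π
  have hrange : range π ≤ csp k b x := by rintro _ ⟨v, rfl⟩; exact h2 v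
  have hr := finrank_mono hrange
  refine hN F hF hp V (ker π) (csp k b x) ?_ (by omega) (by omega) _ (fun g => ?_) π h1
    (fun v hv => hv) h2
  · rw [disjoint_def]; intro v hv hv'; rw [← h1 v hv']; exact hv
  · have h3 := congrFun (hc g) x
    rwa [cubeRep_apply, (cmap_eq_iff_mem_Gs b _ x).2 ((Gs ⊤ _).inv_mem
      (Gs_mono le_top le_rfl g.2))] at h3

end CubeVan

/-! ### Functors with two compatible actions -/

/-- A factorization of a functor through the diagonal, vanishing on the axes. -/
structure VFun.Bi {k : Type} [Field k] (F : VFun k) where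
  /-- the action of pairs of maps -/
  map2 {V W : Type} [AbGrp V] [Module k V] [AbGrp W] [Module k W]
    (f g : V →ₗ[k] W) : F.obj V →+ F.obj W
  map2_self {V W : Type} [AbGrp V] [Module k V] [AbGrp W] [Module k W]
    (f : V →ₗ[k] W) (x : F.obj V) : map2 f f x = F.map f x
  map2_comp {V W U : Type} [AbGrp V] [Module k V] [AbGrp W] [Module k W]
    [AbGrp U] [Module k U] (g g' : W →ₗ[k] U) (f f' : V →ₗ[k] W) (x : F.obj V) :
    map2 (g ∘ₗ f) (g' ∘ₗ f') x = map2 g g' (map2 f f' x)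
  zero_left {V W : Type} [AbGrp V] [Module k V] [AbGrp W] [Module k W]
    (g : V →ₗ[k] W) (x : F.obj V) : map2 0 g x = 0
  zero_right {V W : Type} [AbGrp V] [Module k V] [AbGrp W] [Module k W]
    (f : V →ₗ[k] W) (x : F.obj V) : map2 f 0 x = 0

section Extend

variable {k : Type} [Field k] {V : Type} [AbGrp V] [Module k V]

lemma exists_retraction (A : Submodule k V) : ∃ π : V →ₗ[k] A, ∀ a : A, π a = a := by
  obtain ⟨π, hπ⟩ := A.subtype.exists_leftInverse_of_injective (Submodule.ker_subtype A)
  exact ⟨π, fun a => LinearMap.congr_fun hπ a⟩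

lemma exists_equiv_extend [FinDim k V] (A : Submodule k V) (f : V →ₗ[k] V)
  (hf : ∀ a ∈ A, f a = 0 → a = 0) : ∃ g : V ≃ₗ[k] V, ∀ a ∈ A, g a = f a := by
  let f' : A →ₗ[k] V := f.domRestrict A
  have hinj : Injective f' := by
    rw [← LinearMap.ker_eq_bot, LinearMap.ker_eq_bot']; exact fun a ha => Subtype.ext (hf a a.2 ha)
  obtain ⟨C, hC⟩ := exists_isCompl A; obtain ⟨C', hC'⟩ := exists_isCompl (range f')
  have e1 : A ≃ₗ[k] range f' := LinearEquiv.ofInjective f' hinj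
  have h1 := Submodule.finrank_add_eq_of_isCompl hC
  have h2 := Submodule.finrank_add_eq_of_isCompl hC'; have h3 := e1.finrank_eq
  let e2 : C ≃ₗ[k] C' := LinearEquiv.ofFinrankEq _ _ (by omega)
  refine ⟨(prodEquivOfIsCompl A C hC).symm.trans
    (((LinearEquiv.ofInjective f' hinj).prodCongr e2).trans
      (prodEquivOfIsCompl _ C' hC')), fun a ha => ?_⟩
  have : (prodEquivOfIsCompl A C hC).symm a = (⟨a, ha⟩, 0) :=
    Submodule.prodEquivOfIsCompl_symm_apply_left A C hC ⟨a, ha⟩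
  simp [this, f']

/-- Two independent copies of a subspace. -/
structure Copies (A : Submodule k V) (i₁ i₂ p₁ p₂ : V →ₗ[k] V) : Prop where
  h₁₁ : ∀ a ∈ A, p₁ (i₁ a) = a
  h₂₂ : ∀ a ∈ A, p₂ (i₂ a) = a
  h₁₂ : ∀ a ∈ A, p₁ (i₂ a) = 0
  h₂₁ : ∀ a ∈ A, p₂ (i₁ a) = 0

lemma exists_copies [FinDim k V] (A : Submodule k V)
  (h : 2 * finrank k A ≤ finrank k V) : ∃ i₁ i₂ p₁ p₂, Copies A i₁ i₂ p₁ p₂ := by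
  obtain ⟨j, hj⟩ := exists_injective_of_finrank_le (k := k) (V := A × A) (W := V)
    (by rw [Module.finrank_prod]; omega)
  obtain ⟨q, hq⟩ := j.exists_leftInverse_of_injective (LinearMap.ker_eq_bot.2 hj)
  have hq' : ∀ x, q (j x) = x := fun x => LinearMap.congr_fun hq x
  obtain ⟨π, hπ⟩ := exists_retraction A
  refine ⟨j ∘ₗ inl k A A ∘ₗ π, j ∘ₗ inr k A A ∘ₗ π,
    A.subtype ∘ₗ fst k A A ∘ₗ q, A.subtype ∘ₗ snd k A A ∘ₗ q, ?_, ?_, ?_, ?_⟩ <;>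
  · intro a ha; simp [hq', hπ ⟨a, ha⟩]

lemma Copies.mono {A B : Submodule k V} {i₁ i₂ p₁ p₂ : V →ₗ[k] V} (h : Copies A i₁ i₂ p₁ p₂)
  (hBA : B ≤ A) : Copies B i₁ i₂ p₁ p₂ :=
  ⟨fun a ha => h.1 a (hBA ha), fun a ha => h.2 a (hBA ha), fun a ha => h.3 a (hBA ha),
    fun a ha => h.4 a (hBA ha)⟩

end Extend

section Contract

variable {k : Type} [Field k] {F : VFun k} (B : F.Bi) {V : Type} [AbGrp V] [Module k V]
  [FinDim k V]

/-- Equivariant functions whose values are supported on the span of the argument. -/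
structure Supp (F : VFun k) (V : Type) [AbGrp V] [Module k V] (b : ℕ)
  (c : Cube b V → F.obj V) : Prop where
  equi : ∀ (g : V ≃ₗ[k] V) (x : Cube b V), c (cmap b g x) = F.map (g : V →ₗ[k] V) (c x)
  proj : ∀ (x : Cube b V) (π : V →ₗ[k] V), (∀ a ∈ csp k b x, π a = a) →
    (∀ v, π v ∈ csp k b x) → F.map π (c x) = c x

include B

lemma Supp.map2_congr {b : ℕ} {c : Cube b V → F.obj V} (hc : Supp F V b c) (x : Cube b V)
  {f f' h h' : V →ₗ[k] V} (e : ∀ a ∈ csp k b x, f a = h a) (e' : ∀ a ∈ csp k b x, f' a = h' a) :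
  B.map2 f f' (c x) = B.map2 h h' (c x) := by
  obtain ⟨π, hπ⟩ := exists_retraction (csp k b x)
  have h1 := hc.proj x ((csp k b x).subtype ∘ₗ π) (fun a ha => congrArg Subtype.val (hπ ⟨a, ha⟩))
    (fun v => (π v).2)
  rw [← h1, ← B.map2_self, ← B.map2_comp, ← B.map2_comp]; congr 2 <;> ext v
  · exact e _ (π v).2
  · exact e' _ (π v).2

lemma Supp.map_injOn {b : ℕ} {c : Cube b V → F.obj V} (hc : Supp F V b c) (x : Cube b V)
  (f : V →ₗ[k] V) (hf : ∀ a ∈ csp k b x, f a = 0 → a = 0) :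
  c (cmap b f x) = F.map f (c x) := by
  obtain ⟨g, hg⟩ := exists_equiv_extend (csp k b x) f hf
  have h1 : cmap b f x = cmap b g x := cmap_congr (k := k) b x fun a ha => (hg a ha).symm
  rw [h1, hc.equi g x, ← B.map2_self, ← B.map2_self]; exact hc.map2_congr B x hg hg

lemma Supp.copies_indep {b : ℕ} {c : Cube (b + 1) V → F.obj V} (hc : Supp F V (b + 1) c)
  (x : Cube b V) {i₁ i₂ p₁ p₂ i₁' i₂' p₁' p₂' : V →ₗ[k] V}
  (h : Copies (csp k b x) i₁ i₂ p₁ p₂) (h' : Copies (csp k b x) i₁' i₂' p₁' p₂') :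
  B.map2 p₁ p₂ (csq b V _ c (cmap b (i₁.prod i₂) x)) =
  B.map2 p₁' p₂' (csq b V _ c (cmap b (i₁'.prod i₂') x)) := by
  let f : V →ₗ[k] V := i₁' ∘ₗ p₁ + i₂' ∘ₗ p₂
  have hf1 : ∀ a ∈ csp k b x, f (i₁ a) = i₁' a := fun a ha => by simp [f, h.h₁₁ a ha, h.h₂₁ a ha]
  have hf2 : ∀ a ∈ csp k b x, f (i₂ a) = i₂' a := fun a ha => by simp [f, h.h₂₂ a ha, h.h₁₂ a ha]
  have hx : cmap b (i₁'.prod i₂') x = cmap b (Prod.map f f) (cmap b (i₁.prod i₂) x) := by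
    rw [← cmap_comp]
    exact cmap_congr (k := k) b x fun a ha => Prod.ext (hf1 a ha).symm (hf2 a ha).symm
  let y : Cube (b + 1) V := cmap b (i₁.prod i₂) x
  have hy : csp k (b + 1) y = (csp k b x).map i₁ ⊔ (csp k b x).map i₂ := csp_pair b x i₁ i₂
  have hmem : ∀ v ∈ csp k (b + 1) y, ∃ a ∈ csp k b x, ∃ a' ∈ csp k b x, v = i₁ a + i₂ a' := by
    intro v hv; rw [hy] at hv; obtain ⟨_, ⟨a, ha, rfl⟩, _, ⟨a', ha', rfl⟩, rfl⟩ := mem_sup.1 hv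
    exact ⟨a, ha, a', ha', rfl⟩
  have h1 : csq b V _ c (cmap b (i₁'.prod i₂') x) = F.map f (c y) := by
    rw [hx]; refine hc.map_injOn B y f fun v hv hv0 => ?_
    obtain ⟨a, ha, a', ha', rfl⟩ := hmem v hv; rw [map_add, hf1 a ha, hf2 a' ha'] at hv0
    have e1 := congrArg p₁' hv0; have e2 := congrArg p₂' hv0
    rw [map_add, h'.h₁₁ a ha, h'.h₁₂ a' ha', map_zero, add_zero] at e1
    rw [map_add, h'.h₂₁ a ha, h'.h₂₂ a' ha', map_zero, zero_add] at e2
    rw [e1, e2, map_zero, map_zero, add_zero]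
  rw [h1, ← B.map2_self, ← B.map2_comp]; refine hc.map2_congr B y (fun v hv => ?_) (fun v hv => ?_)
  · obtain ⟨a, ha, a', ha', rfl⟩ := hmem v hv
    simp only [comp_apply, map_add, hf1 a ha, hf2 a' ha', h.h₁₁ a ha, h.h₁₂ a' ha',
      h'.h₁₁ a ha, h'.h₁₂ a' ha']
  · obtain ⟨a, ha, a', ha', rfl⟩ := hmem v hv
    simp only [comp_apply, map_add, hf1 a ha, hf2 a' ha', h.h₂₁ a ha, h.h₂₂ a' ha',
      h'.h₂₁ a ha, h'.h₂₂ a' ha']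

lemma Supp.eval_copies {b : ℕ} {c : Cube b V → F.obj V} (hc : Supp F V b c)
  (x : Cube b V) {i₁ i₂ p₁ p₂ : V →ₗ[k] V} (h : Copies (csp k b x) i₁ i₂ p₁ p₂) :
  B.map2 p₁ p₂ (c (cmap b (i₁ + i₂ : V →ₗ[k] V) x)) = c x ∧
  B.map2 p₁ p₂ (c (cmap b i₁ x)) = 0 ∧ B.map2 p₁ p₂ (c (cmap b i₂ x)) = 0 := by
  refine ⟨?_, ?_, ?_⟩
  · rw [hc.map_injOn B x _ fun a ha h0 => ?_, ← B.map2_self, ← B.map2_comp,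
      hc.map2_congr B x (h := .id) (h' := .id) (fun a ha => ?_) (fun a ha => ?_),
      B.map2_self, F.map_id]
    · simp [h.h₁₁ a ha, h.h₁₂ a ha]
    · simp [h.h₂₁ a ha, h.h₂₂ a ha]
    · simpa [h.h₁₁ a ha, h.h₁₂ a ha] using congrArg p₁ h0
  · rw [hc.map_injOn B x _ fun a ha h0 => ?_, ← B.map2_self, ← B.map2_comp,
      hc.map2_congr B x (h := .id) (h' := 0) (fun a ha => ?_) (fun a ha => ?_),
      B.zero_right]
    · simp [h.h₁₁ a ha]
    · simp [h.h₂₁ a ha]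
    · simpa [h.h₁₁ a ha] using congrArg p₁ h0
  · rw [hc.map_injOn B x _ fun a ha h0 => ?_, ← B.map2_self, ← B.map2_comp,
      hc.map2_congr B x (h := 0) (h' := .id) (fun a ha => ?_) (fun a ha => ?_),
      B.zero_left]
    · simp [h.h₁₂ a ha]
    · simp [h.h₂₂ a ha]
    · simpa [h.h₂₂ a ha] using congrArg p₂ h0

lemma Supp.exists_cdel_eq {b : ℕ} {c : Cube (b + 1) V → F.obj V} (hc : Supp F V (b + 1) c)
  (hV : 2 ^ (b + 2) ≤ finrank k V) (hz : cdel (b + 1) V (F.obj V) c = 0) :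
  ∃ e : Cube b V → F.obj V, (∀ g, cubeRep (F.rep V) b g e = e) ∧ cdel b V (F.obj V) e = c := by
  have hcop : ∀ x : Cube b V, ∃ i₁ i₂ p₁ p₂, Copies (csp k b x) i₁ i₂ p₁ p₂ := fun x => by
    refine exists_copies _ ?_
    have := finrank_csp_le (k := k) b x; have e : 2 ^ (b + 2) = 2 * (2 * 2 ^ b) := by ring
    omega
  choose i₁ i₂ p₁ p₂ hcp using hcop
  let e : Cube b V → F.obj V := fun x =>
    B.map2 (p₁ x) (p₂ x) (csq b V _ c (cmap b ((i₁ x).prod (i₂ x)) x))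
  refine ⟨e, fun g => ?_, ?_⟩
  · funext x; rw [cubeRep_apply]; set y := cmap b (g⁻¹ : V ≃ₗ[k] V) x with hy
    have hcs : csp k b y = (csp k b x).map (g⁻¹ : V ≃ₗ[k] V)ˡ :=
      csp_cmap b x (g⁻¹ : V ≃ₗ[k] V)ˡ
    have hm : ∀ a ∈ csp k b x, g⁻¹ a ∈ csp k b y := fun a ha => by rw [hcs]; exact ⟨a, ha, rfl⟩
    have hg : ∀ a, g (g⁻¹ a) = a := fun a => g.apply_symm_apply a
    have h1 : Copies (csp k b x) (i₁ y ∘ₗ (g⁻¹ : V ≃ₗ[k] V)ˡ)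
        (i₂ y ∘ₗ (g⁻¹ : V ≃ₗ[k] V)ˡ) (gˡ ∘ₗ p₁ y) (gˡ ∘ₗ p₂ y) := by
      refine ⟨fun a ha => ?_, fun a ha => ?_, fun a ha => ?_, fun a ha => ?_⟩
      · exact (congrArg g ((hcp y).h₁₁ _ (hm a ha))).trans (hg a)
      · exact (congrArg g ((hcp y).h₂₂ _ (hm a ha))).trans (hg a)
      · exact (congrArg g ((hcp y).h₁₂ _ (hm a ha))).trans (map_zero g)
      · exact (congrArg g ((hcp y).h₂₁ _ (hm a ha))).trans (map_zero g)
    have h2 := hc.copies_indep B x h1 (hcp x)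
    have h3 : cmap b ((i₁ y ∘ₗ (g⁻¹ : V ≃ₗ[k] V)ˡ).prod
        (i₂ y ∘ₗ (g⁻¹ : V ≃ₗ[k] V)ˡ)) x = cmap b ((i₁ y).prod (i₂ y)) y := by
      rw [hy, ← cmap_comp]; rfl
    rwa [h3, B.map2_comp, B.map2_self] at h2
  · funext x
    obtain ⟨j₁, j₂, q₁, q₂, hq⟩ := exists_copies (csp k (b + 1) x) (by
      have := finrank_csp_le (k := k) (b + 1) x; have e : 2 ^ (b + 2) = 2 * 2 ^ (b + 1) := by ring
      omega)
    have h1 : cdel b V (F.obj V) e x = cdel b V (F.obj V)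
        (fun y => B.map2 q₁ q₂ (csq b V _ c (cmap b (j₁.prod j₂) y))) x := by
      refine cdel_congr_range b x (csp k (b + 1) x).toAddSubgroup
        (exists_cmap_subtype (b + 1) (csp k (b + 1) x) x le_rfl) fun y => ?_
      refine hc.copies_indep B _ (hcp _) (hq.mono ?_)
      let S := csp k (b + 1) x
      have h2 : ∀ y : Cube b S, csp k b (cmap b S.subtype y) = (csp k b y).map S.subtype :=
        fun y => csp_cmap b y S.subtype
      refine (le_of_eq (h2 y)).trans ?_
      rintro _ ⟨a, _, rfl⟩; exact a.2
    have h2 := cocycle_add b c hz j₁.toAddMonoidHom j₂.toAddMonoidHom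
    have h3 := cdel_push b (B.map2 q₁ q₂) (cpull b (F.obj V) (j₁.toAddMonoidHom.prod
      j₂.toAddMonoidHom) (csq b V _ c)) x
    have h4 := h1.trans h3; rw [h4, ← h2]; obtain ⟨e1, e2, e3⟩ := hc.eval_copies B x hq
    rw [Pi.sub_apply, Pi.sub_apply, map_sub, map_sub]
    refine (congrArg₂ (· - ·) (congrArg₂ (· - ·) e1 e2) e3).trans ?_
    rw [sub_zero, sub_zero]

lemma Supp.hom_eq_zero {η : V →+ F.obj V} (hc : Supp F V 0 (addCoe V _ η))
  (hV : 2 ≤ finrank k V) : η = 0 := by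
  ext v
  obtain ⟨i₁, i₂, p₁, p₂, h⟩ := exists_copies (csp k 0 (v : Cube 0 V)) (by
    have := finrank_csp_le (k := k) 0 (v : Cube 0 V); omega)
  obtain ⟨e1, e2, e3⟩ := hc.eval_copies B v h
  have e4 : η (i₁ v + i₂ v) = η (i₁ v) + η (i₂ v) := map_add η _ _
  have e5 := (congrArg (B.map2 p₁ p₂) e4).trans (map_add (B.map2 p₁ p₂) _ _)
  exact e1.symm.trans (e5.trans ((congrArg₂ (· + ·) e2 e3).trans (add_zero _)))

end Contract

section BiVan

variable {k : Type} [Field k] [Finite k] (p : ℕ) [Fact p.Prime] [CharP k p]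

/-- Cohomology of additive maps into polynomial functors with two compatible actions vanishes. -/
lemma exists_van_adRep_of_bi (s d : ℕ) : ∃ N, ∀ F : VFun k, F.Poly d → F.Tors p → Nonempty F.Bi →
    ∀ (V : Type) [AbGrp V] [Module k V] [FinDim k V], N ≤ finrank k V →
    ∀ x ≤ s, Van x (adRep (F.rep V)) := by
  obtain ⟨N₁, hN₁⟩ := exists_uniform (P := fun b N => ∀ x < s + 1, ∀ F : VFun k, F.Poly d →
      F.Tors p → ∀ (V : Type) [AbGrp V] [Module k V] [FinDim k V],
      N ≤ finrank k V → Van (x + 1) (cubeRep (F.rep V) b))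
    (fun b N N' h h' x hx F hF hp V _ _ _ hV => h' x hx F hF hp V (h.trans hV)) (s + 1)
    (fun b _ => exists_uniform (P := fun x N => ∀ F : VFun k, F.Poly d →
      F.Tors p → ∀ (V : Type) [AbGrp V] [Module k V] [FinDim k V],
      N ≤ finrank k V → Van (x + 1) (cubeRep (F.rep V) b)) (fun b N N' h h' F hF hp V _ _ _ hV => h' F hF hp V (h.trans hV))
      (s + 1) (fun x _ => exists_van_cubeRep p x d b))
  obtain ⟨N₂, hN₂⟩ := exists_uniform (P := fun b N => ∀ F : VFun k, F.Poly d → F.Tors p →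
      ∀ (V : Type) [AbGrp V] [Module k V] [FinDim k V], N ≤ finrank k V →
      ∀ c : Cube b V → F.obj V, (∀ g, cubeRep (F.rep V) b g c = c) → ∀ (x : Cube b V)
      (π : V →ₗ[k] V), (∀ a ∈ csp k b x, π a = a) → (∀ v, π v ∈ csp k b x) →
      F.map π (c x) = c x)
    (fun b N N' h h' F hF hp V _ _ _ hV => h' F hF hp V (h.trans hV)) (s + 1)
    (fun b _ => exists_map_proj p d b)
  refine ⟨N₁ + N₂ + 2 ^ (s + 2), fun F hF hp ⟨B⟩ V _ _ _ hV => ?_⟩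
  have h2 : 2 ≤ 2 ^ (s + 2) := by
    calc 2 = 2 ^ 1 := rfl
      _ ≤ _ := Nat.pow_le_pow_right (by norm_num) (by omega)
  have hsupp : ∀ b < s + 1, ∀ c : Cube b V → F.obj V, (∀ g, cubeRep (F.rep V) b g c = c) →
      Supp F V b c := by
    intro b hb c hc
    refine ⟨fun g x => ?_, hN₂ b hb F hF hp V (by omega) c hc⟩
    have := congrFun (hc g) (cmap b g x)
    rw [cubeRep_apply, ← cmap_comp] at this
    have e : ((g⁻¹ : V ≃ₗ[k] V) : V → V) ∘ g = id := funext fun v => g.symm_apply_apply v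
    rw [e, cmap_id] at this
    exact this.symm
  haveI : Finite V := Module.finite_of_finite k
  letI : Module (ZMod p) V := AddCommGroup.zmodModule (n := p) fun v => by
    rw [charP_nsmul k]
  letI : Module (ZMod p) (F.obj V) := AddCommGroup.zmodModule (n := p) (hp V)
  refine van_adRep p (F.rep V) s (fun b x hx => hN₁ b (by omega) x (by omega) F hF hp V (by omega))
    (fun η hη => ?_) (fun b hb c hc hz => ?_)
  · refine (hsupp 0 (by omega) (addCoe V _ η) fun g => ?_).hom_eq_zero B (by omega)
    exact (equi_addCoe (F.rep V) g η).symm.trans (congrArg (addCoe V (F.obj V)) (hη g))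
  · have h3 : 2 ^ (b + 2) ≤ 2 ^ (s + 2) := Nat.pow_le_pow_right (by norm_num) (by omega)
    exact (hsupp (b + 1) (by omega) c hc).exists_cdel_eq B (by omega) hz

end BiVan

/-! ### Cohomology groups, their orders, and exact sequences -/

section Hq

variable {G H A B C M N : Type} [Group G] [Group H] [AbGrp A] [AbGrp B]
  [AbGrp C] [AbGrp M] [AbGrp N]

/-- Coboundaries inside the cocycles. -/
def Bq (i : ℕ) (ρ : GMod G M) : AddSubgroup (cd ρ i).ker where
  carrier := {z | IsCob ρ i z.1}
  zero_mem' := IsCob.zero ρ i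
  add_mem' := IsCob.add
  neg_mem' := IsCob.neg

/-- The cohomology group. -/
abbrev Hq (i : ℕ) (ρ : GMod G M) := (cd ρ i).ker ⧸ Bq i ρ

/-- The order of the cohomology group. -/
def hcard (i : ℕ) (ρ : GMod G M) : ℕ := Nat.card (Hq i ρ)

lemma Hq.mk_eq_zero {i : ℕ} {ρ : GMod G M} (z : (cd ρ i).ker) :
  (QuotientAddGroup.mk z : Hq i ρ) = 0 ↔ IsCob ρ i z.1 :=
  eq_zero_iff z

lemma Van.subsingleton {i : ℕ} {ρ : GMod G M} (h : Van i ρ) : Subsingleton (Hq i ρ) := by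
  refine ⟨fun a b => ?_⟩; obtain ⟨a, rfl⟩ := mk_surjective a; obtain ⟨b, rfl⟩ := mk_surjective b
  rw [← sub_eq_zero]; exact (Hq.mk_eq_zero (a - b)).2 (h _ (a - b).2)

lemma hcard_eq_one_iff (i : ℕ) (ρ : GMod G M) [Finite (Hq i ρ)] : hcard i ρ = 1 ↔ Van i ρ := by
  rw [hcard, Nat.card_eq_one_iff_unique, and_iff_left ⟨0⟩]; constructor
  · intro h z hz; exact (Hq.mk_eq_zero ⟨z, hz⟩).1 (Subsingleton.elim _ _)
  · exact fun h => h.subsingleton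

lemma Van.hcard {i : ℕ} {ρ : GMod G M} (h : Van i ρ) : hcard i ρ = 1 := by
  have := h.subsingleton; exact (hcard_eq_one_iff i ρ).2 h

lemma van_of_hcard {i : ℕ} {ρ : GMod G M} (h : hcard i ρ = 1) : Van i ρ := by
  have : Finite (Hq i ρ) := Nat.finite_of_card_ne_zero (by rw [← _root_.hcard, h]; exact one_ne_zero)
  exact (hcard_eq_one_iff i ρ).1 h

/-- The induced map on cocycles. -/
def zmap {f : H →* G} {ρ : GMod G M} {σ : GMod H N} {φ : M →+ N} (hφ : Equi f ρ σ φ) (i : ℕ) :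
  (cd ρ i).ker →+ (cd σ i).ker :=
  ((pull f φ i).comp (AddSubgroup.subtype _)).codRestrict _ fun z => by
    change cd σ i (pull f φ i z.1) = 0; rw [cd_pull hφ, show cd ρ i z.1 = 0 from z.2, map_zero]

/-- The induced map on cohomology. -/
def hmap {f : H →* G} {ρ : GMod G M} {σ : GMod H N} {φ : M →+ N} (hφ : Equi f ρ σ φ) (i : ℕ) :
  Hq i ρ →+ Hq i σ :=
  QuotientAddGroup.map _ _ (zmap hφ i) fun _ hz => IsCob.push hφ hz

lemma hcard_eq_of_inverse {f : H →* G} {f' : G →* H} {ρ : GMod G M} {σ : GMod H N} {φ : M →+ N}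
  {ψ : N →+ M} (hφ : Equi f ρ σ φ) (hψ : Equi f' σ ρ ψ) (i : ℕ)
  (h₁ : ∀ z, cd ρ i z = 0 → IsCob ρ i (pull f' ψ i (pull f φ i z) - z))
  (h₂ : ∀ z, cd σ i z = 0 → IsCob σ i (pull f φ i (pull f' ψ i z) - z)) :
  hcard i ρ = hcard i σ := by
  refine Nat.card_congr ⟨hmap hφ i, hmap hψ i, fun x => ?_, fun x => ?_⟩
  · obtain ⟨z, rfl⟩ := mk_surjective x; rw [← sub_eq_zero]
    exact (Hq.mk_eq_zero (zmap hψ i (zmap hφ i z) - z)).2 (h₁ z.1 z.2)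
  · obtain ⟨z, rfl⟩ := mk_surjective x; rw [← sub_eq_zero]
    exact (Hq.mk_eq_zero (zmap hφ i (zmap hψ i z) - z)).2 (h₂ z.1 z.2)

lemma hcard_congr (f : H ≃* G) (φ : M ≃+ N) {ρ : GMod G M} {σ : GMod H N}
  (hφ : Equi f.toMonoidHom ρ σ φ.toAddMonoidHom) (i : ℕ) : hcard i ρ = hcard i σ := by
  have h : Equi f.symm.toMonoidHom σ ρ φ.symm.toAddMonoidHom := by
    intro g n; have := hφ (f.symm g) (φ.symm n)
    simp only [MulEquiv.toMonoidHom_eq_coe, MonoidHom.coe_coe, MulEquiv.apply_symm_apply,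
      AddEquiv.toAddMonoidHom_eq_coe, AddMonoidHom.coe_coe, AddEquiv.apply_symm_apply] at this ⊢
    rw [← this, AddEquiv.symm_apply_apply]
  refine hcard_eq_of_inverse hφ h i (fun z _ => ?_) (fun z _ => ?_)
  · convert IsCob.zero ρ i
    rw [sub_eq_zero]; ext x; simp [pull_apply, Function.comp_def]
  · convert IsCob.zero σ i
    rw [sub_eq_zero]; ext x; simp [pull_apply, Function.comp_def]

lemma hcard_zero (ρ : GMod G M) : hcard 0 ρ = Nat.card {m : M // ∀ g, ρ g m = m} := by
  have e : (cd ρ 0).ker ≃ {m : M // ∀ g, ρ g m = m} :=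
    { toFun := fun z => ⟨z.1 Fin.elim0, (cd_zero_iff ρ z.1).1 z.2⟩
      invFun := fun m => ⟨fun _ => m.1, (cd_zero_iff ρ _).2 m.2⟩
      left_inv := fun z => Subtype.ext (funext fun x => congrArg z.1 (Subsingleton.elim _ _))
      right_inv := fun m => rfl }
  rw [← Nat.card_congr e]; have : Bq 0 ρ = ⊥ := by rw [eq_bot_iff]; exact fun z hz => Subtype.ext hz
  rw [hcard, Hq, this]; exact Nat.card_congr QuotientAddGroup.quotientBot.toEquiv

namespace SES

variable {ρ : GMod G A} {σ : GMod G B} {τ : GMod G C} {f : A →+ B} {g : B →+ C}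
  (h : SES ρ σ τ f g)
include h

lemma exists_invariant_lift (hA : Van 1 ρ) (c : C) (hc : ∀ x, τ x c = c) :
  ∃ b, (∀ x, σ x b = b) ∧ g b = c := by
  obtain ⟨b, rfl⟩ := h.surj c
  let u : (Fin 0 → G) → B := fun _ => b
  obtain ⟨a, ha⟩ := h.push_lift 1 (cd σ 0 u) (by rw [← cd_pull h.eg, cd_zero_iff]; exact hc)
  obtain ⟨v, hv⟩ := hA a (h.push_inj _ (by rw [← cd_pull h.ef, ha, cd_cd, map_zero]))
  have h1 : cd σ 0 (u - push f 0 v) = 0 := by rw [map_sub, cd_pull h.ef, hv, ha, sub_self]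
  refine ⟨b - f (v Fin.elim0), (cd_zero_iff σ _).1 h1, ?_⟩
  rw [map_sub, (h.exact (f (v Fin.elim0))).2 ⟨_, rfl⟩, sub_zero]

lemma hcard_zero_eq (hC : Van 0 τ) : hcard 0 ρ = hcard 0 σ := by
  rw [hcard_zero, hcard_zero]
  refine Nat.card_congr (Equiv.ofBijective (fun m => ⟨f m.1, fun x => by rw [← h.ef, m.2]⟩)
    ⟨fun a b hab => Subtype.ext (h.inj (congrArg Subtype.val hab)), fun b => ?_⟩)
  have h1 : g b.1 = 0 := (van_zero_iff τ).1 hC _ fun x => by rw [← h.eg, b.2]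
  obtain ⟨a, ha⟩ := (h.exact _).1 h1
  exact ⟨⟨a, fun x => h.inj (by exact (h.ef x a).trans (by simpa [ha] using b.2 x))⟩, Subtype.ext ha⟩

lemma hcard_succ {i : ℕ} (hB : Van i σ) (hC : Van (i + 1) τ) :
  hcard (i + 1) ρ = hcard i τ * hcard (i + 1) σ := by
  let E : AddSubgroup (((Fin i → G) → B) × ((Fin (i + 1) → G) → A)) :=
    ((cd σ i).comp (AddMonoidHom.fst _ _) - (push f (i + 1)).comp (AddMonoidHom.snd _ _)).ker
  have hE : ∀ e : E, cd σ i e.1.1 = push f (i + 1) e.1.2 := fun e => sub_eq_zero.1 e.2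
  have c1 : ∀ e : E, cd τ i (push g i e.1.1) = 0 := fun e => by rw [cd_pull h.eg, hE, h.push_comp]
  have c2 : ∀ e : E, cd ρ (i + 1) e.1.2 = 0 := fun e => h.push_inj _ (by
    rw [← cd_pull h.ef, ← hE, cd_cd, map_zero])
  let φ₁ : E →+ Hq i τ := (QuotientAddGroup.mk' (Bq i τ)).comp
    ((((push g i).comp (AddMonoidHom.fst _ _)).comp E.subtype).codRestrict _ c1)
  let φ₂ : E →+ Hq (i + 1) ρ := (QuotientAddGroup.mk' (Bq (i + 1) ρ)).comp
    (((AddMonoidHom.snd _ _).comp E.subtype).codRestrict _ c2)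
  have hk₁ : ∀ e, e ∈ φ₁.ker ↔ IsCob τ i (push g i e.1.1) := fun e => Hq.mk_eq_zero _
  have hk₂ : ∀ e, e ∈ φ₂.ker ↔ IsCob ρ (i + 1) e.1.2 := fun e => Hq.mk_eq_zero _
  have hker : φ₁.ker = φ₂.ker := by
    ext e; rw [hk₁, hk₂]; exact ⟨h.isCob_succ (hE e), h.isCob_push_of_van hB (hE e)⟩
  have hs₁ : Surjective φ₁ := by
    intro x; obtain ⟨z, rfl⟩ := mk_surjective x; obtain ⟨u, hu⟩ := h.push_surj i z.1
    obtain ⟨a, ha⟩ := h.push_lift (i + 1) (cd σ i u) (by rw [← cd_pull h.eg, hu]; exact z.2)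
    refine ⟨⟨(u, a), sub_eq_zero.2 ha.symm⟩, ?_⟩
    exact congrArg QuotientAddGroup.mk (Subtype.ext hu)
  have hr₂ : φ₂.range = (hmap h.ef (i + 1)).ker := by
    ext x; constructor
    · rintro ⟨e, rfl⟩; exact (Hq.mk_eq_zero _).2 ⟨e.1.1, hE e⟩
    · intro hx; obtain ⟨z, rfl⟩ := mk_surjective x
      obtain ⟨u, hu⟩ := (Hq.mk_eq_zero (zmap h.ef (i + 1) z)).1 hx
      exact ⟨⟨(u, z.1), sub_eq_zero.2 hu⟩, rfl⟩
  have hs : Surjective (hmap h.ef (i + 1)) := by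
    intro x; obtain ⟨z, rfl⟩ := mk_surjective x
    obtain ⟨u, hu⟩ := hC (push g (i + 1) z.1) (by
      rw [cd_pull h.eg, show cd σ (i + 1) z.1 = 0 from z.2, map_zero])
    obtain ⟨u, rfl⟩ := h.push_surj i u
    obtain ⟨a, ha⟩ := h.push_lift (i + 1) (z.1 - cd σ i u) (by
      rw [map_sub, ← hu, cd_pull h.eg, sub_self])
    refine ⟨QuotientAddGroup.mk ⟨a, h.push_inj _ ?_⟩, ?_⟩
    · rw [← cd_pull h.ef, ha, map_sub, cd_cd, map_zero, sub_zero]; exact z.2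
    · rw [← sub_eq_zero]; refine (Hq.mk_eq_zero (zmap h.ef (i + 1) ⟨a, _⟩ - z)).2 ⟨-u, ?_⟩
      change cd σ i (-u) = push f (i + 1) a - z.1; rw [ha, map_neg]; abel
  have e₁ := (QuotientAddGroup.quotientAddEquivOfEq hker).symm.trans
    (QuotientAddGroup.quotientKerEquivOfSurjective φ₁ hs₁)
  have e₂ := QuotientAddGroup.quotientKerEquivRange φ₂; rw [hr₂] at e₂
  have e₃ := QuotientAddGroup.quotientKerEquivOfSurjective _ hs
  rw [hcard, AddSubgroup.card_eq_card_quotient_mul_card_addSubgroup (hmap h.ef (i + 1)).ker,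
    Nat.card_congr e₃.toEquiv, ← Nat.card_congr (e₁.symm.trans e₂).toEquiv, mul_comm]
  rfl

end SES

end Hq

section AdSES

variable {k : Type} [Field k] {V A B C : Type} [AbGrp V] [Module k V] [AbGrp A]
  [AbGrp B] [AbGrp C] {ρ : GMod (V ≃ₗ[k] V) A} {σ : GMod (V ≃ₗ[k] V) B}
  {τ : GMod (V ≃ₗ[k] V) C} {f : A →+ B} {g : B →+ C}

/-- Composition with an additive map. -/
def postComp (V : Type) [AbGrp V] {A B : Type} [AbGrp A] [AbGrp B]
  (f : A →+ B) : (V →+ A) →+ (V →+ B) := AddMonoidHom.compHom f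

lemma equi_postComp (hf : ∀ x a, f (ρ x a) = σ x (f a)) (x : V ≃ₗ[k] V) (η : V →+ A) :
  postComp V f (adRep ρ x η) = adRep σ x (postComp V f η) := by
  ext v; exact hf _ _

lemma exists_lift_of_zmod (p : ℕ) [Fact p.Prime] [Module (ZMod p) V] [Module (ZMod p) B]
  [Module (ZMod p) C] (g : B →+ C) (hg : Surjective g) (η : V →+ C) :
  ∃ ξ, postComp V g ξ = η := by
  obtain ⟨r, hr⟩ := LinearMap.exists_rightInverse_of_surjective (g.toZModLinearMap p)
    (LinearMap.range_eq_top.2 hg)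
  exact ⟨(r ∘ₗ η.toZModLinearMap p).toAddMonoidHom,
    AddMonoidHom.ext fun v => LinearMap.congr_fun hr (η v)⟩

/-- Additive maps from a `p`-torsion group are exact on `p`-torsion groups. -/
lemma SES.ad (p : ℕ) [Fact p.Prime] [CharP k p] (h : SES ρ σ τ f g) (hp : ∀ b : B, p • b = 0) :
  SES (adRep ρ) (adRep σ) (adRep τ) (postComp V f) (postComp V g) where
  ef := equi_postComp h.ef
  eg := equi_postComp h.eg
  inj η η' hη := by ext v; exact h.inj (DFunLike.congr_fun hη v)
  surj η := by
    letI : Module (ZMod p) V := AddCommGroup.zmodModule (n := p) fun v => by rw [charP_nsmul k]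
    letI : Module (ZMod p) B := AddCommGroup.zmodModule (n := p) hp
    letI : Module (ZMod p) C := AddCommGroup.zmodModule (n := p) fun c => by
      obtain ⟨b, rfl⟩ := h.surj c; rw [← map_nsmul, hp, map_zero]
    exact exists_lift_of_zmod p g h.surj η
  exact η := by
    constructor
    · intro hη; choose a ha using fun v => (h.exact (η v)).1 (DFunLike.congr_fun hη v)
      refine ⟨AddMonoidHom.mk' a fun v w => h.inj ?_, AddMonoidHom.ext ha⟩
      rw [map_add, ha, ha, ha, map_add]
    · rintro ⟨ξ, rfl⟩; ext v; exact (h.exact _).2 ⟨ξ v, rfl⟩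

end AdSES

/-! ### Polynomial functors -/

open MvPolynomial in
lemma weightedHomogeneousComponent_comm {σ σ' K M M' : Type} [CommSemiring K] [AddCommMonoid M]
  [AddCommMonoid M'] {w : σ → M} {w' : σ' → M'} (L : MvPolynomial σ K →ₗ[K] MvPolynomial σ' K)
  (θ : M → M') (hθ : Injective θ)
  (hL : ∀ n f, IsWH w f n → IsWH w' (L f) (θ n)) (n : M)
  (f : MvPolynomial σ K) :
  whComp w' (θ n) (L f) = L (whComp w n f) := by
  classical
  induction f using MvPolynomial.induction_on' with
  | monomial d c =>
    have h1 := isWeightedHomogeneous_monomial w d c rfl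
    by_cases h : Finsupp.weight w d = n
    · subst h
      rw [h1.weightedHomogeneousComponent_same, (hL _ _ h1).weightedHomogeneousComponent_same]
    · rw [h1.weightedHomogeneousComponent_ne _ (Ne.symm h), map_zero,
        (hL _ _ h1).weightedHomogeneousComponent_ne _ (fun h' => h (hθ h').symm)]
  | add f g hf hg => rw [map_add, map_add, map_add, map_add, hf, hg]

section Pol

open MvPolynomial

/-- Polynomials in the coordinates of `T` copies of the dual of `V`. -/
abbrev Pol (k K T V : Type) [Field k] [Field K] [AbGrp V] [Module k V] :=
  MvPolynomial ((BIdx k V) × T) K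

variable {k K T V W U : Type} [Field k] [Field K] [Algebra k K] [AbGrp V] [Module k V]
  [AbGrp W] [Module k W] [AbGrp U] [Module k U]

/-- The linear form attached to a vector. -/
def lin (k K : Type) {T V : Type} [Field k] [Field K] [Algebra k K] [AbGrp V] [Module k V]
  (t : T) : V →ₗ[k] Pol k K T V :=
  (BVec k V).constr k fun b => X (b, t)

lemma lin_basis (t : T) (b : BIdx k V) : lin k K t (BVec k V b) = (X (b, t) : Pol k K T V) := by
  rw [lin, Basis.constr_basis]

/-- Substitution of linear maps, slot by slot. -/
def slot (K : Type) [Field K] [Algebra k K] (φ : T → V →ₗ[k] W) : Pol k K T V →ₐ[K] Pol k K T W :=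
  aeval fun bt => lin k K bt.2 (φ bt.2 (BVec k V bt.1))

@[simp] lemma slot_X (φ : T → V →ₗ[k] W) (bt : BIdx k V × T) :
  slot K φ (X bt) = lin k K bt.2 (φ bt.2 (BVec k V bt.1)) := aeval_X _ _

lemma slot_lin (φ : T → V →ₗ[k] W) (t : T) (v : V) : slot K φ (lin k K t v) = lin k K t (φ t v) := by
  have : ((slot K φ).restrictScalars k).toLinearMap ∘ₗ lin k K t = lin k K t ∘ₗ φ t :=
    (BVec k V).ext fun b => by rw [comp_apply, lin_basis]; exact slot_X φ (b, t)
  exact LinearMap.congr_fun this v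

lemma slot_comp (ψ : T → W →ₗ[k] U) (φ : T → V →ₗ[k] W) (f : Pol k K T V) :
  slot K (fun t => ψ t ∘ₗ φ t) f = slot K ψ (slot K φ f) := by
  have : slot K (fun t => ψ t ∘ₗ φ t) = (slot K ψ).comp (slot K φ) :=
    algHom_ext fun bt => by rw [AlgHom.comp_apply, slot_X, slot_X, slot_lin]; rfl
  rw [this, AlgHom.comp_apply]

lemma slot_id (f : Pol k K T V) : slot K (fun _ => (.id : V →ₗ[k] V)) f = f := by
  have : slot K (fun _ => (.id : V →ₗ[k] V)) = AlgHom.id K (Pol k K T V) :=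
    algHom_ext fun bt => by rw [slot_X, LinearMap.id_apply, lin_basis]; rfl
  rw [this, AlgHom.id_apply]

variable {M : Type} [AddCommMonoid M] (wt : T → M)

/-- Homogeneity with respect to a weight on the slots. -/
abbrev IsHom (f : Pol k K T V) (μ : M) : Prop := IsWH (fun bt => wt bt.2) f μ

lemma hom_of_forall_basis {S : Submodule K (Pol k K T W)} (t : T)
  (h : ∀ b, (X (b, t) : Pol k K T W) ∈ S) (v : W) : lin k K t v ∈ S := by
  have h1 : (⊤ : Submodule k W) ≤ (S.restrictScalars k).comap (lin k K t) := by
    rw [← (BVec k W).span_eq, Submodule.span_le]; rintro _ ⟨b, rfl⟩; change lin k K t _ ∈ S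
    rw [lin_basis]; exact h b
  exact h1 (Submodule.mem_top (x := v))

lemma lin_hom (t : T) (v : V) : IsHom wt (lin k K t v : Pol k K T V) (wt t) :=
  hom_of_forall_basis (S := weightedHomogeneousSubmodule K
    (fun bt : (BIdx k V) × T => wt bt.2) (wt t)) t
    (fun b => isWeightedHomogeneous_X K (fun bt : (BIdx k V) × T => wt bt.2) (b, t)) v

lemma aeval_hom {σ σ' : Type} {w : σ → M} {w' : σ' → M} (x : σ → MvPolynomial σ' K)
  (hx : ∀ i, IsWH w' (x i) (w i)) {f : MvPolynomial σ K} {μ : M}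
  (hf : IsWH w f μ) : IsWH w' (aeval x f) μ := by
  rw [aeval_def, eval₂_eq]; refine IsWeightedHomogeneous.sum _ _ _ fun d hd => ?_
  refine IsWeightedHomogeneous.C_mul ?_ _
  have h1 := IsWeightedHomogeneous.prod (R := K) d.support (fun i => x i ^ d i) (fun i => d i • w i)
    (w := w') (fun i _ => (hx i).pow (d i))
  rwa [← hf (mem_support_iff.1 hd), weight_apply, Finsupp.sum]

lemma slot_hom (φ : T → V →ₗ[k] W) {f : Pol k K T V} {μ : M} (hf : IsHom wt f μ) :
  IsHom wt (slot K φ f) μ := by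
  rw [slot]
  exact aeval_hom (w := fun bt : (BIdx k V) × T => wt bt.2)
    (fun bt => lin k K bt.2 (φ bt.2 (BVec k V bt.1)))
    (fun bt => lin_hom wt bt.2 _) hf

/-- Polynomials of a given weight. -/
abbrev polObj (k K : Type) {T : Type} [Field k] [Field K] (wt : T → M) (μ : M) (V : Type)
  [AbGrp V] [Module k V] : Submodule K (Pol k K T V) :=
  weightedHomogeneousSubmodule K (fun bt : (BIdx k V) × T => wt bt.2) μ

/-- Substitution on polynomials of a given weight. -/
def slotHom (φ : T → V →ₗ[k] W) (μ : M) : polObj k K wt μ V →+ polObj k K wt μ W :=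
  ((slot K φ).toLinearMap.restrict fun _ hx => slot_hom wt φ hx).toAddMonoidHom

@[simp] lemma slotHom_coe (φ : T → V →ₗ[k] W) (μ : M) (x : polObj k K wt μ V) :
  (slotHom wt φ μ x : Pol k K T W) = slot K φ x := rfl

/-- The functor of polynomials of a given weight. -/
abbrev polF (k K : Type) {T : Type} [Field k] [Field K] [Algebra k K] (wt : T → M) (μ : M) :
  VFun k where
  obj V _ _ := polObj k K wt μ V
  grp V _ _ := inferInstance
  map f := slotHom wt (fun _ => f) μ
  map_id V _ _ x := Subtype.ext (slot_id x.1)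
  map_comp g f x := Subtype.ext (slot_comp (fun _ => g) (fun _ => f) x.1)

lemma slot_pd (f : Pol k K T V) {d : ℕ} (hf : ∀ s ∈ f.support, s.degree ≤ d) :
  PD (d + 1) (fun h : V →ₗ[k] W => slot K (fun _ => h) f) := by
  have hmon : ∀ (n : ℕ) (s : (BIdx k V) × T →₀ ℕ) (a : K), s.degree = n →
      PD (n + 1) (fun h : V →ₗ[k] W => slot K (fun _ => h) (monomial s a)) := by
    intro n
    induction n with
    | zero =>
      intro s a hs; rw [Finsupp.degree_eq_zero_iff] at hs; subst hs; intro h x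
      simp only [monomial_zero', algHom_C, sub_self]
    | succ n ih =>
      intro s a hs
      obtain ⟨i, hi⟩ : ∃ i, s i ≠ 0 := by
        by_contra! h; rw [show s = 0 from Finsupp.ext h] at hs; simp at hs
      have e : s = single i 1 + (s - single i 1) := by
        rw [add_tsub_cancel_of_le]; rwa [single_le_iff, Nat.one_le_iff_ne_zero]
      have hd : (s - single i 1).degree = n := by
        have := congrArg Finsupp.degree e; rw [map_add, Finsupp.degree_single, hs] at this; omega
      let L : (V →ₗ[k] W) →+ Pol k K T W :=
        (lin k K i.2).toAddMonoidHom.comp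
          (LinearMap.applyₗ (BVec k V i.1) : (V →ₗ[k] W) →ₗ[k] W).toAddMonoidHom
      have h1 := PD.mul (ih (s - single i 1) a hd) L
      have e' : (monomial s a : Pol k K T V) = X i * monomial (s - single i 1) a := by
        rw [X, monomial_mul, one_mul, ← e]
      have e'' : (fun h : V →ₗ[k] W => slot K (fun _ => h) (monomial s a)) =
          fun h => L h * slot K (fun _ => h) (monomial (s - single i 1) a) := by
        funext h; rw [e', map_mul, slot_X]; rfl
      rw [e'']; exact h1
  have e : (fun h : V →ₗ[k] W => slot K (fun _ => h) f) =
      fun h => ∑ s ∈ f.support, slot K (fun _ => h) (monomial s (coeff s f)) := by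
    funext h; rw [← map_sum, ← f.as_sum]
  rw [e]; exact PD.sum _ fun s hs => (hmon _ s _ rfl).mono_le (by have := hf s hs; omega)

lemma weight_hom_apply {σ M' : Type} [AddCommMonoid M'] (w : σ → M) (α : M →+ M') (s : σ →₀ ℕ) :
  α (Finsupp.weight w s) = Finsupp.weight (fun i => α (w i)) s := by
  simp [weight_apply, Finsupp.sum, map_sum]

lemma polF_poly (μ : M) (δ : M →+ ℕ) (hδ : ∀ t, δ (wt t) = 1) : (polF k K wt μ).Poly (δ μ) := by
  intro V W _ _ _ _ x
  refine PD.of_injective (f := (Submodule.subtype _).toAddMonoidHom) Subtype.val_injective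
    (slot_pd x.1 fun s hs => ?_)
  have h1 := congrArg δ (x.2 (mem_support_iff.1 hs)); rw [weight_hom_apply] at h1
  simp only [hδ] at h1; rw [← h1, weight_apply, Finsupp.degree_apply]; simp [Finsupp.sum]

lemma polF_tors (p : ℕ) [CharP K p] (μ : M) : (polF k K wt μ).Tors p := fun V _ _ x => by
  rw [charP_nsmul K]

lemma slot_eq_zero (φ : T → V →ₗ[k] W) (A : T → Prop) [DecidablePred A] (h0 : ∀ t, A t → φ t = 0)
  (α : M →+ ℕ) (hα : ∀ t, α (wt t) = if A t then 1 else 0) {μ : M} (hμ : α μ ≠ 0)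
  {f : Pol k K T V} (hf : IsHom wt f μ) : slot K φ f = 0 := by
  rw [slot, aeval_def, eval₂_eq]; refine sum_eq_zero fun s hs => ?_
  have h1 := congrArg α (hf (mem_support_iff.1 hs))
  rw [weight_hom_apply, weight_apply, Finsupp.sum] at h1
  obtain ⟨i, hi, hi'⟩ := Finset.exists_ne_zero_of_sum_ne_zero (h1.trans_ne hμ)
  have hA : A i.2 := by
    by_contra h
    rw [hα, if_neg h] at hi'; simp at hi'
  rw [Finset.prod_eq_zero hi, mul_zero]
  rw [h0 _ hA, LinearMap.zero_apply, map_zero, zero_pow (Finsupp.mem_support_iff.1 hi)]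

/-- Polynomials depending on two groups of slots. -/
def polF_bi (μ : M) (A : T → Prop) [DecidablePred A] (α β : M →+ ℕ)
  (hα : ∀ t, α (wt t) = if A t then 1 else 0) (hβ : ∀ t, β (wt t) = if ¬ A t then 1 else 0)
  (hμ : α μ ≠ 0) (hμ' : β μ ≠ 0) : (polF k K wt μ).Bi where
  map2 f g := slotHom wt (fun t => if A t then f else g) μ
  map2_self f x := Subtype.ext (by simp)
  map2_comp g g' f f' x := Subtype.ext (by
    rw [slotHom_coe, slotHom_coe, slotHom_coe, ← slot_comp]; congr 2; funext t; split_ifs <;> rfl)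
  zero_left g x := Subtype.ext (by
    rw [slotHom_coe, ZeroMemClass.coe_zero]
    exact slot_eq_zero wt (fun t => if A t then 0 else g) A (fun t ht => if_pos ht) α hα hμ x.2)
  zero_right f x := Subtype.ext (by
    rw [slotHom_coe, ZeroMemClass.coe_zero]
    exact slot_eq_zero wt (fun t => if A t then f else 0) (fun t => ¬ A t)
      (fun t ht => if_neg ht) β hβ hμ' x.2)

end Pol

/-! ### Quotient functors -/

namespace VFun

variable {k : Type} [Field k] (F : VFun k)

/-- The quotient by a subfunctor. -/
abbrev quot (S : ∀ (V : Type) [AbGrp V] [Module k V], AddSubgroup (F.obj V))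
  (hS : ∀ {V W : Type} [AbGrp V] [Module k V] [AbGrp W] [Module k W]
  (f : V →ₗ[k] W), ∀ x ∈ S V, F.map f x ∈ S W) : VFun k where
  obj V _ _ := F.obj V ⧸ S V
  grp V _ _ := inferInstance
  map {V W} _ _ _ _ f := QuotientAddGroup.map (S V) (S W) (F.map f) (hS f)
  map_id V _ _ x := by
    obtain ⟨y, rfl⟩ := mk_surjective x; exact congrArg QuotientAddGroup.mk (F.map_id V y)
  map_comp g f x := by
    obtain ⟨y, rfl⟩ := mk_surjective x; exact congrArg QuotientAddGroup.mk (F.map_comp g f y)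

lemma quot_poly (S hS) {d : ℕ} (h : F.Poly d) : (F.quot S hS).Poly d := by
  intro V W _ _ _ _ x; obtain ⟨y, rfl⟩ := mk_surjective x
  exact (h V W y).hom_comp (QuotientAddGroup.mk' (S W))

lemma quot_tors (S hS) {p : ℕ} (h : F.Tors p) : (F.quot S hS).Tors p := by
  intro V _ _ x; obtain ⟨y, rfl⟩ := mk_surjective x
  rw [← QuotientAddGroup.mk_nsmul, h V y, QuotientAddGroup.mk_zero]

/-- Pairs of maps act on the quotient. -/
def Bi.quot {F : VFun k} (B : F.Bi) (S hS)
  (hB : ∀ {V W : Type} [AbGrp V] [Module k V] [AbGrp W] [Module k W]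
  (f g : V →ₗ[k] W), ∀ x ∈ S V, B.map2 f g x ∈ S W) : (F.quot S hS).Bi where
  map2 {V W} _ _ _ _ f g := QuotientAddGroup.map (S V) (S W) (B.map2 f g) (hB f g)
  map2_self f x := by
    obtain ⟨y, rfl⟩ := mk_surjective x; exact congrArg QuotientAddGroup.mk (B.map2_self f y)
  map2_comp g g' f f' x := by
    obtain ⟨y, rfl⟩ := mk_surjective x; exact congrArg QuotientAddGroup.mk (B.map2_comp g g' f f' y)
  zero_left g x := by
    obtain ⟨y, rfl⟩ := mk_surjective x; exact congrArg QuotientAddGroup.mk (B.zero_left g y)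
  zero_right f x := by
    obtain ⟨y, rfl⟩ := mk_surjective x; exact congrArg QuotientAddGroup.mk (B.zero_right f y)

end VFun

/-! ### The shift derivation -/

section Shift

open MvPolynomial

lemma derivation_hom {σ K M : Type} [Field K] [AddCommMonoid M] {w : σ → M}
  (v : σ → MvPolynomial σ K) (c : M) (hv : ∀ i, IsWH w (v i) (w i + c))
  {f : MvPolynomial σ K} {n : M} (hf : IsWH w f n) :
  IsWH w (mkDerivation K v f) (n + c) := by
  induction hf using IsWeightedHomogeneous.induction_on with
  | zero => rw [map_zero]; exact isWeightedHomogeneous_zero _ _ _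
  | add f g _ _ hf hg => rw [map_add]; exact hf.add hg
  | monomial s r hs =>
    rw [mkDerivation_monomial, Finsupp.sum]
    refine (weightedHomogeneousSubmodule K w (n + c)).smul_mem r
      (IsWeightedHomogeneous.sum _ _ _ fun i hi => ?_)
    have h1 := (isWeightedHomogeneous_monomial w (s - single i 1) ((s i : ℕ) : K) rfl).mul (hv i)
    have h2 : Finsupp.weight w (s - single i 1) + (w i + c) = n + c := by
      rw [← add_assoc, ← hs]; congr 1
      have h3 : s - single i 1 + single i 1 = s := tsub_add_cancel_of_le (by
        rw [single_le_iff, Nat.one_le_iff_ne_zero]; exact Finsupp.mem_support_iff.1 hi)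
      conv_rhs => rw [← h3]
      rw [map_add, Finsupp.weight_single, one_smul]
    rwa [h2] at h1

lemma euler_hom {σ K : Type} [Field K] (w : σ → ℕ) {f : MvPolynomial σ K} {n : ℕ}
  (hf : IsWH w f n) : mkDerivation K (fun i => (w i : K) • X i) f = (n : K) • f := by
  induction hf using IsWeightedHomogeneous.induction_on with
  | zero => simp
  | add f g _ _ hf hg => rw [map_add, hf, hg, smul_add]
  | monomial s r hs =>
    rw [mkDerivation_monomial, ← hs, weight_apply, Finsupp.sum, Finsupp.sum, Nat.cast_sum,
      Finset.sum_smul, Finset.smul_sum]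
    refine sum_congr rfl fun i hi => ?_
    have h1 : (monomial (s - single i 1) ((s i : ℕ) : K)) * X i = (s i : K) • monomial s 1 := by
      rw [X, monomial_mul, mul_one, tsub_add_cancel_of_le, smul_monomial, smul_eq_mul, mul_one]
      rw [single_le_iff, Nat.one_le_iff_ne_zero]; exact Finsupp.mem_support_iff.1 hi
    rw [smul_eq_mul, mul_smul_comm, h1, smul_smul, smul_smul, smul_monomial, smul_monomial]; congr 1
    simp only [smul_eq_mul]; push_cast; ring

lemma derivation_iterate_mul {K A : Type} [Field K] [CommRing A] [Algebra K A]
  (D : Derivation K A A) (n : ℕ) (a b : A) : ((D : A →ₗ[K] A) ^ n) (a * b) =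
  ∑ ij ∈ Finset.HasAntidiagonal.antidiagonal n,
  n.choose ij.1 • (((D : A →ₗ[K] A) ^ ij.1) a * ((D : A →ₗ[K] A) ^ ij.2) b) := by
  induction n with
  | zero => simp
  | succ n ih =>
    rw [Finset.sum_antidiagonal_choose_succ_nsmul
      (M := A) (fun i j => ((D : A →ₗ[K] A) ^ i) a * ((D : A →ₗ[K] A) ^ j) b) n, pow_succ',
      End.mul_apply, ih, map_sum, ← sum_add_distrib]
    refine sum_congr rfl fun ij hij => ?_
    rw [n.choose_symm_of_eq_add (Finset.HasAntidiagonal.mem_antidiagonal.1 hij).symm, map_nsmul,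
      ← nsmul_add]
    congr 1; rw [pow_succ', pow_succ', End.mul_apply, End.mul_apply]; change D (_ * _) = _
    rw [D.leibniz, smul_eq_mul, smul_eq_mul, mul_comm (((D : A →ₗ[K] A) ^ ij.2) b)]; rfl

variable {K ι : Type} [Field K] {p : ℕ} [Fact p.Prime] [CharP K p]
local notation "MP" => MvPolynomial (ι × Fin p) K

/-- The variables of a block. -/
def blk (K : Type) [Field K] (p : ℕ) (i : ι) (n : ℕ) : MvPolynomial (ι × Fin p) K :=
  if h : n < p then X (i, ⟨n, h⟩) else 0

lemma blk_fin (i : ι) (t : Fin p) : blk K p i t = X (i, t) := dif_pos t.2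

lemma blk_of_le (i : ι) {n : ℕ} (h : p ≤ n) : blk K p i n = 0 := dif_neg (by omega)

/-- The derivation shifting the slots. -/
def shift (K ι : Type) [Field K] (p : ℕ) :
  Derivation K (MvPolynomial (ι × Fin p) K) (MvPolynomial (ι × Fin p) K) :=
  mkDerivation K fun it => blk K p it.1 (it.2 + 1)

/-- The shift as a linear map. -/
abbrev shl (K ι : Type) [Field K] (p : ℕ) : Module.End K (MvPolynomial (ι × Fin p) K) :=
  (shift K ι p : MvPolynomial (ι × Fin p) K →ₗ[K] MvPolynomial (ι × Fin p) K)

local notation "Dl" => shl K ι p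
local notation "Ds" => shift K ι p

lemma shift_blk (i : ι) (n : ℕ) : Ds (blk K p i n) = blk K p i (n + 1) := by
  by_cases h : n < p
  · have := blk_fin (K := K) i (⟨n, h⟩ : Fin p); rw [show blk K p i n = X (i, ⟨n, h⟩) from this]
    exact mkDerivation_X _ _ _
  · rw [blk_of_le i (by omega), blk_of_le i (by omega), map_zero]

lemma shl_pow_blk (i : ι) (n j : ℕ) : (Dl ^ j) (blk K p i n) = blk K p i (n + j) := by
  induction j with
  | zero => rfl
  | succ j ih =>
    rw [pow_succ', End.mul_apply, ih]; exact shift_blk i (n + j)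

lemma shl_pow_prime (f : MP) : (Dl ^ p) f = 0 := by
  have hp := primeOut p
  induction f using MvPolynomial.induction_on with
  | C a =>
    obtain ⟨q, hq⟩ : ∃ q, p = q + 1 := ⟨p - 1, by have := hp.pos; omega⟩
    have h : Dl (C a) = 0 := derivation_C _ a
    have h2 : Dl ^ p = Dl ^ q * Dl := by
      conv_lhs => rw [show Dl ^ p = Dl ^ (q + 1) by rw [← hq]]
      rw [pow_succ]
    rw [h2, End.mul_apply, h, map_zero]
  | add f g hf hg => rw [map_add, hf, hg, add_zero]
  | mul_X f it hf =>
    rw [derivation_iterate_mul]; refine sum_eq_zero fun ij hij => ?_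
    rw [Finset.HasAntidiagonal.mem_antidiagonal] at hij; rcases Nat.eq_zero_or_pos ij.1 with h | h
    · have h2 : ij.2 = p := by omega
      rw [h2, ← blk_fin it.1 it.2, shl_pow_blk, blk_of_le _ (by omega), mul_zero, smul_zero]
    · rcases Nat.eq_zero_or_pos ij.2 with h' | h'
      · have h2 : ij.1 = p := by omega
        rw [h2, hf, zero_mul, smul_zero]
      · rw [← Nat.cast_smul_eq_nsmul K, (CharP.cast_eq_zero_iff K p _).2
          (hp.dvd_choose_self (by omega) (by omega)), zero_smul]

/-- The lowering derivation of a block. -/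
def lower (K : Type) {ι : Type} [Field K] (p : ℕ) [DecidableEq ι] (i : ι) :
  Derivation K (MvPolynomial (ι × Fin p) K) (MvPolynomial (ι × Fin p) K) :=
  mkDerivation K fun jt => if jt.1 = i then -((jt.2 : ℕ) : K) • blk K p i (jt.2 - 1) else 0

lemma lower_blk [DecidableEq ι] (i j : ι) (n : ℕ) (hn : n ≤ p) : lower K p i (blk K p j n) =
  if j = i then -(n : K) • blk K p i (n - 1) else 0 := by
  rcases hn.lt_or_eq with h | rfl
  · rw [show blk K p j n = X (j, ⟨n, h⟩) from blk_fin (K := K) j (⟨n, h⟩ : Fin p)]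
    exact mkDerivation_X _ _ _
  · rw [blk_of_le j le_rfl, map_zero, CharP.cast_eq_zero, neg_zero, zero_smul, ite_self]

/-- The block degrees. -/
abbrev bdeg (ι : Type) (p : ℕ) : ι × Fin p → (ι →₀ ℕ) := fun it => single it.1 1

local notation "bd" => bdeg ι p

lemma shift_lower [DecidableEq ι] (i : ι) {f : MP} {δ : ι →₀ ℕ} (hf : IsWH bd f δ) :
  Ds (lower K p i f) - lower K p i (Ds f) = (δ i : K) • f := by
  have h1 : ⁅Ds, lower K p i⁆ =
      mkDerivation K fun it => ((if it.1 = i then 1 else 0 : ℕ) : K) • X it := by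
    refine derivation_ext fun jt => ?_
    rw [Derivation.commutator_apply, mkDerivation_X, ← blk_fin jt.1 jt.2, shift_blk,
      lower_blk i _ _ jt.2.2.le, lower_blk i _ _ (Nat.succ_le_of_lt jt.2.2)]
    split_ifs with h
    · rw [Derivation.map_smul, shift_blk, h, Nat.succ_sub_one]
      rcases Nat.eq_zero_or_pos (jt.2 : ℕ) with h0 | h0
      · simp [h0]
      · rw [Nat.sub_add_cancel h0, ← sub_smul]; congr 1; push_cast; ring
    · simp
  have h2 : IsWH (fun it : ι × Fin p => if it.1 = i then 1 else 0) f (δ i) := by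
    intro s hs; rw [← hf hs, ← Finsupp.applyAddHom_apply, weight_hom_apply]; congr 2; funext it
    simp [Finsupp.single_apply]
  rw [← euler_hom _ h2, ← h1, Derivation.commutator_apply]

lemma lower_hom [DecidableEq ι] (i : ι) {f : MP} {δ : ι →₀ ℕ} (hf : IsWH bd f δ) :
  IsWH bd (lower K p i f) δ := by
  have := derivation_hom (w := bd) (fun jt => if jt.1 = i then
    -((jt.2 : ℕ) : K) • blk K p i (jt.2 - 1) else 0) 0 (fun jt => ?_) hf
  · rwa [add_zero] at this
  · rw [add_zero]; split_ifs with h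
    · refine (weightedHomogeneousSubmodule K _ _).smul_mem _ ?_
      rw [blk, dif_pos (by have := jt.2.2; omega)]
      have := isWeightedHomogeneous_X K bd (i, (⟨jt.2 - 1, by have := jt.2.2; omega⟩ : Fin p))
      rw [bdeg, h]; exact this
    · exact isWeightedHomogeneous_zero _ _ _

lemma blk_hom {M : Type} [AddCommMonoid M] (w : ι × Fin p → M) (i : ι) (n : ℕ) (m : M)
  (h : ∀ h : n < p, w (i, ⟨n, h⟩) = m) : IsWH w (blk K p i n) m := by
  rw [blk]; split_ifs with hn
  · rw [← h hn]; exact isWeightedHomogeneous_X K w _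
  · exact isWeightedHomogeneous_zero _ _ _

lemma shift_hom {f : MP} {δ : ι →₀ ℕ} (hf : IsWH bd f δ) : IsWH bd (Ds f) δ := by
  have := derivation_hom (w := bd) (fun it => blk K p it.1 (it.2 + 1)) 0
    (fun it => by rw [add_zero]; exact blk_hom _ _ _ _ fun _ => rfl) hf
  rwa [add_zero] at this

lemma shl_pow_hom (j : ℕ) {f : MP} {δ : ι →₀ ℕ} (hf : IsWH bd f δ) : IsWH bd ((Dl ^ j) f) δ := by
  induction j with
  | zero => exact hf
  | succ j ih => rw [pow_succ', End.mul_apply]; exact shift_hom ih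

lemma exists_shl_of_not_dvd (i : ι) {f : MP} {δ : ι →₀ ℕ} (hf : IsWH bd f δ) (hδ : ¬ p ∣ δ i)
  {I : Ideal MP}
  (hI : ∀ a ∈ I, Ds a ∈ I) (hI' : [DecidableEq ι] → ∀ a ∈ I, lower K p i a ∈ I)
  (h0 : Ds f ∈ I) :
  ∃ g, IsWH bd g δ ∧ f - (Dl ^ (p - 1)) g ∈ I := by
  classical
  have hp := primeOut p
  have hc : (δ i : K) ≠ 0 := by rwa [Ne, CharP.cast_eq_zero_iff K p]
  let L : Module.End K MP :=
    (lower K p i : MP →ₗ[K] _)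
  have hL : ∀ n, IsWH bd ((L ^ n) f) δ := by
    intro n
    induction n with
    | zero => exact hf
    | succ n ih => rw [pow_succ', End.mul_apply]; exact lower_hom i ih
  have h1 : ∀ n : ℕ, Dl ((L ^ n) f) - ((n : K) * (δ i : K)) • (L ^ (n - 1)) f ∈ I := by
    intro n
    induction n with
    | zero => simpa using h0
    | succ n ih =>
      have e := shift_lower i (hL n)
      have e1 : Dl ((L ^ (n + 1)) f) = L (Dl ((L ^ n) f)) + (δ i : K) • (L ^ n) f := by
        rw [pow_succ', End.mul_apply, ← e]
        exact (add_sub_cancel _ _).symm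
      have h2 : L (Dl ((L ^ n) f) - ((n : K) * (δ i : K)) • (L ^ (n - 1)) f) ∈ I := hI' _ ih
      rw [e1, Nat.add_sub_cancel]
      convert h2 using 1
      rw [map_sub, map_smul]
      rcases n with _ | n
      · simp
      · have e2 : L ((L ^ n) f) = (L ^ (n + 1)) f := by rw [pow_succ', End.mul_apply]
        rw [Nat.add_sub_cancel, e2]
        push_cast
        rw [add_mul ((n : K) + 1), one_mul, add_smul]
        abel
  have hpow : ∀ j, ∀ a ∈ I, (Dl ^ j) a ∈ I := by
    intro j
    induction j with
    | zero => exact fun a ha => ha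
    | succ j ih =>
      intro a ha
      rw [pow_succ', End.mul_apply]
      exact hI _ (ih a ha)
  have h3 : ∀ n : ℕ, (Dl ^ n) ((L ^ n) f) - ((n.factorial : K) * (δ i : K) ^ n) • f ∈ I := by
    intro n
    induction n with
    | zero => simp
    | succ n ih =>
      have h4 := hpow n _ (h1 (n + 1))
      rw [map_sub, map_smul, Nat.add_sub_cancel, ← End.mul_apply, ← pow_succ] at h4
      have h5 : (((n + 1 : ℕ) : K) * (δ i : K)) • ((Dl ^ n) ((L ^ n) f) -
          ((n.factorial : K) * (δ i : K) ^ n) • f) ∈ I := by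
        rw [← C_mul']
        exact I.mul_mem_left _ ih
      convert I.add_mem h4 h5 using 1
      rw [smul_sub, smul_smul, sub_add_sub_cancel]
      congr 2
      rw [Nat.factorial_succ]
      push_cast
      ring
  have hu : ((p - 1).factorial : K) * (δ i : K) ^ (p - 1) ≠ 0 := by
    refine mul_ne_zero ?_ (pow_ne_zero _ hc)
    rw [Ne, CharP.cast_eq_zero_iff K p, hp.dvd_factorial]
    have := hp.pos
    omega
  set u := ((p - 1).factorial : K) * (δ i : K) ^ (p - 1)
  refine ⟨u⁻¹ • (L ^ (p - 1)) f, (weightedHomogeneousSubmodule K _ _).smul_mem _ (hL _), ?_⟩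
  have h7 : C (-u⁻¹) * ((Dl ^ (p - 1)) ((L ^ (p - 1)) f) - u • f) ∈ I :=
    I.mul_mem_left _ (h3 (p - 1))
  convert h7 using 1
  rw [C_mul', map_smul, neg_smul, smul_sub, smul_smul, inv_mul_cancel₀ hu, one_smul]
  abel

end Shift

/-! ### Exactness of the shift -/

section ShiftExact

open MvPolynomial

variable {K ι : Type} [Field K] {p : ℕ} [Fact p.Prime] [CharP K p]
local notation "MP" => MvPolynomial (ι × Fin p) K
local notation "Dl" => shl K ι p
local notation "Ds" => shift K ι p
local notation "bd" => bdeg ι p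

/-- The first slot. -/
def slot₀ (p : ℕ) [Fact p.Prime] : Fin p := ⟨0, (primeOut p).pos⟩

/-- Exponents of the generators of `truncI`. -/
def truncS (p : ℕ) [Fact p.Prime] (i : ι) (m : ℕ) : Set (ι × Fin p →₀ ℕ) :=
  {s | s = single (i, slot₀ p) p ∨ ∃ t : Fin p, m ≤ t ∧ s = single (i, t) 1}

/-- The ideal generated by the `p`-th power of the first variable of a block and the variables
from the `m`-th on. -/
def truncI (K : Type) [Field K] (p : ℕ) [Fact p.Prime] (i : ι) (m : ℕ) :
  Ideal (MvPolynomial (ι × Fin p) K) :=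
  Ideal.span ((fun s => monomial s (1 : K)) '' truncS p i m)

local notation "TI" => truncI K p

lemma mem_truncI {i : ι} {m : ℕ} {f : MP} :
  f ∈ TI i m ↔ ∀ s ∈ f.support, p ≤ s (i, slot₀ p) ∨ ∃ t : Fin p, m ≤ t ∧ 1 ≤ s (i, t) := by
  rw [truncI, mem_ideal_span_monomial_image]; refine forall₂_congr fun s _ => ⟨?_, ?_⟩
  · rintro ⟨_, rfl | ⟨t, ht, rfl⟩, h⟩
    · exact Or.inl (single_le_iff.1 h)
    · exact Or.inr ⟨t, ht, single_le_iff.1 h⟩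
  · rintro (h | ⟨t, ht, h⟩)
    · exact ⟨_, Or.inl rfl, single_le_iff.2 h⟩
    · exact ⟨_, Or.inr ⟨t, ht, rfl⟩, single_le_iff.2 h⟩

lemma truncI_anti (i : ι) {m m' : ℕ} (h : m ≤ m') : TI i m' ≤ TI i m := by
  intro f hf; rw [mem_truncI] at hf ⊢
  exact fun s hs => (hf s hs).imp id fun ⟨t, ht, h'⟩ => ⟨t, h.trans ht, h'⟩

lemma derivation_mem_span {A : Type} [CommRing A] [Algebra K A] (D : Derivation K A A) (S : Set A)
  (h : ∀ a ∈ S, D a ∈ Ideal.span S) {a : A} (ha : a ∈ Ideal.span S) : D a ∈ Ideal.span S := by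
  induction ha using Submodule.span_induction with
  | mem x hx => exact h x hx
  | zero => rw [map_zero]; exact zero_mem _
  | add x y _ _ hx hy => rw [map_add]; exact add_mem hx hy
  | smul a x hx' hx =>
    rw [smul_eq_mul, D.leibniz]
    exact add_mem (Submodule.smul_mem _ _ hx) (Ideal.mul_mem_right _ _ hx')

lemma derivation_pow_char {A : Type} [CommRing A] [Algebra K A] (D : Derivation K A A) (a : A) :
  D (a ^ p) = 0 := by
  rw [D.leibniz_pow, charP_nsmul K]

lemma blk_mem_truncI (i : ι) {m n : ℕ} (h : m ≤ n) : blk K p i n ∈ TI i m := by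
  rw [blk]; split_ifs with hn
  · exact Ideal.subset_span ⟨_, Or.inr ⟨⟨n, hn⟩, h, rfl⟩, rfl⟩
  · exact zero_mem _

lemma shift_mem_truncI {i : ι} {m : ℕ} {f : MP} (hf : f ∈ TI i m) : Ds f ∈ TI i m := by
  refine derivation_mem_span _ _ ?_ hf; rintro _ ⟨_, rfl | ⟨t, ht, rfl⟩, rfl⟩
  · dsimp only
    rw [← X_pow_eq_monomial, derivation_pow_char]; exact zero_mem _
  · have : Ds (X (i, t)) ∈ TI i m := by
      rw [← blk_fin, shift_blk]; exact blk_mem_truncI i (by omega)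
    exact this

lemma shl_pow_mem_truncI {i : ι} {m : ℕ} (j : ℕ) {f : MP}
  (hf : f ∈ TI i m) : (Dl ^ j) f ∈ TI i m := by
  induction j with
  | zero => exact hf
  | succ j ih => rw [pow_succ', End.mul_apply]; exact shift_mem_truncI ih

lemma lower_mem_truncI [DecidableEq ι] {i : ι} {f : MP}
  (hf : f ∈ TI i p) : lower K p i f ∈ TI i p := by
  refine derivation_mem_span _ _ ?_ hf; rintro _ ⟨_, rfl | ⟨t, ht, rfl⟩, rfl⟩
  · dsimp only
    rw [← X_pow_eq_monomial, derivation_pow_char]; exact zero_mem _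
  · exact absurd t.2 (by omega)

/-- Exactness modulo `truncI` in a given block degree. -/
def ExactAt (K : Type) [Field K] (p : ℕ) [Fact p.Prime] (i : ι) (δ : ι →₀ ℕ) (m d : ℕ) : Prop :=
  ∀ f : MvPolynomial (ι × Fin p) K, IsWH (bdeg ι p) f (δ + single i d) →
    shift K ι p f ∈ truncI K p i m → ∃ g, IsWH (bdeg ι p) g
      (δ + single i d) ∧ f - (shl K ι p ^ (p - 1)) g ∈ truncI K p i m

lemma ExactAt.pow {i : ι} {δ : ι →₀ ℕ} {m d : ℕ} (h : ExactAt K p i δ m d) (j : ℕ) (hj : j + 1 ≤ p) :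
  ∀ f : MP, IsWH bd f (δ + single i d) →
  (Dl ^ (j + 1)) f ∈ TI i m → ∃ g, IsWH bd g
  (δ + single i d) ∧ f - (Dl ^ (p - (j + 1))) g ∈ TI i m := by
  induction j with
  | zero => exact fun f hf h0 => h f hf (by rwa [zero_add, pow_one] at h0)
  | succ j ih =>
    intro f hf h0; rw [pow_succ', End.mul_apply] at h0
    obtain ⟨g, hg, hg'⟩ := h _ (shl_pow_hom (j + 1) hf) h0
    have e : p - 1 = j + 1 + (p - (j + 1 + 1)) := by omega
    rw [e, pow_add Dl (j + 1) (p - (j + 1 + 1)), End.mul_apply _ _ g, ← map_sub] at hg'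
    obtain ⟨g', hg1, hg2⟩ := ih (by omega) _ (hf.sub (shl_pow_hom _ hg)) hg'
    refine ⟨g + Ds g', hg.add (shift_hom hg1), ?_⟩
    have e2 : p - (j + 1) = p - (j + 1 + 1) + 1 := by omega
    rw [e2, pow_succ, End.mul_apply] at hg2; rw [map_add, ← sub_sub]; exact hg2

lemma exists_sub_X_mul_mem {i : ι} {δ : ι →₀ ℕ} {d : ℕ} (t : Fin p) {u : MP}
  (hu : IsWH bd u (δ + single i (d + 1)))
  (hI : u ∈ TI i t) : ∃ f, IsWH bd f (δ + single i d) ∧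
  u - X (i, t) * f ∈ TI i (t + 1) := by
  refine ⟨u.divMonomial (single (i, t) 1), fun s hs => ?_, ?_⟩
  · rw [coeff_divMonomial] at hs; have h1 := hu hs
    rw [map_add, Finsupp.weight_single, one_smul, Finsupp.single_add, ← add_assoc,
      add_comm (δ + _)] at h1
    exact add_left_cancel h1
  · have e : u - X (i, t) * (u.divMonomial (single (i, t) 1)) =
        u.modMonomial (single (i, t) 1) := by
      rw [sub_eq_iff_eq_add, add_comm]; exact (divMonomial_add_modMonomial_single u (i, t)).symm
    rw [e, mem_truncI]; intro s hs; rw [MvPolynomial.mem_support_iff] at hs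
    have hle : ¬ single (i, t) 1 ≤ s := fun h => hs (coeff_modMonomial_of_le u h)
    rw [coeff_modMonomial_of_not_le u hle] at hs
    refine (mem_truncI.1 hI s (MvPolynomial.mem_support_iff.2 hs)).imp id ?_
    rintro ⟨t', ht', h⟩; refine ⟨t', ?_, h⟩
    have : (t' : ℕ) ≠ t := by intro h'; rw [Fin.ext h'] at h; exact hle (single_le_iff.2 h)
    omega

lemma mem_of_X_mul_mem {i : ι} (t : Fin p) (ht : 1 ≤ (t : ℕ)) {f : MP}
  (h : X (i, t) * f ∈ TI i (t + 1)) : f ∈ TI i (t + 1) := by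
  classical
  rw [mem_truncI] at h ⊢
  intro s hs
  have h1 := h (single (i, t) 1 + s) (by
    rw [MvPolynomial.mem_support_iff, coeff_X_mul]
    exact MvPolynomial.mem_support_iff.1 hs)
  have h2 : ∀ t' : Fin p, (t' : ℕ) ≠ t → (single (i, t) 1 + s : ι × Fin p →₀ ℕ) (i, t') = s (i, t') := by
    intro t' h'
    rw [Finsupp.add_apply, Finsupp.single_apply, if_neg, zero_add]
    intro e
    exact h' (congrArg (fun x => (x.2 : ℕ)) e).symm
  rw [h2 _ (by change 0 ≠ _; omega)] at h1
  refine h1.imp id ?_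
  rintro ⟨t', ht', h'⟩
  rw [h2 _ (by omega)] at h'
  exact ⟨t', ht', h'⟩

lemma shl_pow_X_mul {i : ι} (t : Fin p) (j : ℕ) (f : MP) :
  (Dl ^ j) (X (i, t) * f) - X (i, t) * (Dl ^ j) f ∈ TI i (t + 1) := by
  induction j with
  | zero => simp
  | succ j ih =>
    have h1 : Ds _ ∈ _ := shift_mem_truncI ih
    rw [map_sub, Derivation.leibniz, ← blk_fin, shift_blk, smul_eq_mul, smul_eq_mul, ← sub_sub] at h1
    have h2 := (TI i (t + 1)).add_mem h1
      ((TI i (t + 1)).mul_mem_left ((Dl ^ j) f) (blk_mem_truncI i le_rfl))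
    rw [sub_add_cancel, blk_fin] at h2; rw [pow_succ', End.mul_apply, End.mul_apply]; exact h2

lemma X_mul_hom {i : ι} (t : Fin p) {δ : ι →₀ ℕ} {d : ℕ} {f : MP}
  (hf : IsWH bd f (δ + single i d)) :
  IsWH bd (X (i, t) * f) (δ + single i (d + 1)) := by
  have := (isWeightedHomogeneous_X K bd (i, t)).mul hf
  rwa [add_left_comm, ← Finsupp.single_add, add_comm 1] at this

lemma ExactAt.step_up {i : ι} {δ : ι →₀ ℕ} (t : Fin p) (ht : 1 ≤ (t : ℕ)) {d : ℕ}
  (h₁ : ExactAt K p i δ (t + 1) d) (h₂ : ExactAt K p i δ t (d + 1)) :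
  ExactAt K p i δ (t + 1) (d + 1) := by
  intro f hf h0; obtain ⟨g, hg, hg'⟩ := h₂ f hf (truncI_anti i (Nat.le_succ _) h0)
  obtain ⟨f', hf', hu⟩ := exists_sub_X_mul_mem t (hf.sub (shl_pow_hom _ hg)) hg'
  have h3 : Ds f - Ds ((Dl ^ (p - 1)) g) - Ds (X (i, t) * f') ∈ TI i (t + 1) := by
    rw [← map_sub, ← map_sub]; exact shift_mem_truncI hu
  have h4 : Ds ((Dl ^ (p - 1)) g) = 0 := by
    have := shl_pow_prime g; have hp := (primeOut p).pos
    rw [show Dl ^ p = Dl ^ (p - 1 + 1) by rw [Nat.sub_add_cancel hp], pow_succ',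
      End.mul_apply] at this
    exact this
  rw [h4, sub_zero] at h3
  have h5 : Ds (X (i, t) * f') ∈ TI i (t + 1) := by
    have := (TI i (t + 1)).sub_mem h0 h3; rwa [sub_sub_cancel] at this
  have h6 := shl_pow_X_mul (K := K) (i := i) t 1 f'; rw [pow_one] at h6
  have h7 : X (i, t) * Ds f' ∈ TI i (t + 1) := by
    have := (TI i (t + 1)).sub_mem h5 h6
    rwa [show Dl (X (i, t) * f') = Ds (X (i, t) * f') from rfl, sub_sub_cancel] at this
  obtain ⟨g', hg1, hg2⟩ := h₁ f' hf' (mem_of_X_mul_mem t ht h7)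
  refine ⟨g + X (i, t) * g', hg.add (X_mul_hom t hg1), ?_⟩
  have h8 := (TI i (t + 1)).add_mem hu ((TI i (t + 1)).mul_mem_left (X (i, t)) hg2)
  convert (TI i (t + 1)).sub_mem h8 (shl_pow_X_mul t (p - 1) g') using 1
  rw [map_add]; ring

lemma ExactAt.step_down {i : ι} {δ : ι →₀ ℕ} (t : Fin p) (ht : 1 ≤ (t : ℕ)) {d : ℕ}
  (h₁ : ExactAt K p i δ (t + 1) d) (h₂ : ExactAt K p i δ (t + 1) (d + 1)) :
  ExactAt K p i δ t (d + 1) := by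
  intro f hf h0; have hp := (primeOut p).two_le
  obtain ⟨s, hs, hs'⟩ := exists_sub_X_mul_mem t (shift_hom hf) h0
  have h3 := shl_pow_mem_truncI (p - 1) hs'
  have h4 : (Dl ^ (p - 1)) (Ds f) = 0 := by
    have := shl_pow_prime f
    rw [show Dl ^ p = Dl ^ (p - 1 + 1) by rw [Nat.sub_add_cancel (by omega)], pow_succ,
      End.mul_apply] at this
    exact this
  rw [map_sub, h4, zero_sub, neg_mem_iff] at h3
  have h5 : X (i, t) * (Dl ^ (p - 1)) s ∈ TI i (t + 1) := by
    have := (TI i (t + 1)).sub_mem h3 (shl_pow_X_mul t (p - 1) s); rwa [sub_sub_cancel] at this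
  obtain ⟨s', hs1, hs2⟩ := h₁.pow (p - 2) (by omega) s hs (by
    rw [show p - 2 + 1 = p - 1 by omega]; exact mem_of_X_mul_mem t ht h5)
  rw [show p - (p - 2 + 1) = 1 by omega, pow_one] at hs2
  have h6 := shl_pow_X_mul (K := K) (i := i) t 1 s'; rw [pow_one] at h6
  obtain ⟨g, hg, hg'⟩ := h₂ (f - X (i, t) * s') (hf.sub (X_mul_hom t hs1)) (by
    have := (TI i (t + 1)).sub_mem ((TI i (t + 1)).add_mem hs'
      ((TI i (t + 1)).mul_mem_left (X (i, t)) hs2)) h6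
    convert this using 1
    rw [map_sub, show Dl (X (i, t) * s') = Ds (X (i, t) * s') from rfl]; ring)
  refine ⟨g, hg, ?_⟩
  have h7 : X (i, t) * s' ∈ TI i t := by
    rw [← blk_fin]; exact Ideal.mul_mem_right _ _ (blk_mem_truncI i le_rfl)
  convert (TI i t).add_mem (truncI_anti i (Nat.le_succ _) hg') h7 using 1; ring

lemma exactAt_of_lt (i : ι) {δ : ι →₀ ℕ} (hδ : δ i = 0) (n : ℕ) : ∀ m d, m + n = p → 1 ≤ m →
  n < d → d < p → ExactAt K p i δ m d := by
  induction n with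
  | zero =>
    intro m d hm _ hd hd' f hf h0; obtain rfl : m = p := by omega
    refine exists_shl_of_not_dvd i hf ?_ (fun a ha => shift_mem_truncI ha)
      (fun a ha => lower_mem_truncI ha) h0
    rw [Finsupp.add_apply, hδ, zero_add, Finsupp.single_eq_same]
    exact Nat.not_dvd_of_pos_of_lt hd hd'
  | succ n ih =>
    intro m d hm h1 hd hd'; obtain ⟨d, rfl⟩ : ∃ e, d = e + 1 := ⟨d - 1, by omega⟩
    exact ExactAt.step_down (⟨m, by omega⟩ : Fin p) h1 (ih (m + 1) d (by omega) (by omega)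
      (by omega) (by omega)) (ih (m + 1) (d + 1) (by omega) (by omega) (by omega) (by omega))

lemma exactAt_of_le (i : ι) {δ : ι →₀ ℕ} (hδ : δ i = 0) (m : ℕ) : m + 1 ≤ p → ∀ d, p ≤ d →
  ExactAt K p i δ (m + 1) d := by
  induction m with
  | zero =>
    intro _ d hd f hf _; refine ⟨0, isWeightedHomogeneous_zero _ _ _, ?_⟩
    rw [map_zero, sub_zero, mem_truncI]; intro s hs; by_contra! hcon
    have h1 := congrArg (Finsupp.applyAddHom i) (hf (MvPolynomial.mem_support_iff.1 hs))
    rw [weight_hom_apply, Finsupp.applyAddHom_apply, Finsupp.add_apply, hδ, zero_add,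
      Finsupp.single_eq_same, weight_apply, Finsupp.sum] at h1
    have h2 : ∑ jt ∈ s.support, s jt • (Finsupp.applyAddHom i) (bd jt) ≤ s (i, slot₀ p) := by
      rw [sum_eq_single (i, slot₀ p)]
      · simp
      · rintro ⟨j, t⟩ hjt hne; rw [Finsupp.applyAddHom_apply]
        by_cases hj : j = i
        · subst hj
          have ht : 1 ≤ (t : ℕ) := by
            by_contra h
            exact hne (Prod.ext rfl (Fin.ext (by change (t : ℕ) = 0; omega)))
          have := hcon.2 t ht; exact absurd (Finsupp.mem_support_iff.1 hjt) (by omega)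
        · simp [Finsupp.single_apply, hj]
      · intro h; simp [Finsupp.notMem_support_iff.1 h]
    omega
  | succ m ih =>
    intro hm d hd
    induction d, hd using Nat.le_induction with
    | base =>
      have h1 : ExactAt K p i δ (m + 1 + 1) (p - 1) :=
        exactAt_of_lt i hδ (p - (m + 2)) _ _ (by omega) (by omega) (by omega) (by omega)
      have h2 := ih (by omega) (p - 1 + 1) (by omega)
      have h3 := ExactAt.step_up (⟨m + 1, by omega⟩ : Fin p) (Nat.le_add_left 1 m) h1 h2
      rwa [Nat.sub_add_cancel (by omega)] at h3
    | succ d hd ihd =>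
      exact ExactAt.step_up (⟨m + 1, by omega⟩ : Fin p) (Nat.le_add_left 1 m) ihd
        (ih (by omega) (d + 1) (by omega))

/-- Weight of the slots. -/
abbrev slotWt (ι : Type) (p : ℕ) : ι × Fin p → ℤ := fun it => (it.2 : ℤ)

lemma exists_shl_add (n : ℕ) : ∀ (f : MP) (δ : ι →₀ ℕ), δ.degree ≤ n →
    IsWH bd f δ → Ds f = 0 →
    ∃ g u, IsWH (slotWt ι p) u 0 ∧ f = (Dl ^ (p - 1)) g + u := by
  have hp := primeOut p
  induction n using Nat.strong_induction_on with
  | _ n ih =>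
  intro f δ hδ hf h0
  by_cases h1 : ∃ i, p ≤ δ i
  · obtain ⟨i, hi⟩ := h1
    have e : δ = δ.erase i + single i (δ i) := by rw [add_comm, Finsupp.single_add_erase]
    have h2 := exactAt_of_le (K := K) (p := p) i (δ := δ.erase i) (Finsupp.erase_same) (p - 1)
      (by have := hp.pos; omega) (δ i) hi f (e ▸ hf) (by rw [h0]; exact Submodule.zero_mem _)
    rw [Nat.sub_add_cancel hp.pos, ← e] at h2
    obtain ⟨g, hg, hg'⟩ := h2
    set q := f - (Dl ^ (p - 1)) g with hq
    have hqh : IsWH bd q δ := hf.sub (shl_pow_hom _ hg)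
    have hdiv : monomial (single (i, slot₀ p) p) (1 : K) * (q.divMonomial
        (single (i, slot₀ p) p)) = q := by
      have h3 := divMonomial_add_modMonomial q (single (i, slot₀ p) p)
      have h4 : q.modMonomial (single (i, slot₀ p) p) = 0 := by
        ext s
        rw [coeff_zero]
        by_cases hs : single (i, slot₀ p) p ≤ s
        · exact coeff_modMonomial_of_le q hs
        · rw [coeff_modMonomial_of_not_le q hs]
          by_contra hc
          rcases mem_truncI.1 hg' s (MvPolynomial.mem_support_iff.2 hc) with h | ⟨t, ht, -⟩
          · exact hs (single_le_iff.2 h)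
          · exact absurd t.2 (by omega)
      rwa [h4, add_zero] at h3
    set f' := q.divMonomial (single (i, slot₀ p) p) with hf'
    have hle : single i p ≤ δ := single_le_iff.2 hi
    have hf'h : IsWH bd f' (δ - single i p) := by
      intro s hs
      rw [hf', coeff_divMonomial] at hs
      have h3 := hqh hs
      rw [map_add, Finsupp.weight_single, Finsupp.smul_single, smul_eq_mul, mul_one] at h3
      exact eq_tsub_of_add_eq (by rw [add_comm]; exact h3)
    have hX : monomial (single (i, slot₀ p) p) (1 : K) = X (i, slot₀ p) ^ p :=
      X_pow_eq_monomial.symm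
    have hDq : Ds q = 0 := by
      have := shl_pow_prime g
      rw [show Dl ^ p = Dl ^ (p - 1 + 1) by rw [Nat.sub_add_cancel hp.pos], pow_succ',
        End.mul_apply] at this
      rw [hq, map_sub, h0, zero_sub, neg_eq_zero]
      exact this
    have hpw : ∀ (j : ℕ) (a : MP), (Dl ^ j) (X (i, slot₀ p) ^ p * a) =
        X (i, slot₀ p) ^ p * (Dl ^ j) a := by
      intro j a
      induction j with
      | zero => rfl
      | succ j ih =>
        rw [pow_succ', End.mul_apply, ih, End.mul_apply]
        change Ds (_ * _) = _
        rw [Derivation.leibniz, derivation_pow_char, smul_zero, add_zero]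
        rfl
    have hD : Ds f' = 0 := by
      rw [← hdiv, hX] at hDq
      have h3 := hpw 1 f'
      rw [pow_one] at h3
      have h4 : X (i, slot₀ p) ^ p * Ds f' = 0 := h3.symm.trans hDq
      exact (mul_eq_zero.1 h4).resolve_left (pow_ne_zero _ (X_ne_zero _))
    have hdeg : (δ - single i p).degree + p = δ.degree := by
      conv_rhs => rw [← tsub_add_cancel_of_le hle]
      rw [map_add, Finsupp.degree_single]
    obtain ⟨g', u, hu, hgu⟩ := ih (δ - single i p).degree (by have := hp.pos; omega) f' _
      le_rfl hf'h hD
    refine ⟨g + X (i, slot₀ p) ^ p * g', X (i, slot₀ p) ^ p * u, ?_, ?_⟩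
    · have h3 := ((isWeightedHomogeneous_X K (slotWt ι p) (i, slot₀ p)).pow p).mul hu
      rwa [show slotWt ι p (i, slot₀ p) = 0 from rfl, smul_zero, add_zero] at h3
    · rw [map_add, hpw, add_assoc, ← mul_add, ← hgu, ← hX, hdiv, hq]
      abel
  · push Not at h1
    by_cases h2 : δ = 0
    · refine ⟨0, f, ?_, by rw [map_zero, zero_add]⟩
      intro s hs
      have h3 := congrArg Finsupp.degree (hf hs)
      rw [h2, weight_hom_apply, map_zero] at h3
      have h4 : s = 0 := by
        rw [← Finsupp.degree_eq_zero_iff, ← h3, weight_apply, Finsupp.degree_apply]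
        simp [Finsupp.sum]
      rw [h4, map_zero]
    · obtain ⟨i, hi⟩ := Finsupp.ne_iff.1 h2
      obtain ⟨g, -, hg⟩ := exists_shl_of_not_dvd i hf (Nat.not_dvd_of_pos_of_lt
        (Nat.pos_of_ne_zero hi) (h1 i)) (I := ⊥) (fun a ha => by
          rw [Ideal.mem_bot.1 ha, map_zero]; exact Submodule.zero_mem _)
        (fun a ha => by rw [Ideal.mem_bot.1 ha, map_zero]; exact Submodule.zero_mem _)
        (by rw [h0]; exact Submodule.zero_mem _)
      exact ⟨g, 0, isWeightedHomogeneous_zero _ _ _, by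
        rw [add_zero]; exact sub_eq_zero.1 (Ideal.mem_bot.1 hg)⟩

lemma sum_weightedHomogeneousComponent_eq {σ M : Type} [AddCommMonoid M] (w : σ → M)
  (f : MvPolynomial σ K) (S : Finset M) (h : ∀ s ∈ f.support, Finsupp.weight w s ∈ S) :
  ∑ n ∈ S, whComp w n f = f := by
  classical
  ext s
  rw [coeff_sum]
  simp only [coeff_weightedHomogeneousComponent]
  rw [Finset.sum_ite_eq]
  split_ifs with hs
  · rfl
  · by_contra hc
    exact hs (h s (MvPolynomial.mem_support_iff.2 (Ne.symm hc)))

/-- Degree and weight. -/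
abbrev trWt (ι : Type) (p : ℕ) : ι × Fin p → ℕ × ℤ := fun it => (1, (it.2 : ℤ))

lemma shl_pow_trWt (j : ℕ) {f : MP} {n : ℕ × ℤ} (hf : IsWH (trWt ι p) f n) :
  IsWH (trWt ι p) ((Dl ^ j) f) (n + (0, (j : ℤ))) := by
  induction j with
  | zero => rw [Nat.cast_zero, Prod.mk_zero_zero, add_zero]; exact hf
  | succ j ih =>
    rw [pow_succ', End.mul_apply]
    have := derivation_hom (w := trWt ι p) (fun it => blk K p it.1 (it.2 + 1)) (0, 1)
      (fun it => blk_hom _ _ _ _ fun _ => by simp [trWt]) ih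
    have e : n + (0, (j : ℤ)) + (0, 1) = n + (0, ((j + 1 : ℕ) : ℤ)) := by ext <;> simp [add_assoc]
    rwa [e] at this

lemma exists_shl_eq (f : MP) (d : ℕ) (w w' : ℤ) (hw : 0 < w)
  (hw' : w = w' + (p - 1 : ℕ)) (hf : IsWH (trWt ι p) f (d, w))
  (h0 : Dl f = 0) : ∃ g, IsWH (trWt ι p) g (d, w') ∧ (Dl ^ (p - 1)) g = f := by
  classical
  let c : (ι →₀ ℕ) → MP := fun δ => whComp bd δ f
  have h1 : ∀ δ, ∃ g u, IsWH (slotWt ι p) u 0 ∧ c δ = (Dl ^ (p - 1)) g + u := by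
    intro δ
    refine exists_shl_add δ.degree (c δ) δ le_rfl
      (weightedHomogeneousComponent_isWeightedHomogeneous _ _) ?_
    have h2 := weightedHomogeneousComponent_comm (w := bd) (w' := bd) Dl id
      Function.injective_id (fun n f hf => shift_hom hf) δ f
    rw [h0, map_zero] at h2; exact h2.symm
  choose g u hu hgu using h1
  let S : Finset (ι →₀ ℕ) := f.support.image (Finsupp.weight bd)
  have h2 : f = (Dl ^ (p - 1)) (∑ δ ∈ S, g δ) + ∑ δ ∈ S, u δ := by
    rw [map_sum, ← sum_add_distrib, ← sum_congr rfl fun δ _ => hgu δ]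
    exact (sum_weightedHomogeneousComponent_eq bd f S fun s hs => Finset.mem_image_of_mem _ hs).symm
  have h3 := congrArg (whComp (trWt ι p) (d, w)) h2
  rw [hf.weightedHomogeneousComponent_same, map_add] at h3
  have h4 : whComp (trWt ι p) (d, w) (∑ δ ∈ S, u δ) = 0 := by
    ext s; rw [coeff_weightedHomogeneousComponent, coeff_zero]; split_ifs with hs
    · by_contra hc
      have h5 := (IsWeightedHomogeneous.sum S u 0 fun δ _ => hu δ) hc
      have h6 := congrArg (AddMonoidHom.snd ℕ ℤ) hs; rw [weight_hom_apply] at h6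
      exact hw.ne (h5.symm.trans h6)
    · rfl
  have h5 := weightedHomogeneousComponent_comm (w := trWt ι p) (w' := trWt ι p)
    (Dl ^ (p - 1)) (fun n => n + (0, ((p - 1 : ℕ) : ℤ))) (add_left_injective _)
    (fun n f hf => shl_pow_trWt _ hf) (d, w') (∑ δ ∈ S, g δ)
  rw [Prod.mk_add_mk, add_zero, ← hw'] at h5; rw [h4, add_zero, h5] at h3
  exact ⟨_, weightedHomogeneousComponent_isWeightedHomogeneous _ _, h3.symm⟩

/-- Exactness of the shift in positive weights. -/
lemma exists_shl_pow_eq (j : ℕ) (hj : j + 1 ≤ p) : ∀ (f : MP) (d : ℕ)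
  (w w' : ℤ), 0 < w → w = w' + (p - (j + 1) : ℕ) → IsWH (trWt ι p) f (d, w) →
  (Dl ^ (j + 1)) f = 0 → ∃ g, IsWH (trWt ι p) g (d, w') ∧
  (Dl ^ (p - (j + 1))) g = f := by
  induction j with
  | zero => exact fun f d w w' hw hw' hf h0 => exists_shl_eq f d w w' hw hw' hf (by rwa [zero_add, pow_one] at h0)
  | succ j ih =>
    intro f d w w' hw hw' hf h0; have hfj := shl_pow_trWt (j + 1) hf
    rw [Prod.mk_add_mk, add_zero] at hfj
    have hbase : ∃ g, IsWH (trWt ι p) g (d, w') ∧ (Dl ^ (p - 1)) g = (Dl ^ (j + 1)) f := by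
      exact exists_shl_eq _ d _ w' (by omega) (by omega) hfj (by
        rw [← End.mul_apply, ← pow_succ']; exact h0)
    obtain ⟨g, hg, hg'⟩ := hbase; have e : p - 1 = j + 1 + (p - (j + 1 + 1)) := by omega
    have hg2 := shl_pow_trWt (p - (j + 1 + 1)) hg; rw [Prod.mk_add_mk, add_zero, ← hw'] at hg2
    obtain ⟨g', hg1, hg3⟩ := ih (by omega) (f - (Dl ^ (p - (j + 1 + 1))) g) d w (w' - 1) hw
      (by omega) (hf.sub hg2) (by
        rw [map_sub, ← End.mul_apply _ _ g, ← pow_add, ← e, hg', sub_self])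
    refine ⟨g + Dl g', hg.add ?_, ?_⟩
    · have := shl_pow_trWt 1 hg1
      rwa [pow_one, Prod.mk_add_mk, add_zero, Nat.cast_one, sub_add_cancel] at this
    · rw [show p - (j + 1) = p - (j + 1 + 1) + 1 by omega, pow_succ, End.mul_apply] at hg3
      rw [map_add, hg3, add_sub_cancel]

end ShiftExact

/-! ### Decomposition of polynomial functors by weights -/

section Decomp

open MvPolynomial

variable {k K T V M M' : Type} [Field k] [Field K] [Algebra k K] [AbGrp V] [Module k V]
  [AddCommMonoid M] [AddCommMonoid M'] {wt : T → M}

lemma isWeightedHomogeneous_map {σ : Type} {w : σ → M} (α : M →+ M') {f : MvPolynomial σ K} {n : M}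
  (hf : IsWH w f n) : IsWH (fun i => α (w i)) f (α n) :=
  fun s hs => by rw [← weight_hom_apply, hf hs]

variable (V) in
/-- Inclusion of a refined weight space. -/
def incW (wt : T → M) (α : M →+ M') (μ : M) :
  polObj k K wt μ V →+ polObj k K (fun t => α (wt t)) (α μ) V :=
  (Submodule.inclusion fun _ hf => isWeightedHomogeneous_map α hf).toAddMonoidHom

variable (V) in
/-- Projection to a refined weight space. -/
def projW (wt : T → M) (α : M →+ M') (μ : M) :
  polObj k K (fun t => α (wt t)) (α μ) V →+ polObj k K wt μ V :=
  (((whComp (fun bt : (BIdx k V) × T => wt bt.2) μ).comp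
    (Submodule.subtype _)).codRestrict _ fun f =>
      weightedHomogeneousComponent_isWeightedHomogeneous _ _).toAddMonoidHom

lemma equi_incW (α : M →+ M') (μ : M) (g : V ≃ₗ[k] V) (x : polObj k K wt μ V) :
  incW V wt α μ ((polF k K wt μ).rep V g x) =
  (polF k K (fun t => α (wt t)) (α μ)).rep V g (incW V wt α μ x) := rfl

lemma rep_coe (wt : T → M) (μ : M) (g : V ≃ₗ[k] V) (x : polObj k K wt μ V) :
  ((polF k K wt μ).rep V g x : Pol k K T V) = slot K (fun _ => gˡ) x.1 := rfl

lemma projW_coe (α : M →+ M') (μ : M) (x : polObj k K (fun t => α (wt t)) (α μ) V) :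
  (projW V wt α μ x : Pol k K T V) = whComp
  (fun bt : (BIdx k V) × T => wt bt.2) μ x.1 := rfl

lemma equi_projW (α : M →+ M') (μ : M) (g : V ≃ₗ[k] V)
  (x : polObj k K (fun t => α (wt t)) (α μ) V) :
  projW V wt α μ ((polF k K (fun t => α (wt t)) (α μ)).rep V g x) =
  (polF k K wt μ).rep V g (projW V wt α μ x) := by
  have h := weightedHomogeneousComponent_comm (w := fun bt : (BIdx k V) × T => wt bt.2)
    (w' := fun bt : (BIdx k V) × T => wt bt.2)
    (slot K fun _ => g.toLinearMap).toLinearMap id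
    Function.injective_id (fun n f hf => slot_hom wt (fun _ => g.toLinearMap) (f := f) (μ := n) hf)
    μ x.1
  refine Subtype.ext ?_
  rw [projW_coe, rep_coe, rep_coe, projW_coe]; exact h

lemma projW_incW (α : M →+ M') (μ : M) (x : polObj k K wt μ V) :
  projW V wt α μ (incW V wt α μ x) = x :=
  Subtype.ext (IsWeightedHomogeneous.weightedHomogeneousComponent_same x.2)

/-- All refined weights that occur. -/
def Covers (k K V : Type) [Field k] [Field K] [AbGrp V] [Module k V] (wt : T → M)
  (α : M →+ M') (ν : M') (S : Finset M) : Prop :=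
  (∀ μ ∈ S, α μ = ν) ∧ ∀ f : Pol k K T V, IsHom (fun t => α (wt t)) f ν →
    ∀ s ∈ f.support, Finsupp.weight (fun bt : (BIdx k V) × T => wt bt.2) s ∈ S

lemma Covers.isCob {α : M →+ M'} {ν : M'} {S : Finset M} (hS : Covers k K V wt α ν S) {i : ℕ}
  {S' : Finset M} (hS' : S' ⊆ S)
  (hv : ∀ μ ∈ S', Van i (adRep ((polF k K wt μ).rep V)))
  (z : (Fin i → (V ≃ₗ[k] V)) → (V →+ polObj k K (fun t => α (wt t)) ν V))
  (hz : cd (adRep ((polF k K (fun t => α (wt t)) ν).rep V)) i z = 0) :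
  ∃ y, IsCob (adRep ((polF k K (fun t => α (wt t)) ν).rep V)) i y ∧
  ∀ x v, (y x v).1 = ∑ μ ∈ S', whComp
  (fun bt : (BIdx k V) × T => wt bt.2) μ (z x v).1 := by
  classical
  induction S' using Finset.induction_on with
  | empty => exact ⟨0, IsCob.zero _ _, fun x v => by simp⟩
  | insert μ S' hμ ih =>
    obtain ⟨y, hy, hy'⟩ := ih ((Finset.subset_insert _ _).trans hS')
      fun μ hμ => hv μ (Finset.mem_insert_of_mem hμ)
    obtain rfl := hS.1 μ (hS' (Finset.mem_insert_self _ _))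
    have e1 : Equi (.id _) (adRep ((polF k K (fun t => α (wt t)) (α μ)).rep V))
      (adRep ((polF k K wt μ).rep V)) (postComp V (projW V wt α μ)) :=
      equi_postComp (equi_projW α μ)
    have e2 : Equi (.id _) (adRep ((polF k K wt μ).rep V))
      (adRep ((polF k K (fun t => α (wt t)) (α μ)).rep V)) (postComp V (incW V wt α μ)) :=
      equi_postComp (equi_incW α μ)
    have h1 := hv μ (Finset.mem_insert_self _ _) (pull (.id _) _ i z)
      (by rw [cd_pull e1, hz, map_zero])
    refine ⟨_, (IsCob.push e2 h1).add hy, fun x v => ?_⟩; rw [Finset.sum_insert hμ, ← hy']; rfl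

lemma Covers.van {α : M →+ M'} {ν : M'} {S : Finset M} (hS : Covers k K V wt α ν S) {i : ℕ}
  (hv : ∀ μ ∈ S, Van i (adRep ((polF k K wt μ).rep V))) :
  Van i (adRep ((polF k K (fun t => α (wt t)) ν).rep V)) := by
  intro z hz; obtain ⟨y, hy, hy'⟩ := hS.isCob subset_rfl hv z hz; convert hy; ext x v : 3
  rw [hy', sum_weightedHomogeneousComponent_eq _ _ S (hS.2 _ (z x v).2)]

lemma Covers.hcard_eq [DecidableEq M] {α : M →+ M'} {μ : M} {S : Finset M}
  (hS : Covers k K V wt α (α μ) S) (hμ : μ ∈ S) {i : ℕ}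
  (hv : ∀ μ' ∈ S, μ' ≠ μ → Van i (adRep ((polF k K wt μ').rep V))) :
  hcard i (adRep ((polF k K (fun t => α (wt t)) (α μ)).rep V)) =
  hcard i (adRep ((polF k K wt μ).rep V)) := by
  have e1 : Equi (.id _) (adRep ((polF k K (fun t => α (wt t)) (α μ)).rep V))
    (adRep ((polF k K wt μ).rep V)) (postComp V (projW V wt α μ)) := equi_postComp (equi_projW α μ)
  have e2 : Equi (.id _) (adRep ((polF k K wt μ).rep V))
    (adRep ((polF k K (fun t => α (wt t)) (α μ)).rep V)) (postComp V (incW V wt α μ)) :=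
    equi_postComp (equi_incW α μ)
  refine hcard_eq_of_inverse e1 e2 i (fun z hz => ?_) (fun z _ => ?_)
  · obtain ⟨y, hy, hy'⟩ := hS.isCob (Finset.erase_subset μ S) (fun μ' h =>
      hv μ' (Finset.mem_of_mem_erase h) (Finset.ne_of_mem_erase h)) z hz
    convert hy.neg
    ext x v : 3; have h1 := sum_weightedHomogeneousComponent_eq _ _ S (hS.2 _ (z x v).2)
    rw [← Finset.add_sum_erase S _ hμ, ← hy'] at h1
    change whComp _ μ (z x v).1 - (z x v).1 = -(y x v).1
    rw [eq_neg_iff_add_eq_zero, sub_add_eq_add_sub, h1, sub_self]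
  · convert IsCob.zero _ i
    rw [sub_eq_zero]; exact funext fun x => AddMonoidHom.ext fun v => projW_incW α μ (z x v)

/-- The functor of symmetric powers. -/
abbrev symF (k K : Type) [Field k] [Field K] [Algebra k K] (d : ℕ) : VFun k :=
  polF k K unitWt d

section renT

variable {T' : Type} (τ : T → T')

/-- Renaming the slots. -/
def renT : Pol k K T V →ₐ[K] Pol k K T' V := aeval fun bt => X (bt.1, τ bt.2)

lemma renT_X (bt : BIdx k V × T) : renT τ (X bt : Pol k K T V) = X (bt.1, τ bt.2) := aeval_X _ _

lemma renT_lin (t : T) (v : V) : renT τ (lin k K t v : Pol k K T V) = lin k K (τ t) v := by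
  have : ((renT τ).restrictScalars k).toLinearMap ∘ₗ lin k K t =
      (lin k K (τ t) : V →ₗ[k] Pol k K T' V) :=
    (BVec k V).ext fun b => by rw [comp_apply, lin_basis, lin_basis]; exact renT_X τ (b, t)
  exact LinearMap.congr_fun this v

lemma renT_slot (g : V →ₗ[k] V) (f : Pol k K T V) :
  renT τ (slot K (fun _ => g) f) = slot K (fun _ => g) (renT τ f) := by
  have : (renT τ).comp (slot K fun _ => g) = (slot K fun _ => g).comp (renT τ) :=
    algHom_ext fun bt => by
      rw [AlgHom.comp_apply, AlgHom.comp_apply, slot_X, renT_lin, renT_X, slot_X]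
  exact DFunLike.congr_fun this f

lemma renT_hom (wt : T' → M) {μ : M} {f : Pol k K T V}
  (hf : IsHom (fun t => wt (τ t)) f μ) : IsHom wt (renT τ f) μ :=
  aeval_hom (w := fun bt : (BIdx k V) × T => wt (τ bt.2))
    (w' := fun bt : (BIdx k V) × T' => wt bt.2)
    (fun bt => X (bt.1, τ bt.2)) (fun bt => isWeightedHomogeneous_X K _ (bt.1, τ bt.2)) hf

end renT

lemma renT_injective (t : T) : Injective (renT (fun _ : Unit => t) :
  Pol k K Unit V →ₐ[K] Pol k K T V) := by
  refine Function.LeftInverse.injective (g := renT fun _ => ()) fun f => ?_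
  have : (renT fun _ : T => ()).comp (renT fun _ : Unit => t) = AlgHom.id K (Pol k K Unit V) :=
    algHom_ext fun bt => by rw [AlgHom.comp_apply, renT_X, renT_X]; rfl
  exact DFunLike.congr_fun this f

lemma renT_renT (t : T) {y : Pol k K T V} (hy : ∀ s ∈ y.support, ∀ bt, s bt ≠ 0 → bt.2 = t) :
  renT (fun _ => t) (renT (fun _ => ()) y) = y := by
  refine hom_congr_vars (f₁ := ((renT fun _ : Unit => t).comp (renT fun _ => ()) :
    Pol k K T V →ₐ[K] Pol k K T V).toRingHom) (f₂ := RingHom.id _) (p₁ := y) (p₂ := y)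
    (RingHom.ext fun c => by simp) (fun bt hbt _ => ?_) rfl
  obtain ⟨s, hs, hb⟩ := (mem_vars bt).1 hbt
  change renT (fun _ => t) (renT (fun _ => ()) (X bt)) = X bt
  rw [renT_X, renT_X, ← hy s hs bt (Finsupp.mem_support_iff.1 hb)]

lemma hcard_adRep_congr {A B : Type} [AbGrp A] [AbGrp B] {ρ : GMod (V ≃ₗ[k] V) A}
  {σ : GMod (V ≃ₗ[k] V) B} (φ : A →+ B) (hφ : ∀ g x, φ (ρ g x) = σ g (φ x))
  (hb : Function.Bijective φ) (i : ℕ) : hcard i (adRep ρ) = hcard i (adRep σ) := by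
  let e := AddEquiv.ofBijective φ hb
  let E : (V →+ A) ≃+ (V →+ B) :=
    AddEquiv.ofBijective (postComp V φ) ⟨fun a b hab => AddMonoidHom.ext fun v =>
      hb.1 (DFunLike.congr_fun hab v), fun b => ⟨postComp V e.symm.toAddMonoidHom b,
        AddMonoidHom.ext fun v => e.apply_symm_apply (b v)⟩⟩
  exact hcard_congr (.refl _) E (fun g η => equi_postComp hφ g η) i

lemma hcard_single [Fintype T] [DecidableEq T] (t : T) (d i : ℕ) :
  hcard i (adRep ((symF k K d).rep V)) =
  hcard i (adRep ((polF k K (fun t => (Pi.single t 1 : T → ℕ)) (Pi.single t d)).rep V)) := by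
  have hh : ∀ f : Pol k K Unit V, IsHom (fun _ => 1) f d →
      IsHom (fun t => (Pi.single t 1 : T → ℕ)) (renT (fun _ => t) f) (Pi.single t d) := by
    intro f hf
    exact renT_hom (fun _ : Unit => t) (fun t => (Pi.single t 1 : T → ℕ))
      (isWeightedHomogeneous_map (.single (fun _ : T => ℕ) t) hf)
  let φ : polObj k K (fun _ : Unit => 1) d V →+
      polObj k K (fun t => (Pi.single t 1 : T → ℕ)) (Pi.single t d) V :=
    ((renT fun _ => t).toLinearMap.restrict hh).toAddMonoidHom
  have hφ : ∀ g x, φ ((symF k K d).rep V g x) = (polF k K _ _).rep V g (φ x) := fun g x =>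
    Subtype.ext (renT_slot (fun _ => t) g.toLinearMap x.1)
  have hsurj : Surjective φ := by
    intro y
    have h1 : ∀ s ∈ y.1.support, ∀ bt, s bt ≠ 0 → bt.2 = t := by
      intro s hs bt hbt
      by_contra hne
      have h2 := congrFun (y.2 (MvPolynomial.mem_support_iff.1 hs)) bt.2
      rw [Pi.single_eq_of_ne hne, Finsupp.weight_apply, Finsupp.sum, Finset.sum_apply,
        Finset.sum_eq_zero_iff] at h2
      have h3 := h2 bt (Finsupp.mem_support_iff.2 hbt); simp [hbt] at h3
    have h3 := isWeightedHomogeneous_map (∑ t, Pi.evalAddMonoidHom (fun _ : T => ℕ) t) y.2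
    have h4 : IsHom (fun _ : Unit => 1) (renT (fun _ => ()) y.1) d := by
      refine renT_hom (fun _ => ()) (fun _ : Unit => 1) ?_
      convert h3 <;> simp [Finset.sum_pi_single, AddMonoidHom.finset_sum_apply]
    exact ⟨⟨_, h4⟩, Subtype.ext (renT_renT t h1)⟩
  exact hcard_adRep_congr φ hφ ⟨fun a b hab => Subtype.ext
    (renT_injective t (congrArg Subtype.val hab)), hsurj⟩ i

end Decomp

/-! ### Passing from degree `pj` to degree `j` -/

/-- The action on an invariant subgroup. -/
def GMod.restr {G M : Type} [Group G] [AbGrp M] (ρ : GMod G M) (S : AddSubgroup M)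
  (hS : ∀ g, ∀ x ∈ S, ρ g x ∈ S) : GMod G S where
  toFun g := ((ρ.hom g).comp S.subtype).codRestrict S fun x => hS g x x.2
  map_one' := AddMonoidHom.ext fun x => Subtype.ext (ρ.one_apply x.1)
  map_mul' g h := AddMonoidHom.ext fun x => Subtype.ext (ρ.mul_apply g h x.1)

section Counting

variable {G : Type} [Group G] {Z X : ℕ → Type} [∀ m, AbGrp (Z m)] [∀ m, AbGrp (X m)]
  {ζ : ∀ m, GMod G (Z m)} {ξ : ∀ m, GMod G (X m)} {ι : ∀ m, Z m →+ X m} {π : ∀ m, X m →+ Z (m + 1)}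

lemma hcard_of_resolution (hS : ∀ m, SES (ζ m) (ξ m) (ζ (m + 1)) (ι m) (π m)) {p j q s : ℕ}
  (hj : 0 < j) (hp : 0 < p)
  (hX : ∀ i ≤ s, ∀ m, hcard i (ξ m) = if (∃ t < p, m = 2 * j * t) ∧ 2 * j * p ∣ i then q else 1) :
  ∀ i ≤ s, ∀ m, hcard i (ζ m) =
  if 2 * j ∣ i + m ∧ m ≤ 2 * j * ((i + m) / (2 * j) % p) then q else 1 := by
  have hX' : ∀ i ≤ s, ∀ m, (i + m) % 2 = 1 → Van i (ξ m) := by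
    intro i hi m h; refine van_of_hcard ((hX i hi m).trans (if_neg ?_))
    rintro ⟨⟨t, _, rfl⟩, ⟨u, rfl⟩⟩
    rw [show 2 * j * p * u + 2 * j * t = 2 * (j * p * u + j * t) by ring] at h; omega
  have hodd : ∀ {c m : ℕ} (P : Prop) [Decidable P], c % 2 = 1 →
      (if 2 * j ∣ c ∧ P then q else 1) = 1 := by
    intro c m P _ h; refine if_neg ?_
    rintro ⟨⟨u, rfl⟩, _⟩; rw [mul_assoc] at h; omega
  have h2j : 0 < 2 * j := by omega
  intro i
  induction i with
  | zero =>
    have hv : ∀ m, m % 2 = 1 → Van 0 (ζ m) := fun m hm =>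
      (hS m).van_left_zero (hX' 0 (Nat.zero_le _) m (by omega))
    intro hi m; rcases Nat.mod_two_eq_zero_or_one m with hm | hm
    · rw [(hS m).hcard_zero_eq (hv _ (by omega)), hX 0 hi m, zero_add]
      refine if_congr ⟨?_, ?_⟩ rfl rfl
      · rintro ⟨⟨t, ht, rfl⟩, _⟩; rw [Nat.mul_div_cancel_left _ h2j, Nat.mod_eq_of_lt ht]
        exact ⟨dvd_mul_right _ _, le_rfl⟩
      · rintro ⟨⟨u, rfl⟩, h⟩; rw [Nat.mul_div_cancel_left _ h2j] at h
        exact ⟨⟨u, (Nat.le_of_mul_le_mul_left h h2j).trans_lt (Nat.mod_lt _ hp), rfl⟩, dvd_zero _⟩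
    · rw [(hv m hm).hcard, hodd (m := m) _ (by omega)]
  | succ i ih =>
    intro hi; have ih := ih (by omega)
    have hv : ∀ m, (i + 1 + m) % 2 = 1 → Van (i + 1) (ζ m) := fun m hm =>
      (hS m).van_left (van_of_hcard (by rw [ih, hodd (m := m) _ (by omega)])) (hX' _ hi m hm)
    intro m; rcases Nat.mod_two_eq_zero_or_one (i + 1 + m) with hm | hm
    · rw [(hS m).hcard_succ (hX' i (by omega) m (by omega)) (hv _ (by omega)), ih, hX _ hi,
        show i + (m + 1) = i + 1 + m by omega]
      by_cases hc : 2 * j ∣ i + 1 + m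
      · obtain ⟨r, hr⟩ := hc; rw [hr, Nat.mul_div_cancel_left _ h2j]
        have h1 : ((∃ t < p, m = 2 * j * t) ∧ 2 * j * p ∣ i + 1) ↔ m = 2 * j * (r % p) := by
          constructor
          · rintro ⟨⟨t, ht, rfl⟩, ⟨u, hu⟩⟩; rw [hu, mul_assoc (2 * j), ← mul_add] at hr
            rw [← Nat.eq_of_mul_eq_mul_left h2j hr, Nat.mul_add_mod, Nat.mod_eq_of_lt ht]
          · intro h; refine ⟨⟨_, Nat.mod_lt _ hp, h⟩, r / p, ?_⟩
            have := congrArg (2 * j * ·) (Nat.div_add_mod r p)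
            simp only [mul_add, ← mul_assoc] at this; omega
        simp only [h1, dvd_mul_right, true_and]
        rcases lt_trichotomy m (2 * j * (r % p)) with h | h | h
        · rw [if_pos (by omega), if_neg (by omega), if_pos (by omega), mul_one]
        · rw [if_neg (by omega), if_pos h, if_pos (by omega), one_mul]
        · rw [if_neg (by omega), if_neg (by omega), if_neg (by omega), mul_one]
      · rw [if_neg fun h => hc h.1, if_neg, if_neg fun h => hc h.1]; rintro ⟨⟨t, _, rfl⟩, h⟩
        exact hc (((dvd_mul_right _ _).trans h).add (dvd_mul_right _ _))
    · rw [(hv m hm).hcard, hodd (m := m) _ (by omega)]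

end Counting

section Resolution

open MvPolynomial

variable {k K V : Type} [Field k] [Field K] [Algebra k K] [AbGrp V] [Module k V]
  {p : ℕ} [Fact p.Prime] [CharP K p]

lemma shift_slot (g : V →ₗ[k] V) (f : Pol k K (Fin p) V) :
  shift K _ p (slot K (fun _ => g) f) = slot K (fun _ => g) (shift K _ p f) := by
  let L : ℕ → V →ₗ[k] Pol k K (Fin p) V := fun n => if h : n < p then lin k K ⟨n, h⟩ else 0
  have h1 : ∀ b n, slot K (fun _ => g) (blk K p b n) = L n (g (BVec k V b)) := by
    intro b n; rw [blk]
    by_cases h : n < p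
    · rw [dif_pos h, slot_X]; simp only [L, dif_pos h]
    · rw [dif_neg h, map_zero]; simp only [L, dif_neg h, LinearMap.zero_apply]
  have h2 : ∀ b n, L n (BVec k V b) = blk K p b n := by
    intro b n; rw [blk]
    by_cases h : n < p
    · rw [dif_pos h, ← lin_basis]; simp only [L, dif_pos h]
    · rw [dif_neg h]; simp only [L, dif_neg h, LinearMap.zero_apply]
  have h3 : ∀ n v, shift K _ p (L n v) = L (n + 1) v := by
    intro n v
    have : ((shl K _ p).restrictScalars k) ∘ₗ L n = L (n + 1) :=
      (BVec k V).ext fun b => by rw [comp_apply, h2, h2]; exact shift_blk b n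
    exact LinearMap.congr_fun this v
  induction f using MvPolynomial.induction_on with
  | C a => 
    rw [algHom_C, algebraMap_eq]
    exact (derivation_C _ a).trans ((congrArg _ (derivation_C _ a)).trans (map_zero _)).symm
  | add f g hf hg => rw [map_add, map_add, map_add, map_add, hf, hg]
  | mul_X f bt hf =>
    rw [map_mul, Derivation.leibniz, hf, Derivation.leibniz, ← blk_fin, shift_blk, h1, h3, ← h1,
      ← h1]
    simp only [smul_eq_mul, map_add, map_mul]

lemma shl_pow_slot (e : ℕ) (g : V →ₗ[k] V) (f : Pol k K (Fin p) V) :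
  (shl K _ p ^ e) (slot K (fun _ => g) f) = slot K (fun _ => g) ((shl K _ p ^ e) f) := by
  induction e with
  | zero => rfl
  | succ e ih => rw [pow_succ', End.mul_apply, End.mul_apply, ih]; exact shift_slot g _

/-- The weights in the resolution. -/
def resWt (p m : ℕ) : ℤ := p * (m / 2 : ℕ) + (m % 2 : ℕ)

/-- The order of the differentials in the resolution. -/
def resExp (p m : ℕ) : ℕ := if m % 2 = 0 then 1 else p - 1

lemma resWt_succ (p m : ℕ) (hp : 1 ≤ p) : resWt p m + (resExp p m : ℕ) = resWt p (m + 1) := by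
  rcases Nat.mod_two_eq_zero_or_one m with h | h
  · rw [resWt, resWt, resExp, if_pos h, h, show (m + 1) / 2 = m / 2 by omega,
      show (m + 1) % 2 = 1 by omega]
    push_cast; ring
  · rw [resWt, resWt, resExp, if_neg (by omega), h, show (m + 1) / 2 = m / 2 + 1 by omega,
      show (m + 1) % 2 = 0 by omega]
    push_cast [hp]; ring

lemma resExp_succ (p m : ℕ) (hp : 1 ≤ p) : resExp p m = p - resExp p (m + 1) := by
  rcases Nat.mod_two_eq_zero_or_one m with h | h
  · rw [resExp, resExp, if_pos h, if_neg (by omega)]; omega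
  · rw [resExp, resExp, if_neg (by omega), if_pos (by omega)]

/-- The terms of the resolution. -/
abbrev resObj (k K V : Type) [Field k] [Field K] [AbGrp V] [Module k V] (p d m : ℕ) :=
  polObj k K (fun t : Fin p => ((1 : ℕ), (t : ℤ))) (d, resWt p m) V

/-- The representations in the resolution. -/
abbrev resRep (k K V : Type) [Field k] [Field K] [Algebra k K] [AbGrp V] [Module k V]
  (p d m : ℕ) := (polF k K (fun t : Fin p => ((1 : ℕ), (t : ℤ))) (d, resWt p m)).rep V

/-- The differentials of the resolution. -/
def resD (k K V : Type) [Field k] [Field K] [AbGrp V] [Module k V] (p : ℕ) [Fact p.Prime]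
  [CharP K p] (d m : ℕ) : resObj k K V p d m →+ resObj k K V p d (m + 1) :=
  ((shl K _ p ^ resExp p m).restrict fun f hf => by
    have := shl_pow_trWt (resExp p m) (ι := BIdx k V) (n := (d, resWt p m)) hf
    rwa [Prod.mk_add_mk, add_zero, resWt_succ p m (primeOut p).one_le] at this).toAddMonoidHom

lemma resD_coe (d m : ℕ) (x : resObj k K V p d m) :
  (resD k K V p d m x : Pol k K (Fin p) V) = (shl K _ p ^ resExp p m) x.1 := rfl

lemma resD_rep (d m : ℕ) (g : V ≃ₗ[k] V) (x : resObj k K V p d m) :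
  resD k K V p d m (resRep k K V p d m g x) = resRep k K V p d (m + 1) g (resD k K V p d m x) :=
  Subtype.ext (by rw [resD_coe, rep_coe, rep_coe, resD_coe, shl_pow_slot])

/-- The action on cycles. -/
def cycRep (k K V : Type) [Field k] [Field K] [Algebra k K] [AbGrp V] [Module k V] (p : ℕ)
  [Fact p.Prime] [CharP K p] (d m : ℕ) : GMod (V ≃ₗ[k] V) (resD k K V p d m).ker :=
  (resRep k K V p d m).restr _ fun g x hx => by
    rw [AddMonoidHom.mem_ker] at hx ⊢; rw [resD_rep, hx, map_zero]

lemma resD_exact (d m : ℕ) (y : resObj k K V p d (m + 1)) :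
  resD k K V p d (m + 1) y = 0 ↔ ∃ x, resD k K V p d m x = y := by
  have hp2 := (primeOut p).two_le
  have he : 1 ≤ resExp p (m + 1) ∧ resExp p (m + 1) ≤ p := by rw [resExp]; split_ifs <;> omega
  constructor
  · intro hy
    have h2 : 0 < resWt p (m + 1) := by
      rw [← resWt_succ p m (primeOut p).one_le, resWt, resExp]
      have : (0 : ℤ) ≤ p * (m / 2 : ℕ) := by positivity
      split_ifs <;> omega
    obtain ⟨g, hg, hg'⟩ := exists_shl_pow_eq (resExp p (m + 1) - 1) (by omega) y.1 d
      (resWt p (m + 1)) (resWt p m) h2 (by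
        rw [Nat.sub_add_cancel he.1, ← resExp_succ p m (primeOut p).one_le, resWt_succ p m (primeOut p).one_le]) y.2 (by
        rw [Nat.sub_add_cancel he.1]; exact congrArg Subtype.val hy)
    rw [Nat.sub_add_cancel he.1, ← resExp_succ p m (primeOut p).one_le] at hg'
    exact ⟨⟨g, hg⟩, Subtype.ext hg'⟩
  · rintro ⟨x, rfl⟩; refine Subtype.ext ?_
    rw [resD_coe, resD_coe, ← End.mul_apply, ← pow_add, resExp_succ p m (primeOut p).one_le,
      Nat.add_sub_cancel' he.2]
    exact shl_pow_prime _

lemma resSES (d m : ℕ) : SES (cycRep k K V p d m) (resRep k K V p d m)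
  (cycRep k K V p d (m + 1)) (AddSubgroup.subtype _)
  ((resD k K V p d m).codRestrict _ fun x => (resD_exact d m _).2 ⟨x, rfl⟩) where
  ef _ _ := rfl
  eg g x := Subtype.ext (resD_rep d m g x)
  inj := Subtype.val_injective
  surj y := by obtain ⟨x, hx⟩ := (resD_exact d m y.1).1 y.2; exact ⟨x, Subtype.ext hx⟩
  exact x := ⟨fun hx => ⟨⟨x, congrArg Subtype.val hx⟩, rfl⟩, by
    rintro ⟨a, rfl⟩; exact Subtype.ext a.2⟩

end Resolution

/-! ### Cohomology of symmetric powers of degree a power of `p` -/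

section SymStep

open MvPolynomial

variable {k K V : Type} [Field k] [Field K] [Algebra k K] [AbGrp V] [Module k V]
  {p : ℕ} [Fact p.Prime] [CharP K p]

lemma eq_of_slotWt_zero {ι : Type} {f : MvPolynomial (ι × Fin p) K} {d : ℕ}
  (hf : IsWH (trWt ι p) f (d, 0)) {s : ι × Fin p →₀ ℕ} (hs : s ∈ f.support)
  {bt : ι × Fin p} (h : s bt ≠ 0) : (bt.2 : ℕ) = 0 := by
  have h1 := congrArg (AddMonoidHom.snd ℕ ℤ) (hf (MvPolynomial.mem_support_iff.1 hs))
  rw [weight_hom_apply, weight_apply, Finsupp.sum] at h1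
  have h2 := (Finset.sum_eq_zero_iff_of_nonneg (fun i _ => by simp; positivity)).1 h1 bt
    (Finsupp.mem_support_iff.2 h)
  simpa [h] using h2

lemma dvd_of_shift_eq_zero {ι : Type} {f : MvPolynomial (ι × Fin p) K} {d : ℕ}
  (hf : IsWH (trWt ι p) f (d, 0)) (h0 : shift K ι p f = 0)
  {s : ι × Fin p →₀ ℕ} (hs : s ∈ f.support) (bt : ι × Fin p) : p ∣ s bt := by
  classical
  by_cases hbt : s bt = 0
  · exact hbt ▸ dvd_zero p
  let δ := Finsupp.weight (bdeg ι p) s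
  let c := whComp (bdeg ι p) δ f
  have hsc : coeff s c = coeff s f := by rw [coeff_weightedHomogeneousComponent, if_pos rfl]
  have hcs : ∀ u ∈ c.support, u ∈ f.support := fun u hu => by
    rw [MvPolynomial.mem_support_iff, coeff_weightedHomogeneousComponent] at hu
    exact MvPolynomial.mem_support_iff.2 fun h => hu (by rw [h, ite_self])
  have h1 : shift K ι p c = 0 := by
    have := weightedHomogeneousComponent_comm (w := bdeg ι p) (w' := bdeg ι p) (shl K ι p) id
      Function.injective_id (fun n f hf => shift_hom hf) δ f
    exact this.symm.trans ((congrArg _ h0).trans (map_zero _))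
  have h2 : lower K p bt.1 c = 0 := by
    rw [c.as_sum, map_sum]; refine sum_eq_zero fun u hu => ?_
    rw [lower, mkDerivation_monomial]; convert smul_zero _; refine sum_eq_zero fun jt hjt => ?_
    simp only [eq_of_slotWt_zero hf (hcs u hu) (Finsupp.mem_support_iff.1 hjt), Nat.cast_zero,
      neg_zero, zero_smul, ite_self, smul_zero]
  have h3 := shift_lower bt.1 (weightedHomogeneousComponent_isWeightedHomogeneous (w := bdeg ι p)
    δ f)
  change shift K ι p (lower K p bt.1 c) - lower K p bt.1 (shift K ι p c) = (δ bt.1 : K) • c at h3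
  rw [h1, h2, map_zero, map_zero, sub_zero] at h3; have h4 := congrArg (coeff s) h3
  rw [coeff_zero, coeff_smul, hsc, smul_eq_mul, eq_comm, mul_eq_zero,
    or_iff_left (MvPolynomial.mem_support_iff.1 hs), CharP.cast_eq_zero_iff K p] at h4
  have h5 : δ bt.1 = s bt := by
    simp only [δ, weight_apply, Finsupp.sum, Finsupp.finset_sum_apply, Finsupp.smul_apply,
      smul_eq_mul, Finsupp.single_apply, mul_ite, mul_one, mul_zero]
    rw [sum_eq_single bt]
    · rw [if_pos rfl]
    · intro b hb hne; refine if_neg fun h => hne (Prod.ext h (Fin.ext ?_))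
      rw [eq_of_slotWt_zero hf hs (Finsupp.mem_support_iff.1 hb), eq_of_slotWt_zero hf hs hbt]
    · intro h; rw [if_pos rfl]; exact Finsupp.notMem_support_iff.1 h
  rwa [h5] at h4

lemma exists_pow_eq_of_dvd [Finite K] {σ : Type} (f : MvPolynomial σ K)
    (h : ∀ s ∈ f.support, ∀ i, p ∣ s i) :
    ∃ u, u ^ p = f ∧ ∀ s ∈ u.support, p • s ∈ f.support := by
  classical
  have hp := primeOut p
  have := Fintype.ofFinite K
  choose r hr using fun a : K => (bijective_frobenius K p).2 a
  have hq : ∀ s ∈ f.support, p • s.mapRange (· / p) (Nat.zero_div p) = s := fun s hs =>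
    Finsupp.ext fun i => Nat.mul_div_cancel' (h s hs i)
  refine ⟨∑ s ∈ f.support, monomial (s.mapRange (· / p) (Nat.zero_div p)) (r (coeff s f)), ?_, ?_⟩
  · rw [sum_pow_char p]
    conv_rhs => rw [f.as_sum]
    refine sum_congr rfl fun s hs => ?_
    rw [monomial_pow, hq s hs]
    exact congrArg _ (hr _)
  · intro s hs
    obtain ⟨u, hu, hu'⟩ := Finset.mem_biUnion.1 (support_sum hs)
    rw [Finset.mem_singleton.1 (support_monomial_subset hu'), hq u hu]
    exact hu

variable (k K V p) in
lemma hcard_cycRep_zero [Finite K] (j i : ℕ) : hcard i (adRep ((symF k K j).rep V)) =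
  hcard i (adRep (cycRep k K V p (p * j) 0)) := by
  have hp := primeOut p; have hw : resWt p 0 = 0 := by simp [resWt]
  have he : resExp p 0 = 1 := rfl
  let t₀ : Fin p := ⟨0, hp.pos⟩
  let wt : Fin p → ℕ × ℤ := fun t => (1, (t : ℤ))
  have hh : ∀ f : Pol k K Unit V, IsHom (fun _ => 1) f j →
      IsHom wt (renT (fun _ => t₀) f ^ p) (p * j, resWt p 0) := by
    intro f hf
    have h1 := (renT_hom (fun _ : Unit => t₀) wt (μ := (j, 0))
      (isWeightedHomogeneous_map (AddMonoidHom.inl ℕ ℤ) hf)).pow p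
    rwa [Prod.smul_mk, smul_zero, smul_eq_mul, ← hw] at h1
  let φ : polObj k K unitWt j V →+ (resD k K V p (p * j) 0).ker :=
    AddMonoidHom.mk' (fun f => ⟨⟨renT (fun _ => t₀) f.1 ^ p, hh f.1 f.2⟩, Subtype.ext (by
      rw [resD_coe, he, pow_one]; change shift K _ p _ = 0
      rw [Derivation.leibniz_pow, charP_nsmul K])⟩)
      fun f g => Subtype.ext (Subtype.ext (by
        change renT (fun _ => t₀) (f.1 + g.1) ^ p = _; rw [map_add, add_pow_char]; rfl))
  refine hcard_adRep_congr φ (fun g x => Subtype.ext (Subtype.ext ?_)) ⟨fun a b hab => ?_,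
    fun y => ?_⟩ i
  · change renT (fun _ => t₀) (slot K (fun _ => gˡ) x.1) ^ p =
      slot K (fun _ => gˡ) (renT (fun _ => t₀) x.1 ^ p)
    rw [renT_slot, map_pow]
  · refine Subtype.ext (renT_injective t₀ (frobenius_inj _ p ?_))
    exact congrArg (fun x => x.1.1) hab
  · have hy : IsWH (trWt (BIdx k V) p) y.1.1 (p * j, 0) := by
      rw [← hw]; exact y.1.2
    have h0 : shift K _ p y.1.1 = 0 := by
      have := congrArg Subtype.val y.2; rwa [resD_coe, he, pow_one] at this
    obtain ⟨u, hu, hu'⟩ := exists_pow_eq_of_dvd (p := p) y.1.1 fun s hs bt =>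
      dvd_of_shift_eq_zero hy h0 hs bt
    have h1 : renT (fun _ => t₀) (renT (fun _ => ()) u) = u := renT_renT t₀ fun s hs bt hbt =>
      Fin.ext (eq_of_slotWt_zero hy (hu' s hs) (by simp [hbt, hp.ne_zero]))
    have h2 : IsHom (fun _ : Fin p => 1) u j := by
      intro s hs
      have h3 := congrArg (AddMonoidHom.fst ℕ ℤ)
        (hy (MvPolynomial.mem_support_iff.1 (hu' s (MvPolynomial.mem_support_iff.2 hs))))
      rw [weight_hom_apply, map_nsmul] at h3; exact Nat.eq_of_mul_eq_mul_left hp.pos h3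
    refine ⟨⟨renT (fun _ => ()) u, renT_hom (fun _ => ()) unitWt h2⟩, Subtype.ext (Subtype.ext ?_)⟩
    change renT (fun _ => t₀) (renT (fun _ => ()) u) ^ p = y.1.1; rw [h1, hu]

/-- Degree and slot weight of a multidegree. -/
def multiWt (p : ℕ) : (Fin p → ℕ) →+ ℕ × ℤ :=
  AddMonoidHom.prod (∑ t, Pi.evalAddMonoidHom (fun _ : Fin p => ℕ) t)
    (∑ t : Fin p, (t : ℕ) • (Nat.castAddMonoidHom ℤ).comp (Pi.evalAddMonoidHom (fun _ : Fin p => ℕ) t))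

lemma multiWt_apply (p : ℕ) (μ : Fin p → ℕ) : multiWt p μ = (∑ t, μ t, ∑ t : Fin p, (t : ℤ) * μ t) := by
  simp [multiWt, AddMonoidHom.finset_sum_apply]

lemma multiWt_single (p : ℕ) (t : Fin p) (d : ℕ) :
  multiWt p (Pi.single t d) = (d, (t : ℤ) * d) := by
  rw [multiWt_apply, Finset.sum_pi_single', if_pos (mem_univ _), sum_eq_single t]
  · rw [Pi.single_eq_same]
  · intro u _ hu; rw [Pi.single_eq_of_ne hu, Nat.cast_zero, mul_zero]
  · simp

/-- The functor of multihomogeneous polynomials. -/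
abbrev multiF (k K : Type) [Field k] [Field K] [Algebra k K] {p : ℕ} (μ : Fin p → ℕ) : VFun k :=
  polF k K (fun t => (Pi.single t 1 : Fin p → ℕ)) μ

variable {j s q : ℕ} (hac : ∀ μ : Fin p → ℕ, ∑ t, μ t = p * j → (∀ t, μ ≠ Pi.single t (p * j)) →
  ∀ i ≤ s, Van i (adRep ((multiF k K μ).rep V)))

include hac in
lemma hcard_resRep (hj : 0 < j) (h : ∀ i ≤ s, hcard i (adRep ((symF k K (p * j)).rep V)) =
  if 2 * (p * j) ∣ i then q else 1) (i : ℕ) (hi : i ≤ s) (m : ℕ) :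
  hcard i (adRep (resRep k K V p (p * j) m)) =
  if (∃ t < p, m = 2 * j * t) ∧ 2 * j * p ∣ i then q else 1 := by
  classical
  have hp := primeOut p
  have hwt : (fun t : Fin p => ((1 : ℕ), (t : ℤ))) = fun t => multiWt p (Pi.single t 1) := by
    funext t
    rw [multiWt_single, Nat.cast_one, mul_one]
  rw [resRep, hwt]
  let S := (Fintype.piFinset fun _ : Fin p => Finset.range (p * j + 1)).filter
    fun μ => multiWt p μ = (p * j, resWt p m)
  have hS : Covers k K V (fun t => (Pi.single t 1 : Fin p → ℕ)) (multiWt p)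
      (p * j, resWt p m) S := by
    refine ⟨fun μ hμ => (Finset.mem_filter.1 hμ).2, fun f hf u hu => ?_⟩
    have h1 := hf (MvPolynomial.mem_support_iff.1 hu)
    rw [← weight_hom_apply] at h1
    refine Finset.mem_filter.2 ⟨Fintype.mem_piFinset.2 fun t => Finset.mem_range.2 ?_, h1⟩
    have h2 := congrArg Prod.fst h1
    rw [multiWt_apply] at h2
    have h3 := Finset.single_le_sum (f := Finsupp.weight
      (fun bt : (BIdx k V) × Fin p => (Pi.single bt.2 1 : Fin p → ℕ)) u)
      (fun _ _ => Nat.zero_le _) (mem_univ t)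
    exact Nat.lt_succ_of_le (h3.trans_eq h2)
  have hsum : ∀ μ ∈ S, ∑ t, μ t = p * j := fun μ hμ => by
    have := congrArg Prod.fst (hS.1 μ hμ)
    rwa [multiWt_apply] at this
  have hsing : ∀ t : Fin p, multiWt p (Pi.single t (p * j)) = (p * j, resWt p m) ↔
      m = 2 * j * t := by
    intro t
    rw [multiWt_single, Prod.mk.injEq, and_iff_right rfl, resWt]
    have e : (t : ℤ) * ((p * j : ℕ) : ℤ) = ((p * (t * j) : ℕ) : ℤ) := by push_cast; ring
    rw [e]
    norm_cast
    constructor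
    · intro h1
      have h2 : m % 2 = 0 := by
        have h3 := congrArg (· % p) h1
        simp only [Nat.mul_mod_right, Nat.mul_add_mod] at h3
        rcases Nat.mod_two_eq_zero_or_one m with h4 | h4
        · exact h4
        · rw [h4, Nat.mod_eq_of_lt hp.one_lt] at h3
          omega
      rw [h2, add_zero] at h1
      have h3 := Nat.eq_of_mul_eq_mul_left hp.pos h1
      have h4 : 2 * j * (t : ℕ) = 2 * (t * j) := by ring
      omega
    · rintro rfl
      have h4 : 2 * j * (t : ℕ) = 2 * (t * j) := by ring
      rw [h4, Nat.mul_mod_right, Nat.mul_div_cancel_left _ two_pos, add_zero]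
  by_cases hm : ∃ t < p, m = 2 * j * t
  · obtain ⟨t, ht, hmt⟩ := hm
    have h1 := (hsing ⟨t, ht⟩).2 hmt
    rw [if_congr (and_iff_right ⟨t, ht, hmt⟩) rfl rfl]
    rw [← h1] at hS ⊢
    rw [hS.hcard_eq (Finset.mem_filter.2 ⟨Fintype.mem_piFinset.2 fun u => Finset.mem_range.2 ?_, h1⟩)
      fun μ hμ hne => hac μ (hsum μ hμ) (fun u hu => hne ?_) i hi, ← hcard_single, h i hi]
    · refine if_congr ?_ rfl rfl
      rw [show 2 * (p * j) = 2 * j * p by ring]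
    · rw [Pi.single_apply]
      split_ifs <;> omega
    · subst hu
      have h2 := (hsing u).1 ((hS.1 _ hμ).trans h1)
      rw [show u = ⟨t, ht⟩ from Fin.ext (Nat.eq_of_mul_eq_mul_left (by omega) (h2.symm.trans hmt))]
  · rw [if_neg fun h => hm h.1]
    refine Van.hcard (hS.van fun μ hμ => hac μ (hsum μ hμ) (fun t ht => hm ?_) i hi)
    subst ht
    exact ⟨t, t.2, (hsing t).1 (hS.1 _ hμ)⟩

include hac in
lemma hcard_sym_of_mul [CharP k p] [Finite K] (hj : 0 < j)
  (h : ∀ i ≤ s, hcard i (adRep ((symF k K (p * j)).rep V)) = if 2 * (p * j) ∣ i then q else 1) :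
  ∀ i ≤ s, hcard i (adRep ((symF k K j).rep V)) = if 2 * j ∣ i then q else 1 := by
  intro i hi
  rw [hcard_cycRep_zero k K V p, hcard_of_resolution (q := q)
    (fun m => (resSES (k := k) (K := K) (V := V) (p := p) (p * j) m).ad p fun b =>
      polF_tors (k := k) (K := K) _ p _ V b) hj
    (primeOut p).pos (hcard_resRep hac hj h) i hi 0]
  exact if_congr (by simp) rfl rfl

end SymStep

lemma exists_van_multiF (k K : Type) [Field k] [Finite k] [Field K] [Algebra k K] (p : ℕ)
  [Fact p.Prime] [CharP k p] [CharP K p] (d s : ℕ) : ∃ N, ∀ (V : Type) [AbGrp V]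
  [Module k V] [FinDim k V], N ≤ finrank k V → ∀ μ : Fin p → ℕ, ∑ t, μ t = d →
  (∀ t, μ ≠ Pi.single t d) → ∀ i ≤ s, Van i (adRep ((multiF k K μ).rep V)) := by
  classical
  obtain ⟨N, hN⟩ := exists_van_adRep_of_bi (k := k) p s d
  refine ⟨N, fun V _ _ _ hV μ hμ hμ' i hi => hN (multiF k K μ) ?_ (polF_tors _ p _) ?_ V hV i hi⟩
  · have := polF_poly (k := k) (K := K) (fun t => (Pi.single t 1 : Fin p → ℕ)) μ
      (∑ t, Pi.evalAddMonoidHom (fun _ : Fin p => ℕ) t)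
      (fun t => by simp [AddMonoidHom.finset_sum_apply])
    simpa [AddMonoidHom.finset_sum_apply, hμ] using this
  · have hp := primeOut p
    obtain ⟨a, ha⟩ : ∃ a, μ a ≠ 0 := by
      by_contra! h
      refine hμ' ⟨0, hp.pos⟩ ?_
      rw [← hμ, sum_eq_zero fun t _ => h t, Pi.single_zero]
      exact funext h
    have hb : ∑ t ∈ Finset.univ.erase a, μ t ≠ 0 := by
      intro h
      refine hμ' a (funext fun t => ?_)
      have h1 := Finset.add_sum_erase Finset.univ μ (mem_univ a)
      rw [h, add_zero, hμ] at h1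
      by_cases hta : t = a
      · rw [hta, Pi.single_eq_same, h1]
      · rw [Pi.single_eq_of_ne hta]
        exact Finset.sum_eq_zero_iff.1 h t (Finset.mem_erase.2 ⟨hta, mem_univ t⟩)
    refine ⟨polF_bi _ μ (· = a) (Pi.evalAddMonoidHom (fun _ : Fin p => ℕ) a)
      (∑ t ∈ Finset.univ.erase a, Pi.evalAddMonoidHom (fun _ : Fin p => ℕ) t) (fun t => ?_)
      (fun t => ?_) ha ?_⟩
    · simp [Pi.single_apply, eq_comm]
    · simp [AddMonoidHom.finset_sum_apply, Finset.sum_pi_single]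
    · simpa [AddMonoidHom.finset_sum_apply] using hb

/-! ### Truncated symmetric powers -/

section Trunc

open MvPolynomial

lemma aeval_mul_pow {σ K A : Type} [Field K] [CommRing A] [Algebra K A] (y : σ → A) (u : A)
  {w : σ → ℕ} {f : MvPolynomial σ K} {n : ℕ} (hf : IsWH w f n) :
  aeval (fun i => y i * u ^ w i) f = aeval y f * u ^ n := by
  rw [aeval_def, aeval_def, eval₂_eq, eval₂_eq, Finset.sum_mul]; refine sum_congr rfl fun s hs => ?_
  rw [← hf (MvPolynomial.mem_support_iff.1 hs), weight_apply, Finsupp.sum,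
    ← Finset.prod_pow_eq_pow_sum, mul_assoc, ← Finset.prod_mul_distrib]
  exact congrArg _ (Finset.prod_congr rfl fun i _ => by rw [mul_pow, ← pow_mul, mul_comm (w i)]; rfl)

/-- The ideal generated by the `Q`-th powers of the variables. -/
def trI (K σ : Type) [Field K] (Q : ℕ) : Ideal (MvPolynomial σ K) :=
  Ideal.span ((fun s => monomial s 1) '' Set.range fun i => single i Q)

lemma mem_trI {K σ : Type} [Field K] {Q : ℕ} {f : MvPolynomial σ K} :
  f ∈ trI K σ Q ↔ ∀ s ∈ f.support, ∃ i, Q ≤ s i := by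
  rw [trI, mem_ideal_span_monomial_image]; simp

lemma aeval_mem_trI {K σ σ' : Type} [Field K] {Q : ℕ} (x : σ → MvPolynomial σ' K)
  (hx : ∀ i, x i ^ Q ∈ trI K σ' Q) {f : MvPolynomial σ K} (hf : f ∈ trI K σ Q) :
  aeval x f ∈ trI K σ' Q := by
  have h : trI K σ Q ≤ (trI K σ' Q).comap (aeval x) := by
    rw [trI, Ideal.span_le]; rintro _ ⟨_, ⟨i, rfl⟩, rfl⟩
    change aeval x (monomial (single i Q) 1) ∈ trI K σ' Q
    rw [aeval_monomial, map_one, one_mul, Finsupp.prod_single_index (h := fun i n => x i ^ n) (pow_zero _)]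
    exact hx i
  exact h hf

variable {k K T V W : Type} [Field k] [Field K] [Algebra k K] [AbGrp V] [Module k V]
  [AbGrp W] [Module k W] {p : ℕ} [Fact p.Prime] [CharP K p] (e : ℕ)

/-- The elements whose power lies in the truncation ideal. -/
def trRoot (K σ : Type) [Field K] (p : ℕ) [Fact p.Prime] [CharP K p] (e : ℕ) :
  Submodule K (MvPolynomial σ K) where
  carrier := {f | f ^ p ^ e ∈ trI K σ (p ^ e)}
  zero_mem' := by
    rw [Set.mem_setOf_eq, zero_pow (pow_ne_zero _ (primeOut p).ne_zero)]; exact zero_mem _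
  add_mem' {f g} hf hg := by rw [Set.mem_setOf_eq, add_pow_char_pow]; exact add_mem hf hg
  smul_mem' c f hf := by
    rw [Set.mem_setOf_eq, smul_pow, smul_eq_C_mul]; exact Ideal.mul_mem_left _ _ hf

lemma X_mem_trRoot {σ : Type} (i : σ) : (X i : MvPolynomial σ K) ∈ trRoot K σ p e := by
  refine Ideal.subset_span ⟨_, ⟨i, rfl⟩, ?_⟩; rw [X_pow_eq_monomial]

lemma slot_mem_trI (φ : T → V →ₗ[k] W) {f : Pol k K T V} (hf : f ∈ trI K _ (p ^ e)) :
  slot K φ f ∈ trI K _ (p ^ e) := by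
  have h1 : ∀ (t : T) (v : W), lin k K t v ∈ trRoot K _ p e := fun t v =>
    hom_of_forall_basis t (fun b => X_mem_trRoot e (b, t)) v
  rw [slot]
  exact aeval_mem_trI (Q := p ^ e) (fun bt : (BIdx k V) × T =>
    lin k K bt.2 (φ bt.2 (BVec k V bt.1))) (fun bt => h1 bt.2 _) hf

/-- Truncated polynomials of a given weight. -/
abbrev trS (k K : Type) [Field k] [Field K] {M : Type} [AddCommMonoid M] (wt : T → M) (μ : M) (Q : ℕ)
  (V : Type) [AbGrp V] [Module k V] : AddSubgroup (polObj k K wt μ V) :=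
  (trI K _ Q).toAddSubgroup.comap (Submodule.subtype _).toAddMonoidHom

/-- The functor of truncated polynomials of a given weight. -/
abbrev trF (k K : Type) [Field k] [Field K] [Algebra k K] {M : Type} [AddCommMonoid M] (wt : T → M)
  (μ : M) (p : ℕ) [Fact p.Prime] [CharP K p] (e : ℕ) : VFun k :=
  (polF k K wt μ).quot (fun V _ _ => trS k K wt μ (p ^ e) V) fun f _ hx =>
    slot_mem_trI e (fun _ => f) hx

/-- The bidegree. -/
abbrev biWt (t : Bool) : ℕ × ℕ := if t then (1, 0) else (0, 1)

/-- The comultiplication. -/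
def dlt (k K V : Type) [Field k] [Field K] [AbGrp V] [Module k V] :
  Pol k K Unit V →ₐ[K] Pol k K Bool V := aeval fun bt => X (bt.1, true) + X (bt.1, false)

lemma dlt_slot (g : V →ₗ[k] V) (f : Pol k K Unit V) :
  dlt k K V (slot K (fun _ => g) f) = slot K (fun _ => g) (dlt k K V f) := by
  have h1 : ∀ v, dlt k K V (lin k K () v) = lin k K true v + lin k K false v := by
    have : ((dlt k K V).restrictScalars k).toLinearMap ∘ₗ lin k K () =
        lin k K true + lin k K false := (BVec k V).ext fun b => by
      rw [comp_apply, LinearMap.add_apply, lin_basis, lin_basis, lin_basis]; exact aeval_X _ _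
    exact LinearMap.congr_fun this
  have : (dlt k K V).comp (slot K fun _ => g) = (slot K fun _ => g).comp (dlt k K V) :=
    algHom_ext fun bt => by
      rw [AlgHom.comp_apply, AlgHom.comp_apply, slot_X, h1, dlt, aeval_X, map_add, slot_X, slot_X]
  exact DFunLike.congr_fun this f

/-- A component of the comultiplication. -/
abbrev dltC (k K V : Type) [Field k] [Field K] [AbGrp V] [Module k V] (a b : ℕ)
  (f : Pol k K Unit V) : Pol k K Bool V := whComp
      (fun bt : (BIdx k V) × Bool => biWt bt.2) (a, b) (dlt k K V f)

lemma dlt_hom {f : Pol k K Unit V} {d : ℕ} (hf : IsHom (fun _ => 1) f d) :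
  IsHom (fun _ => 1) (dlt k K V f) d := by
  rw [dlt]
  exact aeval_hom (w := fun _ : (BIdx k V) × Unit => 1) (w' := fun _ : (BIdx k V) × Bool => 1)
    (fun bt => X (bt.1, true) + X (bt.1, false))
    (fun bt => (isWeightedHomogeneous_X K _ _).add (isWeightedHomogeneous_X K _ _)) hf

lemma renT_dltC {a b : ℕ} {f : Pol k K Unit V} (hf : IsHom (fun _ => 1) f (a + b)) :
  renT (fun _ => ()) (dltC k K V a b f) = ((a + b).choose b : K) • f := by
  let u : Polynomial (Pol k K Unit V) := Polynomial.X
  let y : (BIdx k V) × Bool → Polynomial (Pol k K Unit V) := fun bt =>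
    Polynomial.C (X (bt.1, ()))
  let w : (BIdx k V) × Bool → ℕ := fun bt => (biWt bt.2).2
  let Θ : Pol k K Bool V →ₐ[K] Polynomial (Pol k K Unit V) := aeval fun bt => y bt * u ^ w bt
  have hC : ∀ g : Pol k K Bool V, aeval y g = Polynomial.C (renT (fun _ => ()) g) := fun g => by
    have : aeval y = (Polynomial.CAlgHom (R := K)).comp (renT fun _ : Bool => ()) :=
      algHom_ext fun bt => by rw [AlgHom.comp_apply, renT_X, aeval_X]; rfl
    rw [this]; rfl
  have h1 : Θ (dlt k K V f) = Polynomial.C f * (u + 1) ^ (a + b) := by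
    have e1 : Θ.comp (dlt k K V) =
        aeval fun bt => Polynomial.C (X bt : Pol k K Unit V) * (u + 1) ^ 1 :=
      algHom_ext fun bt => by rcases bt with ⟨b, ⟨⟩⟩; simp [dlt, Θ, y, w, biWt, mul_add, add_comm]
    have e2 : aeval (fun bt => Polynomial.C (X bt : Pol k K Unit V)) =
        Polynomial.CAlgHom (R := K) (A := Pol k K Unit V) := algHom_ext fun bt => by simp
    have := aeval_mul_pow (fun bt => Polynomial.C (X bt : Pol k K Unit V)) (u + 1) hf
    rw [← AlgHom.comp_apply, e1, this, e2]; rfl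
  have h2 : ∀ ab ∈ Finset.HasAntidiagonal.antidiagonal (a + b), Θ (dltC k K V ab.1 ab.2 f) =
      Polynomial.C (renT (fun _ => ()) (dltC k K V ab.1 ab.2 f)) * u ^ ab.2 := fun ab _ => by
    rw [← hC]
    have := isWeightedHomogeneous_map (.snd ℕ ℕ) (weightedHomogeneousComponent_isWeightedHomogeneous
        (w := fun bt : (BIdx k V) × Bool => biWt bt.2) ab (dlt k K V f))
    exact aeval_mul_pow (w := w) y u this
  have h3 := dlt_hom hf
  have h4 := sum_weightedHomogeneousComponent_eq
    (fun bt : (BIdx k V) × Bool => biWt bt.2) (dlt k K V f)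
    (Finset.HasAntidiagonal.antidiagonal (a + b)) fun s hs => by
      have h5 := h3 (MvPolynomial.mem_support_iff.1 hs)
      rw [Finset.HasAntidiagonal.mem_antidiagonal, ← h5]
      have h6 := weight_hom_apply (fun bt : (BIdx k V) × Bool => biWt bt.2)
        (AddMonoidHom.coprod (.id ℕ) (.id ℕ)) s
      refine h6.trans ?_
      congr 2; funext bt; rcases bt with ⟨_, _ | _⟩ <;> rfl
  have h5 := congrArg (fun g => (Θ g).coeff b) h4
  simp only [map_sum, h1, Polynomial.finset_sum_coeff] at h5
  rw [sum_congr rfl fun ab hab => congrArg (Polynomial.coeff · b) (h2 ab hab),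
    sum_eq_single (a, b)] at h5
  · rw [Polynomial.coeff_C_mul, Polynomial.coeff_X_pow, if_pos rfl, mul_one, Polynomial.coeff_C_mul,
      Polynomial.coeff_X_add_one_pow] at h5
    rw [h5, mul_comm, ← nsmul_eq_mul, Nat.cast_smul_eq_nsmul]
  · intro ab hab hne; rw [Polynomial.coeff_C_mul, Polynomial.coeff_X_pow, if_neg, mul_zero]
    rintro rfl; exact hne (Prod.ext (by simpa using hab) rfl)
  · intro h; exact absurd ((Finset.HasAntidiagonal.mem_antidiagonal (a := (a, b))).2 rfl) h

/-- The comultiplication on truncated polynomials. -/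
def trDlt (V : Type) [AbGrp V] [Module k V] (a b : ℕ) :
  (trF k K unitWt (a + b) p e).obj V →+ (trF k K biWt (a, b) p e).obj V :=
  QuotientAddGroup.map _ _ (((((whComp (fun bt : (BIdx k V) × Bool => biWt bt.2) (a, b)).comp
      (dlt k K V).toLinearMap).comp (Submodule.subtype _)).codRestrict (polObj k K biWt (a, b) V)
    fun _ => weightedHomogeneousComponent_isWeightedHomogeneous _ _).toAddMonoidHom) fun x hx => by
      change dltC k K V a b x.1 ∈ trI K _ (p ^ e)
      have h1 : dlt k K V x.1 ∈ trI K _ (p ^ e) := aeval_mem_trI _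
        (fun bt => (add_mem (X_mem_trRoot e _) (X_mem_trRoot e _) : _ ∈ trRoot K _ p e)) hx
      classical
      rw [mem_trI] at h1 ⊢
      intro s hs
      rw [MvPolynomial.mem_support_iff, coeff_weightedHomogeneousComponent] at hs
      exact h1 s (MvPolynomial.mem_support_iff.2 fun h => hs (by rw [h, ite_self]))

/-- The multiplication on truncated polynomials, rescaled. -/
def trMul (V : Type) [AbGrp V] [Module k V] (a b : ℕ) (c : K) :
  (trF k K biWt (a, b) p e).obj V →+ (trF k K unitWt (a + b) p e).obj V :=
  QuotientAddGroup.map _ _ ((c • (renT fun _ => ()).toLinearMap).restrict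
    (q := polObj k K unitWt (a + b) V) (fun x hx => by
      refine Submodule.smul_mem _ c (renT_hom (fun _ => ()) unitWt ?_)
      convert isWeightedHomogeneous_map (AddMonoidHom.coprod (.id ℕ) (.id ℕ)) hx with bt
      · rcases bt with ⟨_, _ | _⟩ <;> rfl
      · simp)).toAddMonoidHom fun x hx => by
      change c • renT (fun _ => ()) x.1 ∈ trI K _ (p ^ e); rw [smul_eq_C_mul]
      exact Ideal.mul_mem_left _ _ (aeval_mem_trI _ (fun bt => X_mem_trRoot e _) hx)

lemma van_trF_of_choose {a b : ℕ} (hc : ((a + b).choose b : K) ≠ 0) {i : ℕ}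
  (hv : Van i (adRep ((trF k K biWt (a, b) p e).rep V))) :
  Van i (adRep ((trF k K unitWt (a + b) p e).rep V)) := by
  refine Van.of_retract (i := postComp V (trDlt e V a b)) (r := postComp V (trMul e V a b
    ((a + b).choose b : K)⁻¹)) (equi_postComp fun g x => ?_) (equi_postComp fun g x => ?_)
    (fun η => AddMonoidHom.ext fun v => ?_) hv
  · obtain ⟨x, rfl⟩ := mk_surjective x; refine congrArg QuotientAddGroup.mk (Subtype.ext ?_)
    have h := weightedHomogeneousComponent_comm (w := fun bt : (BIdx k V) × Bool => biWt bt.2)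
      (w' := fun bt : (BIdx k V) × Bool => biWt bt.2)
      (slot K fun _ => g.toLinearMap).toLinearMap id Function.injective_id
      (fun n f hf => slot_hom biWt (fun _ => g.toLinearMap) (f := f) (μ := n) hf) (a, b)
      (dlt k K V x.1)
    exact (congrArg (whComp _ (a, b)) (dlt_slot g.toLinearMap x.1)).trans h
  · obtain ⟨x, rfl⟩ := mk_surjective x; refine congrArg QuotientAddGroup.mk (Subtype.ext ?_)
    change ((a + b).choose b : K)⁻¹ • renT (fun _ => ()) (slot K (fun _ => g.toLinearMap) x.1) =
      slot K (fun _ => g.toLinearMap) (((a + b).choose b : K)⁻¹ • renT (fun _ => ()) x.1)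
    rw [renT_slot, map_smul]
  · change trMul e V a b _ (trDlt e V a b (η v)) = η v; obtain ⟨x, hx⟩ := mk_surjective (η v)
    rw [← hx]; refine congrArg QuotientAddGroup.mk (Subtype.ext ?_)
    change ((a + b).choose b : K)⁻¹ • renT (fun _ => ()) (dltC k K V a b x.1) = x.1
    rw [renT_dltC x.2, smul_smul, inv_mul_cancel₀ hc, one_smul]

variable (k K p)

lemma exists_van_trF [Finite k] [CharP k p] (a b s : ℕ) (ha : a ≠ 0) (hb : b ≠ 0)
  (hc : ((a + b).choose b : K) ≠ 0) : ∃ N, ∀ (V : Type) [AbGrp V] [Module k V]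
  [FinDim k V], N ≤ finrank k V →
  ∀ i ≤ s, Van i (adRep ((trF k K unitWt (a + b) p e).rep V)) := by
  obtain ⟨N, hN⟩ := exists_van_adRep_of_bi (k := k) p s (a + b)
  refine ⟨N, fun V _ _ _ hV i hi => van_trF_of_choose e hc (hN _ (VFun.quot_poly _ _ _
    (polF_poly biWt (a, b) (AddMonoidHom.coprod (.id ℕ) (.id ℕ)) ?_))
    (VFun.quot_tors _ _ _ (polF_tors biWt p (a, b))) ⟨(polF_bi biWt (a, b) (· = true)
      (.fst ℕ ℕ) (.snd ℕ ℕ) ?_ ?_ ha hb).quot _ _ fun f g x hx =>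
      slot_mem_trI e (fun t => if t = true then f else g) hx⟩ V hV i hi)⟩
  all_goals exact fun t => by cases t <;> rfl

end Trunc

/-! ### Functions on surjective linear maps -/

section Sur

variable {k K V : Type} [Field k] [Field K] [Algebra k K] [AbGrp V] [Module k V]

/-- Surjective linear maps to an extension field. -/
abbrev Sur (k K V : Type) [Field k] [Field K] [Algebra k K] [AbGrp V] [Module k V] :=
  {φ : V →ₗ[k] K // Surjective φ}

/-- The action of linear automorphisms on surjective maps. -/
def surPerm (k K V : Type) [Field k] [Field K] [Algebra k K] [AbGrp V] [Module k V] :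
  (V ≃ₗ[k] V) →* Perm (Sur k K V) :=
  actPerm (fun g φ => ⟨φ.1 ∘ₗ (g⁻¹ : V ≃ₗ[k] V)ˡ, φ.2.comp (g⁻¹ : V ≃ₗ[k] V).surjective⟩)
    (fun _ => rfl) fun g h φ => Subtype.ext (by rw [mul_inv_rev]; rfl)

/-- The functions on surjective maps. -/
abbrev surRep (k K V : Type) [Field k] [Field K] [Algebra k K] [AbGrp V] [Module k V] :
  GMod (V ≃ₗ[k] V) (Sur k K V → K) := funRep (surPerm k K V) 1

lemma surRep_apply (g : V ≃ₗ[k] V) (f : Sur k K V → K) (φ : Sur k K V) :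
  surRep k K V g f φ = f ⟨φ.1 ∘ₗ gˡ, φ.2.comp g.surjective⟩ := rfl

lemma apply_of_surPerm {g : V ≃ₗ[k] V} {φ : Sur k K V} (h : surPerm k K V g φ = φ) (v : V) :
  g v - v ∈ ker φ.1 := by
  have h1 : φ.1 (g⁻¹ (g v)) = φ.1 (g v) := LinearMap.congr_fun (congrArg Subtype.val h) (g v)
  rw [mem_ker, map_sub, sub_eq_zero, ← h1]; exact congrArg φ.1 (g.symm_apply_apply v)

lemma surPerm_of_mem {g : V ≃ₗ[k] V} {φ : Sur k K V} {A : Submodule k V}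
  (h : g ∈ Gs (ker φ.1) A) : surPerm k K V g φ = φ := by
  refine Subtype.ext (LinearMap.ext fun v => ?_); have h1 := mem_ker.1 (h.1 (g⁻¹ v))
  rw [map_sub, sub_eq_zero] at h1; exact h1.symm.trans (congrArg φ.1 (g.apply_symm_apply v))

/-- The functor of additive functions on the dual. -/
abbrev addDualF (k K : Type) [Field k] [Field K] : VFun k where
  obj U _ _ := Dual k U →+ K
  grp U _ _ := inferInstance
  map f := AddMonoidHom.mk' (fun η => η.comp f.dualMap.toAddMonoidHom) fun _ _ => rfl
  map_id _ _ _ _ := rfl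
  map_comp _ _ _ := rfl

variable [FinDim k K]

lemma finrank_le_ker_add [FinDim k V] (φ : V →ₗ[k] K) :
  finrank k V ≤ finrank k (ker φ) + finrank k K := by
  have := finrank_range_add_finrank_ker φ; have := Submodule.finrank_le (range φ); omega

variable (k K) [Finite k] (p : ℕ) [Fact p.Prime] [CharP k p] [CharP K p]

include p

lemma exists_van_surRep (i : ℕ) : ∃ N, ∀ (V : Type) [AbGrp V] [Module k V]
  [FinDim k V], N ≤ finrank k V → Van (i + 1) (adRep (surRep k K V)) := by
  obtain ⟨N, hN⟩ := exists_van_gs (k := k) p i 1 0 (finrank k K)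
  have hK : ∀ x : K, p • x = 0 := fun x => by rw [charP_nsmul K]
  refine ⟨N, fun V _ _ _ hV => ?_⟩
  refine Van.of_retract (σ := funRep (surPerm k K V) (adRep 1))
    (i := AddMonoidHom.mk' (fun η φ => (Pi.evalAddMonoidHom _ φ).comp η) fun _ _ => rfl)
    (r := AddMonoidHom.mk' (fun θ => AddMonoidHom.mk' (fun v φ => θ φ v) fun v w =>
      funext fun φ => map_add (θ φ) v w) fun _ _ => rfl) (fun _ _ => rfl) (fun _ _ => rfl)
    (fun _ => rfl) (van_funRep fun φ => ⟨Gs (ker φ.1) ⊥, inferInstance,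
      (Gs (ker φ.1) ⊥).subtype, Subtype.val_injective, fun g hg =>
      ⟨⟨g, apply_of_surPerm hg, map_mem_bot _⟩, rfl⟩,
      fun g => surPerm_of_mem g.2, ?_⟩)
  obtain ⟨E, hE⟩ := exists_gs_dual (ker φ.1)
  have h1 := hN (addDualF k K) (fun V W _ _ _ _ η f h x => AddMonoidHom.ext fun ψ => ?_)
    (fun U _ _ η => AddMonoidHom.ext fun x => hK _) (Dual k V) ⊤ (ker φ.1).dualAnnihilator
    ?_ (by rw [finrank_top, add_zero]) (by rwa [finrank_top, Subspace.dual_finrank_eq])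
  · refine Van.of_equiv E.symm (N := Dual k (Dual k V) →+ K)
      (AddEquiv.mk' ⟨fun η => η.comp (evalEquiv k V).symmˡ.toAddMonoidHom,
        fun η => η.comp (evalEquiv k V)ˡ.toAddMonoidHom, fun η => AddMonoidHom.ext fun v =>
        congrArg η ((evalEquiv k V).symm_apply_apply v), fun η => AddMonoidHom.ext fun v =>
        congrArg η ((evalEquiv k V).apply_symm_apply v)⟩ fun _ _ => rfl) (fun h η => ?_) h1
    obtain ⟨g, rfl⟩ := E.surjective h; refine AddMonoidHom.ext fun x => ?_
    obtain ⟨v, rfl⟩ := (evalEquiv k V).surjective x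
    have h2 : (E g).1ˡ.dualMap (evalEquiv k V v) = evalEquiv k V (g.1⁻¹ v) := by rw [hE]; rfl
    change η ((E.symm (E g)).1⁻¹ ((evalEquiv k V).symm (evalEquiv k V v))) =
      η ((evalEquiv k V).symm ((E g).1ˡ.dualMap (evalEquiv k V v)))
    rw [h2, E.symm_apply_apply, LinearEquiv.symm_apply_apply, LinearEquiv.symm_apply_apply]
  · have h2 : ∀ f : V →ₗ[k] W, (addDualF k K).map f η ψ = η (ψ ∘ₗ f) := fun _ => rfl
    change (addDualF k K).map (x + h + f) η ψ - (addDualF k K).map (x + h) η ψ -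
      ((addDualF k K).map (x + f) η ψ - (addDualF k K).map x η ψ) = 0
    simp only [h2, LinearMap.comp_add, map_add]; abel
  · have h2 := Subspace.finrank_add_finrank_dualAnnihilator_eq (ker φ.1)
    have := finrank_le_ker_add φ.1; omega

lemma exists_van_cubeRep_surRep (i b : ℕ) : ∃ N, ∀ (V : Type) [AbGrp V] [Module k V]
  [FinDim k V], N ≤ finrank k V → Van (i + 1) (cubeRep (surRep k K V) b) := by
  obtain ⟨N, hN⟩ := exists_van_gs (k := k) p i 0 (finrank k K) (2 ^ b)
  refine ⟨N + finrank k K, fun V _ _ _ hV => ?_⟩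
  refine van_funRep fun x => ⟨Gs ⊤ (csp k b x), inferInstance, (Gs ⊤ (csp k b x)).subtype,
    Subtype.val_injective, fun g hg => ⟨⟨g, (cmap_eq_iff_mem_Gs b g x).1 hg⟩, rfl⟩,
    fun h => (cmap_eq_iff_mem_Gs b h.1 x).2 h.2, ?_⟩
  change Van _ (funRep ((surPerm k K V).comp (Subgroup.subtype _)) (1 : GMod (Gs ⊤ (csp k b x)) K))
  refine van_funRep fun φ => ⟨Gs (ker φ.1) (csp k b x), inferInstance,
    inclusion (Gs_mono le_top le_rfl), Subgroup.inclusion_injective _, fun g hg =>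
      ⟨⟨g.1, apply_of_surPerm hg, g.2.2⟩, rfl⟩, fun g => surPerm_of_mem g.2, ?_⟩
  have h1 := finrank_le_ker_add φ.1
  exact hN (VFun.const k K) (VFun.const_poly K 0) (fun U _ _ (x : K) => by
    rw [charP_nsmul K]) V (ker φ.1) _
    (finrank_csp_le b x) h1 (by omega)

end Sur

/-! ### Polynomial functions on surjective maps -/

section Ev

open MvPolynomial

variable {k K V : Type} [Field k] [Field K] [Algebra k K] [AbGrp V] [Module k V]

/-- The function attached to a polynomial. -/
def ev (k K V : Type) [Field k] [Field K] [Algebra k K] [AbGrp V] [Module k V] :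
  Pol k K Unit V →ₐ[K] (Sur k K V → K) := aeval fun bt φ => φ.1 (BVec k V bt.1)

lemma ev_apply (f : Pol k K Unit V) (φ : Sur k K V) :
  ev k K V f φ = aeval (fun bt => φ.1 (BVec k V bt.1)) f := by
  have : (Pi.evalAlgHom K (fun _ : Sur k K V => K) φ).comp (ev k K V) =
      aeval fun bt => φ.1 (BVec k V bt.1) :=
    algHom_ext fun bt => by rw [AlgHom.comp_apply, ev, aeval_X, aeval_X]; rfl
  exact DFunLike.congr_fun this f

lemma ev_lin (v : V) (φ : Sur k K V) : ev k K V (lin k K () v) φ = φ.1 v := by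
  have : (LinearMap.proj φ).comp (((ev k K V).restrictScalars k).toLinearMap.comp (lin k K ())) =
      φ.1 := (BVec k V).ext fun b => by
    rw [comp_apply, comp_apply, lin_basis]; exact (ev_apply (X (b, ())) φ).trans (aeval_X _ _)
  exact LinearMap.congr_fun this v

lemma ev_slot (g : V ≃ₗ[k] V) (f : Pol k K Unit V) :
  ev k K V (slot K (fun _ => gˡ) f) = surRep k K V g (ev k K V f) := by
  funext φ
  let ψ : Sur k K V := ⟨φ.1 ∘ₗ gˡ, φ.2.comp g.surjective⟩
  have : (Pi.evalAlgHom K (fun _ => K) φ).comp ((ev k K V).comp (slot K fun _ => gˡ)) =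
      (Pi.evalAlgHom K (fun _ => K) ψ).comp (ev k K V) := algHom_ext fun bt => by
    rw [AlgHom.comp_apply, AlgHom.comp_apply, AlgHom.comp_apply, slot_X]
    exact (ev_lin _ φ).trans ((ev_apply (X bt) ψ).trans (aeval_X _ _)).symm
  exact DFunLike.congr_fun this f

/-- Multiplication of a surjective map by a scalar. -/
def Sur.smul (u : Kˣ) (φ : Sur k K V) : Sur k K V :=
  ⟨(u : K) • φ.1, fun x => by
    obtain ⟨v, hv⟩ := φ.2 ((u⁻¹ : Kˣ) * x)
    exact ⟨v, by rw [LinearMap.smul_apply, hv, smul_eq_mul, Units.mul_inv_cancel_left]⟩⟩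

lemma ev_smul {f : Pol k K Unit V} {n : ℕ} (hf : IsHom (fun _ => 1) f n) (u : Kˣ) (φ : Sur k K V) :
  ev k K V f (φ.smul u) = (u : K) ^ n * ev k K V f φ := by
  rw [ev_apply, ev_apply, mul_comm, ← aeval_mul_pow _ _ hf]; congr 2; funext bt
  exact (mul_comm _ _).trans (congrArg _ (pow_one _).symm)

lemma degree_of_hom {f : Pol k K Unit V} {n : ℕ} (hf : IsHom (fun _ => 1) f n) {s}
  (hs : s ∈ f.support) : s.degree = n := by
  rw [← hf (MvPolynomial.mem_support_iff.1 hs), Finsupp.degree_eq_weight_one]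

variable [Fintype K] [DecidableEq K]

/-- The projection to the functions of weight opposite to `d`. -/
def prW (k K V : Type) [Field k] [Field K] [Algebra k K] [AbGrp V] [Module k V] [Fintype K]
  [DecidableEq K] (d : ℕ) : (Sur k K V → K) →+ (Sur k K V → K) :=
  AddMonoidHom.mk' (fun f φ => -∑ u : Kˣ, (u : K) ^ d * f (φ.smul u)) fun f g => funext fun φ => by
    simp only [Pi.add_apply, mul_add, sum_add_distrib, neg_add]

lemma prW_apply (d : ℕ) (f : Sur k K V → K) (φ : Sur k K V) :
  prW k K V d f φ = -∑ u : Kˣ, (u : K) ^ d * f (φ.smul u) := rfl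

lemma prW_prW (d : ℕ) (f : Sur k K V → K) : prW k K V d (prW k K V d f) = prW k K V d f := by
  funext φ
  have h1 : ∀ u : Kˣ, (u : K) ^ d * prW k K V d f (φ.smul u) = prW k K V d f φ := fun u => by
    rw [prW_apply, prW_apply, mul_neg, Finset.mul_sum]
    refine congrArg _ (Fintype.sum_equiv (Equiv.mulRight u) _ _ fun w => ?_)
    rw [← mul_assoc, ← mul_pow, mul_comm (u : K)]
    exact congrArg₂ _ rfl (congrArg f (Subtype.ext (smul_smul _ _ _)))
  rw [prW_apply, sum_congr rfl fun u _ => h1 u, sum_const, Finset.card_univ,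
    Fintype.card_units, nsmul_eq_mul, Nat.cast_sub Fintype.card_pos, FiniteField.cast_card_eq_zero]
  ring

lemma prW_ev (d : ℕ) {f : Pol k K Unit V} {n : ℕ} (hf : IsHom (fun _ => 1) f n) :
  prW k K V d (ev k K V f) = if card K - 1 ∣ d + n then ev k K V f else 0 := by
  funext φ; simp only [prW_apply, ev_smul hf, ← mul_assoc, ← pow_add]
  rw [← Finset.sum_mul, FiniteField.sum_pow_units]; split_ifs <;> simp

/-- The polynomial functions of a given degree. -/
def polW (k K V : Type) [Field k] [Field K] [Algebra k K] [AbGrp V] [Module k V] (n : ℕ) :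
  AddSubgroup (Sur k K V → K) :=
  (polObj k K unitWt n V).toAddSubgroup.map (ev k K V).toLinearMap.toAddMonoidHom

lemma ev_mem_polW {f : Pol k K Unit V} {n : ℕ} (hf : ∀ s ∈ f.support, ∀ c,
  ev k K V (monomial s c) ∈ polW k K V n) : ev k K V f ∈ polW k K V n := by
  rw [f.as_sum, map_sum]; exact sum_mem fun s hs => hf s hs _

lemma monomial_mem_polW {s : (BIdx k V) × Unit →₀ ℕ} {n : ℕ} (hs : s.degree = n)
  (c : K) : ev k K V (monomial s c) ∈ polW k K V n :=
  ⟨_, isHomogeneous_monomial c hs, rfl⟩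

lemma ev_monomial (s : (BIdx k V) × Unit →₀ ℕ) (i) (c : K) :
  ev k K V (monomial (s + single i (card K)) c) =
  ev k K V (monomial (s + single i 1) c) := by
  funext φ
  rw [monomial_add_single, monomial_add_single, map_mul, map_mul, map_pow, map_pow, pow_one,
    Pi.mul_apply, Pi.mul_apply, Pi.pow_apply, FiniteField.pow_card]

lemma exists_eq_add_single {σ : Type} {s : σ →₀ ℕ} {i : σ} {n : ℕ} (h : n ≤ s i) :
  ∃ s', s = s' + single i n := ⟨_, (tsub_add_cancel_of_le (single_le_iff.2 h)).symm⟩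

lemma polW_mono {n : ℕ} (hn : n ≠ 0) : polW k K V n ≤ polW k K V (n + (card K - 1)) := by
  rintro _ ⟨f, hf, rfl⟩; refine ev_mem_polW fun s hs c => ?_
  have hd := degree_of_hom hf hs
  obtain ⟨i, hi⟩ : ∃ i, s i ≠ 0 := by
    by_contra! h; rw [show s = 0 from Finsupp.ext h, map_zero] at hd; exact hn hd.symm
  obtain ⟨s, rfl⟩ := exists_eq_add_single (Nat.one_le_iff_ne_zero.2 hi)
  have := Fintype.card_pos (α := K); rw [← ev_monomial]; refine monomial_mem_polW ?_ c
  rw [map_add, Finsupp.degree_single] at hd ⊢; omega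

lemma ev_mem_of_trI {n : ℕ} {f : Pol k K Unit V}
  (hf : IsHom (fun _ => 1) f (n + (card K - 1))) (h : f ∈ trI K _ (card K)) :
  ev k K V f ∈ polW k K V n := by
  refine ev_mem_polW fun s hs c => ?_
  have hd := degree_of_hom hf hs; obtain ⟨i, hi⟩ := mem_trI.1 h s hs
  obtain ⟨s, rfl⟩ := exists_eq_add_single hi; have := Fintype.card_pos (α := K); rw [ev_monomial]
  refine monomial_mem_polW ?_ c; rw [map_add, Finsupp.degree_single] at hd ⊢; omega

lemma mem_trI_of_ev [FinDim k V] [FinDim k K] {m : ℕ} {f g : Pol k K Unit V}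
  (hf : IsHom (fun _ => 1) f m) (hg : g.totalDegree < m) (h : ev k K V f = ev k K V g)
  (hV : m + finrank k K ≤ finrank k V) : f ∈ trI K _ (card K) := by
  classical
  by_contra hn
  rw [mem_trI] at hn
  push Not at hn
  obtain ⟨s, hs, hs'⟩ := hn; have hd := degree_of_hom hf hs
  have hgs : coeff s g = 0 := coeff_eq_zero_of_totalDegree_lt (by rwa [← Finsupp.degree_apply, hd])
  have hc : coeff s (f - g) ≠ 0 := by
    rw [coeff_sub, hgs, sub_zero]; exact MvPolynomial.mem_support_iff.1 hs
  have ht : (f - g).totalDegree = s.degree := le_antisymm ((totalDegree_sub _ _).trans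
    (max_le ((IsHomogeneous.totalDegree_le hf).trans_eq hd.symm) (hg.le.trans_eq hd.symm)))
    (le_totalDegree (MvPolynomial.mem_support_iff.2 hc))
  let B := (BIdx k V) × Unit
  have := Fintype.ofFinite B
  have hcard : card (Fin (finrank k K)) ≤ card {i : B // i ∉ s.support} := by
    rw [Fintype.card_fin, Fintype.card_subtype_compl, Fintype.card_coe]
    have h1 : card B = finrank k V := by
      rw [← Nat.card_eq_fintype_card, Nat.card_prod, Nat.card_unique (α := Unit), mul_one,
        finrank_eq_nat_card_basis (BVec k V)]
    have h2 : s.support.card ≤ m := by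
      rw [← hd, Finsupp.degree_apply, Finset.card_eq_sum_ones]
      exact Finset.sum_le_sum fun i hi => Nat.one_le_iff_ne_zero.2 (Finsupp.mem_support_iff.1 hi)
    omega
  obtain ⟨j⟩ := Function.Embedding.nonempty_of_card_le hcard
  let y : B → K := Function.extend (fun i => (j i).1) (finBasis k K) 0
  obtain ⟨x, hx, hx'⟩ := combinatorial_nullstellensatz_exists_eval_nonzero (f - g) s hc ht
    (fun i => if i ∈ s.support then Finset.univ else {y i}) fun i => by
      split_ifs with hi
      · exact hs' i
      · rw [Finsupp.notMem_support_iff.1 hi, Finset.card_singleton]; exact one_pos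
  let φ : V →ₗ[k] K := (BVec k V).constr k fun b => x (b, ())
  have hφb : ∀ bt : B, φ (BVec k V bt.1) = x bt := fun bt => Basis.constr_basis _ _ _ _
  have hφ : range φ = ⊤ := by
    rw [eq_top_iff, ← (finBasis k K).span_eq, Submodule.span_le]; rintro _ ⟨i, rfl⟩
    refine ⟨BVec k V (j i).1.1, ?_⟩; have h1 := hx (j i).1
    rw [if_neg (j i).2, Finset.mem_singleton] at h1; rw [hφb, h1]
    exact Injective.extend_apply (fun a b hab => j.injective (Subtype.ext hab)) _ _ _
  refine hx' ?_
  have h1 := congrFun h ⟨φ, LinearMap.range_eq_top.1 hφ⟩; rw [ev_apply, ev_apply] at h1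
  simp only [hφb] at h1; rw [map_sub, ← coe_aeval_eq_eval, sub_eq_zero]; exact h1

end Ev

/-! ### The filtration of the functions by degree -/

section Fil

open MvPolynomial

variable {k K V : Type} [Field k] [Field K] [Algebra k K] [AbGrp V] [Module k V] [Fintype K]
  [DecidableEq K]

/-- The filtration by degree of the functions of weight `d`. -/
def filW (k K V : Type) [Field k] [Field K] [Algebra k K] [AbGrp V] [Module k V] [Fintype K]
  (d : ℕ) : ℕ → AddSubgroup (Sur k K V → K)
  | 0 => ⊥
  | l + 1 => polW k K V (d + l * (card K - 1))

lemma filW_equi (d l : ℕ) (g : V ≃ₗ[k] V) {f : Sur k K V → K} (hf : f ∈ filW k K V d l) :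
  surRep k K V g f ∈ filW k K V d l := by
  cases l with
  | zero => rw [show f = 0 from hf, map_zero]; exact zero_mem _
  | succ l =>
    obtain ⟨f, hf, rfl⟩ := hf
    exact ⟨slot K (fun _ => gˡ) f, slot_hom (fun _ => 1) _ (show IsHom (fun _ => 1) f _ from hf),
      ev_slot g f⟩

lemma filW_mono {d : ℕ} (hd : d ≠ 0) : Monotone (filW k K V d) := monotone_nat_of_le_succ fun l => by
  cases l with
  | zero => exact bot_le
  | succ l =>
    refine (polW_mono (by omega)).trans_eq ?_
    rw [filW, add_mul, one_mul, add_assoc]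

/-- The quotients of the functions by the filtration. -/
def filRep (k K V : Type) [Field k] [Field K] [Algebra k K] [AbGrp V] [Module k V] [Fintype K]
  [DecidableEq K] (d d' l : ℕ) :
  GMod (V ≃ₗ[k] V) ((Sur k K V → K) ⧸ (filW k K V d l).comap (prW k K V d')) :=
  (surRep k K V).quot _ fun g _ hf => filW_equi d l g hf

variable {p : ℕ} [Fact p.Prime] [CharP K p] {e d d' : ℕ}

lemma exists_filRep_ses [FinDim k V] [FinDim k K] (hd : d ≠ 0) (hd' : d' ≠ 0)
  (hQ : card K = p ^ e) (hdd : d + d' = card K - 1) (l : ℕ)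
  (hV : d + l * (card K - 1) + finrank k K ≤ finrank k V) :
  ∃ f g, SES ((trF k K unitWt (d + l * (card K - 1)) p e).rep V)
  (filRep k K V d d' l) (filRep k K V d d' (l + 1)) f g ∧
  ∀ x, g (QuotientAddGroup.mk x) = QuotientAddGroup.mk x := by
  set m := d + l * (card K - 1) with hm
  have hpr : ∀ f ∈ polObj k K unitWt m V, prW k K V d' (ev k K V f) = ev k K V f :=
    fun f hf => (prW_ev d' hf).trans (if_pos ⟨l + 1, by rw [hm, ← hdd]; ring⟩)
  let ε : polObj k K unitWt m V →+ (Sur k K V → K) :=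
    (ev k K V).toLinearMap.toAddMonoidHom.comp (Submodule.subtype _).toAddMonoidHom
  have h1 : trS k K unitWt m (p ^ e) V ≤ ((filW k K V d l).comap (prW k K V d')).comap ε := by
    rintro ⟨f, hfm⟩ hf; change prW k K V d' (ev k K V f) ∈ filW k K V d l; rw [hpr _ hfm]
    have hf' : f ∈ trI K _ (card K) := hQ ▸ hf
    cases l with
    | zero =>
      have h0 : f = 0 := by
        rw [← MvPolynomial.support_eq_empty, Finset.eq_empty_iff_forall_notMem]; intro s hs
        obtain ⟨i, hi⟩ := mem_trI.1 hf' s hs; have h2 := degree_of_hom hfm hs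
        have h3 := Finsupp.le_degree i s; omega
      rw [h0, map_zero]; exact zero_mem _
    | succ l =>
      have h2 : m = d + l * (card K - 1) + (card K - 1) := by rw [hm]; ring
      exact ev_mem_of_trI (h2 ▸ hfm) hf'
  refine ⟨QuotientAddGroup.map _ _ ε h1, QuotientAddGroup.map _ _ (.id _)
    fun f hf => filW_mono hd (Nat.le_succ l) hf, ⟨?_, ?_, ?_, ?_, ?_⟩, fun _ => rfl⟩
  · intro g x; obtain ⟨x, rfl⟩ := mk_surjective x
    exact congrArg QuotientAddGroup.mk (ev_slot g x.1)
  · intro g x; obtain ⟨x, rfl⟩ := mk_surjective x; rfl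
  · rw [injective_iff_map_eq_zero]; intro x hx; obtain ⟨x, rfl⟩ := mk_surjective x
    have h2 : prW k K V d' (ev k K V x.1) ∈ filW k K V d l :=
      (eq_zero_iff (ε x)).1 hx
    rw [hpr _ x.2] at h2; refine (eq_zero_iff _).2 ?_
    change x.1 ∈ trI K _ (p ^ e); rw [← hQ]
    cases l with
    | zero =>
      exact mem_trI_of_ev (g := 0) x.2 (by rw [totalDegree_zero]; omega) (by rw [map_zero]; exact h2) hV
    | succ l =>
      obtain ⟨g, hg, hg'⟩ := h2
      refine mem_trI_of_ev x.2 ((IsHomogeneous.totalDegree_le hg).trans_lt ?_) hg'.symm hV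
      rw [hm, add_mul]; omega
  · intro x; obtain ⟨x, rfl⟩ := mk_surjective x; exact ⟨QuotientAddGroup.mk x, rfl⟩
  · intro x; obtain ⟨x, rfl⟩ := mk_surjective x; constructor
    · intro hx
      obtain ⟨f, hf, hf'⟩ : prW k K V d' x ∈ filW k K V d (l + 1) :=
        (eq_zero_iff (N := (filW k K V d (l + 1)).comap (prW k K V d')) x).1 hx
      refine ⟨QuotientAddGroup.mk ⟨f, hf⟩, (QuotientAddGroup.eq.2 ?_)⟩
      change prW k K V d' (-ev k K V f + x) ∈ filW k K V d l; rw [map_add, map_neg, hpr f hf, ← hf']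
      convert zero_mem (filW k K V d l)
      exact neg_add_cancel _
    · rintro ⟨f, hf⟩; obtain ⟨f, rfl⟩ := mk_surjective f; rw [← hf]; refine (eq_zero_iff _).2 ?_
      change prW k K V d' (ev k K V f.1) ∈ filW k K V d (l + 1); rw [hpr _ f.2]
      exact ⟨f.1, f.2, rfl⟩

/-- The functions of weight `d` inside all functions. -/
def filInc (k K V : Type) [Field k] [Field K] [Algebra k K] [AbGrp V] [Module k V] [Fintype K]
  [DecidableEq K] (d d' : ℕ) :
  ((Sur k K V → K) ⧸ (filW k K V d 0).comap (prW k K V d')) →+ (Sur k K V → K) :=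
  QuotientAddGroup.lift _ (prW k K V d') fun _ hf => hf

lemma filInc_equi (g : V ≃ₗ[k] V) (x) : filInc k K V d d' (filRep k K V d d' 0 g x) =
  surRep k K V g (filInc k K V d d' x) := by
  obtain ⟨x, rfl⟩ := mk_surjective x; rfl

lemma mk_filInc (x) : QuotientAddGroup.mk (filInc k K V d d' x) = x := by
  obtain ⟨x, rfl⟩ := mk_surjective x; refine QuotientAddGroup.eq.2 ?_
  change prW k K V d' (-prW k K V d' x + x) = 0; rw [map_add, map_neg, prW_prW, neg_add_cancel]

lemma mem_fil_of_invariant [Finite k] [FinDim k V] [FinDim k K] (hd : d ≠ 0) (hd' : d' ≠ 0)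
  (hdd : d + d' = card K - 1) {b J : ℕ} (hJ : 2 ^ b ≤ J)
  (hV : 2 ^ b + 5 * finrank k K ≤ finrank k V) {c : Cube b V → Sur k K V → K}
  (hc : ∀ g, cubeRep (surRep k K V) b g c = c) (x : Cube b V) :
  prW k K V d' (c x) ∈ filW k K V d (J + 1) := by
  set A := csp k b x; have hA : finrank k A ≤ 2 ^ b := finrank_csp_le b x
  let v : Fin (finrank k A) → V := fun i => (finBasis k A i : V)
  have h1 : ∀ φ φ' : Sur k K V, (fun i => φ.1 (v i)) = (fun i => φ'.1 (v i)) → c x φ = c x φ' := by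
    intro φ φ' h
    have h2 : φ.1 ∘ₗ A.subtype = φ'.1 ∘ₗ A.subtype := (finBasis k A).ext fun i => congrFun h i
    obtain ⟨g, hg, hg'⟩ := exists_Gs_connect ⊤ A φ.1 φ'.1
      (fun y => (φ.2 y).imp fun v hv => ⟨Submodule.mem_top, hv⟩)
      (fun y => (φ'.2 y).imp fun v hv => ⟨Submodule.mem_top, hv⟩)
      (fun a ha => LinearMap.congr_fun h2 ⟨a, ha⟩) (by rw [top_inf_eq, finrank_top]; omega)
    have h3 := congrFun (congrFun (hc g) x) φ'
    rw [cubeRep_apply, (cmap_eq_iff_mem_Gs b _ x).2 (inv_mem hg), surRep_apply] at h3; rw [← h3]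
    exact congrArg (c x) (Subtype.ext (LinearMap.ext fun w => (hg' w).symm))
  let θ : (Fin (finrank k A) → K) → K := Function.extend (fun φ : Sur k K V => fun i => φ.1 (v i)) (c x) 0
  obtain ⟨f, hf, hfθ⟩ : θ ∈ (restrictDegree (Fin (finrank k A)) K (card K - 1)).map
      (evalₗ K (Fin (finrank k A))) := by
    rw [map_restrict_dom_evalₗ]; exact Submodule.mem_top
  let α : MvPolynomial (Fin (finrank k A)) K →ₐ[K] Pol k K Unit V := aeval fun i => lin k K () (v i)
  have h2 : ev k K V (α f) = c x := funext fun φ => by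
    have e1 : (Pi.evalAlgHom K (fun _ => K) φ).comp ((ev k K V).comp α) = aeval fun i => φ.1 (v i) :=
      algHom_ext fun i => by
        rw [AlgHom.comp_apply, AlgHom.comp_apply, aeval_X, aeval_X]; exact ev_lin (v i) φ
    refine (DFunLike.congr_fun e1 f).trans ((congrFun hfθ fun i => φ.1 (v i)).trans ?_)
    exact Function.FactorsThrough.extend_apply (fun φ φ' h => h1 φ φ' h) _ φ
  rw [← h2, ← sum_homogeneousComponent f, map_sum, map_sum, map_sum]; refine sum_mem fun n hn => ?_
  have h3 : IsHom unitWt (α (homogeneousComponent n f)) n :=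
    aeval_hom (w := fun _ => 1) (w' := fun _ : (BIdx k V) × Unit => 1)
      (fun i => lin k K () (v i)) (fun i => lin_hom unitWt () (v i))
      (homogeneousComponent_isHomogeneous n f)
  rw [prW_ev d' h3]; split_ifs with hdvd
  · obtain ⟨t, ht⟩ := hdvd
    obtain ⟨t, rfl⟩ : ∃ t', t = t' + 1 := ⟨t - 1, by rcases t with _ | t <;> simp at ht ⊢; omega⟩
    have h4 : n ≤ finrank k A * (card K - 1) := by
      refine (Nat.lt_succ_iff.1 (Finset.mem_range.1 hn)).trans (Finset.sup_le fun s hs => ?_)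
      refine (Finset.sum_le_card_nsmul _ _ (card K - 1) fun i _ =>
        (mem_restrictDegree _ _ _).1 hf s hs i).trans (Nat.mul_le_mul_right _ ?_)
      exact (Finset.card_le_univ _).trans_eq (Fintype.card_fin _)
    have h5 : n = d + t * (card K - 1) := by rw [mul_add, mul_one, mul_comm] at ht; omega
    refine filW_mono hd (a := t + 1) ?_ ⟨_, h5 ▸ h3, rfl⟩
    have h6 : t * (card K - 1) ≤ J * (card K - 1) := by
      have := Nat.mul_le_mul_right (card K - 1) (hA.trans hJ); omega
    exact Nat.succ_le_succ (Nat.le_of_mul_le_mul_right h6 (by omega))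
  · exact zero_mem _

end Fil

/-! ### Symmetric powers of large degree -/

section SymTop

lemma choose_pow_mul_ne_zero (K : Type) [Field K] (p : ℕ) [Fact p.Prime] [CharP K p] {n : ℕ}
  (hn : ¬ p ∣ n) (v : ℕ) : ((p ^ v * n).choose (p ^ v) : K) ≠ 0 := by
  have hp := primeOut p; rw [Ne, CharP.cast_eq_zero_iff K p]
  induction v with
  | zero => simpa using hn
  | succ v ih =>
    rw [((Choose.choose_modEq_choose_mod_mul_choose_div_nat (p := p)).dvd_iff dvd_rfl), pow_succ',
      mul_assoc, Nat.mul_mod_right, Nat.mul_mod_right, Nat.mul_div_cancel_left _ hp.pos,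
      Nat.mul_div_cancel_left _ hp.pos, Nat.choose_self, one_mul]
    exact ih

lemma exists_add_eq_choose_ne_zero (K : Type) [Field K] (p : ℕ) [Fact p.Prime] [CharP K p]
  {h e l : ℕ} (hl : l ≠ 0) (hl' : l < p ^ h) (he : p ^ h < p ^ e) : ∃ a b, a ≠ 0 ∧ b ≠ 0 ∧
  p ^ h + l * (p ^ e - 1) = a + b ∧ ((a + b).choose b : K) ≠ 0 := by
  have hp := primeOut p; set m := p ^ h + l * (p ^ e - 1) with hm
  have hm' : m = p ^ e * l + (p ^ h - l) := by
    have : l * (p ^ e - 1) + l = p ^ e * l := by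
      rw [← Nat.mul_succ, mul_comm, Nat.succ_eq_add_one, Nat.sub_add_cancel (by omega)]
    omega
  obtain ⟨v, n, hn, hv⟩ := Nat.exists_eq_pow_mul_and_not_dvd (n := m) (by omega) p hp.ne_one
  have hlt : p ^ v < m := by
    refine lt_of_le_of_ne ?_ fun hvm => ?_
    · rw [hv]; exact Nat.le_mul_of_pos_right _ (Nat.pos_of_ne_zero fun h => hn (h ▸ dvd_zero p))
    · have h1 : p ^ e ≤ p ^ v := by
        rw [hvm, hm']
        exact (Nat.le_mul_of_pos_right _ (Nat.pos_of_ne_zero hl)).trans (Nat.le_add_right _ _)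
      have h2 := pow_dvd_pow p ((Nat.pow_le_pow_iff_right hp.one_lt).1 h1)
      rw [hvm, hm', Nat.dvd_add_right (dvd_mul_right _ _)] at h2
      have := Nat.le_of_dvd (by omega) h2; omega
  have hpv := pow_pos hp.pos v; refine ⟨m - p ^ v, p ^ v, by omega, by omega, by omega, ?_⟩
  rw [Nat.sub_add_cancel hlt.le, hv]; exact choose_pow_mul_ne_zero K p hn v

variable {k K V : Type} [Field k] [Finite k] [Field K] [Algebra k K] [AbGrp V] [Module k V]
  [FinDim k V] [Fintype K] [DecidableEq K] [FinDim k K] {p : ℕ} [Fact p.Prime]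
  [CharP K p] {e d d' : ℕ}

lemma van_trF_of_filtration [CharP k p] (hd : d ≠ 0) (hd' : d' ≠ 0) (hQ : card K = p ^ e)
  (hdd : d + d' = card K - 1) {s J : ℕ} (hJ : 2 ^ s ≤ J)
  (hV : d + J * (card K - 1) + 2 ^ s + 5 * finrank k K ≤ finrank k V)
  (h1 : ∀ x ≤ s, Van (x + 1) (adRep (surRep k K V)))
  (h2 : ∀ b ≤ s, ∀ x ≤ s, Van (x + 1) (cubeRep (surRep k K V) b))
  (h3 : ∀ l < J, ∀ x ≤ s,
  Van x (adRep ((trF k K unitWt (d + (l + 1) * (card K - 1)) p e).rep V)))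
  (h4 : ∀ l ≤ J, ∀ b ≤ s, ∀ x ≤ s + 1,
  Van (x + 1) (cubeRep ((trF k K unitWt (d + l * (card K - 1)) p e).rep V) b)) :
  ∀ x < s, Van (x + 1) (adRep ((trF k K unitWt d p e).rep V)) := by
  have hK : ∀ f : Sur k K V → K, p • f = 0 := fun f => by rw [charP_nsmul K]
  have hq : ∀ (l : ℕ) (f : (Sur k K V → K) ⧸ (filW k K V d l).comap (prW k K V d')), p • f = 0 :=
    fun l f => by
      obtain ⟨f, rfl⟩ := mk_surjective f
      rw [← QuotientAddGroup.mk_nsmul, hK, QuotientAddGroup.mk_zero]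
  have hS : ∀ l ≤ J, ∃ f g, SES ((trF k K unitWt (d + l * (card K - 1)) p e).rep V)
      (filRep k K V d d' l) (filRep k K V d d' (l + 1)) f g ∧
      ∀ x, g (QuotientAddGroup.mk x) = QuotientAddGroup.mk x := fun l hl =>
    exists_filRep_ses hd hd' hQ hdd l (by
      have := Nat.mul_le_mul_right (card K - 1) hl; have := Nat.zero_le (2 ^ s); linarith)
  have hc : ∀ l ≤ J + 1, ∀ b ≤ s, ∀ x ≤ s, Van (x + 1) (cubeRep (filRep k K V d d' l) b) := by
    intro l
    induction l with
    | zero =>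
      intro _ b hb x hx
      exact Van.of_retract (i := (filInc k K V d d').compLeft (Cube b V))
        (r := (QuotientAddGroup.mk' _).compLeft (Cube b V))
        (fun g c => funext fun y => filInc_equi g _) (fun g c => rfl)
        (fun c => funext fun y => mk_filInc (c y)) (h2 b hb x hx)
    | succ l ih =>
      intro hl b hb x hx; obtain ⟨f, g, h, hg⟩ := hS l (by omega)
      exact (h.compLeft (cubePerm k V b)).van_right (ih (by omega) b hb x hx)
        (h4 l (by omega) b hb (x + 1) (by omega))
  have hi : ∀ l ≤ J + 1, ∀ b ≤ s, ∀ c, (∀ g, cubeRep (filRep k K V d d' l) b g c = c) →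
      ∃ c', (∀ g, cubeRep (surRep k K V) b g c' = c') ∧ ∀ x, QuotientAddGroup.mk (c' x) = c x := by
    intro l
    induction l with
    | zero =>
      intro _ b _ c hc
      refine ⟨fun x => filInc k K V d d' (c x), fun g => funext fun x => ?_, fun x => mk_filInc (c x)⟩
      rw [← congrFun (hc g) x, cubeRep_apply, cubeRep_apply, filInc_equi]
    | succ l ih =>
      intro hl b hb c hc; obtain ⟨f, g, h, hg⟩ := hS l (by omega)
      obtain ⟨c₁, hc₁, h₁⟩ := (h.compLeft (cubePerm k V b)).exists_invariant_lift
        (h4 l (by omega) b hb 0 (by omega)) c hc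
      obtain ⟨c', hc', h'⟩ := ih (by omega) b hb c₁ hc₁; refine ⟨c', hc', fun x => ?_⟩
      rw [← congrFun h₁ x]; exact (hg _).symm.trans (congrArg g (h' x))
  have htop : ∀ b ≤ s, ∀ c, (∀ g, cubeRep (filRep k K V d d' (J + 1)) b g c = c) → c = 0 := by
    intro b hb c hc; obtain ⟨c', hc', h⟩ := hi _ le_rfl b hb c hc
    have h2b := Nat.pow_le_pow_right two_pos hb; refine funext fun x => ?_
    rw [← h x]
    exact (eq_zero_iff _).2 (mem_fil_of_invariant hd hd' hdd (h2b.trans hJ) (by omega) hc' x)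
  have ha : ∀ l ≤ J, ∀ x ≤ s, Van x (adRep (filRep k K V d d' (J + 1 - l))) := by
    intro l
    induction l with
    | zero =>
      intro _; have : Finite V := Module.finite_of_finite k
      letI : Module (ZMod p) V := AddCommGroup.zmodModule (n := p) fun v => by rw [charP_nsmul k]
      letI := AddCommGroup.zmodModule (n := p) (hq (J + 1))
      refine van_adRep p _ s (fun b x h => hc _ le_rfl b (by omega) x (by omega))
        (fun η hη => AddMonoidHom.ext fun v => congrFun (htop 0 (Nat.zero_le _) η fun g =>
          funext fun v => DFunLike.congr_fun (hη g) v) v) fun b hb c hc _ => ?_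
      refine ⟨0, fun g => map_zero _, ?_⟩; rw [htop (b + 1) hb c hc, map_zero]
    | succ l ih =>
      intro hl x hx; obtain ⟨f, g, h, hg⟩ := hS (J + 1 - (l + 1)) (by omega)
      have h5 := ih (by omega) x hx; rw [show J + 1 - l = J + 1 - (l + 1) + 1 by omega] at h5
      refine (h.ad p (hq _)).van_mid ?_ h5; have := h3 (J - l - 1) (by omega) x hx
      rwa [show J - l - 1 + 1 = J + 1 - (l + 1) by omega] at this
  intro x hx; obtain ⟨f, g, h, hg⟩ := hS 0 (Nat.zero_le _); have h5 := ha J le_rfl x hx.le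
  rw [Nat.add_sub_cancel_left] at h5
  have h6 := (h.ad p (hq _)).van_left h5 (Van.of_retract (i := postComp V (filInc k K V d d'))
    (r := postComp V (QuotientAddGroup.mk' _)) (equi_postComp filInc_equi)
    (equi_postComp fun g c => rfl) (fun η => AddMonoidHom.ext fun v => mk_filInc (η v)) (h1 x hx.le))
  rwa [zero_mul, add_zero] at h6

end SymTop

lemma van_symF_of_trF {k K V : Type} [Field k] [Field K] [Algebra k K] [AbGrp V] [Module k V]
  {p : ℕ} [Fact p.Prime] [CharP K p] {e d i : ℕ} (hd : d < p ^ e)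
  (h : Van i (adRep ((trF k K unitWt d p e).rep V))) :
  Van i (adRep ((symF k K d).rep V)) := by
  refine van_of_hcard ((hcard_adRep_congr (QuotientAddGroup.mk' _) (fun _ _ => rfl)
    ⟨?_, mk_surjective⟩ i).trans h.hcard)
  rw [injective_iff_map_eq_zero]; intro f hf; refine Subtype.ext ?_
  rw [ZeroMemClass.coe_zero, ← MvPolynomial.support_eq_empty, Finset.eq_empty_iff_forall_notMem]
  intro s hs; obtain ⟨i, hi⟩ := mem_trI.1 ((eq_zero_iff f).1 hf) s hs
  have := degree_of_hom f.2 hs; have := Finsupp.le_degree i s; omega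

lemma le_sum_range (f : ℕ → ℕ) {x n : ℕ} (h : x < n) : f x ≤ ∑ y ∈ Finset.range n, f y :=
  Finset.single_le_sum (fun _ _ => Nat.zero_le _) (Finset.mem_range.2 h)

lemma exists_hcard_symF_one (k : Type) [Field k] [Finite k] (p : ℕ) [Fact p.Prime] [CharP k p]
  (s : ℕ) : ∃ (K : Type) (_ : Field K) (_ : Algebra k K) (_ : FinDim k K) (N : ℕ),
  ∀ (V : Type) [AbGrp V] [Module k V] [FinDim k V], N ≤ finrank k V → ∃ q,
  ∀ i ≤ s, hcard i (adRep ((symF k K 1).rep V)) = if 2 * 1 ∣ i then q else 1 := by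
  classical
  have hp := primeOut p
  let K := FiniteField.Extension k p (s + 3)
  refine ⟨K, inferInstance, inferInstance, inferInstance, ?_⟩
  have := Fintype.ofFinite K
  have : CharP K p := charP_of_injective_algebraMap (algebraMap k K).injective p
  obtain ⟨e, -, hQ⟩ := FiniteField.card K p
  have hlt : p ^ (s + 2) + 1 < p ^ (e : ℕ) := by
    have h1 : p ^ (s + 3) ≤ p ^ (e : ℕ) := by
      rw [← hQ, Fintype.card_eq_nat_card, FiniteField.natCard_extension]
      have := Fintype.ofFinite k
      obtain ⟨f, -, hf⟩ := FiniteField.card k p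
      rw [Nat.card_eq_fintype_card, hf]
      exact Nat.pow_le_pow_left (Nat.le_self_pow f.ne_zero p) _
    have h2 := Nat.mul_le_mul_left (p ^ (s + 2)) hp.two_le
    have h3 := Nat.one_lt_pow (show s + 2 ≠ 0 by omega) hp.one_lt
    rw [pow_succ] at h1
    omega
  have hs2 : 2 ^ s < p ^ (s + 2) := (Nat.pow_lt_pow_right one_lt_two (by omega)).trans_le
    (Nat.pow_le_pow_left hp.two_le (s + 2))
  set d := p ^ (s + 2) with hd
  set D := d + 2 ^ s * (card K - 1) with hD
  choose N₁ h₁ using fun x => exists_van_surRep k K p x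
  choose N₂ h₂ using fun x b => exists_van_cubeRep_surRep k K p x b
  choose N₄ h₄ using fun x b => exists_van_cubeRep (k := k) p x D b
  choose N₅ h₅ using fun r => exists_van_multiF k K p (p * p ^ r) s
  obtain ⟨N₃, h₃⟩ := exists_uniform (P := fun l N => ∀ (V : Type) [AbGrp V] [Module k V]
      [FinDim k V], N ≤ finrank k V → ∀ i ≤ s,
      Van i (adRep ((trF k K unitWt (d + (l + 1) * (card K - 1)) p e).rep V)))
    (fun l N N' hN h V _ _ _ hV => h V (hN.trans hV)) (2 ^ s) fun l hl => by
      obtain ⟨a, b, ha, hb, hab, hc⟩ := exists_add_eq_choose_ne_zero K p (h := s + 2) (e := e)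
        (Nat.succ_ne_zero l) (by omega) (by omega)
      rw [hQ, hab]
      exact exists_van_trF k K p e a b s ha hb hc
  have hD0 : d ≤ D := Nat.le_add_right _ _
  obtain ⟨S, hS⟩ : ∃ S : (ℕ → ℕ) → ℕ, ∀ f x, x < s + 2 → f x ≤ S f :=
    ⟨fun f => ∑ y ∈ Finset.range (s + 2), f y, fun f x => le_sum_range f⟩
  refine ⟨S N₁ ⊔ (S fun x => S (N₂ x)) ⊔ (S fun x => S (N₄ x)) ⊔ S N₅ ⊔ N₃ ⊔
    (D + 2 ^ s + 5 * finrank k K), fun V _ _ _ hV => ?_⟩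
  have hS2 : ∀ f : ℕ → ℕ → ℕ, ∀ x < s + 2, ∀ b < s + 2, f x b ≤ S fun x => S (f x) :=
    fun f x hx b hb => (hS (f x) b hb).trans (hS (fun x => S (f x)) x hx)
  obtain ⟨hV₁, hV₂, hV₄, hV₅, hV₃, hV₀⟩ := by simpa only [sup_le_iff, and_assoc] using hV
  have hv := van_trF_of_filtration (k := k) (K := K) (V := V) (p := p) (e := e) (d := d)
    (d' := p ^ (e : ℕ) - 1 - d) (s := s) (J := 2 ^ s) (pow_pos hp.pos _).ne' (by omega) hQ (by omega) le_rfl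
    hV₀ (fun x hx => h₁ x V ((hS N₁ x (by omega)).trans hV₁))
    (fun b hb x hx => h₂ x b V ((hS2 N₂ x (by omega) b (by omega)).trans hV₂))
    (fun l hl => h₃ l hl V hV₃) fun l hl b hb x hx => h₄ x b _
      ((VFun.quot_poly _ _ _ (polF_poly (k := k) (K := K) unitWt _ (.id ℕ)
        fun _ => rfl)).mono (Nat.add_le_add_left (Nat.mul_le_mul_right _ hl) d))
      (VFun.quot_tors _ _ _ (polF_tors _ p _)) V
      ((hS2 N₄ x (by omega) b (by omega)).trans hV₄)
  refine ⟨hcard 0 (adRep ((symF k K d).rep V)), ?_⟩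
  have key : ∀ r ≤ s + 2, ∀ i ≤ s, hcard i (adRep ((symF k K (p ^ (s + 2 - r))).rep V)) =
      if 2 * p ^ (s + 2 - r) ∣ i then hcard 0 (adRep ((symF k K d).rep V)) else 1 := by
    intro r
    induction r with
    | zero =>
      intro _ i hi
      rcases i with _ | i
      · rw [if_pos (dvd_zero _)]; rfl
      · rw [Nat.sub_zero, if_neg]
        · exact (van_symF_of_trF (show d < p ^ (e : ℕ) by omega) (hv i hi)).hcard
        intro h
        have := Nat.le_of_dvd (Nat.succ_pos i) h
        have := Nat.lt_two_pow_self (n := s)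
        omega
    | succ r ih =>
      intro hr
      have e1 : p ^ (s + 2 - r) = p * p ^ (s + 2 - (r + 1)) := by
        rw [← pow_succ']; congr 1; omega
      have ih := ih (by omega)
      rw [e1] at ih
      exact hcard_sym_of_mul (h₅ _ V ((hS N₅ (s + 2 - (r + 1)) (by omega)).trans hV₅))
        (pow_pos hp.pos _) ih
  have := key (s + 2) le_rfl
  rwa [Nat.sub_self, pow_zero] at this

/-! ### Comparison with additive endomorphisms -/

/-- The tautological action. -/
def tautRep (k V : Type) [Field k] [AbGrp V] [Module k V] : GMod (V ≃ₗ[k] V) V where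
  toFun g := gˡ.toAddMonoidHom
  map_one' := rfl
  map_mul' _ _ := rfl

lemma hcard_pi {G M : Type} [Group G] [AbGrp M] (ρ : GMod G M) (c i : ℕ) :
  hcard i (funRep (1 : G →* Perm (Fin c)) ρ) = hcard i ρ ^ c := by
  have he : ∀ x, Equi (.id G) (funRep 1 ρ) ρ (Pi.evalAddMonoidHom (fun _ : Fin c => M) x) :=
    fun _ _ _ => rfl
  let F : Hq i (funRep (1 : G →* Perm (Fin c)) ρ) →+ (Fin c → Hq i ρ) :=
    AddMonoidHom.pi fun x => hmap (he x) i
  have hF : Function.Bijective F := by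
    constructor
    · rw [injective_iff_map_eq_zero]; intro z hz; obtain ⟨z, rfl⟩ := mk_surjective z
      have h1 : ∀ x, IsCob ρ i fun g => z.1 g x := fun x => (Hq.mk_eq_zero (zmap (he x) i z)).1 (congrFun hz x)
      refine (Hq.mk_eq_zero z).2 ?_
      cases i with
      | zero => exact funext fun g => funext fun x => congrFun (h1 x) g
      | succ i =>
        choose u hu using h1; refine ⟨fun g x => u x g, funext fun g => funext fun x => ?_⟩
        rw [← congrFun (hu x) g]; exact (congrFun (cd_pull (he x) i fun g x => u x g) g).symm
    · intro y; choose z hz using fun x => mk_surjective (y x)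
      refine ⟨QuotientAddGroup.mk ⟨fun g x => (z x).1 g, funext fun g => funext fun x => ?_⟩,
        funext fun x => hz x⟩
      exact (congrFun (cd_pull (he x) i fun g x => (z x).1 g) g).symm.trans (congrFun (z x).2 g)
  rw [hcard, Nat.card_congr (Equiv.ofBijective F hF), Nat.card_fun, Nat.card_fin, hcard]

open MvPolynomial in
lemma hcard_symF_one (k K V : Type) [Field k] [Field K] [Algebra k K] [FinDim k K]
  [AbGrp V] [Module k V] (i : ℕ) :
  hcard i (adRep ((symF k K 1).rep V)) = hcard i (adRep (tautRep k V)) ^ finrank k K := by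
  classical
  let β := finBasis k K
  let Ψ : (Fin (finrank k K) → V) →+ polObj k K unitWt 1 V := AddMonoidHom.mk'
    (fun v => ∑ i, β i • ⟨lin k K () (v i), lin_hom unitWt () (v i)⟩) fun v w => by
      rw [← sum_add_distrib]; refine sum_congr rfl fun i _ => ?_
      rw [← smul_add]; exact congrArg _ (Subtype.ext (map_add (lin k K ()) (v i) (w i)))
  have hΨ : ∀ v, (Ψ v : Pol k K Unit V) = ∑ i, β i • lin k K () (v i) := fun v => by
    change Submodule.subtype _ (∑ i, _) = _; rw [map_sum]; rfl
  rw [← hcard_pi, ← hcard_adRep_congr (ρ := funRep 1 (tautRep k V)) Ψ (fun g v => Subtype.ext ?_)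
    ⟨?_, ?_⟩ i]
  · exact hcard_congr (.refl _) (AddEquiv.mk' ⟨fun η x => (Pi.evalAddMonoidHom _ x).comp η,
      fun θ => AddMonoidHom.mk' (fun v x => θ x v) fun v w => funext fun x => map_add (θ x) v w,
      fun _ => rfl, fun _ => rfl⟩ fun _ _ => rfl) (fun _ _ => rfl) i
  · rw [injective_iff_map_eq_zero]; intro v hv
    have h1 : ∀ b (w : V), coeff (single (b, ()) 1) (lin k K () w) =
        algebraMap k K ((BVec k V).repr w b) := by
      intro b w
      have : ((lcoeff K (single (b, ()) 1)).restrictScalars k) ∘ₗ lin k K () =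
          Algebra.linearMap k K ∘ₗ (BVec k V).coord b :=
        (BVec k V).ext fun b' => by
          rw [comp_apply, lin_basis]
          change coeff _ (X (b', ())) = algebraMap k K ((BVec k V).repr _ b)
          rw [Basis.repr_self, coeff_X, Finsupp.single_apply]
          simp [Finsupp.single_left_inj, apply_ite]
      exact LinearMap.congr_fun this w
    refine funext fun i => (BVec k V).ext_elem fun b => ?_
    have h2 := congrArg (coeff (single (b, ()) 1)) ((hΨ v).symm.trans (congrArg Subtype.val hv))
    simp only [coeff_sum, coeff_smul, h1, smul_eq_mul, mul_comm (β _), ← Algebra.smul_def] at h2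
    rw [Pi.zero_apply, map_zero]; exact Fintype.linearIndependent_iff.1 β.linearIndependent _ h2 i
  · intro f
    have h1 : ∀ b c, ∃ v, (Ψ v : Pol k K Unit V) = c • X (b, ()) := fun b c => by
      refine ⟨fun i => β.repr c i • BVec k V b, ?_⟩; rw [hΨ]
      conv_rhs => rw [← β.sum_repr c, Finset.sum_smul]
      refine sum_congr rfl fun i _ => ?_
      rw [map_smul, lin_basis, smul_comm, smul_assoc]
    have h2 : f.1 ∈ Ψ.range.map (Submodule.subtype _).toAddMonoidHom := by
      rw [f.1.as_sum]; refine sum_mem fun s hs => ?_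
      obtain ⟨⟨b, ⟨⟩⟩, rfl⟩ := (Finsupp.sum_eq_one_iff s).1 (degree_of_hom f.2 hs)
      obtain ⟨v, hv⟩ := h1 b (coeff (single (b, ()) 1) f.1); refine ⟨Ψ v, ⟨v, rfl⟩, hv.trans ?_⟩
      rw [X, smul_monomial, smul_eq_mul, mul_one]
    obtain ⟨_, ⟨v, rfl⟩, hv⟩ := h2; exact ⟨v, Subtype.ext hv⟩
  · rw [rep_coe, hΨ, hΨ, map_sum]; refine sum_congr rfl fun i _ => ?_
    rw [map_smul, slot_lin]; rfl

/-! ### Comparison with group cohomology -/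

open CategoryTheory groupCohomology in
lemma π_eq_zero_iff {k G : Type} [Field k] [Group G] (A : Rep k G) (ρ : GMod G A) (s : ℕ)
  (hd : ∀ n (c : (Fin n → G) → A), inhomogeneousCochains.d A n c = cd ρ n c) (y : cocycles A s) :
  π A s y = 0 ↔ IsCob ρ s (iCocycles A s y) := by
  let C := inhomogeneousCochains A
  have hinj : Injective (iCocycles A s) := (ModuleCat.mono_iff_injective _).1 inferInstance
  have hex := (ShortComplex.moduleCat_exact_iff _).1
    (ShortComplex.exact_of_g_is_cokernel (.mk (C.toCycles _ s) (C.homologyπ s) (by simp))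
      (C.homologyIsCokernel _ s rfl))
  have hi : ∀ u, iCocycles A s (C.toCycles _ s u) = C.d ((ComplexShape.up ℕ).prev s) s u := fun u => by
    rw [← ModuleCat.comp_apply, HomologicalComplex.toCycles_i]
  have h0 : ∀ u, π A s (C.toCycles ((ComplexShape.up ℕ).prev s) s u) = 0 := fun u =>
    ConcreteCategory.congr_hom (C.toCycles_comp_homologyπ _ s) u
  cases s with
  | zero =>
    rw [show IsCob ρ 0 (iCocycles A 0 y) ↔ iCocycles A 0 y = 0 from Iff.rfl, map_eq_zero_iff _ hinj]
    refine ⟨fun h => ?_, fun h => by rw [h, map_zero]⟩; obtain ⟨u, rfl⟩ := hex y h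
    refine hinj ((hi u).trans ?_); rw [C.shape _ _ (by simp), map_zero]; rfl
  | succ s =>
    have hp : (ComplexShape.up ℕ).prev (s + 1) = s := by simp
    rw [hp] at hex hi h0
    have hi' : ∀ u, iCocycles A (s + 1) (C.toCycles s (s + 1) u) = cd ρ s u := fun u =>
      (hi u).trans (by rw [inhomogeneousCochains.d_def]; exact hd s u)
    refine ⟨fun h => ?_, fun ⟨u, hu⟩ => ?_⟩
    · obtain ⟨u, rfl⟩ := hex y h; exact ⟨u, (hi' u).symm⟩
    · rw [← hinj ((hi' u).trans hu)]; exact h0 u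

open CategoryTheory groupCohomology in
lemma card_groupCohomology {k G : Type} [Field k] [Group G] (A : Rep k G) (ρ : GMod G A)
  (hρ : ∀ g a, A.ρ g a = ρ g a) (s : ℕ) : Nat.card (groupCohomology A s) = hcard s ρ := by
  have hd : ∀ n (c : (Fin n → G) → A), inhomogeneousCochains.d A n c = cd ρ n c := fun n c =>
    funext fun g => by
      refine congrArg₂ _ (hρ _ _) (sum_congr rfl fun j _ => ?_); rw [← Int.cast_smul_eq_zsmul k]
      push_cast; rfl
  have hinj : Injective (iCocycles A s) := (ModuleCat.mono_iff_injective _).1 inferInstance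
  let F : (cd ρ s).ker →+ groupCohomology A s := AddMonoidHom.mk'
    (fun z => π A s (cocyclesMk z.1 ((hd s z.1).trans z.2))) fun z w => by
      rw [← map_add]; refine congrArg _ (hinj ?_)
      rw [map_add, iCocycles_mk, iCocycles_mk, iCocycles_mk]; rfl
  have hF : Surjective F := fun x => by
    induction x using groupCohomology_induction_on with
    | h y =>
      have hy : cd ρ s (iCocycles A s y) = 0 := by
        rw [← hd]
        have := ConcreteCategory.congr_hom ((inhomogeneousCochains A).iCycles_d s (s + 1)) y
        rwa [inhomogeneousCochains.d_def] at this
      exact ⟨⟨iCocycles A s y, hy⟩, congrArg (π A s) (hinj (iCocycles_mk _ _))⟩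
  have hk : F.ker = Bq s ρ := by
    ext z; refine (π_eq_zero_iff A ρ s hd _).trans ?_
    rw [iCocycles_mk]; rfl
  rw [hcard, Hq, ← hk]
  exact (Nat.card_congr (QuotientAddGroup.quotientKerEquivOfSurjective F hF).toEquiv).symm

/-- The adjoint action on matrices. -/
def glMod (k : Type) [Field k] (n : ℕ) : GMod (GL (Fin n) k) (Matrix (Fin n) (Fin n) k) where
  toFun g := (glConj k n g).toAddMonoidHom
  map_one' := by rw [map_one]; rfl
  map_mul' g h := by rw [map_mul]; rfl

lemma hcard_glMod_zero (k : Type) [Field k] (n : ℕ) (hn : n ≠ 0) :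
  hcard 0 (glMod k n) = Nat.card k := by
  have : NeZero n := ⟨hn⟩; rw [hcard_zero]
  have h : ∀ c g, glMod k n g (Matrix.scalar (Fin n) c) = Matrix.scalar (Fin n) c := fun c g => by
    change g.1 * Matrix.scalar (Fin n) c * (g⁻¹ : GL (Fin n) k).1 = _
    rw [← (Matrix.scalar_commute c (fun _ => mul_comm _ _) _).eq, mul_assoc, ← Units.val_mul,
      mul_inv_cancel, Units.val_one, mul_one]
  refine (Nat.card_congr (Equiv.ofBijective (fun c => ⟨Matrix.scalar (Fin n) c, h c⟩)
    ⟨fun a b h => Matrix.scalar_inj.1 (congrArg Subtype.val h), fun A => ?_⟩)).symm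
  obtain ⟨c, hc⟩ := Matrix.mem_range_scalar_of_commute_transvectionStruct (M := A.1) fun t => by
      have h := A.2 (Matrix.GeneralLinearGroup.mk'' t.toMatrix (by rw [t.det]; exact isUnit_one))
      change _ * A.1 * _ = A.1 at h
      have h2 := congrArg (· * (Matrix.GeneralLinearGroup.mk'' t.toMatrix
        (by rw [t.det]; exact isUnit_one) : GL (Fin n) k).1) h
      simp only [mul_assoc, ← Units.val_mul, inv_mul_cancel, Units.val_one, mul_one] at h2; exact h2
  exact ⟨c, Subtype.ext hc⟩

lemma sum_units_smul {k M : Type} [Field k] [Fintype k] [DecidableEq k] [AbGrp M] [Module k M]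
  (m : M) : ∑ _ : kˣ, m = -m := by
  rw [sum_const, Finset.card_univ, Fintype.card_units, eq_neg_iff_add_eq_zero, ← succ_nsmul,
    Nat.sub_add_cancel Fintype.card_pos, ← Nat.cast_smul_eq_nsmul k, FiniteField.cast_card_eq_zero,
    zero_smul]

/-- The linear part of an additive endomorphism. -/
def linPart (k V : Type) [Field k] [Fintype k] [DecidableEq k] [AbGrp V] [Module k V] :
  (V →+ V) →+ (V →ₗ[k] V) where
  toFun η :=
    { toFun := fun v => -∑ c : kˣ, c⁻¹ • η (c • v)
      map_add' := fun v w => by simp only [smul_add, map_add, sum_add_distrib, neg_add]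
      map_smul' := fun a v => by
        rcases eq_or_ne a 0 with rfl | ha
        · simp
        lift a to kˣ using ha.isUnit; change -_ = (a : k) • -_; rw [smul_neg, Finset.smul_sum]
        refine congrArg _ (Fintype.sum_equiv (Equiv.mulRight a) _ _ fun c => ?_)
        change c⁻¹ • η (c • a • v) = a • (c * a)⁻¹ • η ((c * a) • v)
        rw [smul_smul, smul_smul, mul_inv_rev, mul_inv_cancel_left] }
  map_zero' := by ext; simp
  map_add' a b := LinearMap.ext fun v => by
    simp only [LinearMap.add_apply, LinearMap.coe_mk, AddHom.coe_mk, AddMonoidHom.add_apply,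
      smul_add, sum_add_distrib, neg_add]

lemma hcard_glMod (k : Type) [Field k] [Finite k] (n i : ℕ) :
  hcard i (adRep (tautRep k (Fin n → k))) = hcard i (glMod k n) := by
  classical
  have := Fintype.ofFinite k
  let V := Fin n → k
  let e : GL (Fin n) k ≃* (V ≃ₗ[k] V) :=
    Matrix.GeneralLinearGroup.toLin.trans (LinearMap.GeneralLinearGroup.generalLinearEquiv k V)
  have he : ∀ g, (e g)ˡ = Matrix.toLin' g.1 := fun g => rfl
  let ψ : Matrix (Fin n) (Fin n) k →+ (V →+ V) := AddMonoidHom.mk'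
    (fun A => (Matrix.toLin' A).toAddMonoidHom) fun A B => by rw [map_add]; rfl
  have hψ : ∀ g A, adRep (tautRep k V) (e g) (ψ A) = ψ (glMod k n g A) := fun g A =>
    AddMonoidHom.ext fun v => by
      change e g (Matrix.toLin' A ((e g)⁻¹ v)) = Matrix.toLin' (g.1 * A * (g⁻¹ : GL (Fin n) k).1) v
      rw [Matrix.toLin'_mul, Matrix.toLin'_mul, ← he, ← he, map_inv]
      rfl
  have hlψ : ∀ A, linPart k V (ψ A) = Matrix.toLin' A := fun A => LinearMap.ext fun v => by
    change -∑ c : kˣ, c⁻¹ • Matrix.toLin' A ((c : k) • v) = _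
    simp only [map_smul]
    change -∑ c : kˣ, c⁻¹ • c • Matrix.toLin' A v = _
    simp only [inv_smul_smul]
    rw [sum_units_smul, neg_neg]
  let φ : (V →+ V) →+ Matrix (Fin n) (Fin n) k :=
    (LinearMap.toMatrix' (R := k))ˡ.toAddMonoidHom.comp (linPart k V)
  have hφψ : ∀ A, φ (ψ A) = A := fun A =>
    (congrArg LinearMap.toMatrix' (hlψ A)).trans (LinearMap.toMatrix'_toLin' A)
  have hψφ : ∀ η v, ψ (φ η) v = -∑ c : kˣ, c⁻¹ • η (c • v) := fun η v =>
    LinearMap.congr_fun (Matrix.toLin'_toMatrix' (linPart k V η)) v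
  have hinj : Injective ψ := fun A B h => by rw [← hφψ A, h, hφψ]
  have hφ : ∀ g η, φ (adRep (tautRep k V) (e g) η) = glMod k n g (φ η) := fun g η => by
    refine hinj (AddMonoidHom.ext fun v => ?_)
    rw [← hψ, hψφ]
    change _ = e g (ψ (φ η) ((e g)⁻¹ v))
    rw [hψφ, map_neg, map_sum]
    refine congrArg _ (Finset.sum_congr rfl fun c _ => ?_)
    change (c⁻¹ : kˣ).1 • e g (η ((e g)⁻¹ (c.1 • v))) = e g ((c⁻¹ : kˣ).1 • η (c.1 • (e g)⁻¹ v))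
    rw [map_smul (e g), map_smul]
  refine hcard_eq_of_inverse (f := e.toMonoidHom) (f' := e.symm.toMonoidHom) (φ := φ) (ψ := ψ) hφ
    (fun g A => ?_) i (fun z hz => ?_) fun z _ => ?_
  · refine (hψ _ _).symm.trans ?_
    congr 2
    exact e.apply_symm_apply g
  · have hz' : pull e.symm.toMonoidHom ψ i (pull e.toMonoidHom φ i z) - z = -∑ c : kˣ,
        (pull (MulAut.conj (LinearEquiv.smulOfUnit c)⁻¹⁻¹).toMonoidHom
          ((adRep (tautRep k V)).hom (LinearEquiv.smulOfUnit c)⁻¹) i z - z) := by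
      funext g
      have h1 : ∀ c : kˣ, ((MulAut.conj (LinearEquiv.smulOfUnit c : V ≃ₗ[k] V)⁻¹⁻¹).toMonoidHom) ∘ g =
          g := fun c => funext fun j => LinearEquiv.ext fun v => by
        change c • g j (c⁻¹ • v) = g j v
        change c • g j ((c⁻¹ : kˣ).1 • v) = g j v
        rw [map_smul]
        exact smul_inv_smul c _
      have h2 : e.toMonoidHom ∘ e.symm.toMonoidHom ∘ g = g := funext fun j => e.apply_symm_apply _
      rw [Finset.sum_sub_distrib, sum_units_smul, sub_neg_eq_add, neg_add']
      refine congrArg (· - z g) (AddMonoidHom.ext fun v => ?_)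
      rw [pull_apply, pull_apply, h2, hψφ, Pi.neg_apply, Finset.sum_apply, AddMonoidHom.neg_apply,
        AddMonoidHom.finset_sum_apply]
      refine congrArg _ (Finset.sum_congr rfl fun c _ => ?_)
      rw [pull_apply, h1]
      rfl
    rw [hz']
    exact (IsCob.sum _ fun c _ => isCob_conj i _ _ z hz).neg
  · have : pull e.toMonoidHom φ i (pull e.symm.toMonoidHom ψ i z) = z := funext fun g => by
      refine (hφψ _).trans (congrArg z (funext fun j => e.symm_apply_apply _))
    rw [this, sub_self]
    exact IsCob.zero _ _

lemma coeff_inv_one_sub_X_sq (s : ℕ) :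
  PowerSeries.coeff s ((1 - PowerSeries.X ^ 2 : PowerSeries ℚ)⁻¹) = if Even s then 1 else 0 := by
  have h : PowerSeries.mk (fun n => if Even n then (1 : ℚ) else 0) = (1 - PowerSeries.X ^ 2)⁻¹ := by
    rw [PowerSeries.eq_inv_iff_mul_eq_one (by simp)]; ext n
    rw [mul_sub, mul_one, map_sub, PowerSeries.coeff_mul_X_pow', PowerSeries.coeff_one]
    rcases n with _ | _ | n
    · simp
    · simp
    · simp [Nat.even_add]
  rw [← h, PowerSeries.coeff_mk]

/-- The stable cohomology of `GL(n,k)` with adjoint coefficients `gl_n` has Poincaré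
series `1/(1−t²)`: in each degree `s` the dimension is eventually constant in `n`,
equal to the coefficient of `t^s`, i.e. `1` if `s` is even and `0` if `s` is odd. -/
theorem gl_stable_cohomology_adjoint
    (k : Type) [Field k] [Fintype k] (p : ℕ) [CharP k p] :
    ∀ s : ℕ, ∃ N : ℕ, ∀ n : ℕ, N ≤ n →
      ((Module.finrank k (groupCohomology (Rep.of (glConj k n)) s) : ℚ)
          = PowerSeries.coeff s ((1 - PowerSeries.X ^ 2 : PowerSeries ℚ)⁻¹))
        ∧ (Module.finrank k (groupCohomology (Rep.of (glConj k n)) s) = if Even s then 1 else 0) := by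
  intro s
  have : Fact p.Prime := ⟨CharP.char_is_prime k p⟩
  obtain ⟨K, _, _, _, N, h⟩ := exists_hcard_symF_one k p s
  refine ⟨N + 1, fun n hn => ?_⟩
  suffices hs : finrank k (groupCohomology (Rep.of (glConj k n)) s) = if Even s then 1 else 0 by
    refine ⟨?_, hs⟩
    rw [hs, coeff_inv_one_sub_X_sq]
    push_cast
    rfl
  obtain ⟨q, hq⟩ := h (Fin n → k) (by rw [finrank_fin_fun]; omega)
  replace hq : ∀ i ≤ s, hcard i (glMod k n) ^ finrank k K = if 2 ∣ i then q else 1 := fun i hi => by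
    rw [← hcard_glMod, ← hcard_symF_one]
    exact hq i hi
  have hq0 := hq 0 (Nat.zero_le s)
  rw [if_pos (dvd_zero _), hcard_glMod_zero k n (by omega)] at hq0
  have hc := card_groupCohomology (Rep.of (glConj k n)) (glMod k n) (fun _ _ => rfl) s
  have hk : 1 < Nat.card k := Finite.one_lt_card
  have hcs : hcard s (glMod k n) = Nat.card k ^ (if Even s then 1 else 0) := by
    refine Nat.pow_left_injective (n := finrank k K) finrank_pos.ne' ?_
    change _ ^ _ = _ ^ _
    rw [hq s le_rfl]
    by_cases he : Even s
    · rw [if_pos he, if_pos he.two_dvd, pow_one, hq0]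
    · rw [if_neg he, if_neg (mt even_iff_two_dvd.2 he), pow_zero, one_pow]
  rw [hcs] at hc
  have : Finite (groupCohomology (Rep.of (glConj k n)) s) :=
    Nat.finite_of_card_ne_zero (hc ▸ (pow_pos (by omega) _).ne')
  have : Module.Finite k (groupCohomology (Rep.of (glConj k n)) s) := Module.Finite.of_finite
  rw [Module.natCard_eq_pow_finrank (K := k)] at hc
  exact Nat.pow_right_injective hk hc
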